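/- Let x > 0 and assume that for every M ≥ 1 a normalized ground-state vector ψ_M of H_M(x) exists. Let r ∈ (0,2), D, E and Ē be defined from x as in the context. Then for every δ ∈ (0,1/2) and every ε > 0 there exists N₀ such that for all integers N1 even, N2 odd, N1, N2 ≥ 2, with N = N1 + N2 ≥ N₀ and δ ≤ ξ ≤ 1 − δ, where ξ = N1/N, the logarithmic bipartite fidelity satisfies | F_{N1,N2} − [ (1/6)·ln N + (1/6)·ln(ξ/(1−ξ)) − ln D + (1/72)·( E/ξ + Ē·(1 − 1/(1−ξ)) )·N^{−1} ] | ≤ ε·N^{−1}. For N1 odd and N2 even the same estimate holds with ξ replaced by 1−ξ in the bracketed expression. -/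

import Mathlib

open scoped Classical

noncomputable section

/-- Spin configurations of an `N`-site chain: `0` encodes `↑`, `1` encodes `↓`. -/
abbrev Conf (N : ℕ) := Fin N → Fin 2

def pauliX : Matrix (Fin 2) (Fin 2) ℂ := !![0, 1; 1, 0]
def pauliY : Matrix (Fin 2) (Fin 2) ℂ := !![0, -Complex.I; Complex.I, 0]
def pauliZ : Matrix (Fin 2) (Fin 2) ℂ := !![1, 0; 0, -1]

/-- The operator acting as `A` on site `i` and as the identity elsewhere. -/
def siteOp (N : ℕ) (i : Fin N) (A : Matrix (Fin 2) (Fin 2) ℂ) :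
    Matrix (Conf N) (Conf N) ℂ :=
  Matrix.of fun α β =>
    A (α i) (β i) * ∏ j ∈ Finset.univ.erase i, (if α j = β j then (1 : ℂ) else 0)

/-- Left boundary field `p = (1/2)(1/2 − x)`. -/
def pL (x : ℝ) : ℝ := (1/2) * (1/2 - x)

/-- Right boundary field `p̄ = (1/2)(1/2 − 1/x)`. -/
def pR (x : ℝ) : ℝ := (1/2) * (1/2 - 1/x)

/-- The open XXZ Hamiltonian at `Δ = −1/2` with diagonal boundary fields. -/
def XXZ (N : ℕ) (hN : 0 < N) (x : ℝ) : Matrix (Conf N) (Conf N) ℂ :=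
  (-(1/2) : ℂ) • (∑ i : Fin (N-1),
      (siteOp N ⟨i.1, by have := i.2; omega⟩ pauliX *
          siteOp N ⟨i.1+1, by have := i.2; omega⟩ pauliX
        + siteOp N ⟨i.1, by have := i.2; omega⟩ pauliY *
          siteOp N ⟨i.1+1, by have := i.2; omega⟩ pauliY
        - (1/2 : ℂ) • (siteOp N ⟨i.1, by have := i.2; omega⟩ pauliZ *
          siteOp N ⟨i.1+1, by have := i.2; omega⟩ pauliZ)))
  + ((pL x : ℝ) : ℂ) • siteOp N ⟨0, hN⟩ pauliZ
  + ((pR x : ℝ) : ℂ) • siteOp N ⟨N-1, by omega⟩ pauliZ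

/-- The special eigenvalue `E₀`. -/
def E0 (N : ℕ) (x : ℝ) : ℝ := -(3*(N:ℝ) - 1)/4 - (1-x)^2/(2*x)

/-- The basis state with `⌊N/2⌋` down spins followed by `⌈N/2⌉` up spins. -/
def baseState (N : ℕ) : Conf N := fun i => if i.1 < N/2 then 1 else 0

/-- `ψ` is a normalized ground-state vector of `H_N(x)`; for `N = 0` it is the
scalar `1` by convention. -/
def IsGroundState (N : ℕ) (x : ℝ) (ψ : Conf N → ℂ) : Prop :=
  if h : 0 < N then
    (XXZ N h x).mulVec ψ = ((E0 N x : ℝ) : ℂ) • ψ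
    ∧ (∀ φ : Conf N → ℂ, (XXZ N h x).mulVec φ = ((E0 N x : ℝ) : ℂ) • φ → ∃ c : ℂ, φ = c • ψ)
    ∧ ψ (baseState N) = 1
  else ∀ α, ψ α = 1

/-- The overlap `O_{N1,N2} = ⟨ψ, ψ1 ⊗ ψ2⟩` (bilinear, unconjugated pairing). -/
def overlap (N1 N2 : ℕ) (ψ : Conf (N1+N2) → ℂ) (ψ1 : Conf N1 → ℂ) (ψ2 : Conf N2 → ℂ) : ℂ :=
  ∑ α : Conf N1, ∑ β : Conf N2, ψ (Fin.append α β) * ψ1 α * ψ2 β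

/-- The square norm `O_{M,0} = ⟨ψ, ψ⟩` (bilinear pairing). -/
def selfOverlap (M : ℕ) (ψ : Conf M → ℂ) : ℂ := ∑ α : Conf M, ψ α * ψ α

/-- `γ_N`: `A_V(N+1)` for `N` even, `N_8(N+1)` for `N` odd. -/
def gammaN (N : ℕ) : ℝ :=
  if N % 2 = 0 then
    ((2:ℝ)⁻¹) ^ (N/2) * ∏ i ∈ Finset.Icc 1 (N/2),
      ((Nat.factorial (6*i-2) : ℝ) * (Nat.factorial (2*i-1) : ℝ)) /
        ((Nat.factorial (4*i-2) : ℝ) * (Nat.factorial (4*i-1) : ℝ))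
  else
    ∏ i ∈ Finset.range ((N+1)/2),
      (((3*i+1 : ℕ) : ℝ) * (Nat.factorial (6*i) : ℝ) * (Nat.factorial (2*i) : ℝ)) /
        ((Nat.factorial (4*i) : ℝ) * (Nat.factorial (4*i+1) : ℝ))

/-- Binomial coefficient `C(a,b)` for integers, vanishing unless `0 ≤ b ≤ a`. -/
def zchoose (a b : ℤ) : ℤ := if 0 ≤ b ∧ b ≤ a then (a.toNat).choose b.toNat else 0

/-- The logarithmic bipartite fidelity. -/
def LBF (N1 N2 : ℕ) (ψ : Conf (N1+N2) → ℂ) (ψ1 : Conf N1 → ℂ) (ψ2 : Conf N2 → ℂ) : ℂ :=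
  -Complex.log ((overlap N1 N2 ψ ψ1 ψ2)^2 /
    (selfOverlap N1 ψ1 * selfOverlap N2 ψ2 * selfOverlap (N1+N2) ψ))

/-- The truncated asymptotic series of the LBF in the mixed-parity case, as a
function of the aspect ratio `t` and the (real) chain length `n`. -/
def asymExprOdd (D E Ebar t n : ℝ) : ℝ :=
  (1/6) * Real.log n + (1/6) * Real.log (t/(1-t)) - Real.log D
    + (1/72) * (E/t + Ebar * (1 - 1/(1-t))) / n

section

/-! ### The inhomogeneous vector: rational form -/

/-- A site of an inhomogeneous chain: a letter (`true` is `↓`) and a spectral parameter. -/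
abbrev Site := Bool × ℂ

/-- Number of inversions (an `↑` standing before a `↓`). -/
def invW : List Site → ℕ
  | [] => 0
  | (true, _) :: l => invW l
  | (false, _) :: l => l.countP (fun z => z.1) + invW l

lemma invW_append (l l' : List Site) :
    invW (l ++ l') = invW l + invW l' + l.countP (fun z => !z.1) * l'.countP (fun z => z.1) := by
  induction l with
  | nil => simp [invW]
  | cons z l ih =>
    obtain ⟨a, s⟩ := z
    cases a
    · simp [invW, ih]; ring
    · simp [invW, ih]

lemma invW_step (p q : List Site) (s t s' t' : ℂ) :
    invW (p ++ (true, s') :: (false, t') :: q) < invW (p ++ (false, s) :: (true, t) :: q) := by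
  simp only [invW_append, invW, List.countP_cons]
  simp

/-- Product over ordered pairs of a list. -/
def pairProd (f : ℂ → ℂ → ℂ) : List ℂ → ℂ
  | [] => 1
  | a :: l => (l.map (f a)).prod * pairProd f l

lemma pairProd_append (f : ℂ → ℂ → ℂ) (l l' : List ℂ) :
    pairProd f (l ++ l') =
      pairProd f l * pairProd f l' * (l.map (fun a => (l'.map (f a)).prod)).prod := by
  induction l with
  | nil => simp [pairProd]
  | cons z l ih => simp [pairProd, ih]; ring

/-- The pair factor of two `↓` sites. -/
def fD (w a b : ℂ) : ℂ := (a - w * b) * (w * a * b - 1)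

/-- The pair factor of two `↑` sites. -/
def fU (w a b : ℂ) : ℂ := (b - w ^ 2 * a) * (w ^ 2 * a * b - 1)

/-- The boundary factor. -/
def th (w x y : ℂ) : ℂ := (x + w) * y - (x + w ^ 2)

def downs (l : List Site) : List ℂ := (l.filter (fun z => z.1)).map Prod.snd

def ups (l : List Site) : List ℂ := (l.filter (fun z => !z.1)).map Prod.snd

@[simp] lemma downs_append (l l' : List Site) : downs (l ++ l') = downs l ++ downs l' := by
  simp [downs]

@[simp] lemma ups_append (l l' : List Site) : ups (l ++ l') = ups l ++ ups l' := by
  simp [ups]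

@[simp] lemma downs_nil : downs [] = [] := rfl
@[simp] lemma ups_nil : ups [] = [] := rfl
@[simp] lemma downs_cons_true (s : ℂ) (l : List Site) : downs ((true, s) :: l) = s :: downs l := by
  simp [downs]
@[simp] lemma downs_cons_false (s : ℂ) (l : List Site) : downs ((false, s) :: l) = downs l := by
  simp [downs]
@[simp] lemma ups_cons_true (s : ℂ) (l : List Site) : ups ((true, s) :: l) = ups l := by
  simp [ups]
@[simp] lemma ups_cons_false (s : ℂ) (l : List Site) : ups ((false, s) :: l) = s :: ups l := by
  simp [ups]

/-- The value at a configuration with all `↓` sites first. -/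
def baseF (w x : ℂ) (l : List Site) : ℂ :=
  ((downs l).map (fun y => y ^ (l.length % 2) * th w x y)).prod
    * pairProd (fD w) (downs l) * pairProd (fU w) (ups l)

def stepT (w s t A B : ℂ) : ℂ := ((w * t - s) * A - (w - 1) * t * B) / (w ^ 2 * (s - t))

/-- The inhomogeneous vector, as a rational function of the parameters. -/
def ratF (w x : ℂ) (l : List Site) : ℂ :=
  if h : ∃ z : List Site × ℂ × ℂ × List Site,
      l = z.1 ++ (false, z.2.1) :: (true, z.2.2.1) :: z.2.2.2 then
    stepT w h.choose.2.1 h.choose.2.2.1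
      (ratF w x (h.choose.1 ++ (true, h.choose.2.2.1) :: (false, h.choose.2.1) :: h.choose.2.2.2))
      (ratF w x (h.choose.1 ++ (true, h.choose.2.1) :: (false, h.choose.2.2.1) :: h.choose.2.2.2))
  else baseF w x l
termination_by invW l
decreasing_by
  all_goals
    conv_rhs => rw [h.choose_spec]
    exact invW_step _ _ _ _ _ _

lemma two_split {α : Type*} {p q p' q' : List α} {a b c d : α}
    (h : p ++ a :: b :: q = p' ++ c :: d :: q') :
    (p = p' ∧ a = c ∧ b = d ∧ q = q')
    ∨ (p' = p ++ [a] ∧ b = c ∧ q = d :: q')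
    ∨ (p = p' ++ [c] ∧ a = d ∧ q' = b :: q)
    ∨ (∃ m, p' = p ++ a :: b :: m ∧ q = m ++ c :: d :: q')
    ∨ (∃ m, p = p' ++ c :: d :: m ∧ q' = m ++ a :: b :: q) := by
  rcases List.append_eq_append_iff.1 h with ⟨as, rfl, h2⟩ | ⟨as, rfl, h2⟩
  · rcases as with _ | ⟨z1, _ | ⟨z2, as⟩⟩
    · simp at h2; left; simp_all
    · simp at h2; right; left; simp_all
    · simp at h2; right; right; right; left; exact ⟨as, by simp_all⟩
  · rcases as with _ | ⟨z1, _ | ⟨z2, as⟩⟩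
    · simp at h2; left; simp_all
    · simp at h2; right; right; left; simp_all
    · simp at h2; right; right; right; right; exact ⟨as, by simp_all⟩

lemma ratF_step (w x : ℂ) (p q : List Site) (s t : ℂ) :
    ratF w x (p ++ (false, s) :: (true, t) :: q) =
      stepT w s t (ratF w x (p ++ (true, t) :: (false, s) :: q))
        (ratF w x (p ++ (true, s) :: (false, t) :: q)) := by
  induction hn : invW (p ++ (false, s) :: (true, t) :: q) using Nat.strong_induction_on
    generalizing p q s t with
  | _ n ih =>
    have ih' : ∀ (p' q' : List Site) (s' t' : ℂ), invW (p' ++ (false, s') :: (true, t') :: q') < n →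
      ratF w x (p' ++ (false, s') :: (true, t') :: q') =
      stepT w s' t' (ratF w x (p' ++ (true, t') :: (false, s') :: q'))
        (ratF w x (p' ++ (true, s') :: (false, t') :: q')) :=
      fun p' q' s' t' h => ih _ h p' q' s' t' rfl
    have h : ∃ z : List Site × ℂ × ℂ × List Site,
      p ++ (false, s) :: (true, t) :: q = z.1 ++ (false, z.2.1) :: (true, z.2.2.1) :: z.2.2.2 :=
      ⟨(p, s, t, q), rfl⟩
    rw [ratF, dif_pos h]
    obtain ⟨⟨p', s', t', q'⟩, hz⟩ : ∃ z, z = h.choose := ⟨_, rfl⟩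
    have hs := h.choose_spec
    rw [← hz] at hs ⊢
    simp only at hs ⊢
    have comm : ∀ (a m b : List Site) (s t s' t' : ℂ),
        invW (a ++ (false, s) :: (true, t) :: (m ++ (false, s') :: (true, t') :: b)) = n →
        stepT w s t (ratF w x (a ++ (true, t) :: (false, s) :: (m ++ (false, s') :: (true, t') :: b)))
          (ratF w x (a ++ (true, s) :: (false, t) :: (m ++ (false, s') :: (true, t') :: b)))
        = stepT w s' t'
          (ratF w x (a ++ (false, s) :: (true, t) :: (m ++ (true, t') :: (false, s') :: b)))
          (ratF w x (a ++ (false, s) :: (true, t) :: (m ++ (true, s') :: (false, t') :: b))) := by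
      intro a m b s t s' t' hn
      have h1 : ∀ u v : ℂ, ratF w x (a ++ (true, u) :: (false, v) :: (m ++ (false, s') :: (true, t') :: b))
          = stepT w s' t'
            (ratF w x (a ++ (true, u) :: (false, v) :: (m ++ (true, t') :: (false, s') :: b)))
            (ratF w x (a ++ (true, u) :: (false, v) :: (m ++ (true, s') :: (false, t') :: b))) := by
        intro u v
        have := ih' (a ++ (true, u) :: (false, v) :: m) b s' t' (by
          rw [← hn]; simpa using invW_step a (m ++ (false, s') :: (true, t') :: b) s t u v)
        simpa using this
      have h2 : ∀ u v : ℂ, ratF w x (a ++ (false, s) :: (true, t) :: (m ++ (true, u) :: (false, v) :: b))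
          = stepT w s t
            (ratF w x (a ++ (true, t) :: (false, s) :: (m ++ (true, u) :: (false, v) :: b)))
            (ratF w x (a ++ (true, s) :: (false, t) :: (m ++ (true, u) :: (false, v) :: b))) := by
        intro u v
        refine ih' a (m ++ (true, u) :: (false, v) :: b) s t ?_
        rw [← hn]
        simpa using invW_step (a ++ (false, s) :: (true, t) :: m) b s' t' u v
      rw [h1, h1, h2, h2]
      simp only [stepT]
      ring
    rcases two_split hs with ⟨rfl, h1, h2, rfl⟩ | ⟨h0, h1, h2⟩ | ⟨h0, h1, h2⟩ | ⟨m, rfl, rfl⟩ | ⟨m, rfl, rfl⟩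
    · simp only [Prod.mk.injEq, true_and] at h1 h2
      rw [h1, h2]
    · simp at h1
    · simp at h1
    · have := comm p m q' s t s' t' (by simpa using hn)
      simpa using this.symm
    · have := comm p' m q s' t' s t (by simpa using hn)
      simpa using this

end

section

lemma word_sorted (l : List Site)
    (h : ¬ ∃ z : List Site × ℂ × ℂ × List Site,
      l = z.1 ++ (false, z.2.1) :: (true, z.2.2.1) :: z.2.2.2) :
    l = (downs l).map (fun y => (true, y)) ++ (ups l).map (fun y => (false, y)) := by
  induction l with
  | nil => simp
  | cons z l ih =>
    obtain ⟨a, s⟩ := z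
    have h' : ¬ ∃ z : List Site × ℂ × ℂ × List Site,
      l = z.1 ++ (false, z.2.1) :: (true, z.2.2.1) :: z.2.2.2 := by
      rintro ⟨⟨p, s', t', q⟩, rfl⟩
      exact h ⟨((a, s) :: p, s', t', q), rfl⟩
    have ih := ih h'
    cases a
    · rcases hd : downs l with _ | ⟨y, ds⟩
      · rw [hd] at ih
        simp [hd] at ih ⊢
        exact ih
      · rw [hd] at ih
        exact absurd ⟨([], s, y, ds.map (fun y => (true, y)) ++ (ups l).map (fun y => (false, y))),
          by simpa using ih⟩ h
    · simpa using ih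

lemma ratF_base (w x : ℂ) (ds us : List ℂ) :
    ratF w x (ds.map (fun y => (true, y)) ++ us.map (fun y => (false, y)))
      = (ds.map (fun y => y ^ ((ds.length + us.length) % 2) * th w x y)).prod
        * pairProd (fD w) ds * pairProd (fU w) us := by
  have hd : downs (ds.map (fun y => (true, y)) ++ us.map (fun y => (false, y))) = ds := by
    simp [downs, List.filter_map, Function.comp_def]
  have hu : ups (ds.map (fun y => (true, y)) ++ us.map (fun y => (false, y))) = us := by
    simp [ups, List.filter_map, Function.comp_def]
  rw [ratF, dif_neg]
  · simp only [baseF, hd, hu]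
    simp
  · rintro ⟨⟨p, s, t, q⟩, h⟩
    simp only at h
    rcases List.append_eq_append_iff.1 h with ⟨as, rfl, h2⟩ | ⟨as, h1, h2⟩
    · have : (true, t) ∈ us.map (fun y => ((false, y) : Site)) := by rw [h2]; simp
      simp at this
    · rcases as with _ | ⟨z, as⟩
      · have : (true, t) ∈ us.map (fun y => ((false, y) : Site)) := by rw [← List.nil_append (List.map _ us), ← h2]; simp
        simp at this
      · have : (false, s) ∈ ds.map (fun y => ((true, y) : Site)) := by
          simp at h2
          rw [h1, ← h2.1]; simp
        simp at this

/-- The exchange relation satisfied by a function of inhomogeneous configurations. -/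
def ExchAt (w : ℂ) (G : List Site → ℂ) (p q : List Site) (a b : Bool) (s t : ℂ) : Prop :=
  (w * t - s) * G (p ++ (a, t) :: (b, s) :: q) =
    if a = b then (w * s - t) * G (p ++ (a, s) :: (b, t) :: q)
    else (w - 1) * (if a then t else s) * G (p ++ (a, s) :: (b, t) :: q)
      + w ^ 2 * (s - t) * G (p ++ (b, s) :: (a, t) :: q)

lemma map_eq_split {c : Bool} {ds : List ℂ} {p q : List Site} {a b : Bool} {s t : ℂ}
    (h : ds.map (fun y => ((c, y) : Site)) = p ++ (a, s) :: (b, t) :: q) :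
    a = c ∧ b = c ∧ ∃ d1 d2, ds = d1 ++ s :: t :: d2 ∧ p = d1.map (fun y => (c, y))
      ∧ q = d2.map (fun y => (c, y)) := by
  obtain ⟨d1, d', rfl, rfl, h0⟩ := List.map_eq_append_iff.1 h
  obtain ⟨s', d'', rfl, h1, h⟩ := List.map_eq_cons_iff.1 h0
  obtain ⟨t', d2, rfl, h2, rfl⟩ := List.map_eq_cons_iff.1 h
  simp at h1 h2
  refine ⟨h1.1.symm, h2.1.symm, d1, d2, ?_, rfl, rfl⟩
  rw [h1.2, h2.2]

lemma pairProd_swap (f : ℂ → ℂ → ℂ) (α β s t : ℂ) (h : α * f t s = β * f s t) (d1 d2 : List ℂ) :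
    α * pairProd f (d1 ++ t :: s :: d2) = β * pairProd f (d1 ++ s :: t :: d2) := by
  simp only [pairProd_append, pairProd, List.map_cons, List.prod_cons]
  have : (d1.map (fun a => f a t * (f a s * (d2.map (f a)).prod))).prod
      = (d1.map (fun a => f a s * (f a t * (d2.map (f a)).prod))).prod := by
    congr 1; refine List.map_congr_left fun a _ => ?_; ring
  rw [this]
  linear_combination pairProd f d1 * (d2.map (f t)).prod * (d2.map (f s)).prod * pairProd f d2
      * (d1.map (fun a => f a s * (f a t * (d2.map (f a)).prod))).prod * h

lemma prod_map_swap (f : ℂ → ℂ) (s t : ℂ) (d1 d2 : List ℂ) :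
    ((d1 ++ t :: s :: d2).map f).prod = ((d1 ++ s :: t :: d2).map f).prod := by
  simp only [List.map_append, List.map_cons, List.prod_append, List.prod_cons]; ring

lemma omega_cube {w : ℂ} (hw : w ^ 2 + w + 1 = 0) : w ^ 3 = 1 := by
  linear_combination (w - 1) * hw

lemma omega_ne_zero {w : ℂ} (hw : w ^ 2 + w + 1 = 0) : w ≠ 0 := by
  rintro rfl; simp at hw

lemma ratF_same_base (w x : ℂ) (hw : w ^ 2 + w + 1 = 0) (p q : List Site) (a : Bool) (s t : ℂ)
    (h : ¬ ∃ z : List Site × ℂ × ℂ × List Site,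
      p ++ (a, s) :: (a, t) :: q = z.1 ++ (false, z.2.1) :: (true, z.2.2.1) :: z.2.2.2) :
    (w * t - s) * ratF w x (p ++ (a, t) :: (a, s) :: q) =
      (w * s - t) * ratF w x (p ++ (a, s) :: (a, t) :: q) := by
  have hs := word_sorted _ h
  have h3 := omega_cube hw
  generalize downs (p ++ (a, s) :: (a, t) :: q) = ds at hs
  generalize ups (p ++ (a, s) :: (a, t) :: q) = us at hs
  have hD : ∀ (d1 d2 us : List ℂ),
      (w * t - s) * ratF w x ((d1 ++ t :: s :: d2).map (fun y => (true, y)) ++ us.map (fun y => (false, y)))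
      = (w * s - t) * ratF w x ((d1 ++ s :: t :: d2).map (fun y => (true, y)) ++ us.map (fun y => (false, y))) := by
    intro d1 d2 us
    rw [ratF_base, ratF_base]
    have hl : (d1 ++ t :: s :: d2).length = (d1 ++ s :: t :: d2).length := by simp
    rw [hl, prod_map_swap]
    have := pairProd_swap (fD w) (w * t - s) (w * s - t) s t (by simp only [fD]; ring) d1 d2
    linear_combination ((d1 ++ s :: t :: d2).map (fun y =>
      y ^ (((d1 ++ s :: t :: d2).length + us.length) % 2) * th w x y)).prod * pairProd (fU w) us * this
  have hU : ∀ (d1 d2 ds : List ℂ),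
      (w * t - s) * ratF w x (ds.map (fun y => (true, y)) ++ (d1 ++ t :: s :: d2).map (fun y => (false, y)))
      = (w * s - t) * ratF w x (ds.map (fun y => (true, y)) ++ (d1 ++ s :: t :: d2).map (fun y => (false, y))) := by
    intro d1 d2 ds
    rw [ratF_base, ratF_base]
    have hl : (d1 ++ t :: s :: d2).length = (d1 ++ s :: t :: d2).length := by simp
    rw [hl]
    have := pairProd_swap (fU w) (w * t - s) (w * s - t) s t (by
      simp only [fU]; linear_combination (s ^ 2 - t ^ 2) * (w ^ 2 * s * t - 1) * h3) d1 d2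
    linear_combination (ds.map (fun y =>
      y ^ ((ds.length + (d1 ++ s :: t :: d2).length) % 2) * th w x y)).prod * pairProd (fD w) ds * this
  rcases List.append_eq_append_iff.1 hs with ⟨as, h1, h2⟩ | ⟨as, h1, h2⟩
  · rcases as with _ | ⟨z, _ | ⟨z', as⟩⟩
    · obtain ⟨rfl, -, d1, d2, rfl, h4, rfl⟩ := map_eq_split (p := []) h2.symm
      simp at h4
      subst h4
      simpa [h1] using hU [] d2 ds
    · exfalso
      simp only [List.cons_append, List.nil_append, List.cons.injEq] at h2
      have h5 : z ∈ ds.map (fun y => ((true, y) : Site)) := by rw [h1]; simp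
      have h6 : (a, t) ∈ us.map (fun y => ((false, y) : Site)) := by rw [← h2.2]; simp
      rw [← h2.1] at h5
      simp at h5 h6
      rw [h6.2] at h5
      simp at h5
    · simp only [List.cons_append, List.cons.injEq] at h2
      obtain ⟨rfl, rfl, rfl⟩ := h2
      obtain ⟨rfl, -, d1, d2, rfl, rfl, rfl⟩ := map_eq_split h1
      simpa using hD d1 d2 us
  · obtain ⟨rfl, -, d1, d2, rfl, rfl, rfl⟩ := map_eq_split h2
    rw [h1]
    simpa using hU d1 d2 ds

lemma braid_up {w s t r : ℂ} (hw : w ≠ 0) (hst : s ≠ t) (hsr : s ≠ r) (htr : t ≠ r)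
    (D : ℂ → ℂ → ℂ → ℂ)
    (er : (w * t - s) * D r t s = (w * s - t) * D r s t)
    (et : (w * r - s) * D t r s = (w * s - r) * D t s r)
    (es : (w * r - t) * D s r t = (w * t - r) * D s t r) :
    (w * t - s) * stepT w s r (stepT w t r (D r t s) (D t r s)) (stepT w t s (D s t r) (D t s r))
      = (w * s - t) *
        stepT w t r (stepT w s r (D r s t) (D s r t)) (stepT w s t (D t s r) (D s t r)) := by
  have h1 : s - t ≠ 0 := sub_ne_zero.2 hst
  have h2 : s - r ≠ 0 := sub_ne_zero.2 hsr
  have h3 : t - r ≠ 0 := sub_ne_zero.2 htr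
  have h4 : t - s = -(s - t) := by ring
  simp only [stepT]
  rw [h4]
  linear_combination (norm := (field_simp; ring))
    (w * r - s) * (w * r - t) / (w ^ 4 * (s - r) * (t - r)) * er
    - (w * t - s) * (w - 1) * r / (w ^ 4 * (s - r) * (t - r)) * et
    + (w * s - t) * (w - 1) * r / (w ^ 4 * (s - r) * (t - r)) * es

lemma braid_down {w s t r : ℂ} (hw : w ≠ 0) (hst : s ≠ t) (hsr : s ≠ r) (htr : t ≠ r)
    (D : ℂ → ℂ → ℂ → ℂ)
    (er : (w * t - s) * D t s r = (w * s - t) * D s t r)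
    (et : (w * r - s) * D r s t = (w * s - r) * D s r t)
    (es : (w * r - t) * D r t s = (w * t - r) * D t r s) :
    (w * t - s) * stepT w r t (stepT w r s (D t s r) (D t r s)) (stepT w t s (D r s t) (D r t s))
      = (w * s - t) *
        stepT w r s (stepT w r t (D s t r) (D s r t)) (stepT w s t (D r t s) (D r s t)) := by
  have h1 : s - t ≠ 0 := sub_ne_zero.2 hst
  have h2 : s - r ≠ 0 := sub_ne_zero.2 hsr
  have h3 : t - r ≠ 0 := sub_ne_zero.2 htr
  have h4 : t - s = -(s - t) := by ring
  have h5 : r - t = -(t - r) := by ring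
  have h6 : r - s = -(s - r) := by ring
  simp only [stepT]
  rw [h4, h5, h6]
  linear_combination (norm := (field_simp; ring))
    (w * s - r) * (w * t - r) / (w ^ 4 * (s - r) * (t - r)) * er
    - (w * s - t) * (w - 1) * t / (w ^ 4 * (s - r) * (t - r)) * et
    + (w * t - s) * (w - 1) * s / (w ^ 4 * (s - r) * (t - r)) * es

lemma ratF_same (w x : ℂ) (hw : w ^ 2 + w + 1 = 0) (p q : List Site) (a : Bool) (s t : ℂ)
    (hn : ((p ++ (a, s) :: (a, t) :: q).map Prod.snd).Nodup) :
    (w * t - s) * ratF w x (p ++ (a, t) :: (a, s) :: q) =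
      (w * s - t) * ratF w x (p ++ (a, s) :: (a, t) :: q) := by
  induction hi : invW (p ++ (a, s) :: (a, t) :: q) using Nat.strong_induction_on
    generalizing p q a s t with
  | _ n ih =>
  by_cases h : ∃ z : List Site × ℂ × ℂ × List Site,
      p ++ (a, s) :: (a, t) :: q = z.1 ++ (false, z.2.1) :: (true, z.2.2.1) :: z.2.2.2
  swap
  · exact ratF_same_base w x hw p q a s t h
  obtain ⟨⟨p', s', t', q'⟩, h⟩ := h
  simp only at h
  have hw0 := omega_ne_zero hw
  rcases two_split h with ⟨rfl, h1, h2, rfl⟩ | ⟨h0, h1, h2⟩ | ⟨h0, h1, h2⟩ | ⟨m, rfl, rfl⟩ | ⟨m, rfl, rfl⟩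
  · simp at h1 h2; simp [h1] at h2
  · simp only [Prod.mk.injEq] at h1
    obtain ⟨rfl, rfl⟩ := h1
    subst h2 h0
    have hn' := hn
    simp only [List.map_append, List.map_cons, List.nodup_append, List.nodup_cons] at hn'
    have hst : s ≠ t := by rintro rfl; simp at hn'
    have hsr : s ≠ t' := by rintro rfl; simp at hn'
    have htr : t ≠ t' := by rintro rfl; simp at hn'
    have e1 : ∀ a b c, ratF w x (p ++ (false, a) :: (false, b) :: (true, c) :: q') =
        stepT w b c (stepT w a c (ratF w x (p ++ (true, c) :: (false, a) :: (false, b) :: q'))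
            (ratF w x (p ++ (true, a) :: (false, c) :: (false, b) :: q')))
          (stepT w a b (ratF w x (p ++ (true, b) :: (false, a) :: (false, c) :: q'))
            (ratF w x (p ++ (true, a) :: (false, b) :: (false, c) :: q'))) := by
      intro a b c
      have := ratF_step w x (p ++ [(false, a)]) q' b c
      simp only [List.append_assoc, List.cons_append, List.nil_append] at this
      rw [this, ratF_step, ratF_step]
    have e2 : ∀ a b c, ((p ++ (true, a) :: (false, b) :: (false, c) :: q').map Prod.snd).Nodup →
        (w * c - b) * ratF w x (p ++ (true, a) :: (false, c) :: (false, b) :: q')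
        = (w * b - c) * ratF w x (p ++ (true, a) :: (false, b) :: (false, c) :: q') := by
      intro a b c h
      have := ih _ (by
        rw [← hi]
        have h1 := invW_step p ((false, c) :: q') s t a b
        have h2 := invW_step (p ++ [(false, s)]) q' t t' t t'
        simp only [List.append_assoc, List.cons_append, List.nil_append] at h2
        refine lt_of_lt_of_le ?_ h2.le
        simp [invW_append, invW]) (p ++ [(true, a)]) q' false b c (by simpa using h) rfl
      simpa using this
    rw [e1, e1]
    refine braid_up hw0 hst hsr htr
      (fun a b c => ratF w x (p ++ (true, a) :: (false, b) :: (false, c) :: q')) ?_ ?_ ?_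
    · refine e2 _ _ _ ((List.Perm.nodup_iff ?_).2 hn)
      simp only [List.map_append, List.map_cons]
      refine List.Perm.append_left _ ?_
      exact (List.Perm.swap _ _ _).trans ((List.Perm.swap _ _ _).cons _)
    · refine e2 _ _ _ ((List.Perm.nodup_iff ?_).2 hn)
      simp only [List.map_append, List.map_cons]
      exact List.Perm.append_left _ (List.Perm.swap _ _ _)
    · exact e2 _ _ _ (by simpa using hn)
  · simp only [Prod.mk.injEq] at h1
    obtain ⟨rfl, rfl⟩ := h1
    subst h2 h0
    simp only [List.append_assoc, List.cons_append, List.nil_append] at hn hi ⊢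
    have hn' := hn
    simp only [List.map_append, List.map_cons, List.nodup_append, List.nodup_cons] at hn'
    have hst : s ≠ t := by rintro rfl; simp at hn'
    have hsr : s ≠ s' := by rintro rfl; simp at hn'
    have htr : t ≠ s' := by rintro rfl; simp at hn'
    have e1 : ∀ a b c, ratF w x (p' ++ (false, a) :: (true, b) :: (true, c) :: q) =
        stepT w a b (stepT w a c (ratF w x (p' ++ (true, b) :: (true, c) :: (false, a) :: q))
            (ratF w x (p' ++ (true, b) :: (true, a) :: (false, c) :: q)))
          (stepT w b c (ratF w x (p' ++ (true, a) :: (true, c) :: (false, b) :: q))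
            (ratF w x (p' ++ (true, a) :: (true, b) :: (false, c) :: q))) := by
      intro a b c
      have := fun d a b => ratF_step w x (p' ++ [(true, d)]) q a b
      simp only [List.append_assoc, List.cons_append, List.nil_append] at this
      rw [ratF_step, this, this]
    have e2 : ∀ a b c, ((p' ++ (true, a) :: (true, b) :: (false, c) :: q).map Prod.snd).Nodup →
        (w * b - a) * ratF w x (p' ++ (true, b) :: (true, a) :: (false, c) :: q)
        = (w * a - b) * ratF w x (p' ++ (true, a) :: (true, b) :: (false, c) :: q) := by
      intro a b c h
      exact ih _ (by
        rw [← hi]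
        have h1 := invW_step p' ((true, t) :: q) s' s s' s
        have h2 := invW_step (p' ++ [(true, a)]) q s t b c
        simp only [List.append_assoc, List.cons_append, List.nil_append] at h2
        refine lt_trans h2 ?_
        simp [invW_append, invW]) p' ((false, c) :: q) true a b (by simpa using h) rfl
    rw [e1, e1]
    refine braid_down hw0 hst hsr htr
      (fun a b c => ratF w x (p' ++ (true, a) :: (true, b) :: (false, c) :: q)) ?_ ?_ ?_
    · refine e2 _ _ _ ((List.Perm.nodup_iff ?_).2 hn)
      simp only [List.map_append, List.map_cons]
      refine List.Perm.append_left _ ?_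
      exact ((List.Perm.swap _ _ _).cons _).trans (List.Perm.swap _ _ _)
    · refine e2 _ _ _ ((List.Perm.nodup_iff ?_).2 hn)
      simp only [List.map_append, List.map_cons]
      exact List.Perm.append_left _ (List.Perm.swap _ _ _)
    · refine e2 _ _ _ ((List.Perm.nodup_iff ?_).2 hn)
      simp only [List.map_append, List.map_cons]
      refine List.Perm.append_left _ ?_
      exact (List.Perm.swap _ _ _).trans ((List.Perm.swap _ _ _).cons _)
  · have e : ∀ u v, ratF w x (p ++ (a, u) :: (a, v) :: (m ++ (false, s') :: (true, t') :: q')) =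
        stepT w s' t' (ratF w x (p ++ (a, u) :: (a, v) :: (m ++ (true, t') :: (false, s') :: q')))
          (ratF w x (p ++ (a, u) :: (a, v) :: (m ++ (true, s') :: (false, t') :: q'))) := by
      intro u v
      simpa using ratF_step w x (p ++ (a, u) :: (a, v) :: m) q' s' t'
    have e1 := ih _ (by
      rw [← hi]; simpa using invW_step (p ++ (a, s) :: (a, t) :: m) q' s' t' t' s') p
        (m ++ (true, t') :: (false, s') :: q') a s t (by
          refine (List.Perm.nodup_iff ?_).2 hn
          simp only [List.map_append, List.map_cons]
          exact (((((List.Perm.swap _ _ _).append_left _).cons _).cons _).append_left _)) rfl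
    have e2 := ih _ (by
      rw [← hi]; simpa using invW_step (p ++ (a, s) :: (a, t) :: m) q' s' t' s' t') p
        (m ++ (true, s') :: (false, t') :: q') a s t (by simpa using hn) rfl
    rw [e, e]
    simp only [stepT]
    linear_combination ((w * t' - s') / (w ^ 2 * (s' - t'))) * e1
      - ((w - 1) * t' / (w ^ 2 * (s' - t'))) * e2
  · have e : ∀ u v, ratF w x (p' ++ (false, s') :: (true, t') :: m ++ (a, u) :: (a, v) :: q) =
        stepT w s' t' (ratF w x (p' ++ (true, t') :: (false, s') :: m ++ (a, u) :: (a, v) :: q))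
          (ratF w x (p' ++ (true, s') :: (false, t') :: m ++ (a, u) :: (a, v) :: q)) := by
      intro u v
      simpa using ratF_step w x p' (m ++ (a, u) :: (a, v) :: q) s' t'
    have e1 := ih _ (by
      rw [← hi]; simpa using invW_step p' (m ++ (a, s) :: (a, t) :: q) s' t' t' s')
        (p' ++ (true, t') :: (false, s') :: m) q a s t (by
          refine (List.Perm.nodup_iff ?_).2 hn
          simp only [List.map_append, List.map_cons]
          exact (((List.Perm.swap _ _ _).append_left _).append_right _)) rfl
    have e2 := ih _ (by
      rw [← hi]; simpa using invW_step p' (m ++ (a, s) :: (a, t) :: q) s' t' s' t')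
        (p' ++ (true, s') :: (false, t') :: m) q a s t (by simpa using hn) rfl
    rw [e, e]
    simp only [stepT]
    linear_combination ((w * t' - s') / (w ^ 2 * (s' - t'))) * e1
      - ((w - 1) * t' / (w ^ 2 * (s' - t'))) * e2

theorem ratF_exch (w x : ℂ) (hw : w ^ 2 + w + 1 = 0) (p q : List Site) (a b : Bool) (s t : ℂ)
    (hn : ((p ++ (a, s) :: (b, t) :: q).map Prod.snd).Nodup) :
    ExchAt w (ratF w x) p q a b s t := by
  have hst : s ≠ t := by
    rintro rfl
    simp [List.nodup_append] at hn
  have h1 : s - t ≠ 0 := sub_ne_zero.2 hst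
  have h2 : t - s ≠ 0 := sub_ne_zero.2 hst.symm
  have hw0 := omega_ne_zero hw
  unfold ExchAt
  by_cases hab : a = b
  · subst hab
    simp only [if_true]
    exact ratF_same w x hw p q a s t hn
  · rw [if_neg hab]
    cases a <;> cases b
    · exact absurd rfl hab
    · rw [ratF_step w x p q s t, ratF_step w x p q t s]
      simp only [stepT, Bool.false_eq_true, if_false]
      have h4 : t - s = -(s - t) := by ring
      rw [h4]
      generalize ratF w x (p ++ (true, t) :: (false, s) :: q) = A
      generalize ratF w x (p ++ (true, s) :: (false, t) :: q) = B
      field_simp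
      have h3 := omega_cube hw
      linear_combination (-w * (s - t) ^ 2 * B) * h3
    · rw [ratF_step w x p q s t]
      simp only [stepT, if_true]
      field_simp
      ring
    · exact absurd rfl hab

end

section

/-! ### Polynomial extension of the inhomogeneous vector -/

section MvPoly
open MvPolynomial

lemma X_sub_X_dvd (i j : ℕ) (f : MvPolynomial ℕ ℂ) :
    (X i - X j : MvPolynomial ℕ ℂ) ∣ f - rename (Equiv.swap i j) f := by
  induction f using MvPolynomial.induction_on with
  | C a => simp
  | add p q hp hq =>
    have := dvd_add hp hq
    rw [map_add]; convert this using 1; ring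
  | mul_X p k hp =>
    have h : (X i - X j : MvPolynomial ℕ ℂ) ∣ X k - X (Equiv.swap i j k) := by
      rcases eq_or_ne k i with rfl | h1
      · simp
      · rcases eq_or_ne k j with rfl | h2
        · rw [Equiv.swap_apply_right, ← neg_sub]; exact (neg_dvd).2 dvd_rfl
        · rw [Equiv.swap_apply_of_ne_of_ne h1 h2]; simp
    rw [map_mul, rename_X]
    have := dvd_add (hp.mul_right (X k)) (h.mul_left (rename (Equiv.swap i j) p))
    convert this using 1; ring

lemma exists_stepPoly (w : ℂ) (i : ℕ) (f : MvPolynomial ℕ ℂ) :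
    ∃ g : MvPolynomial ℕ ℂ, (X i - X (i + 1)) * g =
      (C w * X (i + 1) - X i) * rename (Equiv.swap i (i + 1)) f - C (w - 1) * X (i + 1) * f := by
  obtain ⟨h, hh⟩ := X_sub_X_dvd i (i + 1) f
  refine ⟨-(C w * X (i + 1) - X i) * h - f, ?_⟩
  rw [C_sub, C_1]
  linear_combination (C w * X (i + 1) - X i) * hh

lemma degreeOf_X_sub_X (i k : ℕ) :
    degreeOf k (X i - X (i + 1) : MvPolynomial ℕ ℂ) = if k = i ∨ k = i + 1 then 1 else 0 := by
  split_ifs with h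
  · rcases h with rfl | rfl
    · have := degreeOf_add_eq_of_degreeOf_lt (p := (X k : MvPolynomial ℕ ℂ)) (q := - X (k + 1))
        (i := k) (by rw [degreeOf_neg, degreeOf_X_of_ne (by simp), degreeOf_X_self]; simp)
      rw [sub_eq_add_neg, this, degreeOf_X_self]
    · have := degreeOf_add_eq_of_degreeOf_lt (p := (- X (i + 1) : MvPolynomial ℕ ℂ)) (q := X i)
        (i := i + 1) (by rw [degreeOf_neg, degreeOf_X_of_ne (by simp), degreeOf_X_self]; simp)
      rw [sub_eq_add_neg, add_comm (X i), this, degreeOf_neg, degreeOf_X_self]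
  · push Not at h
    have := degreeOf_sub_le k (X i : MvPolynomial ℕ ℂ) (X (i + 1))
    rw [degreeOf_X_of_ne h.1, degreeOf_X_of_ne h.2] at this
    simpa using this

lemma degreeOf_stepPoly {w : ℂ} {i : ℕ} {f g : MvPolynomial ℕ ℂ}
    (h : (X i - X (i + 1)) * g =
      (C w * X (i + 1) - X i) * rename (Equiv.swap i (i + 1)) f - C (w - 1) * X (i + 1) * f) :
    (∀ k, k ≠ i → k ≠ i + 1 → degreeOf k g ≤ degreeOf k f) ∧
    (degreeOf i g ≤ max (degreeOf (i + 1) f) (degreeOf i f - 1)) ∧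
    (degreeOf (i + 1) g ≤ max (degreeOf i f) (degreeOf (i + 1) f)) := by
  have hren : ∀ k, degreeOf k (rename (Equiv.swap i (i + 1)) f)
      = degreeOf (Equiv.swap i (i + 1) k) f := by
    intro k
    have := degreeOf_rename_of_injective (p := f) (Equiv.swap i (i + 1)).injective
      (Equiv.swap i (i + 1) k)
    simpa using this
  have hX : (X i - X (i + 1) : MvPolynomial ℕ ℂ) ≠ 0 := by
    intro h0
    have := degreeOf_X_sub_X i i
    rw [h0] at this; simp at this
  have key : ∀ k d, degreeOf k ((C w * X (i + 1) - X i) * rename (Equiv.swap i (i + 1)) f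
      - C (w - 1) * X (i + 1) * f) ≤ d →
      degreeOf k g ≤ d - (if k = i ∨ k = i + 1 then 1 else 0) := by
    intro k d hd
    rcases eq_or_ne g 0 with rfl | hg
    · simp
    rw [← h, degreeOf_mul_eq hX hg, degreeOf_X_sub_X] at hd
    omega
  have hL : ∀ k, degreeOf k ((C w * X (i + 1) - X i) * rename (Equiv.swap i (i + 1)) f
      - C (w - 1) * X (i + 1) * f) ≤
      max (max (degreeOf k (X (i + 1) : MvPolynomial ℕ ℂ)) (degreeOf k (X i : MvPolynomial ℕ ℂ))
        + degreeOf (Equiv.swap i (i + 1) k) f)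
      (degreeOf k (X (i + 1) : MvPolynomial ℕ ℂ) + degreeOf k f) := by
    intro k
    refine (degreeOf_sub_le _ _ _).trans (max_le_max ?_ ?_)
    · refine (degreeOf_mul_le _ _ _).trans ?_
      rw [hren]
      gcongr
      refine (degreeOf_sub_le _ _ _).trans (max_le_max ?_ le_rfl)
      exact degreeOf_C_mul_le _ _ _
    · refine (degreeOf_mul_le _ _ _).trans ?_
      gcongr
      exact degreeOf_C_mul_le _ _ _
  refine ⟨fun k h1 h2 => ?_, ?_, ?_⟩
  · have := key k _ (hL k)
    rw [degreeOf_X_of_ne h1, degreeOf_X_of_ne h2, Equiv.swap_apply_of_ne_of_ne h1 h2] at this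
    simpa [h1, h2] using this
  · have := key i _ (hL i)
    rw [degreeOf_X_self, degreeOf_X_of_ne (by simp : i ≠ i + 1)] at this
    simp at this
    rw [le_max_iff]; omega
  · have := key (i + 1) _ (hL (i + 1))
    rw [degreeOf_X_self, degreeOf_X_of_ne (by simp : i + 1 ≠ i)] at this
    simp at this
    rw [le_max_iff]; omega

/-- Product of `f i j` over ordered pairs of a list. -/
def mvPair (f : ℕ → ℕ → MvPolynomial ℕ ℂ) : List ℕ → MvPolynomial ℕ ℂ
  | [] => 1
  | a :: l => (l.map (f a)).prod * mvPair f l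

lemma eval_mvPair (y : ℕ → ℂ) (f : ℕ → ℕ → MvPolynomial ℕ ℂ) (F : ℂ → ℂ → ℂ)
    (h : ∀ i j, eval y (f i j) = F (y i) (y j)) (l : List ℕ) :
    eval y (mvPair f l) = pairProd F (l.map y) := by
  induction l with
  | nil => simp [mvPair, pairProd]
  | cons a l ih =>
    simp only [mvPair, pairProd, List.map_cons, map_mul, ih, map_list_prod, List.map_map]
    congr 2
    refine List.map_congr_left fun b _ => ?_
    simp [h]

lemma degreeOf_listProd_le (k : ℕ) (l : List ℕ) (f : ℕ → MvPolynomial ℕ ℂ) (c : ℕ)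
    (h0 : ∀ i, i ≠ k → degreeOf k (f i) = 0) (h1 : degreeOf k (f k) ≤ c) (hl : l.Nodup) :
    degreeOf k (l.map f).prod ≤ if k ∈ l then c else 0 := by
  induction l with
  | nil => simp
  | cons a l ih =>
    have hl' := List.nodup_cons.1 hl
    have ih := ih hl'.2
    rw [List.map_cons, List.prod_cons]
    refine (degreeOf_mul_le _ _ _).trans ?_
    rcases eq_or_ne a k with rfl | hak
    · rw [if_neg hl'.1] at ih
      simp; omega
    · rw [h0 a hak]
      simpa [hak.symm] using ih

lemma degreeOf_mvPair_le (k : ℕ) (l : List ℕ) (f : ℕ → ℕ → MvPolynomial ℕ ℂ)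
    (h0 : ∀ i j, i ≠ k → j ≠ k → degreeOf k (f i j) = 0)
    (h2 : ∀ i j, i ≠ j → degreeOf k (f i j) ≤ 2) (hl : l.Nodup) :
    degreeOf k (mvPair f l) ≤ if k ∈ l then 2 * (l.length - 1) else 0 := by
  induction l with
  | nil => simp [mvPair]
  | cons a l ih =>
    have hl' := List.nodup_cons.1 hl
    have ih := ih hl'.2
    rw [mvPair]
    refine (degreeOf_mul_le _ _ _).trans ?_
    rcases eq_or_ne a k with rfl | hak
    · rw [if_neg hl'.1] at ih
      have : ∀ l' : List ℕ, a ∉ l' → degreeOf a (l'.map (f a)).prod ≤ 2 * l'.length := by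
        intro l'
        induction l' with
        | nil => simp
        | cons b l' ih' =>
          intro hb
          rw [List.mem_cons, not_or] at hb
          rw [List.map_cons, List.prod_cons]
          refine (degreeOf_mul_le _ _ _).trans ?_
          have := ih' hb.2
          have := h2 a b hb.1
          simp; omega
      have := this l hl'.1
      simp; omega
    · have h3 := degreeOf_listProd_le k l (f a) 2 (fun i hi => h0 a i hak hi) (h2 a k hak) hl'.2
      simp only [List.mem_cons, hak.symm, false_or]
      by_cases hk : k ∈ l
      · simp only [hk, if_true] at h3 ih ⊢
        have : 0 < l.length := List.length_pos_of_mem hk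
        simp; omega
      · simp only [hk, if_false] at h3 ih ⊢
        omega

/-- The parameters of a configuration as a sequence. -/
def env (l : List Site) : ℕ → ℂ := fun i => (l.map Prod.snd).getD i 0

lemma env_swap (p q : List Site) (a b c d : Bool) (s t : ℂ) :
    env (p ++ (a, t) :: (b, s) :: q)
      = env (p ++ (c, s) :: (d, t) :: q) ∘ Equiv.swap p.length (p.length + 1) := by
  ext j
  simp only [env, Function.comp, List.map_append, List.map_cons]
  rcases lt_or_ge j p.length with h | h
  · rw [Equiv.swap_apply_of_ne_of_ne (by omega) (by omega)]
    rw [List.getD_append _ _ _ _ (by simpa using h), List.getD_append _ _ _ _ (by simpa using h)]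
  · obtain ⟨m, rfl⟩ := Nat.exists_eq_add_of_le h
    rcases m with _ | _ | m
    · simp
    · simp
    · rw [Equiv.swap_apply_of_ne_of_ne (by omega) (by omega)]
      rw [List.getD_append_right _ _ _ _ (by simp), List.getD_append_right _ _ _ _ (by simp)]
      simp

lemma env_letters (p q : List Site) (a b c d : Bool) (s t : ℂ) :
    env (p ++ (a, s) :: (b, t) :: q) = env (p ++ (c, s) :: (d, t) :: q) := by
  unfold env; simp

/-- The degree bound at a site with letter `a` for length `N`. -/
def degB (N : ℕ) (a : Bool) : ℕ := if a then N - 1 else N - 1 - (1 - N % 2)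

lemma bool_sorted (v : List Bool) : (∃ p q, v = p ++ false :: true :: q) ∨
    ∃ m n, v = List.replicate m true ++ List.replicate n false := by
  induction v with
  | nil => exact .inr ⟨0, 0, rfl⟩
  | cons a v ih =>
    rcases ih with ⟨p, q, rfl⟩ | ⟨m, n, rfl⟩
    · exact .inl ⟨a :: p, q, rfl⟩
    · cases a
      · rcases m with _ | m
        · exact .inr ⟨0, n + 1, by simp [List.replicate_succ]⟩
        · exact .inl ⟨[], List.replicate m true ++ List.replicate n false,
            by simp [List.replicate_succ]⟩
      · exact .inr ⟨m + 1, n, by simp [List.replicate_succ]⟩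

lemma map_fst_replicate {l : List Site} {n : ℕ} {a : Bool} (h : l.map Prod.fst = List.replicate n a) :
    l = (l.map Prod.snd).map (fun y => (a, y)) := by
  rw [List.map_map]
  conv_lhs => rw [← List.map_id l]
  refine List.map_congr_left fun z hz => ?_
  have : z.1 ∈ List.replicate n a := h ▸ List.mem_map_of_mem hz
  obtain ⟨b, y⟩ := z
  simp [List.mem_replicate] at this
  simp [this]

lemma exists_basePoly (w x : ℂ) (m n : ℕ) : ∃ P : MvPolynomial ℕ ℂ,
    (∀ l : List Site, l.map Prod.fst = List.replicate m true ++ List.replicate n false →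
      ratF w x l = eval (env l) P) ∧
    (m = (m + n) / 2 → ∀ k < m + n, degreeOf k P ≤
      degB (m + n) ((List.replicate m true ++ List.replicate n false).getD k false)) := by
  have hA : ∀ (i j : ℕ) k, degreeOf k ((X i - C w * X j) * (C w * X i * X j - 1) : MvPolynomial ℕ ℂ)
      ≤ 2 * max (degreeOf k (X i : MvPolynomial ℕ ℂ)) (degreeOf k (X j : MvPolynomial ℕ ℂ))
        ∨ i = j := by
    intro i j k
    rcases eq_or_ne i j with h | h
    · exact .inr h
    left
    refine (degreeOf_mul_le _ _ _).trans ?_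
    have h1 := degreeOf_sub_le k (X i : MvPolynomial ℕ ℂ) (C w * X j)
    have h2 := degreeOf_sub_le k (C w * X i * X j : MvPolynomial ℕ ℂ) 1
    have h3 := degreeOf_C_mul_le (X j : MvPolynomial ℕ ℂ) k w
    have h4 := degreeOf_C_mul_le (X i : MvPolynomial ℕ ℂ) k w
    have h5 := degreeOf_mul_le k (C w * X i : MvPolynomial ℕ ℂ) (X j)
    rw [degreeOf_one] at h2
    have h6 : degreeOf k (X i : MvPolynomial ℕ ℂ) = 0 ∨ degreeOf k (X j : MvPolynomial ℕ ℂ) = 0 := by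
      rcases eq_or_ne k i with rfl | hk
      · right; exact degreeOf_X_of_ne h
      · left; exact degreeOf_X_of_ne hk
    simp only [le_max_iff] at *
    omega
  have hB : ∀ (i j : ℕ) k, degreeOf k ((X j - C (w ^ 2) * X i) * (C (w ^ 2) * X i * X j - 1) : MvPolynomial ℕ ℂ)
      ≤ 2 * max (degreeOf k (X i : MvPolynomial ℕ ℂ)) (degreeOf k (X j : MvPolynomial ℕ ℂ))
        ∨ i = j := by
    intro i j k
    rcases eq_or_ne i j with h | h
    · exact .inr h
    left
    refine (degreeOf_mul_le _ _ _).trans ?_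
    have h1 := degreeOf_sub_le k (X j : MvPolynomial ℕ ℂ) (C (w ^ 2) * X i)
    have h2 := degreeOf_sub_le k (C (w ^ 2) * X i * X j : MvPolynomial ℕ ℂ) 1
    have h4 := degreeOf_C_mul_le (X i : MvPolynomial ℕ ℂ) k (w ^ 2)
    have h5 := degreeOf_mul_le k (C (w ^ 2) * X i : MvPolynomial ℕ ℂ) (X j)
    rw [degreeOf_one] at h2
    have h6 : degreeOf k (X i : MvPolynomial ℕ ℂ) = 0 ∨ degreeOf k (X j : MvPolynomial ℕ ℂ) = 0 := by
      rcases eq_or_ne k i with rfl | hk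
      · right; exact degreeOf_X_of_ne h
      · left; exact degreeOf_X_of_ne hk
    simp only [le_max_iff] at *
    omega
  have hX1 : ∀ i k : ℕ, degreeOf k (X i : MvPolynomial ℕ ℂ) ≤ 1 := by
    intro i k; rw [degreeOf_X]; split_ifs <;> simp
  set fT : ℕ → MvPolynomial ℕ ℂ := fun i =>
    X i ^ ((m + n) % 2) * (C (x + w) * X i - C (x + w ^ 2)) with hfT
  have hT : ∀ i k, degreeOf k (fT i) ≤ ((m + n) % 2 + 1) * degreeOf k (X i : MvPolynomial ℕ ℂ) := by
    intro i k
    refine (degreeOf_mul_le _ _ _).trans ?_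
    have h1 := degreeOf_pow_le k (X i : MvPolynomial ℕ ℂ) ((m + n) % 2)
    have h2 := degreeOf_sub_le k (C (x + w) * X i : MvPolynomial ℕ ℂ) (C (x + w ^ 2))
    have h3 := degreeOf_C_mul_le (X i : MvPolynomial ℕ ℂ) k (x + w)
    rw [degreeOf_C, max_eq_left (Nat.zero_le _)] at h2
    linarith
  refine ⟨((List.range m).map fT).prod
      * mvPair (fun i j => (X i - C w * X j) * (C w * X i * X j - 1)) (List.range m)
      * mvPair (fun i j => (X j - C (w ^ 2) * X i) * (C (w ^ 2) * X i * X j - 1)) (List.range' m n),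
      ?_, ?_⟩
  · intro l hl
    obtain ⟨l1, l2, rfl, h1, h2⟩ := List.map_eq_append_iff.1 hl
    have hl1 : l1.length = m := by simpa using congrArg List.length h1
    have hl2 : l2.length = n := by simpa using congrArg List.length h2
    have e1 := map_fst_replicate h1
    have e2 := map_fst_replicate h2
    have r1 : (List.range m).map (env (l1 ++ l2)) = l1.map Prod.snd := by
      refine List.ext_getElem (by simp [hl1]) fun i hi hi' => ?_
      simp at hi hi'
      simp [env, List.getD, List.getElem?_append, hl1, hi]
    have r2 : (List.range' m n).map (env (l1 ++ l2)) = l2.map Prod.snd := by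
      refine List.ext_getElem (by simp [hl2]) fun i hi hi' => ?_
      simp at hi hi'
      simp [env, List.getD, hl1, hi']
    conv_lhs => rw [e1, e2]
    rw [ratF_base]
    rw [map_mul, map_mul, eval_mvPair _ _ (fD w) (by intro i j; simp [fD]),
      eval_mvPair _ _ (fU w) (by intro i j; simp [fU]), r1, r2, map_list_prod, List.map_map]
    congr 2
    simp only [List.length_map, hl1, hl2]
    rw [← List.map_map, ← r1, List.map_map, List.map_map]
    congr 1
    refine List.map_congr_left fun i _ => ?_
    simp [hfT, th]
  · intro hm k hk
    refine (degreeOf_mul_le _ _ _).trans ?_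
    have hTk := degreeOf_listProd_le k (List.range m) fT ((m + n) % 2 + 1)
      (fun i hi => by have := hT i k; rw [degreeOf_X_of_ne hi.symm] at this; simpa using this)
      (by have := hT k k; rw [degreeOf_X_self] at this; simpa using this) List.nodup_range
    have hDk := degreeOf_mvPair_le k (List.range m)
      (fun i j => (X i - C w * X j) * (C w * X i * X j - 1))
      (fun i j hi hj => by
        rcases hA i j k with h | h
        · rw [degreeOf_X_of_ne hi.symm, degreeOf_X_of_ne hj.symm] at h; simpa using h
        · subst h
          refine Nat.le_zero.1 ((degreeOf_mul_le _ _ _).trans ?_)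
          have h1 := degreeOf_sub_le k (X i : MvPolynomial ℕ ℂ) (C w * X i)
          have h2 := degreeOf_sub_le k (C w * X i * X i : MvPolynomial ℕ ℂ) 1
          have h3 := degreeOf_C_mul_le (X i : MvPolynomial ℕ ℂ) k w
          have h4 := degreeOf_mul_le k (C w * X i : MvPolynomial ℕ ℂ) (X i)
          have h5 : degreeOf k (X i : MvPolynomial ℕ ℂ) = 0 := degreeOf_X_of_ne hi.symm
          rw [degreeOf_one] at h2
          rw [le_max_iff] at h1 h2; omega)
      (fun i j hij => by
        rcases hA i j k with h | h
        · have := hX1 i k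
          have := hX1 j k
          omega
        · exact absurd h hij) List.nodup_range
    have hUk := degreeOf_mvPair_le k (List.range' m n)
      (fun i j => (X j - C (w ^ 2) * X i) * (C (w ^ 2) * X i * X j - 1))
      (fun i j hi hj => by
        rcases hB i j k with h | h
        · rw [degreeOf_X_of_ne hi.symm, degreeOf_X_of_ne hj.symm] at h; simpa using h
        · subst h
          refine Nat.le_zero.1 ((degreeOf_mul_le _ _ _).trans ?_)
          have h1 := degreeOf_sub_le k (X i : MvPolynomial ℕ ℂ) (C (w ^ 2) * X i)
          have h2 := degreeOf_sub_le k (C (w ^ 2) * X i * X i : MvPolynomial ℕ ℂ) 1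
          have h3 := degreeOf_C_mul_le (X i : MvPolynomial ℕ ℂ) k (w ^ 2)
          have h4 := degreeOf_mul_le k (C (w ^ 2) * X i : MvPolynomial ℕ ℂ) (X i)
          have h5 : degreeOf k (X i : MvPolynomial ℕ ℂ) = 0 := degreeOf_X_of_ne hi.symm
          rw [degreeOf_one] at h2
          rw [le_max_iff] at h1 h2; omega)
      (fun i j hij => by
        rcases hB i j k with h | h
        · have := hX1 i k
          have := hX1 j k
          omega
        · exact absurd h hij) (List.nodup_range' (step := 1) (by simp))
    have hM := degreeOf_mul_le k ((List.range m).map fT).prod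
      (mvPair (fun i j => (X i - C w * X j) * (C w * X i * X j - 1)) (List.range m))
    simp only [List.mem_range, List.mem_range'_1, List.length_range, List.length_range'] at hTk hDk hUk
    rcases lt_or_ge k m with hkm | hkm
    · rw [List.getD_append _ _ _ _ (by simpa using hkm)]
      have : ¬ (m ≤ k ∧ k < m + n) := by omega
      simp only [hkm, this, if_true, if_false] at hTk hDk hUk
      refine (Nat.add_le_add (hM.trans (Nat.add_le_add hTk hDk)) hUk).trans ?_
      simp [degB, List.getD, hkm]
      omega
    · rw [List.getD_append_right _ _ _ _ (by simpa using hkm)]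
      have h1 : (m ≤ k ∧ k < m + n) := by omega
      have h2 : ¬ k < m := by omega
      simp only [h1, h2, and_self, if_true, if_false] at hTk hDk hUk
      have h3 : k - m < n := by omega
      refine (Nat.add_le_add (hM.trans (Nat.add_le_add hTk hDk)) hUk).trans ?_
      simp [degB, List.getD, h3]
      omega

lemma exists_polyRep (w x : ℂ) (hw : w ≠ 0) (v : List Bool) : ∃ P : MvPolynomial ℕ ℂ,
    (∀ l : List Site, l.map Prod.fst = v → (l.map Prod.snd).Nodup →
      ratF w x l = eval (env l) P) ∧
    (v.countP id = v.length / 2 → ∀ k < v.length, degreeOf k P ≤ degB v.length (v.getD k false)) := by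
  induction hn : invW (v.map (fun a => (a, (0 : ℂ)))) using Nat.strong_induction_on generalizing v with
  | _ n ih =>
  rcases bool_sorted v with ⟨p, q, rfl⟩ | ⟨m, n, rfl⟩
  · have hlt := invW_step (p.map (fun a => (a, (0 : ℂ)))) (q.map (fun a => (a, (0 : ℂ)))) 0 0 0 0
    obtain ⟨f, hf, hdeg⟩ := ih _ (by rw [← hn]; simpa using hlt) (p ++ true :: false :: q) (by simp)
    obtain ⟨g, hg⟩ := exists_stepPoly w p.length f
    refine ⟨C ((w ^ 2)⁻¹) * g, ?_, ?_⟩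
    · intro l hl hnd
      obtain ⟨p', l', rfl, rfl, h0⟩ := List.map_eq_append_iff.1 hl
      obtain ⟨⟨a, s⟩, l'', rfl, h1, h⟩ := List.map_eq_cons_iff.1 h0
      obtain ⟨⟨b, t⟩, q', rfl, h2, rfl⟩ := List.map_eq_cons_iff.1 h
      simp only at h1 h2
      subst h1 h2
      have hst : s ≠ t := by
        rintro rfl
        simp [List.nodup_append] at hnd
      rw [ratF_step, hf _ (by simp) (by
          refine (List.Perm.nodup_iff ?_).1 hnd
          simp only [List.map_append, List.map_cons]
          exact List.Perm.append_left _ (List.Perm.swap _ _ _)),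
        hf _ (by simp) (by simpa using hnd), stepT,
        div_eq_iff (mul_ne_zero (pow_ne_zero 2 hw) (sub_ne_zero.2 hst))]
      rw [env_swap p' q' true false true false s t, env_letters p' q' false true true false]
      have := congrArg (eval (env (p' ++ (true, s) :: (false, t) :: q'))) hg
      have e1 : env (p' ++ (true, s) :: (false, t) :: q') (p'.length) = s := by simp [env, List.getD]
      have e2 : env (p' ++ (true, s) :: (false, t) :: q') (p'.length + 1) = t := by simp [env, List.getD]
      simp only [map_mul, map_sub, eval_X, eval_C, eval_rename, List.length_map, e1, e2] at this ⊢
      rw [← this]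
      field_simp
    · intro hc k hk
      have hd := hdeg (by simpa using hc)
      obtain ⟨d1, d2, d3⟩ := degreeOf_stepPoly hg
      refine (degreeOf_C_mul_le _ _ _).trans ?_
      have hN : (p ++ true :: false :: q).length = (p ++ false :: true :: q).length := by simp
      have hN2 : (p ++ false :: true :: q).length = p.length + q.length + 2 := by simp; omega
      rw [hN] at hd
      have g1 := hd p.length (by omega)
      have g2 := hd (p.length + 1) (by omega)
      simp only [hN2] at g1 g2 hd hk ⊢
      simp [List.getD, degB] at g1 g2
      rcases eq_or_ne k p.length with rfl | hk1
      · simp [List.getD, degB]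
        rw [le_max_iff] at d2
        omega
      · rcases eq_or_ne k (p.length + 1) with rfl | hk2
        · simp [List.getD, degB]
          rw [le_max_iff] at d3
          omega
        · have := (d1 k hk1 hk2).trans (hd k hk)
          convert this using 2
          rcases lt_or_ge k p.length with h | h
          · rw [List.getD_append _ _ _ _ h, List.getD_append _ _ _ _ h]
          · obtain ⟨j, rfl⟩ := Nat.exists_eq_add_of_le h
            rcases j with _ | _ | j
            · simp at hk1
            · simp at hk2
            · rw [List.getD_append_right _ _ _ _ h, List.getD_append_right _ _ _ _ h]
              simp
  · obtain ⟨P, h1, h2⟩ := exists_basePoly w x m n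
    refine ⟨P, fun l hl _ => h1 l hl, fun hc => ?_⟩
    simp [List.countP_replicate] at hc
    simpa using h2 hc

end MvPoly

end

section

section MvPoly
open MvPolynomial

lemma eval_aeval_eq (y : ℕ → ℂ) (f : ℕ → MvPolynomial ℕ ℂ) (Z : MvPolynomial ℕ ℂ) :
    eval y (aeval f Z) = eval (fun i => eval y (f i)) Z := by
  induction Z using MvPolynomial.induction_on with
  | C a => simp
  | add p q hp hq => rw [map_add, map_add, map_add, hp, hq]
  | mul_X p n hp => rw [map_mul, map_mul, map_mul, hp, aeval_X, eval_X]

lemma eval_eq_zero_of_nodup (N : ℕ) (Z : MvPolynomial ℕ ℂ)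
    (h : ∀ ys : List ℂ, ys.length = N → ys.Nodup → eval (fun i => ys.getD i 0) Z = 0)
    (ys : List ℂ) (hys : ys.length = N) : eval (fun i => ys.getD i 0) Z = 0 := by
  set Z' : MvPolynomial ℕ ℂ := aeval (fun i => if i < N then (X i : MvPolynomial ℕ ℂ) else 0) Z
    with hZ'
  have hev : ∀ y : ℕ → ℂ, eval y Z' = eval (fun i => ((List.range N).map y).getD i 0) Z := by
    intro y
    rw [hZ', eval_aeval_eq]
    congr 2
    ext i
    split_ifs with hi
    · simp [List.getD, hi]
    · simp [List.getD, hi]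
  set D : MvPolynomial ℕ ℂ := ∏ i ∈ Finset.range N, ∏ j ∈ Finset.range i, (X i - X j) with hD
  have hD0 : D ≠ 0 := by
    rw [hD, Finset.prod_ne_zero_iff]
    intro i _
    rw [Finset.prod_ne_zero_iff]
    intro j hj
    rw [sub_ne_zero]
    intro he
    have := X_injective he
    simp at hj; omega
  have hZD : Z' * D = 0 := by
    refine MvPolynomial.funext fun y => ?_
    rw [map_mul, map_zero, mul_eq_zero]
    by_cases hy : ((List.range N).map y).Nodup
    · left; rw [hev]; exact h _ (by simp) hy
    · right
      rw [List.nodup_map_iff_inj_on List.nodup_range] at hy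
      push Not at hy
      obtain ⟨i, hi, j, hj, hij, hne⟩ := hy
      simp only [List.mem_range] at hi hj
      rw [hD, map_prod]
      wlog hlt : j < i generalizing i j
      · exact this j i hij.symm hne.symm hj hi (by omega)
      · refine Finset.prod_eq_zero (Finset.mem_range.2 hi) ?_
        rw [map_prod]
        exact Finset.prod_eq_zero (Finset.mem_range.2 hlt) (by simp [hij])
  have hZ0 : Z' = 0 := (mul_eq_zero.1 hZD).resolve_right hD0
  have := hev (fun i => ys.getD i 0)
  rw [hZ0, map_zero] at this
  refine Eq.trans ?_ this.symm
  refine congrArg (fun e => eval e Z) (_root_.funext fun i => ?_)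
  rcases lt_or_ge i N with hi | hi
  · simp [List.getD, hi, hys]
  · have h1 : ys[i]? = none := by simp; omega
    have h2 : (List.range N)[i]? = none := by simp; omega
    simp [List.getD, h1, h2]

/-- A polynomial identity on configurations with distinct parameters holds everywhere. -/
lemma eval_env_eq_zero (v : List Bool) (Z : MvPolynomial ℕ ℂ)
    (h : ∀ l : List Site, l.map Prod.fst = v → (l.map Prod.snd).Nodup → eval (env l) Z = 0)
    (l : List Site) (hl : l.map Prod.fst = v) : eval (env l) Z = 0 := by
  have hlen : v.length = l.length := by rw [← hl]; simp
  refine eval_eq_zero_of_nodup l.length Z (fun ys h1 h2 => ?_) (l.map Prod.snd) (by simp)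
  have := h (v.zip ys) (List.map_fst_zip (by omega))
  unfold env at this
  rw [List.map_snd_zip (by omega)] at this
  exact this h2

/-- The polynomial representing the inhomogeneous vector at the word `v`. -/
def polyRep (w x : ℂ) (v : List Bool) : MvPolynomial ℕ ℂ :=
  if h : w ≠ 0 then (exists_polyRep w x h v).choose else 0

/-- The inhomogeneous vector. -/
def G (w x : ℂ) (l : List Site) : ℂ := eval (env l) (polyRep w x (l.map Prod.fst))

lemma G_eq_ratF {w x : ℂ} (hw : w ≠ 0) {l : List Site} (hl : (l.map Prod.snd).Nodup) :
    G w x l = ratF w x l := by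
  rw [G, polyRep, dif_pos hw, (exists_polyRep w x hw _).choose_spec.1 l rfl hl]

lemma G_eq_of_poly {w x : ℂ} (hw : w ≠ 0) {v : List Bool} (P : MvPolynomial ℕ ℂ)
    (hP : ∀ l : List Site, l.map Prod.fst = v → (l.map Prod.snd).Nodup →
      ratF w x l = eval (env l) P) (l : List Site) (hl : l.map Prod.fst = v) :
    G w x l = eval (env l) P := by
  have := eval_env_eq_zero v (polyRep w x v - P) (fun l hl hn => by
    have h := G_eq_ratF (x := x) hw hn
    rw [G, hl] at h
    rw [map_sub, h, hP l hl hn, sub_self]) l hl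
  rw [map_sub, sub_eq_zero] at this
  rw [G, hl, this]

lemma G_base {w : ℂ} (hw : w ≠ 0) (x : ℂ) (ds us : List ℂ) :
    G w x (ds.map (fun y => (true, y)) ++ us.map (fun y => (false, y)))
      = (ds.map (fun y => y ^ ((ds.length + us.length) % 2) * th w x y)).prod
        * pairProd (fD w) ds * pairProd (fU w) us := by
  obtain ⟨P, hP, _⟩ := exists_basePoly w x ds.length us.length
  have hw' : (ds.map (fun y => ((true, y) : Site)) ++ us.map (fun y => (false, y))).map Prod.fst
      = List.replicate ds.length true ++ List.replicate us.length false := by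
    simp [Function.comp_def]
  rw [G_eq_of_poly hw P (fun l hl _ => hP l hl) _ hw', ← hP _ hw', ratF_base]

lemma G_nil {w : ℂ} (hw : w ≠ 0) (x : ℂ) : G w x [] = 1 := by
  simpa [pairProd] using G_base hw x [] []

theorem G_exch {w : ℂ} (x : ℂ) (hw : w ^ 2 + w + 1 = 0) (p q : List Site) (a b : Bool) (s t : ℂ) :
    ExchAt w (G w x) p q a b s t := by
  have hw0 := omega_ne_zero hw
  have key : ∀ (p q : List Site) (a b : Bool) (s t : ℂ),
      eval (env (p ++ (a, s) :: (b, t) :: q))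
      ((C w * X (p.length + 1) - X p.length) * rename (Equiv.swap p.length (p.length + 1))
          (polyRep w x (p.map Prod.fst ++ a :: b :: q.map Prod.fst))
        - (if a = b then (C w * X p.length - X (p.length + 1))
            * polyRep w x (p.map Prod.fst ++ a :: b :: q.map Prod.fst)
          else C (w - 1) * (if a then X (p.length + 1) else X p.length)
            * polyRep w x (p.map Prod.fst ++ a :: b :: q.map Prod.fst)
            + C (w ^ 2) * (X p.length - X (p.length + 1))
            * polyRep w x (p.map Prod.fst ++ b :: a :: q.map Prod.fst)))
      = (w * t - s) * G w x (p ++ (a, t) :: (b, s) :: q) -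
    (if a = b then (w * s - t) * G w x (p ++ (a, s) :: (b, t) :: q)
    else (w - 1) * (if a then t else s) * G w x (p ++ (a, s) :: (b, t) :: q)
      + w ^ 2 * (s - t) * G w x (p ++ (b, s) :: (a, t) :: q)) := by
    intro p q a b s t
    have e1 : env (p ++ (a, s) :: (b, t) :: q) (p.length) = s := by simp [env, List.getD]
    have e2 : env (p ++ (a, s) :: (b, t) :: q) (p.length + 1) = t := by simp [env, List.getD]
    simp only [G, List.map_append, List.map_cons]
    rw [env_swap p q a b a b s t, env_letters p q b a a b s t]
    split_ifs <;>
    simp only [map_mul, map_sub, map_add, eval_X, eval_C, eval_rename, e1, e2]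
  unfold ExchAt
  rw [← sub_eq_zero, ← key]
  refine eval_env_eq_zero (p.map Prod.fst ++ a :: b :: q.map Prod.fst) _ ?_ _ (by simp)
  intro l hl hn
  obtain ⟨p', l', rfl, h1, h0⟩ := List.map_eq_append_iff.1 hl
  obtain ⟨⟨a', s'⟩, l'', rfl, h2, h0⟩ := List.map_eq_cons_iff.1 h0
  obtain ⟨⟨b', t'⟩, q', rfl, h3, h4⟩ := List.map_eq_cons_iff.1 h0
  simp only at h2 h3
  subst h2 h3
  have hp : p.length = p'.length := by have := congrArg List.length h1; simpa using this.symm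
  rw [← h1, ← h4, hp, key, sub_eq_zero]
  have hsw : ((p' ++ (a', t') :: (b', s') :: q').map Prod.snd).Nodup := by
    refine (List.Perm.nodup_iff ?_).1 hn
    simp only [List.map_append, List.map_cons]
    exact List.Perm.append_left _ (List.Perm.swap _ _ _)
  rw [G_eq_ratF hw0 hsw, G_eq_ratF hw0 hn, G_eq_ratF hw0 (l := p' ++ (b', s') :: (a', t') :: q')
    (by simpa using hn)]
  exact ratF_exch w x hw p' q' a' b' s' t' hn

lemma natDegree_aeval_le (k : ℕ) (c : ℕ → ℂ) (P : MvPolynomial ℕ ℂ) :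
    (aeval (fun i => if i = k then (Polynomial.X : Polynomial ℂ) else Polynomial.C (c i)) P).natDegree
      ≤ degreeOf k P := by
  rw [aeval_def, eval₂_eq]
  refine Polynomial.natDegree_sum_le_of_forall_le _ _ fun d hd => ?_
  refine (Polynomial.natDegree_C_mul_le _ _).trans ?_
  refine (Polynomial.natDegree_prod_le _ _).trans ?_
  refine le_trans ?_ (monomial_le_degreeOf k hd)
  calc _ ≤ ∑ i ∈ d.support, if i = k then d i else 0 := by
        refine Finset.sum_le_sum fun i _ => ?_
        split_ifs with h
        · simp
        · rw [← Polynomial.C_pow]; simp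
    _ ≤ d k := by
        rw [Finset.sum_ite_eq']; split_ifs <;> simp

/-- A word with `⌊N/2⌋` letters `↓`. -/
def Bal (l : List Site) : Prop := l.countP (fun z => z.1) = l.length / 2

lemma G_slot {w : ℂ} (hw : w ≠ 0) (x : ℂ) (p q : List Site) (a : Bool) :
    ∃ Q : Polynomial ℂ, (∀ t, G w x (p ++ (a, t) :: q) = Q.eval t) ∧
      (Bal (p ++ (a, 0) :: q) → Q.natDegree ≤ degB (p.length + q.length + 1) a) := by
  refine ⟨aeval (fun i => if i = p.length then (Polynomial.X : Polynomial ℂ)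
    else Polynomial.C (env (p ++ (a, 0) :: q) i)) (polyRep w x (p.map Prod.fst ++ a :: q.map Prod.fst)),
    fun t => ?_, fun hb => ?_⟩
  · have : ∀ Z : MvPolynomial ℕ ℂ, Polynomial.eval t (aeval (fun i => if i = p.length then (Polynomial.X : Polynomial ℂ)
        else Polynomial.C (env (p ++ (a, 0) :: q) i)) Z) = eval (env (p ++ (a, t) :: q)) Z := by
      intro Z
      induction Z using MvPolynomial.induction_on with
      | C a => simp
      | add p q hp hq => simp [hp, hq]
      | mul_X P n hp =>
        simp only [map_mul, aeval_X, Polynomial.eval_mul, hp, eval_X]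
        congr 1
        split_ifs with h
        · subst h; simp [env, List.getD]
        · simp only [Polynomial.eval_C, env, List.map_append, List.map_cons]
          rcases lt_or_gt_of_ne h with h | h
          · rw [List.getD_append _ _ _ _ (by simpa using h), List.getD_append _ _ _ _ (by simpa using h)]
          · obtain ⟨m, rfl⟩ := Nat.exists_eq_add_of_lt h
            rw [List.getD_append_right _ _ _ _ (by simp; omega), List.getD_append_right _ _ _ _ (by simp; omega)]
            have : p.length + m + 1 - (p.map Prod.snd).length = m + 1 := by simp; omega
            simp only [this, List.getD_cons_succ]
    rw [this, G]
    simp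
  · refine (natDegree_aeval_le _ _ _).trans ?_
    have h := (exists_polyRep w x hw (p.map Prod.fst ++ a :: q.map Prod.fst)).choose_spec.2
      (by
        unfold Bal at hb
        have : p.map Prod.fst ++ a :: q.map Prod.fst = (p ++ (a, 0) :: q).map Prod.fst := by simp
        rw [this, List.countP_map, List.length_map]
        exact hb) p.length (by simp)
    rw [polyRep, dif_pos hw]
    have e1 : (p.map Prod.fst ++ a :: q.map Prod.fst).length = p.length + q.length + 1 := by
      simp; omega
    have e2 : (p.map Prod.fst ++ a :: q.map Prod.fst).getD p.length false = a := by
      rw [List.getD_append_right _ _ _ _ (by simp)]; simp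
    refine h.trans (le_of_eq ?_)
    rw [e1, e2]

lemma G_continuousOn (w x : ℂ) (v : List Bool) (Y : ℕ → ℝ → ℂ) (hY : ∀ i, Continuous (Y i)) :
    Continuous (fun e : ℝ => G w x (v.mapIdx (fun i a => (a, Y i e)))) := by
  have h1 : ∀ e, (v.mapIdx (fun i a => ((a, Y i e) : Site))).map Prod.fst = v := by
    intro e; refine List.ext_getElem (by simp) fun i _ _ => by simp
  simp only [G, h1]
  refine (MvPolynomial.continuous_eval _).comp (continuous_pi fun i => ?_)
  simp only [env, List.getD, List.getElem?_map, List.getElem?_mapIdx]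
  rcases lt_or_ge i v.length with hi | hi
  · simpa [hi] using hY i
  · simp [hi]; exact continuous_const

end MvPoly

lemma ratF_zero (w x : ℂ) (l : List Site) (h0 : (true, (0 : ℂ)) ∈ l) (hodd : l.length % 2 = 1) :
    ratF w x l = 0 := by
  induction hn : invW l using Nat.strong_induction_on generalizing l with
  | _ n ih =>
  by_cases h : ∃ z : List Site × ℂ × ℂ × List Site,
      l = z.1 ++ (false, z.2.1) :: (true, z.2.2.1) :: z.2.2.2
  · obtain ⟨⟨p, s, t, q⟩, rfl⟩ := h
    simp only at *
    rw [ratF_step]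
    have hA : ∀ s' t', (true, (0 : ℂ)) ∈ (p ++ (true, s') :: (false, t') :: q) →
        ratF w x (p ++ (true, s') :: (false, t') :: q) = 0 := by
      intro s' t' h'
      exact ih _ (by rw [← hn]; exact invW_step _ _ _ _ _ _) _ h' (by simpa using hodd) rfl
    by_cases ht : t = 0
    · subst ht
      rw [hA 0 s (by simp)]
      simp [stepT]
    · have hm : (true, (0 : ℂ)) ∈ p ∨ (true, (0 : ℂ)) ∈ q := by
        simp at h0
        rcases h0 with h0 | h0 | h0
        · exact .inl h0
        · exact absurd h0.symm ht
        · exact .inr h0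
      rw [hA _ _ (by simp; tauto), hA _ _ (by simp; tauto)]
      simp [stepT]
  · have hs := word_sorted l h
    rw [hs, ratF_base]
    have hlen : (downs l).length + (ups l).length = l.length := by
      have := congrArg List.length hs; simp at this; omega
    have : (0 : ℂ) ∈ downs l := by
      simp [downs]; simpa using h0
    rw [List.prod_eq_zero (by
      rw [List.mem_map]; exact ⟨0, this, by rw [hlen, hodd]; simp⟩)]
    simp

end

section

/-! ### Consequences of the exchange relations -/

variable {w : ℂ}

lemma ExchAt.sub_mul {H₁ H₂ : List Site → ℂ} {p q : List Site} {a b : Bool} {s t : ℂ} (α β : ℂ)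
    (h₁ : ExchAt w H₁ p q a b s t) (h₂ : ExchAt w H₂ p q a b s t) :
    ExchAt w (fun l => α * H₁ l - β * H₂ l) p q a b s t := by
  unfold ExchAt at *
  split_ifs at * <;> linear_combination α * h₁ - β * h₂

lemma ExchAt.append_left {H : List Site → ℂ} {r p q : List Site} {a b : Bool} {s t : ℂ}
    (h : ExchAt w H (r ++ p) q a b s t) : ExchAt w (fun l => H (r ++ l)) p q a b s t := by
  unfold ExchAt at *; simpa using h

lemma uniq_sorted (hw : w ≠ 0) (Z : List Site → ℂ) (Y : List ℂ) (hY : Y.Nodup) (m : ℕ)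
    (hex : ∀ p q a b s t, (p.map Prod.snd ++ s :: t :: q.map Prod.snd).Perm Y →
      ExchAt w Z p q a b s t)
    (h0 : ∀ ds us : List ℂ, ds.length = m → (ds ++ us).Perm Y →
      Z (ds.map (fun y => (true, y)) ++ us.map (fun y => (false, y))) = 0)
    (l : List Site) (hl : (l.map Prod.snd).Perm Y) (hm : l.countP (fun z => z.1) = m) : Z l = 0 := by
  induction hn : invW l using Nat.strong_induction_on generalizing l with
  | _ n ih =>
  by_cases h : ∃ z : List Site × ℂ × ℂ × List Site,
      l = z.1 ++ (false, z.2.1) :: (true, z.2.2.1) :: z.2.2.2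
  · obtain ⟨⟨p, s, t, q⟩, rfl⟩ := h
    simp only at *
    have hnd : s ≠ t := by
      have := hl.nodup_iff.2 hY
      rintro rfl
      simp [List.nodup_append] at this
    have e := hex p q true false s t (by simpa using hl)
    have hsw : (p.map Prod.snd ++ t :: s :: q.map Prod.snd).Perm Y :=
      (List.Perm.append_left _ (List.Perm.swap _ _ _)).trans (by simpa using hl)
    unfold ExchAt at e
    rw [ih _ (by rw [← hn]; exact invW_step _ _ _ _ _ _) (p ++ (true, t) :: (false, s) :: q)
        (by simpa using hsw) (by simpa using hm) rfl,
      ih _ (by rw [← hn]; exact invW_step _ _ _ _ _ _) (p ++ (true, s) :: (false, t) :: q)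
        (by simpa using hl) (by simpa using hm) rfl] at e
    have h2 : w ^ 2 * (s - t) ≠ 0 := mul_ne_zero (pow_ne_zero 2 hw) (sub_ne_zero.2 hnd)
    simp at e
    rcases e with e | e
    · rcases e with e | e
      · exact absurd e hw
      · exact absurd (sub_eq_zero.1 e) hnd
    · exact e
  · have hs := word_sorted l h
    rw [hs]
    refine h0 _ _ ?_ ?_
    · rw [← hm, downs, List.length_map, List.countP_eq_length_filter]
    · refine List.Perm.trans ?_ hl
      conv_rhs => rw [hs]
      simp [Function.comp_def]

lemma word_opp (l : List Site)
    (h : ¬ ∃ z : List Site × ℂ × ℂ × List Site,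
      l = z.1 ++ (true, z.2.1) :: (false, z.2.2.1) :: z.2.2.2) :
    l = (ups l).map (fun y => (false, y)) ++ (downs l).map (fun y => (true, y)) := by
  induction l with
  | nil => simp
  | cons z l ih =>
    obtain ⟨a, s⟩ := z
    have h' : ¬ ∃ z : List Site × ℂ × ℂ × List Site,
      l = z.1 ++ (true, z.2.1) :: (false, z.2.2.1) :: z.2.2.2 := by
      rintro ⟨⟨p, s', t', q⟩, rfl⟩
      exact h ⟨((a, s) :: p, s', t', q), rfl⟩
    have ih := ih h'
    cases a
    · simpa using ih
    · rcases hd : ups l with _ | ⟨y, ds⟩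
      · rw [hd] at ih
        simp [hd] at ih ⊢
        exact ih
      · rw [hd] at ih
        exact absurd ⟨([], s, y, ds.map (fun y => (false, y)) ++ (downs l).map (fun y => (true, y))),
          by simpa using ih⟩ h

lemma uniq_opp (hw : w ≠ 0) (Z : List Site → ℂ) (Y : List ℂ) (hY : Y.Nodup) (m : ℕ)
    (hex : ∀ p q a b s t, (p.map Prod.snd ++ s :: t :: q.map Prod.snd).Perm Y →
      ExchAt w Z p q a b s t)
    (h0 : ∀ us ds : List ℂ, ds.length = m → (us ++ ds).Perm Y →
      Z (us.map (fun y => (false, y)) ++ ds.map (fun y => (true, y))) = 0)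
    (l : List Site) (hl : (l.map Prod.snd).Perm Y) (hm : l.countP (fun z => z.1) = m) : Z l = 0 := by
  have hinv : ∀ l : List Site, invW l ≤ l.length * l.length := by
    intro l
    induction l with
    | nil => simp [invW]
    | cons z l ih =>
      obtain ⟨a, s⟩ := z
      have := List.countP_le_length (p := fun z : Site => z.1) (l := l)
      cases a <;> simp [invW] <;> nlinarith
  induction hn : l.length * l.length - invW l using Nat.strong_induction_on generalizing l with
  | _ n ih =>
  by_cases h : ∃ z : List Site × ℂ × ℂ × List Site,
      l = z.1 ++ (true, z.2.1) :: (false, z.2.2.1) :: z.2.2.2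
  · obtain ⟨⟨p, s, t, q⟩, rfl⟩ := h
    simp only at *
    have hnd : s ≠ t := by
      have := hl.nodup_iff.2 hY
      rintro rfl
      simp [List.nodup_append] at this
    have e := hex p q false true s t (by simpa using hl)
    have hsw : (p.map Prod.snd ++ t :: s :: q.map Prod.snd).Perm Y :=
      (List.Perm.append_left _ (List.Perm.swap _ _ _)).trans (by simpa using hl)
    unfold ExchAt at e
    have hlt : ∀ s' t', (p ++ (false, s') :: (true, t') :: q).length * (p ++ (false, s') :: (true, t') :: q).length
        - invW (p ++ (false, s') :: (true, t') :: q) < n := by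
      intro s' t'
      have h1 := invW_step p q s' t' s t
      have h2 := hinv (p ++ (false, s') :: (true, t') :: q)
      rw [← hn]
      simp only [List.length_append, List.length_cons] at *
      omega
    rw [ih _ (hlt _ _) (p ++ (false, t) :: (true, s) :: q)
        (by simpa using hsw) (by simpa using hm) rfl,
      ih _ (hlt _ _) (p ++ (false, s) :: (true, t) :: q)
        (by simpa using hl) (by simpa using hm) rfl] at e
    simp at e
    rcases e with e | e
    · rcases e with e | e
      · exact absurd e hw
      · exact absurd (sub_eq_zero.1 e) hnd
    · exact e
  · have hs := word_opp l h
    rw [hs]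
    refine h0 _ _ ?_ ?_
    · rw [← hm, downs, List.length_map, List.countP_eq_length_filter]
    · refine List.Perm.trans ?_ hl
      conv_rhs => rw [hs]
      simp [Function.comp_def]

variable (hw : w ^ 2 + w + 1 = 0) (x : ℂ)
include hw

lemma omega_sub_one_ne : w - 1 ≠ 0 := by
  intro h
  have : w = 1 := by linear_combination h
  subst this; norm_num at hw

lemma singlet_same (p q : List Site) (a : Bool) {t : ℂ} (ht : t ≠ 0) :
    G w x (p ++ (a, w * t) :: (a, t) :: q) = 0 := by
  have e := G_exch x hw p q a a (w * t) t
  unfold ExchAt at e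
  rw [if_pos rfl, sub_self, zero_mul] at e
  have h1 : w * (w * t) - t ≠ 0 := by
    have : w * (w * t) - t = (w - 1) * (w + 1) * t := by ring
    rw [this]
    refine mul_ne_zero (mul_ne_zero (omega_sub_one_ne hw) ?_) ht
    intro h
    have : w ^ 2 = 0 := by linear_combination hw - h
    exact omega_ne_zero hw (pow_eq_zero_iff two_ne_zero |>.1 this)
  exact (mul_eq_zero.1 e.symm).resolve_left h1

lemma singlet_diff (p q : List Site) {t : ℂ} (ht : t ≠ 0) :
    G w x (p ++ (false, w * t) :: (true, t) :: q) = -w * G w x (p ++ (true, w * t) :: (false, t) :: q) := by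
  have e := G_exch x hw p q true false (w * t) t
  unfold ExchAt at e
  rw [if_neg (by simp), sub_self, zero_mul, if_pos rfl] at e
  have h1 : (w - 1) * t ≠ 0 := mul_ne_zero (omega_sub_one_ne hw) ht
  refine mul_left_cancel₀ h1 ?_
  linear_combination (-w) * e
    - (w - 1) * t * (G w x (p ++ (false, w * t) :: (true, t) :: q)) * (w - 1) * hw

lemma singlet_flip (p q : List Site) {t : ℂ} (ht : t ≠ 0) :
    G w x (p ++ (true, w * t) :: (false, t) :: q) =
      - w ^ 2 * G w x (p ++ (true, t) :: (false, w * t) :: q) +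
        G w x (p ++ (false, t) :: (true, w * t) :: q) := by
  have e := G_exch x hw p q true false t (w * t)
  unfold ExchAt at e
  rw [if_neg (by simp), if_pos rfl] at e
  have h1 : (w * (w * t) - t) ≠ 0 := by
    have : w * (w * t) - t = (w - 1) * (w + 1) * t := by ring
    rw [this]
    refine mul_ne_zero (mul_ne_zero (omega_sub_one_ne hw) ?_) ht
    intro h
    have : w ^ 2 = 0 := by linear_combination hw - h
    exact omega_ne_zero hw (pow_eq_zero_iff two_ne_zero |>.1 this)
  refine mul_left_cancel₀ h1 ?_
  have h3 := omega_cube hw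
  linear_combination e + (w * t * G w x (p ++ (true, t) :: (false, w * t) :: q)
    - t * G w x (p ++ (false, t) :: (true, w * t) :: q)) * h3

lemma cube_ne {s t : ℂ} (h : s ^ 3 ≠ t ^ 3) :
    s - t ≠ 0 ∧ w * s - t ≠ 0 ∧ w * t - s ≠ 0 := by
  have h3 := omega_cube hw
  refine ⟨fun e => h ?_, fun e => h ?_, fun e => h ?_⟩
  · rw [sub_eq_zero.1 e]
  · rw [← sub_eq_zero.1 e, mul_pow, h3, one_mul]
  · rw [← sub_eq_zero.1 e, mul_pow, h3, one_mul]

lemma move_one (p q : List Site) (a : Bool) {t η : ℂ} (ht : t ≠ 0) (h : η ^ 3 ≠ t ^ 3) :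
    G w x (p ++ (true, w * t) :: (false, t) :: (a, η) :: q)
      = G w x (p ++ (a, η) :: (true, w * t) :: (false, t) :: q) := by
  have h3 := omega_cube hw
  obtain ⟨n1, n2, n3⟩ := cube_ne hw h
  have hw0 := omega_ne_zero hw
  cases a
  · have e1 := G_exch x hw p ((false, t) :: q) true false (w * t) η
    have e2 := G_exch x hw p ((false, t) :: q) false true (w * t) η
    have e3 := G_exch x hw (p ++ [(true, w * t)]) q false false t η
    have e4 := singlet_same hw x (p ++ [(true, η)]) q false ht
    unfold ExchAt at e1 e2 e3
    simp only [if_true, if_false, Bool.false_eq_true, reduceCtorEq, List.append_assoc,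
      List.cons_append, List.nil_append] at e1 e2 e3 e4
    rw [e4] at e1
    set A := G w x (p ++ (true, w * t) :: (false, η) :: (false, t) :: q)
    set B := G w x (p ++ (false, w * t) :: (true, η) :: (false, t) :: q)
    set T := G w x (p ++ (false, η) :: (true, w * t) :: (false, t) :: q)
    set G0 := G w x (p ++ (true, w * t) :: (false, t) :: (false, η) :: q)
    have k : (η - t) * ((w * t - η) * T) = (η - t) * ((w * η - t) * A) := by
      clear_value A B T G0
      grind
    have k2 := mul_left_cancel₀ n1 k
    rw [e3] at k2
    exact (mul_left_cancel₀ n3 k2).symm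
  · have e1 := G_exch x hw p ((false, t) :: q) true true (w * t) η
    have e2 := G_exch x hw (p ++ [(true, w * t)]) q true false t η
    have e4 := singlet_same hw x p ((false, η) :: q) true ht
    unfold ExchAt at e1 e2
    simp only [if_true, if_false, Bool.true_eq_false, List.append_assoc,
      List.cons_append, List.nil_append] at e1 e2 e4
    rw [e4] at e2
    set A := G w x (p ++ (true, w * t) :: (true, η) :: (false, t) :: q)
    set T := G w x (p ++ (true, η) :: (true, w * t) :: (false, t) :: q)
    set G0 := G w x (p ++ (true, w * t) :: (false, t) :: (true, η) :: q)
    have hn : w * (η - t) * (w * η - t) ≠ 0 := mul_ne_zero (mul_ne_zero hw0 n1) n2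
    refine mul_left_cancel₀ hn ?_
    linear_combination (-(w * η - t)) * e1 - (w * (w * t) - η) * e2 + (t * (η - t) * w * G0) * h3

lemma move_list (p l q : List Site) {t : ℂ} (ht : t ≠ 0) (h : ∀ z ∈ l, z.2 ^ 3 ≠ t ^ 3) :
    G w x (p ++ (true, w * t) :: (false, t) :: (l ++ q))
      = G w x (p ++ l ++ (true, w * t) :: (false, t) :: q) := by
  induction l generalizing p with
  | nil => simp
  | cons z l ih =>
    obtain ⟨a, η⟩ := z
    have h1 := move_one hw x p (l ++ q) a ht (h (a, η) (by simp))
    have h2 := ih (p ++ [(a, η)]) (fun z hz => h z (by simp [hz]))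
    simp only [List.append_assoc, List.cons_append, List.nil_append] at h1 h2 ⊢
    rw [h1, h2]

/-- The factor produced by removing a singlet. -/
def kap (w x t : ℂ) (η : List ℂ) : ℂ :=
  (w * t) ^ (η.length % 2) * th w x (w * t) * (η.map (fU w t)).prod

lemma fD_omega (η t : ℂ) : fD w η (w * t) = fU w t η := by
  have h3 := omega_cube hw
  simp only [fD, fU]
  linear_combination 0 * h3

lemma front (β : List Site) {t : ℂ} (ht : t ≠ 0) (h : ∀ z ∈ β, z.2 ^ 3 ≠ t ^ 3)
    (hn : (β.map Prod.snd).Nodup) :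
    G w x ((true, w * t) :: (false, t) :: β) = kap w x t (β.map Prod.snd) * G w x β := by
  have hw0 := omega_ne_zero hw
  have := uniq_sorted hw0 (fun l => 1 * G w x ((true, w * t) :: (false, t) :: l)
    - kap w x t (β.map Prod.snd) * G w x l) (β.map Prod.snd) hn (β.countP (fun z => z.1))
    ?_ ?_ β (List.Perm.refl _) rfl
  · linear_combination this
  · intro p q a b s t' _
    refine ExchAt.sub_mul _ _ ?_ (G_exch x hw _ _ _ _ _ _)
    exact ExchAt.append_left (r := [(true, w * t), (false, t)]) (G_exch x hw _ _ _ _ _ _)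
  · intro ds us _ hp
    have hc : ∀ η ∈ ds ++ us, η ^ 3 ≠ t ^ 3 := by
      intro η hη
      obtain ⟨z, hz, rfl⟩ := List.mem_map.1 (hp.subset hη)
      exact h z hz
    have e1 := move_list hw x [] (ds.map (fun y => (true, y))) (us.map (fun y => (false, y))) ht (by
      intro z hz
      obtain ⟨η, hη, rfl⟩ := List.mem_map.1 hz
      exact hc η (by simp [hη]))
    have e2 := G_base hw0 x (ds ++ [w * t]) (t :: us)
    have e3 : ds.map (fun y => ((true, y) : Site)) ++ (true, w * t) :: (false, t) :: us.map (fun y => (false, y))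
      = (ds ++ [w * t]).map (fun y => (true, y)) ++ (t :: us).map (fun y => (false, y)) := by simp
    simp only [List.nil_append] at e1
    rw [e1, e3, e2, G_base hw0 x ds us, pairProd_append]
    have e4 : (ds ++ [w * t]).length + (t :: us).length = ds.length + us.length + 2 := by
      simp; omega
    have e5 : kap w x t (β.map Prod.snd) = (w * t) ^ ((ds.length + us.length) % 2) * th w x (w * t)
        * ((ds.map (fU w t)).prod * (us.map (fU w t)).prod) := by
      rw [kap, ← hp.length_eq, ← (hp.map (fU w t)).prod_eq]
      simp
    rw [e4, e5]
    simp [pairProd, fD_omega hw]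
    ring

end

section

/-! ### Polynomial functions of bounded degree -/

/-- `f` is a polynomial function of degree at most `d`. -/
def PolyLe (f : ℂ → ℂ) (d : ℕ) : Prop := ∃ Q : Polynomial ℂ, Q.natDegree ≤ d ∧ ∀ y, f y = Q.eval y

namespace PolyLe

variable {f g : ℂ → ℂ} {d e : ℕ}

lemma mono (h : PolyLe f d) (hd : d ≤ e) : PolyLe f e := by
  obtain ⟨Q, h1, h2⟩ := h
  exact ⟨Q, h1.trans hd, h2⟩

lemma const (c : ℂ) : PolyLe (fun _ => c) 0 := ⟨Polynomial.C c, by simp, by simp⟩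

lemma id : PolyLe (fun y => y) 1 := ⟨Polynomial.X, by simp, by simp⟩

lemma add (hf : PolyLe f d) (hg : PolyLe g d) : PolyLe (fun y => f y + g y) d := by
  obtain ⟨Q, h1, h2⟩ := hf
  obtain ⟨R, h3, h4⟩ := hg
  exact ⟨Q + R, (Polynomial.natDegree_add_le _ _).trans (max_le h1 h3), by simp [h2, h4]⟩

lemma sub (hf : PolyLe f d) (hg : PolyLe g d) : PolyLe (fun y => f y - g y) d := by
  obtain ⟨Q, h1, h2⟩ := hf
  obtain ⟨R, h3, h4⟩ := hg
  exact ⟨Q - R, (Polynomial.natDegree_sub_le _ _).trans (max_le h1 h3), by simp [h2, h4]⟩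

lemma mul (hf : PolyLe f d) (hg : PolyLe g e) : PolyLe (fun y => f y * g y) (d + e) := by
  obtain ⟨Q, h1, h2⟩ := hf
  obtain ⟨R, h3, h4⟩ := hg
  exact ⟨Q * R, Polynomial.natDegree_mul_le.trans (add_le_add h1 h3), by simp [h2, h4]⟩

lemma const_mul (c : ℂ) (hf : PolyLe f d) : PolyLe (fun y => c * f y) d :=
  ((const c).mul hf).mono (by simp)

lemma mul_const (c : ℂ) (hf : PolyLe f d) : PolyLe (fun y => f y * c) d :=
  (hf.mul (const c)).mono (by simp)

lemma pow (hf : PolyLe f d) (n : ℕ) : PolyLe (fun y => f y ^ n) (n * d) := by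
  obtain ⟨Q, h1, h2⟩ := hf
  exact ⟨Q ^ n, Polynomial.natDegree_pow_le.trans (Nat.mul_le_mul_left _ h1), by simp [h2]⟩

lemma lin (a b : ℂ) : PolyLe (fun y => a * y + b) 1 :=
  (id.const_mul a).add ((const b).mono (by simp))

lemma congr (h : PolyLe f d) (hfg : ∀ y, g y = f y) : PolyLe g d := by
  rwa [funext hfg]

lemma list_prod {L : List ℂ} {F : ℂ → ℂ → ℂ} (h : ∀ b ∈ L, PolyLe (fun y => F y b) d) :
    PolyLe (fun y => (L.map (F y)).prod) (d * L.length) := by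
  induction L with
  | nil => exact ((const 1).mono (by simp)).congr (by simp)
  | cons b L ih =>
    refine (((h b (by simp)).mul (ih fun b hb => h b (by simp [hb]))).mono ?_).congr
      (fun y => by simp)
    simp; ring_nf; rfl

lemma eq_zero (hf : PolyLe f d) (L : List ℂ) (hn : L.Nodup) (hd : d < L.length)
    (h0 : ∀ z ∈ L, f z = 0) (y : ℂ) : f y = 0 := by
  obtain ⟨Q, h1, h2⟩ := hf
  have : Q = 0 := Polynomial.eq_zero_of_natDegree_lt_card_of_eval_eq_zero' Q L.toFinset
    (fun z hz => by rw [← h2]; exact h0 z (by simpa using hz))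
    (by rw [List.toFinset_card_of_nodup hn]; omega)
  rw [h2, this, Polynomial.eval_zero]

end PolyLe

/-! ### The opposite word -/

variable {w : ℂ}

/-- Generic parameters: nonzero with pairwise distinct cubes. -/
def Gen (Y : List ℂ) : Prop := (Y.map (fun y => y ^ 3)).Nodup ∧ ∀ y ∈ Y, y ≠ 0

lemma Gen.perm {Y Y' : List ℂ} (h : Gen Y) (hp : Y.Perm Y') : Gen Y' :=
  ⟨(hp.map _).nodup_iff.1 h.1, fun y hy => h.2 y (hp.symm.subset hy)⟩

lemma Gen.nodup {Y : List ℂ} (h : Gen Y) : Y.Nodup := h.1.of_map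

lemma Gen.sublist {Y Y' : List ℂ} (h : Gen Y) (hs : Y'.Sublist Y) : Gen Y' :=
  ⟨h.1.sublist (hs.map _), fun y hy => h.2 y (hs.subset hy)⟩

lemma gen_cons {y : ℂ} {Y : List ℂ} :
    Gen (y :: Y) ↔ (∀ z ∈ Y, z ^ 3 ≠ y ^ 3) ∧ y ≠ 0 ∧ Gen Y := by
  simp only [Gen, List.map_cons, List.nodup_cons, List.mem_map, List.mem_cons, forall_eq_or_imp,
    not_exists, not_and]
  tauto

lemma zero_perm (hw : w ^ 2 + w + 1 = 0) (Z : List ℂ → ℂ)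
    (hex : ∀ p q s t, (w * t - s) * Z (p ++ t :: s :: q) = (w * s - t) * Z (p ++ s :: t :: q))
    {L L' : List ℂ} (hp : L.Perm L') : (L.map (fun y => y ^ 3)).Nodup →
      ∀ p, Z (p ++ L) = 0 → Z (p ++ L') = 0 := by
  induction hp with
  | nil => exact fun _ p h => h
  | cons a _ ih =>
    intro hn p h
    have := ih (by simpa using (List.nodup_cons.1 (by simpa using hn)).2) (p ++ [a]) (by simpa using h)
    simpa using this
  | swap s t q =>
    intro hn p h
    have hst : t ^ 3 ≠ s ^ 3 := by
      simp at hn; tauto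
    obtain ⟨_, n2, n3⟩ := cube_ne hw hst
    have := hex p q t s
    rw [h, mul_zero] at this
    exact (mul_eq_zero.1 this).resolve_left n3
  | trans h1 h2 ih1 ih2 =>
    intro hn p h
    exact ih2 ((h1.map _).nodup_iff.1 hn) p (ih1 hn p h)

/-- The component on the opposite word. -/
def oppF (w x : ℂ) (us ds : List ℂ) : ℂ :=
  (ds.map (fun y => (w * y) ^ ((us.length + ds.length) % 2) * (-w) * th w x (w * y))).prod
    * pairProd (fD w) us * pairProd (fU w) ds

/-- The word with all `↑` first. -/
def oppW (us ds : List ℂ) : List Site :=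
  us.map (fun y => (false, y)) ++ ds.map (fun y => (true, y))

lemma Gen.split_mem {us ds : List ℂ} {t : ℂ} (hg : Gen (us ++ t :: ds)) :
    Gen (us ++ ds) ∧ (∀ z ∈ us ++ ds, z ^ 3 ≠ t ^ 3) ∧ t ≠ 0 := by
  have := gen_cons.1 (hg.perm List.perm_middle)
  exact ⟨this.2.2, this.1, this.2.1⟩

lemma Gen.cubes_right {us ds : List ℂ} (hg : Gen (us ++ ds)) : (ds.map (fun y => y ^ 3)).Nodup :=
  (hg.sublist (List.sublist_append_right us ds)).1

lemma Gen.cubes_left {us ds : List ℂ} (hg : Gen (us ++ ds)) : (us.map (fun y => y ^ 3)).Nodup :=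
  (hg.sublist (List.sublist_append_left us ds)).1

lemma bal_oppW {us ds : List ℂ} (hb : ds.length = (us.length + ds.length) / 2) :
    Bal (oppW us ds) := by
  have h : List.countP (fun z : Site => z.1) (us.map (fun y => (false, y))) = 0 := by
    simp [List.countP_map, Function.comp_def]
  have h' : List.countP (fun z : Site => z.1) (ds.map (fun y => (true, y))) = ds.length := by
    simp [List.countP_map, Function.comp_def]
  rw [Bal, oppW, List.countP_append, h, h']
  simpa using hb

variable (hw : w ^ 2 + w + 1 = 0) (x : ℂ)
include hw

lemma opp_exch_us (ds p q : List ℂ) (s t : ℂ) :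
    (w * t - s) * (G w x (oppW (p ++ t :: s :: q) ds) - oppF w x (p ++ t :: s :: q) ds)
      = (w * s - t) * (G w x (oppW (p ++ s :: t :: q) ds) - oppF w x (p ++ s :: t :: q) ds) := by
  have e := G_exch x hw (p.map (fun y => (false, y)))
    (q.map (fun y => (false, y)) ++ ds.map (fun y => (true, y))) false false s t
  unfold ExchAt at e
  rw [if_pos rfl] at e
  have e2 := pairProd_swap (fD w) (w * t - s) (w * s - t) s t (by simp only [fD]; ring) p q
  have hl : (p ++ t :: s :: q).length = (p ++ s :: t :: q).length := by simp
  simp only [oppW, oppF, hl, List.map_append, List.map_cons, List.append_assoc, List.cons_append] at e ⊢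
  linear_combination e - (ds.map (fun y => (w * y) ^ (((p ++ s :: t :: q).length + ds.length) % 2) *
    (-w) * th w x (w * y))).prod * pairProd (fU w) ds * e2

lemma opp_exch_ds (us p q : List ℂ) (s t : ℂ) :
    (w * t - s) * (G w x (oppW us (p ++ t :: s :: q)) - oppF w x us (p ++ t :: s :: q))
      = (w * s - t) * (G w x (oppW us (p ++ s :: t :: q)) - oppF w x us (p ++ s :: t :: q)) := by
  have h3 := omega_cube hw
  have e := G_exch x hw (us.map (fun y => (false, y)) ++ p.map (fun y => (true, y)))
    (q.map (fun y => (true, y))) true true s t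
  unfold ExchAt at e
  rw [if_pos rfl] at e
  have e2 := pairProd_swap (fU w) (w * t - s) (w * s - t) s t
    (by simp only [fU]; linear_combination (w ^ 2 * t * s - 1) * (t ^ 2 - s ^ 2) * (-h3) + 0 * h3) p q
  have hl : (p ++ t :: s :: q).length = (p ++ s :: t :: q).length := by simp
  have e3 := prod_map_swap (fun y => (w * y) ^ ((us.length + (p ++ s :: t :: q).length) % 2) *
    (-w) * th w x (w * y)) s t p q
  simp only [oppF, hl, e3]
  generalize (List.map _ _ : List ℂ).prod = K
  simp only [oppW, List.map_append, List.map_cons, List.append_assoc] at e ⊢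
  linear_combination e - K * pairProd (fD w) us * e2

lemma opp_perm_us (ds : List ℂ) {L L' : List ℂ} (hp : L.Perm L')
    (hn : (L.map (fun y => y ^ 3)).Nodup) (p : List ℂ)
    (h : G w x (oppW (p ++ L) ds) = oppF w x (p ++ L) ds) :
    G w x (oppW (p ++ L') ds) = oppF w x (p ++ L') ds :=
  sub_eq_zero.1 (zero_perm hw (fun L => G w x (oppW L ds) - oppF w x L ds) (opp_exch_us hw x ds)
    hp hn p (sub_eq_zero.2 h))

lemma opp_perm_ds (us : List ℂ) {L L' : List ℂ} (hp : L.Perm L')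
    (hn : (L.map (fun y => y ^ 3)).Nodup) (p : List ℂ)
    (h : G w x (oppW us (p ++ L)) = oppF w x us (p ++ L)) :
    G w x (oppW us (p ++ L')) = oppF w x us (p ++ L') :=
  sub_eq_zero.1 (zero_perm hw (fun L => G w x (oppW us L) - oppF w x us L) (opp_exch_ds hw x us)
    hp hn p (sub_eq_zero.2 h))

/-- Removing a singlet in the middle of the opposite word. -/
lemma opp_key (us ds : List ℂ) {t : ℂ} (ht : t ≠ 0) (hg : Gen (us ++ ds))
    (hc : ∀ z ∈ us ++ ds, z ^ 3 ≠ t ^ 3)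
    (ih : G w x (oppW us ds) = oppF w x us ds) :
    G w x (oppW (us ++ [w * t]) (t :: ds)) = oppF w x (us ++ [w * t]) (t :: ds) := by
  have hn : ((oppW us ds).map Prod.snd) = us ++ ds := by
    simp [oppW, Function.comp_def]
  have h1 := singlet_diff hw x (us.map (fun y => (false, y))) (ds.map (fun y => (true, y))) ht
  have h2 := move_list hw x [] (us.map (fun y => (false, y))) (ds.map (fun y => (true, y))) ht (by
    intro z hz
    obtain ⟨η, hη, rfl⟩ := List.mem_map.1 hz
    exact hc η (by simp [hη]))
  have h3 := front hw x (oppW us ds) ht (by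
    intro z hz
    exact hc _ (hn ▸ List.mem_map_of_mem hz)) (hn ▸ hg.nodup)
  rw [hn] at h3
  simp only [List.nil_append] at h2
  have e : oppW (us ++ [w * t]) (t :: ds)
    = us.map (fun y => (false, y)) ++ (false, w * t) :: (true, t) :: ds.map (fun y => (true, y)) := by
    simp [oppW]
  rw [e, h1, ← h2]
  change -w * G w x ((true, w * t) :: (false, t) :: oppW us ds) = _
  rw [h3, ih, oppF, oppF, pairProd_append]
  have e4 : (us ++ [w * t]).length + (t :: ds).length = us.length + ds.length + 2 := by
    simp; omega
  rw [e4, kap]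
  simp [pairProd, fD_omega hw]
  ring

set_option maxHeartbeats 800000 in
lemma opp_step_even {N : ℕ} (hpar : N % 2 = 0) (us ds : List ℂ) (hg : Gen (us ++ ds))
    (hb : ds.length = (us.length + ds.length) / 2)
    (hN : us.length + ds.length = N)
    (mid : ∀ (us ds : List ℂ) (t : ℂ), Gen (us ++ ds) → (∀ z ∈ us ++ ds, z ^ 3 ≠ t ^ 3) → t ≠ 0 →
      ds.length = (us.length + ds.length) / 2 → us.length + ds.length + 2 = N →
      G w x (oppW (us ++ [w * t]) (t :: ds)) = oppF w x (us ++ [w * t]) (t :: ds)) :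
    G w x (oppW us ds) = oppF w x us ds := by
  have hw0 := omega_ne_zero hw
  have h3 := omega_cube hw
  rcases us with _ | ⟨y, us⟩
  · have : ds = [] := by
      rw [← List.length_eq_zero_iff]; simp at hb hN; omega
    subst this
    simpa [oppW, oppF, pairProd] using G_nil hw0 x
  have hg' : Gen (us ++ ds) := hg.sublist (by simp)
  have hn3 : (∀ z ∈ us ++ ds, z ^ 3 ≠ y ^ 3) := (gen_cons.1 hg).1
  have hl : us.length + ds.length + 1 = N := by simpa [add_right_comm] using hN
  have hP : PolyLe (fun y => G w x (oppW (y :: us) ds) - oppF w x (y :: us) ds) (N - 2) := by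
    refine PolyLe.sub ?_ ?_
    · obtain ⟨Q, h1, h2⟩ := G_slot hw0 x [] (oppW us ds) false
      refine ⟨Q, (h2 ?_).trans ?_, fun y => by rw [← h1]; rfl⟩
      · exact bal_oppW (us := 0 :: us) (ds := ds) (by simpa using hb)
      · simp [degB, oppW]
        omega
    · have : PolyLe (fun y => (us.map (fD w y)).prod) (2 * us.length) :=
        PolyLe.list_prod fun b _ => (((PolyLe.lin 1 (-(w * b))).mul
          (PolyLe.lin (w * b) (-1))).mono (by simp)).congr (fun y => by simp only [fD]; ring)
      refine ((this.const_mul ((ds.map (fun y => (w * y) ^ ((us.length + 1 + ds.length) % 2) * (-w)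
        * th w x (w * y))).prod * pairProd (fD w) us * pairProd (fU w) ds)).mono ?_).congr ?_
      · simp at hb; omega
      · intro y
        simp only [oppF, pairProd, List.length_cons]
        ring
  refine sub_eq_zero.1 (hP.eq_zero ((us ++ ds).map (fun z => w * z)) ?_ ?_ ?_ y)
  · exact hg'.nodup.map (mul_right_injective₀ hw0)
  · simp; omega
  · intro z hz
    obtain ⟨t, ht, rfl⟩ := List.mem_map.1 hz
    have ht0 := hg'.2 t ht
    refine sub_eq_zero.2 ?_
    rcases List.mem_append.1 ht with ht | ht
    · have hp := List.perm_cons_erase ht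
      refine opp_perm_us hw x ds hp.symm ((hp.map _).nodup_iff.1 hg'.cubes_left) [w * t] ?_
      have e1 := singlet_same hw x [] (oppW (us.erase t) ds) false ht0
      simp only [List.nil_append, oppW, List.map_cons, List.cons_append, oppF, pairProd] at e1 ⊢
      rw [e1]
      simp [fD]
    · have hp := List.perm_cons_erase ht
      obtain ⟨g1, g2, _⟩ := Gen.split_mem (hg'.perm (hp.append_left us))
      have hl2 := hp.length_eq
      simp at hl2 hb
      have m := mid us (ds.erase t) t g1 g2 ht0 (by omega) (by omega)
      have hn : ((us ++ [w * t]).map (fun y => y ^ 3)).Nodup := by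
        rw [List.map_append, List.map_singleton, mul_pow, h3, one_mul]
        refine List.nodup_append.2 ⟨g1.cubes_left, by simp, ?_⟩
        intro a ha b hb
        obtain ⟨c, hc, rfl⟩ := List.mem_map.1 ha
        rw [List.mem_singleton.1 hb]
        exact g2 c (by simp [hc])
      have m2 := opp_perm_us hw x (t :: ds.erase t) (List.perm_append_singleton (w * t) us) hn [] m
      exact opp_perm_ds hw x (w * t :: us) hp.symm ((hp.map _).nodup_iff.1 hg'.cubes_right) [] m2

set_option maxHeartbeats 800000 in
lemma opp_step_odd {N : ℕ} (hpar : N % 2 = 1) (us ds : List ℂ) (hg : Gen (us ++ ds))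
    (hb : ds.length = (us.length + ds.length) / 2)
    (hN : us.length + ds.length = N)
    (mid : ∀ (us ds : List ℂ) (t : ℂ), Gen (us ++ ds) → (∀ z ∈ us ++ ds, z ^ 3 ≠ t ^ 3) → t ≠ 0 →
      ds.length = (us.length + ds.length) / 2 → us.length + ds.length + 2 = N →
      G w x (oppW (us ++ [w * t]) (t :: ds)) = oppF w x (us ++ [w * t]) (t :: ds)) :
    G w x (oppW us ds) = oppF w x us ds := by
  have hw0 := omega_ne_zero hw
  have h3 := omega_cube hw
  rcases ds with _ | ⟨y, ds⟩
  · have e1 : us.length = 1 := by simp at hb hN; omega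
    obtain ⟨y, rfl⟩ := List.length_eq_one_iff.1 e1
    have := G_base hw0 x [] [y]
    simpa [oppW, oppF, pairProd] using this
  have hg' : Gen (us ++ ds) := hg.sublist (by simp)
  have hl : us.length + ds.length + 1 = N := by simpa [add_assoc] using hN
  have hP : PolyLe (fun y => G w x (oppW us (y :: ds)) - oppF w x us (y :: ds)) (N - 1) := by
    refine PolyLe.sub ?_ ?_
    · obtain ⟨Q, h1, h2⟩ := G_slot hw0 x (us.map (fun y => (false, y)))
        (ds.map (fun y => (true, y))) true
      refine ⟨Q, (h2 ?_).trans ?_, fun y => by rw [← h1]; rfl⟩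
      · exact bal_oppW (us := us) (ds := 0 :: ds) (by simpa using hb)
      · simp [degB]
        omega
    · have : PolyLe (fun y => (ds.map (fU w y)).prod) (2 * ds.length) :=
        PolyLe.list_prod fun b _ => (((PolyLe.lin (-w ^ 2) b).mul
          (PolyLe.lin (w ^ 2 * b) (-1))).mono (by simp)).congr (fun y => by simp only [fU]; ring)
      have h2 : PolyLe (fun y => (w * y) ^ 1 * (-w) * th w x (w * y)) 2 :=
        (((PolyLe.lin (-w ^ 2) 0).mul (PolyLe.lin ((x + w) * w) (-(x + w ^ 2)))).mono
          (by simp)).congr (fun y => by simp only [th]; ring)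
      refine (((h2.mul this).const_mul ((ds.map (fun y => (w * y) ^ 1 * (-w)
        * th w x (w * y))).prod * pairProd (fD w) us * pairProd (fU w) ds)).mono ?_).congr ?_
      · simp at hb; omega
      · intro y
        have : (us.length + (y :: ds).length) % 2 = 1 := by rw [← hpar, ← hl]; simp [add_assoc]
        simp only [oppF, this]
        simp only [pairProd, List.map_cons, List.prod_cons]
        ring
  refine sub_eq_zero.1 (hP.eq_zero (0 :: (us.map (fun z => w ^ 2 * z) ++ ds.map (fun z => w * z)))
    ?_ ?_ ?_ y)
  · have hc := hg'.1
    rw [List.map_append, List.nodup_append] at hc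
    refine List.nodup_cons.2 ⟨?_, List.nodup_append.2 ⟨?_, ?_, ?_⟩⟩
    · simp only [List.mem_append, List.mem_map, not_or, not_exists, not_and]
      exact ⟨fun z hz => mul_ne_zero (pow_ne_zero 2 hw0) (hg'.2 z (by simp [hz])),
        fun z hz => mul_ne_zero hw0 (hg'.2 z (by simp [hz]))⟩
    · exact hc.1.of_map.map (mul_right_injective₀ (pow_ne_zero 2 hw0))
    · exact hc.2.1.of_map.map (mul_right_injective₀ hw0)
    · intro a ha b hb e
      obtain ⟨a, ha', rfl⟩ := List.mem_map.1 ha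
      obtain ⟨b, hb', rfl⟩ := List.mem_map.1 hb
      refine hc.2.2 (a ^ 3) (List.mem_map.2 ⟨a, ha', rfl⟩) (b ^ 3) (List.mem_map.2 ⟨b, hb', rfl⟩) ?_
      have := congrArg (· ^ 3) e
      simpa [mul_pow, ← pow_mul, show w ^ 6 = 1 by rw [show 6 = 3 * 2 by rfl, pow_mul, h3]; simp, h3] using this
  · simp; omega
  · intro z hz
    rcases List.mem_cons.1 hz with rfl | hz
    · have : G w x (oppW us (0 :: ds)) = 0 := by
        rw [G_eq_ratF hw0, ratF_zero]
        · simp [oppW]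
        · simp [oppW]; omega
        · have : (oppW us (0 :: ds)).map Prod.snd = us ++ 0 :: ds := by
            simp [oppW, Function.comp_def]
          rw [this, List.nodup_middle]
          exact List.nodup_cons.2 ⟨fun h => hg'.2 0 h rfl, hg'.nodup⟩
      have h1 : (us.length + ((0 : ℂ) :: ds).length) % 2 = 1 := by rw [← hpar, ← hl]; simp [add_assoc]
      simp only [this, oppF, h1]
      simp
    refine sub_eq_zero.2 ?_
    rcases List.mem_append.1 hz with hz | hz
    · obtain ⟨a, ha, rfl⟩ := List.mem_map.1 hz
      have hp := List.perm_cons_erase ha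
      have g := hg'.perm (hp.append_right ds)
      obtain ⟨g1, g2, g3⟩ := gen_cons.1 g |>.imp id id |> fun h => (⟨h.2.2, h.1, h.2.1⟩ :
        Gen (us.erase a ++ ds) ∧ (∀ z ∈ us.erase a ++ ds, z ^ 3 ≠ a ^ 3) ∧ a ≠ 0)
      have m := mid (us.erase a) ds (w ^ 2 * a) g1 (by
        intro z hz
        rw [mul_pow, ← pow_mul, mul_comm 2 3, pow_mul, h3, one_pow, one_mul]
        exact g2 z hz) (mul_ne_zero (pow_ne_zero 2 hw0) g3) (by
          have := hp.length_eq
          simp at this hb; omega) (by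
          have := hp.length_eq
          simp at this hb; omega)
      have e : w * (w ^ 2 * a) = a := by linear_combination a * h3
      rw [e] at m
      have hp2 := (List.perm_append_singleton a (us.erase a)).trans hp.symm
      exact opp_perm_us hw x (w ^ 2 * a :: ds) hp2
        ((hp2.map _).nodup_iff.2 hg'.cubes_left) [] m
    · obtain ⟨t, ht, rfl⟩ := List.mem_map.1 hz
      have ht0 := hg'.2 t (by simp [ht])
      have hp := List.perm_cons_erase ht
      refine opp_perm_ds hw x us hp.symm ((hp.map _).nodup_iff.1 hg'.cubes_right) [w * t] ?_
      have e1 := singlet_same hw x (us.map (fun y => (false, y)))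
        ((ds.erase t).map (fun y => (true, y))) true ht0
      have e : t - w ^ 2 * (w * t) = 0 := by linear_combination (-t) * h3
      simp only [oppW, List.map_cons, List.cons_append, List.nil_append, oppF, pairProd] at e1 ⊢
      rw [e1]
      simp [fU, e]

theorem opp_gen (us ds : List ℂ) (hg : Gen (us ++ ds)) (hb : ds.length = (us.length + ds.length) / 2) :
    G w x (oppW us ds) = oppF w x us ds := by
  induction hN : us.length + ds.length using Nat.strong_induction_on generalizing us ds with
  | _ N ih =>
  have mid : ∀ (us ds : List ℂ) (t : ℂ), Gen (us ++ ds) → (∀ z ∈ us ++ ds, z ^ 3 ≠ t ^ 3) → t ≠ 0 →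
      ds.length = (us.length + ds.length) / 2 → us.length + ds.length + 2 = N →
      G w x (oppW (us ++ [w * t]) (t :: ds)) = oppF w x (us ++ [w * t]) (t :: ds) := by
    intro us ds t hg hc ht hb hN
    exact opp_key hw x us ds ht hg hc (ih _ (by omega) us ds hg hb rfl)
  rcases Nat.mod_two_eq_zero_or_one N with hpar | hpar
  · exact opp_step_even hw x hpar us ds hg hb hN mid
  · exact opp_step_odd hw x hpar us ds hg hb hN mid

end

section

/-! ### Inversion of the first parameter, and reversal -/

lemma pairProd_reverse (f : ℂ → ℂ → ℂ) (l : List ℂ) :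
    pairProd f l.reverse = pairProd (fun a b => f b a) l := by
  induction l with
  | nil => rfl
  | cons a l ih =>
    rw [List.reverse_cons, pairProd_append, ih]
    simp [pairProd, mul_comm]

lemma list_prod_mul_pow (L : List ℂ) (f g : ℂ → ℂ) (c : ℂ) (h : ∀ b ∈ L, c * f b = g b) :
    c ^ L.length * (L.map f).prod = (L.map g).prod := by
  induction L with
  | nil => simp
  | cons b L ih =>
    have := ih fun b hb => h b (by simp [hb])
    simp only [List.length_cons, List.map_cons, List.prod_cons, ← h b (by simp), ← this]
    ring

variable {w : ℂ} (hw : w ^ 2 + w + 1 = 0) (x : ℂ)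
include hw

lemma omega_sq : (w ^ 2) ^ 2 + w ^ 2 + 1 = 0 := by
  linear_combination (w ^ 2 - w + 1) * hw

lemma flip_up (q : List Site) {y : ℂ} (hy : Gen (y :: q.map Prod.snd))
    (hy' : Gen (y⁻¹ :: q.map Prod.snd)) (hb : Bal ((false, y) :: q)) :
    y ^ q.length * G w x ((false, y⁻¹) :: q)
      = y ^ (1 - (q.length + 1) % 2) * G w x ((false, y) :: q) := by
  have hw0 := omega_ne_zero hw
  have hy0 : y ≠ 0 := (gen_cons.1 hy).2.1
  have hb' : q.countP (fun z => z.1) = (q.length + 1) / 2 := by simpa [Bal] using hb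
  have := uniq_opp hw0 (fun l => y ^ q.length * G w x ((false, y⁻¹) :: l)
    - y ^ (1 - (q.length + 1) % 2) * G w x ((false, y) :: l)) (q.map Prod.snd)
    (gen_cons.1 hy).2.2.nodup _ ?_ ?_ q (List.Perm.refl _) rfl
  · linear_combination this
  · intro p q a b s t' _
    refine ExchAt.sub_mul _ _ ?_ ?_
    · exact ExchAt.append_left (r := [(false, y⁻¹)]) (G_exch x hw _ _ _ _ _ _)
    · exact ExchAt.append_left (r := [(false, y)]) (G_exch x hw _ _ _ _ _ _)
  · intro us ds hd hp
    have hl := hp.length_eq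
    simp only [List.length_append, List.length_map] at hl
    have e1 := opp_gen hw x (y⁻¹ :: us) ds (hy'.perm (hp.symm.cons _)) (by simp; omega)
    have e2 := opp_gen hw x (y :: us) ds (hy.perm (hp.symm.cons _)) (by simp; omega)
    have e3 := list_prod_mul_pow us (fD w y⁻¹) (fD w y) (y ^ 2) (fun b _ => by
      simp only [fD]; field_simp; ring)
    rw [← pow_mul] at e3
    have e4 : q.length = (1 - (q.length + 1) % 2) + 2 * us.length := by omega
    simp only [oppW, List.map_cons, List.cons_append] at e1 e2
    rw [e1, e2]
    nth_rewrite 1 [e4]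
    simp only [oppF, pairProd, List.length_cons, pow_add]
    linear_combination y ^ (1 - (q.length + 1) % 2) * (ds.map (fun y => (w * y) ^ ((us.length + 1 + ds.length) % 2) * (-w)
      * th w x (w * y))).prod * pairProd (fD w) us * pairProd (fU w) ds * e3

lemma flip_down (q : List Site) {y : ℂ} (hy0 : y ≠ 0) (hy : (q.map Prod.snd).Nodup)
    (hb : Bal ((true, y) :: q)) :
    y ^ q.length * (y * th w x y) * G w x ((true, y⁻¹) :: q)
      = y ^ (1 - (q.length + 1) % 2) * ((x + w) - (x + w ^ 2) * y) * G w x ((true, y) :: q) := by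
  have hw0 := omega_ne_zero hw
  have hb' : q.countP (fun z => z.1) + 1 = (q.length + 1) / 2 := by simpa [Bal] using hb
  have := uniq_sorted hw0 (fun l => y ^ q.length * (y * th w x y) * G w x ((true, y⁻¹) :: l)
    - y ^ (1 - (q.length + 1) % 2) * ((x + w) - (x + w ^ 2) * y) * G w x ((true, y) :: l))
    (q.map Prod.snd) hy _ ?_ ?_ q (List.Perm.refl _) rfl
  · linear_combination this
  · intro p q a b s t' _
    refine ExchAt.sub_mul _ _ ?_ ?_
    · exact ExchAt.append_left (r := [(true, y⁻¹)]) (G_exch x hw _ _ _ _ _ _)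
    · exact ExchAt.append_left (r := [(true, y)]) (G_exch x hw _ _ _ _ _ _)
  · intro ds us hd hp
    have hl := hp.length_eq
    simp only [List.length_append, List.length_map] at hl
    have e1 := G_base hw0 x (y⁻¹ :: ds) us
    have e2 := G_base hw0 x (y :: ds) us
    have e3 := list_prod_mul_pow ds (fD w y⁻¹) (fD w y) (y ^ 2) (fun b _ => by
      simp only [fD]; field_simp; ring)
    rw [← pow_mul] at e3
    have e5 : y * th w x y⁻¹ = (x + w) - (x + w ^ 2) * y := by
      simp only [th]; field_simp
    simp only [List.map_cons, List.cons_append] at e1 e2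
    rw [e1, e2, ← e5]
    have e6 : ds.length + 1 + us.length = q.length + 1 := by omega
    simp only [pairProd, List.length_cons, List.prod_cons, e6]
    rw [← e3]
    rcases Nat.mod_two_eq_zero_or_one (q.length + 1) with h | h
    · have e4 : q.length = 2 * ds.length + 1 := by omega
      rw [h, e4]
      ring
    · have e4 : q.length = 2 * ds.length + 2 := by omega
      rw [h, e4]
      field_simp
      ring

lemma rev_exch (p q : List Site) (a b : Bool) (s t : ℂ) :
    ExchAt (w ^ 2) (fun l => G w x l.reverse) p q a b s t := by
  have h3 := omega_cube hw
  have e := G_exch x hw q.reverse p.reverse b a t s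
  unfold ExchAt at e ⊢
  simp only [List.reverse_append, List.reverse_cons, List.append_assoc, List.cons_append,
    List.nil_append]
  cases a <;> cases b <;>
    simp only [reduceCtorEq, if_true, if_false, Bool.false_eq_true] at e ⊢ <;>
    generalize G w x (q.reverse ++ _) = A at e ⊢ <;>
    generalize G w x (q.reverse ++ _) = B at e ⊢ <;>
    try generalize G w x (q.reverse ++ _) = C at e ⊢
  all_goals grind

theorem G_reverse (hx : x ≠ 0) (l : List Site) (hg : Gen (l.map Prod.snd)) (hb : Bal l) :
    G w x l.reverse = (-x * w ^ (l.length % 2)) ^ (l.length / 2) * G (w ^ 2) x⁻¹ l := by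
  have hw0 := omega_ne_zero hw
  have h3 := omega_cube hw
  have := uniq_sorted (pow_ne_zero 2 hw0) (fun l' => 1 * G w x l'.reverse -
    (-x * w ^ (l.length % 2)) ^ (l.length / 2) * G (w ^ 2) x⁻¹ l')
    (l.map Prod.snd) hg.nodup _ ?_ ?_ l (List.Perm.refl _) rfl
  · linear_combination this
  · intro p q a b s t' _
    exact ExchAt.sub_mul _ _ (rev_exch hw x _ _ _ _ _ _) (G_exch _ (omega_sq hw) _ _ _ _ _ _)
  · intro ds us hd hp
    have hl := hp.length_eq
    simp only [List.length_append, List.length_map] at hl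
    unfold Bal at hb
    rw [hb] at hd
    have e1 := opp_gen hw x us.reverse ds.reverse (hg.perm (hp.symm.trans
      (List.perm_append_comm.trans ((List.reverse_perm _).symm.append (List.reverse_perm _).symm))))
      (by simp; omega)
    rw [G_base (pow_ne_zero 2 hw0), List.reverse_append, ← List.map_reverse, ← List.map_reverse]
    rw [oppW] at e1
    rw [e1, oppF, pairProd_reverse, pairProd_reverse, ← hd]
    have f1 : (fun a b => fD w b a) = fU (w ^ 2) := by
      funext a b; simp only [fD, fU]
      have h4 : (w ^ 2) ^ 2 = w := by linear_combination w * h3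
      rw [h4]
      ring
    have f2 : (fun a b => fU w b a) = fD (w ^ 2) := by
      funext a b; simp only [fD, fU]; ring
    have f3 := list_prod_mul_pow ds (fun y => y ^ ((ds.length + us.length) % 2) * th (w ^ 2) x⁻¹ y)
      (fun y => (w * y) ^ ((us.reverse.length + ds.reverse.length) % 2) * (-w) * th w x (w * y))
      (-x * w ^ (l.length % 2)) (fun y _ => by
        simp only [List.length_reverse, add_comm us.length, hl]
        have : -x * th (w ^ 2) x⁻¹ y = (-w) * th w x (w * y) := by
          simp only [th]
          field_simp
          linear_combination (w * x - 1 + y) * h3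
        linear_combination w ^ (l.length % 2) * y ^ (l.length % 2) * this)
    rw [f1, f2, List.map_reverse, List.prod_reverse, ← f3]
    ring

end

section

/-! ### Sums over spin words -/

def sumS : List ℂ → (List Site → ℂ) → ℂ
  | [], f => f []
  | y :: Y, f => sumS Y (fun l => f ((true, y) :: l)) + sumS Y (fun l => f ((false, y) :: l))

lemma sumS_append (P Y : List ℂ) (f : List Site → ℂ) :
    sumS (P ++ Y) f = sumS P fun p => sumS Y fun l => f (p ++ l) := by
  induction P generalizing f with
  | nil => rfl
  | cons y P ih => simp only [List.cons_append, sumS, ih]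

lemma sumS_congr (Y : List ℂ) {f g : List Site → ℂ} (h : ∀ l, l.map Prod.snd = Y → f l = g l) :
    sumS Y f = sumS Y g := by
  induction Y generalizing f g with
  | nil => exact h [] rfl
  | cons y Y ih =>
    simp only [sumS]
    rw [ih fun l hl => h ((true, y) :: l) (by simp [hl]),
      ih fun l hl => h ((false, y) :: l) (by simp [hl])]

lemma sumS_add (Y : List ℂ) (f g : List Site → ℂ) :
    sumS Y (fun l => f l + g l) = sumS Y f + sumS Y g := by
  induction Y generalizing f g with
  | nil => rfl
  | cons y Y ih => simp only [sumS, ih]; ring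

lemma sumS_mul_left (Y : List ℂ) (c : ℂ) (f : List Site → ℂ) :
    sumS Y (fun l => c * f l) = c * sumS Y f := by
  induction Y generalizing f with
  | nil => rfl
  | cons y Y ih => simp only [sumS, ih]; ring

lemma sumS_comm (Y Y' : List ℂ) (f : List Site → List Site → ℂ) :
    sumS Y (fun l => sumS Y' (f l)) = sumS Y' fun l' => sumS Y fun l => f l l' := by
  induction Y generalizing f with
  | nil => rfl
  | cons y Y ih => simp only [sumS, ih, sumS_add]

lemma sumS_reverse (Y : List ℂ) (f : List Site → ℂ) :
    sumS Y.reverse f = sumS Y fun l => f l.reverse := by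
  induction Y generalizing f with
  | nil => rfl
  | cons y Y ih =>
    rw [List.reverse_cons, sumS_append, ih]
    simp only [sumS, sumS_add, List.reverse_cons]

/-! ### Laurent-type degree bounds away from the origin -/

def LaurLe (h : ℂ → ℂ) (d : ℕ) : Prop := ∃ g, PolyLe g d ∧ ∀ y, y ≠ 0 → g y = h y

namespace LaurLe

variable {f g : ℂ → ℂ} {d e : ℕ}

lemma of_polyLe (h : PolyLe f d) : LaurLe f d := ⟨f, h, fun _ _ => rfl⟩

lemma inv (h : PolyLe f d) : LaurLe (fun y => y ^ d * f y⁻¹) d := by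
  obtain ⟨Q, hQ, hf⟩ := h
  refine ⟨fun y => (Q.reflect d).eval y, ⟨_, ?_, fun _ => rfl⟩, fun y hy => ?_⟩
  · refine Polynomial.natDegree_le_iff_coeff_eq_zero.2 fun n hn => ?_
    rw [Polynomial.coeff_reflect, Polynomial.revAt_eq_self_of_lt hn]
    exact Polynomial.coeff_eq_zero_of_natDegree_lt (hQ.trans_lt hn)
  · let _ : Invertible (y⁻¹) := invertibleOfNonzero (inv_ne_zero hy)
    have := Polynomial.eval₂_reflect_mul_pow (RingHom.id ℂ) y⁻¹ d Q hQ
    simp only [invOf_eq_inv, inv_inv, Polynomial.eval₂_id] at this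
    beta_reduce
    rw [hf, ← this, mul_comm, mul_assoc, ← mul_pow, inv_mul_cancel₀ hy, one_pow, mul_one]

lemma mono (h : LaurLe f d) (hd : d ≤ e) : LaurLe f e := by
  obtain ⟨g, hg, h⟩ := h
  exact ⟨g, hg.mono hd, h⟩

lemma congr (h : LaurLe f d) (hfg : ∀ y, y ≠ 0 → g y = f y) : LaurLe g d := by
  obtain ⟨k, hk, h⟩ := h
  exact ⟨k, hk, fun y hy => by rw [h y hy, hfg y hy]⟩

lemma add (hf : LaurLe f d) (hg : LaurLe g d) : LaurLe (fun y => f y + g y) d := by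
  obtain ⟨F, hF, hf⟩ := hf
  obtain ⟨G, hG, hg⟩ := hg
  exact ⟨_, hF.add hG, fun y hy => by rw [hf y hy, hg y hy]⟩

lemma mul (hf : LaurLe f d) (hg : LaurLe g e) : LaurLe (fun y => f y * g y) (d + e) := by
  obtain ⟨F, hF, hf⟩ := hf
  obtain ⟨G, hG, hg⟩ := hg
  exact ⟨_, hF.mul hG, fun y hy => by rw [hf y hy, hg y hy]⟩

lemma const_mul (c : ℂ) (hf : LaurLe f d) : LaurLe (fun y => c * f y) d :=
  ((of_polyLe (PolyLe.const c)).mul hf).mono (by simp)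

lemma sumS (Y : List ℂ) {F : ℂ → List Site → ℂ} (h : ∀ l, l.map Prod.snd = Y → LaurLe (fun y => F y l) d) :
    LaurLe (fun y => sumS Y (F y)) d := by
  induction Y generalizing F with
  | nil => exact h [] rfl
  | cons y Y ih =>
    exact (ih fun l hl => h _ (by simp [hl])).add (ih fun l hl => h _ (by simp [hl]))

lemma eq_of_finite (hf : LaurLe f d) (hg : LaurLe g e) (S : Set ℂ) (hS : S.Finite)
    (h : ∀ y, y ≠ 0 → y ∉ S → f y = g y) {y : ℂ} (hy : y ≠ 0) : f y = g y := by
  obtain ⟨F, ⟨P, _, hP⟩, hf⟩ := hf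
  obtain ⟨G, ⟨Q, _, hQ⟩, hg⟩ := hg
  have : P = Q := by
    refine Polynomial.eq_of_infinite_eval_eq P Q ?_
    refine Set.Infinite.mono (s := (insert 0 S)ᶜ) ?_ (hS.insert 0).infinite_compl
    intro z hz
    simp only [Set.mem_compl_iff, Set.mem_insert_iff, not_or] at hz
    simp only [Set.mem_ofPred_eq]
    rw [← hP, ← hQ, hf z hz.1, hg z hz.1, h z hz.1 hz.2]
  rw [← hf y hy, ← hg y hy, hP, hQ, this]

end LaurLe

/-! ### The sector-projected vector and the overlap sums -/

def Gb (w x : ℂ) (l : List Site) : ℂ := if Bal l then G w x l else 0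

def invS (l : List Site) : List Site := l.map fun z => (z.1, z.2⁻¹)

lemma invS_append (l l' : List Site) : invS (l ++ l') = invS l ++ invS l' := by simp [invS]

lemma invS_cons (z : Site) (l : List Site) : invS (z :: l) = (z.1, z.2⁻¹) :: invS l := by simp [invS]

lemma invS_snd (l : List Site) : (invS l).map Prod.snd = (l.map Prod.snd).map (·⁻¹) := by
  simp [invS]

def ovS (w x : ℂ) (Y1 Y2 : List ℂ) : ℂ :=
  sumS Y1 fun l1 => sumS Y2 fun l2 => Gb w x (invS (l1 ++ l2)) * Gb w x l1 * Gb w x l2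

def InvExch (w : ℂ) (F : List Site → ℂ) : Prop :=
  ∀ (p q : List Site) (a b : Bool) (s t : ℂ), s ≠ 0 → t ≠ 0 →
    (w * s - t) * F (p ++ (a, t) :: (b, s) :: q) =
      if a = b then (w * t - s) * F (p ++ (a, s) :: (b, t) :: q)
      else (w - 1) * (if a then s else t) * F (p ++ (a, s) :: (b, t) :: q)
        + w ^ 2 * (t - s) * F (p ++ (b, s) :: (a, t) :: q)

lemma InvExch.sumS {w : ℂ} (Y : List ℂ) {F : List Site → List Site → ℂ}
    (h : ∀ l', InvExch w (fun l => F l l')) : InvExch w (fun l => sumS Y (F l)) := by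
  intro p q a b s t hs ht
  dsimp only
  split_ifs <;>
  · simp only [← sumS_mul_left, ← sumS_add]
    refine sumS_congr _ fun l' _ => ?_
    have := h l' p q a b s t hs ht
    simp_all

lemma InvExch.mul_const {w : ℂ} {F : List Site → ℂ} (h : InvExch w F) (c : ℂ) :
    InvExch w (fun l => F l * c) := by
  intro p q a b s t hs ht
  have := h p q a b s t hs ht
  dsimp only
  split_ifs at this ⊢ <;> linear_combination c * this

lemma bal_swap (p q : List Site) (a b : Bool) (s t s' t' : ℂ) :
    Bal (p ++ (a, s) :: (b, t) :: q) ↔ Bal (p ++ (b, s') :: (a, t') :: q) := by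
  simp only [Bal, List.countP_append, List.countP_cons, List.length_append, List.length_cons]
  rw [add_right_comm (List.countP _ q)]

lemma bal_param (p q : List Site) (a : Bool) (s t : ℂ) :
    Bal (p ++ (a, s) :: q) ↔ Bal (p ++ (a, t) :: q) := by
  simp only [Bal, List.countP_append, List.countP_cons, List.length_append, List.length_cons]

section
variable {w : ℂ} (hw : w ^ 2 + w + 1 = 0) (x : ℂ)
include hw

lemma Gb_exch (p q : List Site) (a b : Bool) (s t : ℂ) : ExchAt w (Gb w x) p q a b s t := by
  have e := G_exch x hw p q a b s t
  have h1 : Bal (p ++ (a, t) :: (b, s) :: q) ↔ Bal (p ++ (a, s) :: (b, t) :: q) := by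
    simp only [Bal, List.countP_append, List.countP_cons, List.length_append, List.length_cons]
  have h2 := bal_swap p q b a s t s t
  unfold ExchAt Gb at *
  simp only [h1, h2]
  by_cases h : Bal (p ++ (a, s) :: (b, t) :: q)
  · simpa only [h, if_true] using e
  · simp [h]

lemma Gb_invExch (r : List Site) : InvExch w (fun l => Gb w x (invS (r ++ l))) := by
  intro p q a b s t hs ht
  have e := Gb_exch hw x (invS (r ++ p)) (invS q) a b s⁻¹ t⁻¹
  unfold ExchAt at e
  simp only [invS_append, invS_cons, ← List.append_assoc] at e ⊢
  generalize Gb w x (invS r ++ invS p ++ (a, t⁻¹) :: _) = A at *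
  generalize Gb w x (invS r ++ invS p ++ (a, s⁻¹) :: _) = B at *
  generalize Gb w x (invS r ++ invS p ++ (b, s⁻¹) :: _) = C at *
  split_ifs at e ⊢ <;> field_simp at e ⊢ <;> linear_combination e

lemma Gb_invExch_left (r : List Site) : InvExch w (fun l => Gb w x (invS (l ++ r))) := by
  intro p q a b s t hs ht
  have := Gb_invExch hw x [] p (q ++ r) a b s t hs ht
  simpa [List.append_assoc] using this

end

lemma sumS_swap {w : ℂ} (A B : List Site → ℂ) (hA : InvExch w A)
    (hB : ∀ p q a b s t, ExchAt w B p q a b s t) (hw3 : w ^ 3 = 1)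
    {s t : ℂ} (hs : s ≠ 0) (ht : t ≠ 0) (h1 : w * t - s ≠ 0) (h2 : w * s - t ≠ 0) (P Q : List ℂ) :
    sumS (P ++ t :: s :: Q) (fun l => A l * B l) = sumS (P ++ s :: t :: Q) (fun l => A l * B l) := by
  simp only [sumS_append]
  refine sumS_congr _ fun p _ => ?_
  simp only [sumS, ← sumS_add]
  refine sumS_congr _ fun q _ => ?_
  have a1 := hA p q true true s t hs ht
  have a2 := hA p q true false s t hs ht
  have a3 := hA p q false true s t hs ht
  have a4 := hA p q false false s t hs ht
  have b1 := hB p q true true s t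
  have b2 := hB p q true false s t
  have b3 := hB p q false true s t
  have b4 := hB p q false false s t
  simp only [ExchAt, if_true, reduceCtorEq, if_false, Bool.false_eq_true] at a1 a2 a3 a4 b1 b2 b3 b4
  refine mul_left_cancel₀ (mul_ne_zero h1 h2) ?_
  have k1 := congrArg₂ (· * ·) a1 b1
  have k2 := congrArg₂ (· * ·) a2 b2
  have k3 := congrArg₂ (· * ·) a3 b3
  have k4 := congrArg₂ (· * ·) a4 b4
  clear a1 a2 a3 a4 b1 b2 b3 b4 hA hB h1 h2
  generalize A (p ++ (true, s) :: (true, t) :: q) = A1 at *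
  generalize A (p ++ (true, s) :: (false, t) :: q) = A2 at *
  generalize A (p ++ (false, s) :: (true, t) :: q) = A3 at *
  generalize A (p ++ (false, s) :: (false, t) :: q) = A4 at *
  generalize B (p ++ (true, s) :: (true, t) :: q) = B1 at *
  generalize B (p ++ (true, s) :: (false, t) :: q) = B2 at *
  generalize B (p ++ (false, s) :: (true, t) :: q) = B3 at *
  generalize B (p ++ (false, s) :: (false, t) :: q) = B4 at *
  generalize A (p ++ (true, t) :: (true, s) :: q) = C1 at *
  generalize A (p ++ (true, t) :: (false, s) :: q) = C2 at *
  generalize A (p ++ (false, t) :: (true, s) :: q) = C3 at *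
  generalize A (p ++ (false, t) :: (false, s) :: q) = C4 at *
  generalize B (p ++ (true, t) :: (true, s) :: q) = D1 at *
  generalize B (p ++ (true, t) :: (false, s) :: q) = D2 at *
  generalize B (p ++ (false, t) :: (true, s) :: q) = D3 at *
  generalize B (p ++ (false, t) :: (false, s) :: q) = D4 at *
  linear_combination k1 + k2 + k3 + k4 + (-w * (t - s) ^ 2 * (A2 * B2 + A3 * B3)) * hw3

end

section

lemma LaurLe.comp_inv {h : ℂ → ℂ} {d : ℕ} (hh : LaurLe h d) : LaurLe (fun y => y ^ d * h y⁻¹) d := by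
  obtain ⟨g, hg, hgh⟩ := hh
  exact (LaurLe.inv hg).congr fun y hy => by rw [hgh _ (inv_ne_zero hy)]

lemma Gen.inv {Y : List ℂ} (h : Gen Y) : Gen (Y.map (·⁻¹)) := by
  refine ⟨?_, ?_⟩
  · have : (Y.map (·⁻¹)).map (· ^ 3) = (Y.map (· ^ 3)).map (·⁻¹) := by
      simp [Function.comp_def, inv_pow]
    rw [this]
    exact h.1.map inv_injective
  · intro y hy
    obtain ⟨z, hz, rfl⟩ := List.mem_map.1 hy
    exact inv_ne_zero (h.2 z hz)

lemma finite_cube_eq (c : ℂ) : {y : ℂ | y ^ 3 = c}.Finite := by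
  have h0 : (Polynomial.X ^ 3 - Polynomial.C c : Polynomial ℂ) ≠ 0 :=
    Polynomial.X_pow_sub_C_ne_zero (by norm_num) c
  refine (Polynomial.X ^ 3 - Polynomial.C c : Polynomial ℂ).roots.toFinset.finite_toSet.subset ?_
  intro y hy
  simp only [Set.mem_ofPred_eq] at hy
  simp [h0, hy]

lemma finite_not_gen (Y : List ℂ) (hY : Gen Y) : {y : ℂ | y ≠ 0 ∧ ¬ Gen (y :: Y)}.Finite := by
  refine ((Y.map (· ^ 3)).toFinset.finite_toSet.biUnion fun c _ => finite_cube_eq c).subset ?_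
  rintro y ⟨hy0, hy⟩
  simp only [gen_cons, hY, hy0, ne_eq, not_false_eq_true, and_true] at hy
  push Not at hy
  obtain ⟨z, hz, h⟩ := hy
  simp only [Set.mem_iUnion, Set.mem_ofPred_eq]
  exact ⟨z ^ 3, by simpa using ⟨z, hz, rfl⟩, h.symm⟩

lemma bal_pair (q : List Site) (s t : ℂ) : Bal ((true, s) :: (false, t) :: q) ↔ Bal q := by
  simp only [Bal, List.countP_cons, List.length_cons, if_true, Bool.false_eq_true, if_false]
  omega

lemma bal_pair' (q : List Site) (s t : ℂ) : Bal ((false, s) :: (true, t) :: q) ↔ Bal q := by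
  simp only [Bal, List.countP_cons, List.length_cons, if_true, Bool.false_eq_true, if_false]
  omega

section
variable {w : ℂ} (hw : w ^ 2 + w + 1 = 0) (x : ℂ)
include hw

lemma Gb_slot (p q : List Site) (a : Bool) :
    PolyLe (fun t => Gb w x (p ++ (a, t) :: q)) (p.length + q.length) := by
  obtain ⟨Q, hQ, hd⟩ := G_slot (omega_ne_zero hw) x p q a
  by_cases h : Bal (p ++ (a, 0) :: q)
  · refine ⟨Q, (hd h).trans ?_, fun t => ?_⟩
    · unfold degB; split_ifs <;> omega
    · beta_reduce
      rw [Gb, if_pos ((bal_param p q a t 0).2 h), hQ]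
  · exact ⟨0, by simp, fun t => by
      beta_reduce; rw [Gb, if_neg (fun h' => h ((bal_param p q a t 0).1 h'))]; simp⟩

lemma ovS_laur (P Q Y2 : List ℂ) :
    LaurLe (fun y => y ^ (P.length + Q.length + Y2.length) * ovS w x (P ++ y :: Q) Y2)
      ((P.length + Q.length + Y2.length) + (P.length + Q.length)) := by
  unfold ovS
  simp only [sumS_append, ← sumS_mul_left]
  refine LaurLe.sumS _ fun p hp => ?_
  have hp' : p.length = P.length := by rw [← hp, List.length_map]
  simp only [sumS, ← sumS_add]
  refine LaurLe.sumS _ fun q hq => ?_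
  have hq' : q.length = Q.length := by rw [← hq, List.length_map]
  refine LaurLe.sumS _ fun l hl => ?_
  have hl' : l.length = Y2.length := by rw [← hl, List.length_map]
  have key : ∀ a, LaurLe (fun y => y ^ (P.length + Q.length + Y2.length) *
      (Gb w x (invS (p ++ (a, y) :: q ++ l)) * Gb w x (p ++ (a, y) :: q) * Gb w x l))
      ((P.length + Q.length + Y2.length) + (P.length + Q.length)) := by
    intro a
    have h1 := LaurLe.inv (Gb_slot hw x (invS p) (invS (q ++ l)) a)
    have h2 := LaurLe.of_polyLe (Gb_slot hw x p q a)
    refine (((h1.mul h2).const_mul (Gb w x l)).mono ?_).congr fun y _ => ?_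
    · simp [invS, hp', hq', hl', add_assoc]
    · simp only [invS_append, invS_cons, List.append_assoc, List.cons_append, List.length_append]
      simp only [invS, List.length_map, hp', hq', hl', add_assoc]
      ring
  refine ((key true).add (key false)).congr fun y _ => ?_
  ring

lemma ovS_swap (P Q Y2 : List ℂ) {s t : ℂ} (hs : s ≠ 0) (ht : t ≠ 0) :
    ovS w x (P ++ t :: s :: Q) Y2 = ovS w x (P ++ s :: t :: Q) Y2 := by
  have h3 := omega_cube hw
  have hf := ovS_laur hw x (P ++ [t]) Q Y2
  have hg := ovS_laur hw x P (t :: Q) Y2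
  have := hf.eq_of_finite hg {w * t, w ^ 2 * t} (by simp) ?_ hs
  · simp only [List.length_append, List.length_cons, List.length_nil, List.append_assoc,
      List.cons_append, List.nil_append] at this
    refine mul_left_cancel₀ (pow_ne_zero (P.length + (0 + 1) + Q.length + Y2.length) hs) ?_
    rw [this]
    congr 2
    omega
  · intro y hy hyS
    simp only [Set.mem_insert_iff, Set.mem_singleton_iff, not_or] at hyS
    have h1 : w * t - y ≠ 0 := sub_ne_zero.2 (Ne.symm hyS.1)
    have h2 : w * y - t ≠ 0 := by
      intro h
      refine hyS.2 ?_
      linear_combination w ^ 2 * h - y * h3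
    have key := sumS_swap (fun l1 => sumS Y2 fun l2 => Gb w x (invS (l1 ++ l2)) * Gb w x l2)
      (Gb w x) (InvExch.sumS Y2 fun l' => (Gb_invExch_left hw x l').mul_const _)
      (Gb_exch hw x) h3 hy ht h1 h2 P Q
    have e : ∀ Y, ovS w x Y Y2 = sumS Y fun l1 =>
        (sumS Y2 fun l2 => Gb w x (invS (l1 ++ l2)) * Gb w x l2) * Gb w x l1 := by
      intro Y
      refine sumS_congr _ fun l _ => ?_
      rw [mul_comm, ← sumS_mul_left]
      exact sumS_congr _ fun l2 _ => by ring
    have hlen : (P ++ [t]).length + Q.length + Y2.length = P.length + (t :: Q).length + Y2.length := by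
      simp; omega
    rw [hlen]
    simp only [List.append_assoc, List.cons_append, List.nil_append]
    rw [e, e, key]

lemma ovS_perm {Y Y' : List ℂ} (h : Y.Perm Y') (h0 : ∀ y ∈ Y, y ≠ 0) (Y2 : List ℂ) :
    ovS w x Y Y2 = ovS w x Y' Y2 := by
  have : ∀ P : List ℂ, ovS w x (P ++ Y) Y2 = ovS w x (P ++ Y') Y2 := by
    induction h with
    | nil => intro P; rfl
    | cons a h ih =>
      intro P
      have := ih (fun y hy => h0 y (by simp [hy])) (P ++ [a])
      simpa using this
    | swap a b l =>
      intro P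
      exact ovS_swap hw x P l Y2 (h0 _ (by simp)) (h0 _ (by simp))
    | trans h1 h2 ih1 ih2 =>
      intro P
      rw [ih1 h0 P, ih2 (fun y hy => h0 y (h1.mem_iff.2 hy)) P]
  exact this []

/-! ### Recursion at a singlet -/

lemma Gb_same (a : Bool) (q : List Site) {t : ℂ} (ht : t ≠ 0) : Gb w x ((a, w * t) :: (a, t) :: q) = 0 := by
  unfold Gb
  have := singlet_same hw x [] q a ht
  simp only [List.nil_append] at this
  simp [this]

lemma Gb_diff (q : List Site) {t : ℂ} (ht : t ≠ 0) :
    Gb w x ((false, w * t) :: (true, t) :: q) = -w * Gb w x ((true, w * t) :: (false, t) :: q) := by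
  have := singlet_diff hw x [] q ht
  simp only [List.nil_append] at this
  simp only [Gb, bal_pair, bal_pair', this]
  split_ifs <;> simp

lemma Gb_flip (q : List Site) {t : ℂ} (ht : t ≠ 0) :
    Gb w x ((true, w * t) :: (false, t) :: q) =
      - w ^ 2 * Gb w x ((true, t) :: (false, w * t) :: q) + Gb w x ((false, t) :: (true, w * t) :: q) := by
  have := singlet_flip hw x [] q ht
  simp only [List.nil_append] at this
  simp only [Gb, bal_pair, bal_pair']
  split_ifs
  · exact this
  · simp

lemma Gb_front (β : List Site) {t : ℂ} (ht : t ≠ 0) (h : ∀ z ∈ β.map Prod.snd, z ^ 3 ≠ t ^ 3)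
    (hn : (β.map Prod.snd).Nodup) :
    Gb w x ((true, w * t) :: (false, t) :: β) = kap w x t (β.map Prod.snd) * Gb w x β := by
  have := front hw x β ht (fun z hz => h _ (List.mem_map_of_mem hz)) hn
  simp only [Gb, bal_pair]
  split_ifs
  · exact this
  · simp

lemma ovS_rec (η Y2 : List ℂ) {t : ℂ} (hg : Gen (t :: (η ++ Y2))) :
    ovS w x (w * t :: t :: η) Y2 =
      -w * kap w x t η * kap w x (w * t)⁻¹ ((η ++ Y2).map (·⁻¹)) * ovS w x η Y2 := by
  have hw0 := omega_ne_zero hw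
  have h3 := omega_cube hw
  obtain ⟨hg1, ht, hg2⟩ := gen_cons.1 hg
  simp only [ovS, sumS, ← sumS_add, ← sumS_mul_left]
  refine sumS_congr _ fun l1 h1 => ?_
  rw [← h1] at hg1 hg2 ⊢
  refine sumS_congr _ fun l2 h2 => ?_
  rw [← h2] at hg1 hg2 ⊢
  rw [Gb_same hw x true l1 ht, Gb_same hw x false l1 ht, Gb_diff hw x l1 ht,
    Gb_front hw x l1 ht (fun z hz => hg1 z (List.mem_append_left _ hz))
      (hg2.nodup.sublist (List.sublist_append_left _ _))]
  have hτ : (w * t)⁻¹ ≠ 0 := inv_ne_zero (mul_ne_zero hw0 ht)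
  have e1 := Gb_flip hw x (invS (l1 ++ l2)) hτ
  rw [Gb_front hw x _ hτ] at e1
  · have h4 : w * (w * t)⁻¹ = t⁻¹ := by field_simp
    rw [h4] at e1
    rw [invS_snd, List.map_append] at e1
    simp only [invS_cons, List.cons_append]
    linear_combination w * kap w x t (l1.map Prod.snd) * Gb w x l1 * Gb w x l2 * e1
      - kap w x t (l1.map Prod.snd) * Gb w x l1 * Gb w x l2 *
        Gb w x ((true, (w * t)⁻¹) :: (false, t⁻¹) :: invS (l1 ++ l2)) * h3
  · intro z hz
    rw [invS_snd, List.map_append] at hz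
    obtain ⟨z', hz', rfl⟩ := List.mem_map.1 hz
    intro h
    refine hg1 z' hz' ?_
    rw [inv_pow, inv_pow, inv_inj, mul_pow, h3, one_mul] at h
    exact h
  · rw [invS_snd, List.map_append]
    exact hg2.inv.nodup

end

end

section

section
variable {w : ℂ} (hw : w ^ 2 + w + 1 = 0) (x : ℂ)
include hw

lemma Gb_inv_up (q : List Site) {y : ℂ} (hy : Gen (y :: q.map Prod.snd))
    (hy' : Gen (y⁻¹ :: q.map Prod.snd)) :
    y ^ (2 * (q.length / 2)) * Gb w x ((false, y⁻¹) :: q) = Gb w x ((false, y) :: q) := by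
  have hy0 : y ≠ 0 := (gen_cons.1 hy).2.1
  have hb := bal_param [] q false y y⁻¹
  simp only [List.nil_append] at hb
  unfold Gb
  by_cases h : Bal ((false, y) :: q)
  · rw [if_pos h, if_pos (hb.1 h)]
    have := flip_up hw x q hy hy' h
    refine mul_left_cancel₀ (pow_ne_zero (1 - (q.length + 1) % 2) hy0) ?_
    rw [← this, ← mul_assoc, ← pow_add]
    congr 2
    omega
  · rw [if_neg h, if_neg fun h' => h (hb.2 h'), mul_zero]

lemma Gb_inv_down (q : List Site) {y : ℂ} (hy0 : y ≠ 0) (hn : (q.map Prod.snd).Nodup) :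
    y ^ (2 * (q.length / 2)) * (y * th w x y) * Gb w x ((true, y⁻¹) :: q)
      = ((x + w) - (x + w ^ 2) * y) * Gb w x ((true, y) :: q) := by
  have hb := bal_param [] q true y y⁻¹
  simp only [List.nil_append] at hb
  unfold Gb
  by_cases h : Bal ((true, y) :: q)
  · rw [if_pos h, if_pos (hb.1 h)]
    have := flip_down hw x q hy0 hn h
    refine mul_left_cancel₀ (pow_ne_zero (1 - (q.length + 1) % 2) hy0) ?_
    have e : q.length = (1 - (q.length + 1) % 2) + 2 * (q.length / 2) := by omega
    nth_rewrite 1 [e] at this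
    rw [pow_add] at this
    linear_combination this
  · rw [if_neg h, if_neg fun h' => h (hb.2 h'), mul_zero, mul_zero]

lemma ovS_flip_aux (Q Y2 : List ℂ) {y : ℂ} (h1 : Gen (y :: (Q ++ Y2))) (h2 : Gen (y⁻¹ :: (Q ++ Y2)))
    (ht1 : th w x y ≠ 0) (ht2 : (x + w) - (x + w ^ 2) * y ≠ 0) :
    y ^ (2 * (Q.length / 2)) * ovS w x (y⁻¹ :: Q) Y2
      = y ^ (2 * ((Q.length + Y2.length) / 2)) * ovS w x (y :: Q) Y2 := by
  have hy0 : y ≠ 0 := (gen_cons.1 h1).2.1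
  simp only [ovS, sumS, ← sumS_add, ← sumS_mul_left]
  refine sumS_congr _ fun l1 e1 => ?_
  have hl1 : l1.length = Q.length := by rw [← e1, List.length_map]
  refine sumS_congr _ fun l2 e2 => ?_
  have hl2 : l2.length = Y2.length := by rw [← e2, List.length_map]
  subst e1 e2
  have s1 : ∀ z : ℂ, (z :: l1.map Prod.snd).Sublist (z :: (l1.map Prod.snd ++ l2.map Prod.snd)) :=
    fun z => (List.sublist_append_left _ _).cons_cons _
  have hi : (invS (l1 ++ l2)).map Prod.snd = (l1.map Prod.snd ++ l2.map Prod.snd).map (·⁻¹) := by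
    rw [invS_snd, List.map_append]
  have hlen : (invS (l1 ++ l2)).length = l1.length + l2.length := by simp [invS]
  have g1 : Gen (y :: (invS (l1 ++ l2)).map Prod.snd) := by
    rw [hi]; simpa using h2.inv
  have g2 : Gen (y⁻¹ :: (invS (l1 ++ l2)).map Prod.snd) := by
    rw [hi]; exact h1.inv
  have u1 := Gb_inv_up hw x l1 (h1.sublist (s1 _)) (h2.sublist (s1 _))
  have u2 := Gb_inv_up hw x _ g1 g2
  have d1 := Gb_inv_down hw x l1 hy0 (h1.sublist (s1 _)).nodup.of_cons
  have d2 := Gb_inv_down hw x _ hy0 g1.nodup.of_cons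
  rw [hlen] at u2 d2
  simp only [invS_cons, List.cons_append, inv_inv, List.length_map]
  have d3 : y ^ (2 * (l1.length / 2)) * Gb w x ((true, y⁻¹) :: l1) * Gb w x ((true, y) :: invS (l1 ++ l2))
      = y ^ (2 * ((l1.length + l2.length) / 2)) * Gb w x ((true, y⁻¹) :: invS (l1 ++ l2))
        * Gb w x ((true, y) :: l1) := by
    refine mul_left_cancel₀ (mul_ne_zero (mul_ne_zero hy0 ht1) ht2) ?_
    linear_combination ((x + w) - (x + w ^ 2) * y) * Gb w x ((true, y) :: invS (l1 ++ l2)) * d1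
      - ((x + w) - (x + w ^ 2) * y) * Gb w x ((true, y) :: l1) * d2
  linear_combination Gb w x l2 * d3 + Gb w x l2 * Gb w x ((false, y) :: invS (l1 ++ l2)) * u1
    - Gb w x l2 * Gb w x ((false, y) :: l1) * u2

theorem ovS_flip (hx1 : x + w ≠ 0) (hx2 : x + w ^ 2 ≠ 0) (Q Y2 : List ℂ) (hg : Gen (Q ++ Y2))
    {y : ℂ} (hy : y ≠ 0) :
    y ^ (2 * (Q.length / 2)) * ovS w x (y⁻¹ :: Q) Y2
      = y ^ (2 * ((Q.length + Y2.length) / 2)) * ovS w x (y :: Q) Y2 := by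
  have hf := ovS_laur hw x [] Q Y2
  simp only [List.length_nil, zero_add, List.nil_append] at hf
  have hf' := hf.comp_inv
  set k := Q.length + Y2.length with hk
  have e1 : LaurLe (fun y => y ^ k * (y ^ (2 * (Q.length / 2)) * ovS w x (y⁻¹ :: Q) Y2)) _ :=
    ((LaurLe.of_polyLe (PolyLe.id.pow (2 * (Q.length / 2) + k - Q.length))).mul hf').congr (by
      intro y hy
      rw [inv_pow, pow_add _ k]
      have h : k + 2 * (Q.length / 2) = 2 * (Q.length / 2) + k - Q.length + Q.length := by omega
      rw [← mul_assoc, ← pow_add, h, pow_add]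
      field_simp)
  have e2 : LaurLe (fun y => y ^ k * (y ^ (2 * (k / 2)) * ovS w x (y :: Q) Y2)) _ :=
    ((LaurLe.of_polyLe (PolyLe.id.pow (2 * (k / 2)))).mul hf).congr (by
      intro y hy; ring)
  refine mul_left_cancel₀ (pow_ne_zero k hy) (e1.eq_of_finite e2
    ({y | y ≠ 0 ∧ ¬ Gen (y :: (Q ++ Y2))} ∪ (·⁻¹) '' {y | y ≠ 0 ∧ ¬ Gen (y :: (Q ++ Y2))} ∪
      {(x + w ^ 2) / (x + w), (x + w) / (x + w ^ 2)}) ?_ ?_ hy)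
  · exact ((finite_not_gen _ hg).union ((finite_not_gen _ hg).image _)).union (by simp)
  · intro y hy hS
    simp only [Set.mem_union, not_or, Set.mem_ofPred_eq, not_and, not_not, Set.mem_image,
      not_exists, Set.mem_insert_iff, Set.mem_singleton_iff] at hS
    obtain ⟨⟨h1, h2⟩, h3, h4⟩ := hS
    rw [ovS_flip_aux hw x Q Y2 (h1 hy)]
    · by_contra h
      exact h2 y⁻¹ ⟨inv_ne_zero hy, h⟩ (inv_inv y)
    · intro h
      refine h3 ?_
      unfold th at h
      field_simp
      linear_combination h
    · intro h
      refine h4 ?_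
      field_simp
      linear_combination -h

/-! ### Reversal -/

omit hw in
lemma bal_reverse (l : List Site) : Bal l.reverse ↔ Bal l := by
  simp only [Bal, List.countP_reverse, List.length_reverse]

lemma Gb_reverse (hx : x ≠ 0) (l : List Site) (hg : Gen (l.map Prod.snd)) :
    Gb w x l.reverse = (-x * w ^ (l.length % 2)) ^ (l.length / 2) * Gb (w ^ 2) x⁻¹ l := by
  unfold Gb
  by_cases h : Bal l
  · rw [if_pos h, if_pos ((bal_reverse l).2 h), G_reverse hw x hx l hg h]
  · rw [if_neg h, if_neg fun h' => h ((bal_reverse l).1 h'), mul_zero]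

omit hw in
lemma invS_reverse (l : List Site) : invS l.reverse = (invS l).reverse := by
  simp [invS]

theorem ovS_reverse (hx : x ≠ 0) (Y1 Y2 : List ℂ) (hg : Gen (Y1 ++ Y2)) :
    ovS w x Y2.reverse Y1.reverse = (-x * w ^ ((Y1.length + Y2.length) % 2)) ^ ((Y1.length + Y2.length) / 2)
      * (-x * w ^ (Y1.length % 2)) ^ (Y1.length / 2) * (-x * w ^ (Y2.length % 2)) ^ (Y2.length / 2)
      * ovS (w ^ 2) x⁻¹ Y1 Y2 := by
  unfold ovS
  rw [sumS_comm]
  simp only [sumS_reverse, ← sumS_mul_left]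
  refine sumS_congr _ fun l1 e1 => sumS_congr _ fun l2 e2 => ?_
  subst e1 e2
  have hg' : Gen ((invS (l1 ++ l2)).map Prod.snd) := by
    rw [invS_snd, List.map_append]; exact hg.inv
  rw [← List.reverse_append, invS_reverse, Gb_reverse hw x hx _ hg',
    Gb_reverse hw x hx l1 (hg.sublist (List.sublist_append_left _ _)),
    Gb_reverse hw x hx l2 (hg.sublist (List.sublist_append_right _ _))]
  have : (invS (l1 ++ l2)).length = l1.length + l2.length := by simp [invS]
  simp only [List.length_map, this]
  ring

end

end

section

/-! ### Alternants -/

def detOf (f : ℕ → ℂ → ℂ) (L : List ℂ) : ℂ :=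
  Matrix.det (Matrix.of fun i j : Fin L.length => f j (L.get i))

def skipIdx (j k : ℕ) : ℕ := if k < j then k else k + 1

lemma detOf_cons (f : ℕ → ℂ → ℂ) (a : ℂ) (L : List ℂ) :
    detOf f (a :: L) = ∑ j ∈ Finset.range (L.length + 1),
      (-1) ^ j * f j a * detOf (fun k => f (skipIdx j k)) L := by
  rw [Finset.sum_range (f := fun j => (-1) ^ j * f j a * detOf (fun k => f (skipIdx j k)) L)]
  refine (Matrix.det_succ_row_zero (n := L.length) _).trans (Finset.sum_congr rfl fun j _ => ?_)
  congr 2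
  ext i k
  simp only [Matrix.submatrix_apply, Matrix.of_apply, skipIdx]
  congr 1
  simp only [Fin.succAbove, Fin.lt_def, Fin.val_castSucc]
  split_ifs <;> simp

lemma detOf_congr {f g : ℕ → ℂ → ℂ} (L : List ℂ) (h : ∀ j < L.length, ∀ u ∈ L, f j u = g j u) :
    detOf f L = detOf g L := by
  unfold detOf
  congr 1
  ext i j
  exact h _ j.2 _ (List.get_mem _ _)

lemma detOf_perm {L L' : List ℂ} (h : L.Perm L') : ∃ e : ℂ, e ≠ 0 ∧ ∀ f, detOf f L' = e * detOf f L := by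
  induction h with
  | nil => exact ⟨1, one_ne_zero, fun f => by simp⟩
  | @cons a l l' h ih =>
    obtain ⟨e, he, ih⟩ := ih
    refine ⟨e, he, fun f => ?_⟩
    rw [detOf_cons, detOf_cons, Finset.mul_sum, h.length_eq]
    refine Finset.sum_congr rfl fun j _ => ?_
    rw [ih]; ring
  | swap a b l =>
    refine ⟨-1, by simp, fun f => ?_⟩
    have h01 : (0 : Fin (l.length + 1 + 1)) ≠ 1 := by simp
    have := Matrix.det_permute (Equiv.swap (0 : Fin (l.length + 1 + 1)) 1)
      (Matrix.of fun i j : Fin (l.length + 1 + 1) => f j ((b :: a :: l).get i))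
    rw [Equiv.Perm.sign_swap h01] at this
    simp only [Units.val_neg, Units.val_one, Int.cast_neg, Int.cast_one] at this
    unfold detOf
    refine Eq.trans ?_ this
    congr 1
    ext i j
    simp only [Matrix.submatrix_apply, Matrix.of_apply, id]
    congr 1
    refine Fin.cases ?_ (fun i => Fin.cases ?_ (fun i => ?_) i) i
    · simp
    · have : (Fin.succ 0 : Fin (l.length + 1 + 1)) = 1 := rfl
      rw [this]; simp
    · rw [Equiv.swap_apply_of_ne_of_ne (Fin.succ_ne_zero _)]
      · simp
      · intro h
        exact Fin.succ_ne_zero _ (Fin.succ_injective _ h)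
  | trans _ _ ih1 ih2 =>
    obtain ⟨e1, h1, ih1⟩ := ih1
    obtain ⟨e2, h2, ih2⟩ := ih2
    exact ⟨e2 * e1, mul_ne_zero h2 h1, fun f => by rw [ih2, ih1]; ring⟩

lemma detOf_triangular {f g : ℕ → ℂ → ℂ} (a : ℕ → ℕ → ℂ)
    (h : ∀ j u, g j u = f j u + ∑ k ∈ Finset.range j, a j k * f k u) (L : List ℂ) :
    detOf g L = detOf f L := by
  set U : Matrix (Fin L.length) (Fin L.length) ℂ :=
    Matrix.of fun k j => if k = j then 1 else if k < j then a j k else 0 with hU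
  have hdet : U.det = 1 := by
    rw [Matrix.det_of_isUpperTriangular]
    · simp [hU]
    · intro i j hij
      have hij' : j < i := hij
      simp [hU, hij'.ne', hij'.not_gt]
  unfold detOf
  rw [← mul_one (Matrix.det (Matrix.of fun i j : Fin L.length => f j (L.get i))), ← hdet,
    ← Matrix.det_mul]
  congr 1
  ext i j
  rw [Matrix.mul_apply]
  simp only [Matrix.of_apply, h, hU]
  have e1 : ∀ k : Fin L.length, f k (L.get i) * (if k = j then 1 else if k < j then a j k else 0)
      = (if k = j then f j (L.get i) else 0) + (if k.1 < j.1 then a j k * f k (L.get i) else 0) := by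
    intro k
    by_cases hk : k = j
    · subst hk; simp
    · simp only [hk, if_false, Fin.lt_def, zero_add]
      split_ifs <;> ring
  rw [Finset.sum_congr rfl fun k _ => e1 k, Finset.sum_add_distrib]
  congr 1
  · simp
  · rw [← Finset.sum_range (f := fun k => if k < j.1 then a j k * f k (L.get i) else 0),
      ← Finset.sum_filter]
    refine Finset.sum_congr ?_ fun _ _ => rfl
    ext k
    simp only [Finset.mem_range, Finset.mem_filter]
    have := j.2
    omega

lemma detOf_mul (f : ℕ → ℂ → ℂ) (v : ℂ → ℂ) (L : List ℂ) :
    detOf (fun j u => v u * f j u) L = (L.map v).prod * detOf f L := by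
  unfold detOf
  refine (Matrix.det_mul_column (fun i => v (L.get i)) _).trans ?_
  congr 1
  simp [← Fin.prod_univ_fun_getElem]

lemma detOf_cons_zero (f : ℕ → ℂ → ℂ) (a : ℂ) (L : List ℂ) (h : ∀ j, f (j + 1) a = 0) :
    detOf f (a :: L) = f 0 a * detOf (fun k => f (k + 1)) L := by
  rw [detOf_cons, Finset.sum_range_succ', Finset.sum_eq_zero fun j _ => by rw [h]; ring]
  simp [skipIdx]

def powF (j : ℕ) (u : ℂ) : ℂ := u ^ j

lemma detOf_pow_cons (a : ℂ) (L : List ℂ) :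
    detOf powF (a :: L) = (L.map (fun b => b - a)).prod * detOf powF L := by
  rw [← detOf_triangular (f := powF) (g := fun j u => if j = 0 then 1 else (u - a) * u ^ (j - 1))
      (fun j k => if k + 1 = j then -a else 0), detOf_cons_zero]
  · simp only [if_true, one_mul, Nat.add_eq_zero_iff, one_ne_zero, and_false, if_false,
      Nat.add_sub_cancel]
    exact detOf_mul powF _ L
  · intro j; simp
  · intro j u
    rcases j with _ | j
    · simp [powF]
    · rw [Finset.sum_range_succ, Finset.sum_eq_zero]
      · simp [powF]; ring
      · intro k hk
        rw [Finset.mem_range] at hk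
        rw [if_neg (by omega), zero_mul]

lemma detOf_pow_ne_zero {L : List ℂ} (h : L.Nodup) : detOf powF L ≠ 0 := by
  induction L with
  | nil => simp [detOf]
  | cons a L ih =>
    rw [List.nodup_cons] at h
    rw [detOf_pow_cons]
    refine mul_ne_zero (List.prod_ne_zero ?_) (ih h.2)
    intro h0
    obtain ⟨b, hb, h0⟩ := List.mem_map.1 h0
    exact h.1 (sub_eq_zero.1 h0 ▸ hb)

def cub (j : ℕ) (u : ℂ) : ℂ := u ^ (j % 2) * (u ^ 3 - 3 * u) ^ (j / 2)

def AA (L : List ℂ) : ℂ := detOf cub L / detOf powF L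

lemma AA_perm {L L' : List ℂ} (h : L.Perm L') : AA L = AA L' := by
  obtain ⟨e, he, h⟩ := detOf_perm h
  unfold AA
  rw [h, h, mul_div_mul_left _ _ he]

lemma AA_nil : AA [] = 1 := by simp [AA, detOf]

lemma AA_singleton (a : ℂ) : AA [a] = 1 := by
  simp [AA, detOf, cub, powF]

lemma AA_pair {a b : ℂ} (h : a ≠ b) : AA [a, b] = 1 := by
  have : detOf cub [a, b] = detOf powF [a, b] := by
    refine detOf_congr _ fun j hj u _ => ?_
    simp only [List.length_cons, List.length_nil] at hj
    interval_cases j <;> simp [cub, powF]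
  rw [AA, this, div_self (detOf_pow_ne_zero (by simp [h]))]

lemma detOf_cub_rec (w1 w2 v : ℂ) (h1 : w1 ^ 3 - 3 * w1 = v) (h2 : w2 ^ 3 - 3 * w2 = v) (L : List ℂ) :
    detOf cub (w1 :: w2 :: L) = (w2 - w1) * ((L.map fun u => u ^ 3 - 3 * u - v).prod * detOf cub L) := by
  set g : ℕ → ℂ → ℂ := fun j u => if j < 2 then u ^ j else (u ^ 3 - 3 * u - v) * cub (j - 2) u with hg
  rw [← detOf_triangular (f := cub) (g := g) (fun j k => if k + 2 = j then -v else 0)]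
  · have hR : detOf (fun k => g (k + 2)) L = (L.map fun u => u ^ 3 - 3 * u - v).prod * detOf cub L := by
      rw [← detOf_mul]
      exact detOf_congr _ fun j _ u _ => by simp [hg]
    have z1 : ∀ j, g (j + 2) w1 = 0 := fun j => by simp [hg, h1]
    have z2 : ∀ j, g (j + 2) w2 = 0 := fun j => by simp [hg, h2]
    have e0 : detOf (fun k => g (skipIdx 0 k)) (w2 :: L) = w2 * detOf (fun k => g (k + 2)) L := by
      rw [detOf_cons_zero]
      · simp [skipIdx, hg]
      · intro j; simpa [skipIdx] using z2 j
    have e1 : detOf (fun k => g (skipIdx 1 k)) (w2 :: L) = 1 * detOf (fun k => g (k + 2)) L := by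
      rw [detOf_cons_zero]
      · simp [skipIdx, hg]
      · intro j; simpa [skipIdx] using z2 j
    rw [detOf_cons, List.length_cons, Finset.sum_range_succ', Finset.sum_range_succ',
      Finset.sum_eq_zero fun j _ => by rw [show j + 1 + 1 = j + 2 from rfl, z1]; ring]
    rw [show (0 + 1 : ℕ) = 1 from rfl, e0, e1, hR]
    simp [hg]
    ring
  · intro j u
    rcases j with _ | _ | j
    · simp [hg, cub]
    · simp [hg, cub]
    · rw [Finset.sum_range_succ, Finset.sum_range_succ, Finset.sum_eq_zero]
      · simp only [hg, cub]
        have a1 : (j + 1 + 1) % 2 = j % 2 := by omega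
        have a2 : (j + 1 + 1) / 2 = j / 2 + 1 := by omega
        rw [a1, a2]
        simp
        ring
      · intro k hk
        rw [Finset.mem_range] at hk
        rw [if_neg (by omega), zero_mul]

lemma AA_rec {w1 w2 w0 : ℂ} (L : List ℂ) (hn : (w1 :: w2 :: L).Nodup)
    (h : ∀ u : ℂ, u ^ 3 - 3 * u - (w0 ^ 3 - 3 * w0) = (u - w1) * (u - w2) * (u - w0)) :
    AA (w1 :: w2 :: L) = (L.map fun u => u - w0).prod * AA L := by
  have h1 : w1 ^ 3 - 3 * w1 = w0 ^ 3 - 3 * w0 := by linear_combination h w1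
  have h2 : w2 ^ 3 - 3 * w2 = w0 ^ 3 - 3 * w0 := by linear_combination h w2
  have hL := detOf_pow_ne_zero hn.of_cons.of_cons
  have hN := detOf_pow_ne_zero hn
  unfold AA
  rw [mul_div_assoc', div_eq_div_iff hN hL, detOf_cub_rec _ _ _ h1 h2, detOf_pow_cons,
    detOf_pow_cons]
  have : (L.map fun u => u ^ 3 - 3 * u - (w0 ^ 3 - 3 * w0)).prod =
      (L.map fun u => u - w1).prod * (L.map fun u => u - w2).prod * (L.map fun u => u - w0).prod := by
    rw [← List.prod_map_mul, ← List.prod_map_mul]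
    congr 1
    exact List.map_congr_left fun u _ => h u
  rw [this]
  simp only [List.map_cons, List.prod_cons]
  ring

lemma cub_polyLe (j d : ℕ) (h : j % 2 + 3 * (j / 2) ≤ d) : PolyLe (cub j) d := by
  have h1 : PolyLe (fun u => u ^ 3 - 3 * u) 3 :=
    ((PolyLe.id.pow 3).sub ((PolyLe.id.const_mul 3).mono (by omega))).mono (by omega)
  exact ((PolyLe.id.pow (j % 2)).mul (h1.pow (j / 2))).mono (by omega)

lemma PolyLe.sum {ι : Type*} (s : Finset ι) (F : ι → ℂ → ℂ) (d : ℕ) (h : ∀ i ∈ s, PolyLe (F i) d) :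
    PolyLe (fun y => ∑ i ∈ s, F i y) d := by
  induction s using Finset.induction_on with
  | empty => simpa using (PolyLe.const 0).mono (Nat.zero_le d)
  | insert a s ha ih =>
    refine ((h a (by simp)).add (ih fun i hi => h i (by simp [hi]))).congr fun y => ?_
    rw [Finset.sum_insert ha]

lemma PolyLe.divide {L : List ℂ} (hn : L.Nodup) {f : ℂ → ℂ} {d : ℕ} (hf : PolyLe f (d + L.length))
    (hz : ∀ a ∈ L, f a = 0) : ∃ g, PolyLe g d ∧ ∀ y, f y = (L.map fun b => b - y).prod * g y := by
  induction L generalizing f d with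
  | nil => exact ⟨f, by simpa using hf, by simp⟩
  | cons a L ih =>
    rw [List.nodup_cons] at hn
    obtain ⟨g, hg, hfg⟩ := ih hn.2 (f := f) (d := d + 1)
      (by rw [List.length_cons] at hf; exact hf.mono (by omega)) (fun b hb => hz b (by simp [hb]))
    obtain ⟨Q, hQ, hgQ⟩ := hg
    have hroot : Q.IsRoot a := by
      have := hfg a
      rw [hz a (by simp), eq_comm, mul_eq_zero] at this
      rcases this with h | h
      · exfalso
        rw [List.prod_eq_zero_iff] at h
        obtain ⟨b, hb, h0⟩ := List.mem_map.1 h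
        exact hn.1 (sub_eq_zero.1 h0 ▸ hb)
      · rw [Polynomial.IsRoot, ← hgQ, h]
    obtain ⟨R, hR⟩ := Polynomial.dvd_iff_isRoot.2 hroot
    refine ⟨fun y => -R.eval y, ⟨-R, ?_, by simp⟩, fun y => ?_⟩
    · by_cases h0 : R = 0
      · simp [h0]
      · rw [hR, Polynomial.natDegree_mul (Polynomial.X_sub_C_ne_zero a) h0,
          Polynomial.natDegree_X_sub_C] at hQ
        rw [Polynomial.natDegree_neg]
        omega
    · rw [hfg, hgQ, hR]
      simp
      ring

lemma AA_poly {L : List ℂ} (hn : L.Nodup) :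
    ∃ g, PolyLe g (L.length / 2) ∧ ∀ a, a ∉ L → g a = AA (a :: L) := by
  have hp : PolyLe (fun a => detOf cub (a :: L)) (L.length / 2 + L.length) := by
    simp only [detOf_cons]
    refine PolyLe.sum _ _ _ fun j hj => ?_
    rw [Finset.mem_range] at hj
    exact ((cub_polyLe j _ (by omega)).const_mul _).mul_const _
  obtain ⟨g, hg, h⟩ := hp.divide hn (fun a ha => by
    refine Matrix.det_zero_of_row_eq (i := (0 : Fin (L.length + 1)))
      (j := Fin.succ ⟨L.idxOf a, List.idxOf_lt_length_iff.2 ha⟩) (Fin.succ_ne_zero _).symm ?_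
    funext k
    simp)
  refine ⟨fun a => g a * (detOf powF L)⁻¹, hg.mul_const _, fun a ha => ?_⟩
  have h1 := detOf_pow_ne_zero hn
  have h2 : (L.map fun b => b - a).prod ≠ 0 := by
    have := detOf_pow_ne_zero (List.nodup_cons.2 ⟨ha, hn⟩)
    rw [detOf_pow_cons] at this
    exact left_ne_zero_of_mul this
  rw [AA, detOf_pow_cons, h]
  field_simp

end

section

def Wf (y : ℂ) : ℂ := y + y⁻¹

def wb (x : ℂ) : ℂ := (4 * x - 1 - x ^ 2) / (x ^ 2 - x + 1)

def ex (N n : ℕ) : ℕ := (N - 1) / 2 - (n - 1) / 2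

def gph (n1 n2 : ℕ) : ℕ := (n1 % 2) * (n1 / 2 + 2 * (n2 / 2)) + (n2 % 2) * (2 * (n1 / 2) + n2 / 2)

def cc (w x : ℂ) (n1 n2 : ℕ) : ℂ := (-(x ^ 2 - x + 1)) ^ ((n1 + n2) / 2) * w ^ gph n1 n2

/-- The closed formula for the inhomogeneous overlap. -/
def OvF (w x : ℂ) (Y1 Y2 : List ℂ) : Prop :=
  (Y1.map fun y => y ^ ex (Y1.length + Y2.length) Y1.length).prod
      * (Y2.map fun y => y ^ ex (Y1.length + Y2.length) Y2.length).prod * ovS w x Y1 Y2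
    = cc w x Y1.length Y2.length * AA (Y1.map Wf) * AA (Y2.map Wf) * AA (wb x :: (Y1 ++ Y2).map Wf)

lemma prod_map_pow_succ (k : ℕ) (L : List ℂ) :
    (L.map fun y => y ^ (k + 1)).prod = (L.map fun y => y ^ k).prod * L.prod := by
  induction L with
  | nil => simp
  | cons a L ih =>
    simp only [List.map_cons, List.prod_cons, ih]
    ring

lemma Wf_inv (y : ℂ) : Wf y⁻¹ = Wf y := by simp [Wf, add_comm]

section
variable {w : ℂ} (hw : w ^ 2 + w + 1 = 0) (x : ℂ)
include hw

lemma pow_omega_mod (k : ℕ) : w ^ k = w ^ (k % 3) := by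
  conv_lhs => rw [← Nat.div_add_mod k 3]
  rw [pow_add, pow_mul, omega_cube hw, one_pow, one_mul]

lemma Wf_omega_cubic {t : ℂ} (ht : t ≠ 0) (u : ℂ) :
    u ^ 3 - 3 * u - (Wf (w ^ 2 * t) ^ 3 - 3 * Wf (w ^ 2 * t))
      = (u - Wf (w * t)) * (u - Wf t) * (u - Wf (w ^ 2 * t)) := by
  have h3 := omega_cube hw
  have hw0 := omega_ne_zero hw
  have i1 : (w ^ 2 * t)⁻¹ = w * t⁻¹ := by field_simp; linear_combination -h3
  have i2 : (w * t)⁻¹ = w ^ 2 * t⁻¹ := by field_simp; linear_combination -h3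
  unfold Wf
  rw [i1, i2]
  have e : t * t⁻¹ = 1 := mul_inv_cancel₀ ht
  generalize t⁻¹ = s at *
  have hw2 : w ^ 2 = -1 - w := by linear_combination hw
  grind

lemma prod_fU {t : ℂ} (ht : t ≠ 0) (η : List ℂ) (h : ∀ y ∈ η, y ≠ 0) :
    (η.map (fU w t)).prod
      = (w ^ 2 * t) ^ η.length * η.prod * (η.map fun y => Wf y - Wf (w ^ 2 * t)).prod := by
  induction η with
  | nil => simp
  | cons a η ih =>
    have ha : a ≠ 0 := h a (by simp)
    have hw0 := omega_ne_zero hw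
    simp only [List.map_cons, List.prod_cons, List.length_cons]
    rw [ih fun y hy => h y (by simp [hy])]
    have : fU w t a = w ^ 2 * t * a * (Wf a - Wf (w ^ 2 * t)) := by
      unfold fU Wf
      field_simp
      ring
    rw [this]
    ring

lemma prod_fU_inv {t : ℂ} (ht : t ≠ 0) (L : List ℂ) (h : ∀ y ∈ L, y ≠ 0) :
    ((L.map (·⁻¹)).map (fU w (w * t)⁻¹)).prod
      = (w * t⁻¹) ^ L.length * (L.prod)⁻¹ * (L.map fun y => Wf y - Wf (w ^ 2 * t)).prod := by
  induction L with
  | nil => simp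
  | cons a η ih =>
    have ha : a ≠ 0 := h a (by simp)
    have hw0 := omega_ne_zero hw
    have h3 := omega_cube hw
    simp only [List.map_cons, List.prod_cons, List.length_cons]
    rw [ih fun y hy => h y (by simp [hy])]
    have : fU w (w * t)⁻¹ a⁻¹ = w * t⁻¹ * a⁻¹ * (Wf a - Wf (w ^ 2 * t)) := by
      unfold fU Wf
      field_simp
      grind
    rw [this, mul_inv]
    ring

lemma th_mul_th {t : ℂ} (ht : t ≠ 0) (hX : x ^ 2 - x + 1 ≠ 0) :
    th w x (w * t) * th w x (w * (w * t)⁻¹)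
      = w ^ 2 * (x ^ 2 - x + 1) * (wb x - Wf (w ^ 2 * t)) := by
  have h3 := omega_cube hw
  have hw0 := omega_ne_zero hw
  have i1 : (w ^ 2 * t)⁻¹ = w * t⁻¹ := by field_simp; linear_combination -h3
  have i2 : w * (w * t)⁻¹ = t⁻¹ := by field_simp
  have e : wb x * (x ^ 2 - x + 1) = 4 * x - 1 - x ^ 2 := div_mul_cancel₀ _ hX
  have et : t * t⁻¹ = 1 := mul_inv_cancel₀ ht
  unfold Wf
  rw [i2, i1]
  unfold th
  have hw2 : w ^ 2 = -1 - w := by linear_combination hw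
  generalize wb x = b at *
  generalize t⁻¹ = s at *
  grind

lemma cc_rec {t : ℂ} (ht : t ≠ 0) (m n : ℕ) (hp : n = 0 ∨ (m + n) % 2 = 1) :
    (w * t) ^ ex (m + 2 + n) (m + 2) * t ^ ex (m + 2 + n) (m + 2) * (-w) * (w * t) ^ (m % 2)
      * (w ^ 2 * t) ^ m * (t⁻¹) ^ ((m + n) % 2) * (w * t⁻¹) ^ (m + n) * w ^ 2 * (x ^ 2 - x + 1)
      * cc w x m n = cc w x (m + 2) n := by
  have key : (t⁻¹) ^ ((m + n) % 2) * (t⁻¹) ^ (m + n)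
      * (t ^ ex (m + 2 + n) (m + 2) * t ^ ex (m + 2 + n) (m + 2) * t ^ (m % 2) * t ^ m) = 1 := by
    rw [← pow_add, ← pow_add, ← pow_add, ← pow_add, inv_pow, inv_mul_eq_one₀ (pow_ne_zero _ ht)]
    congr 1
    unfold ex
    omega
  have kw : w ^ ex (m + 2 + n) (m + 2) * w * w ^ (m % 2) * (w ^ 2) ^ m * w ^ (m + n) * w ^ 2
      * w ^ gph m n = w ^ gph (m + 2) n := by
    rw [← pow_mul, ← pow_succ, ← pow_add, ← pow_add, ← pow_add, ← pow_add, ← pow_add, pow_omega_mod hw,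
      pow_omega_mod hw (gph (m + 2) n)]
    congr 1
    unfold gph ex
    rcases Nat.mod_two_eq_zero_or_one m with h | h <;> rcases Nat.mod_two_eq_zero_or_one n with h' | h'
      <;> rw [show (m + 2) % 2 = m % 2 by omega, h, h'] <;> omega
  unfold cc
  rw [show (m + 2 + n) / 2 = (m + n) / 2 + 1 by omega, pow_succ, ← kw]
  simp only [mul_pow]
  linear_combination (-(x ^ 2 - x + 1) * (-(x ^ 2 - x + 1)) ^ ((m + n) / 2) * (w ^ ex (m + 2 + n) (m + 2) * w * w ^ (m % 2) * (w ^ 2) ^ m * w ^ (m + n) * w ^ 2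
      * w ^ gph m n)) * key

lemma OvF_rec {t : ℂ} (hX : x ^ 2 - x + 1 ≠ 0) {η Y2 : List ℂ} (hg : Gen (t :: (η ++ Y2)))
    (hn : (wb x :: Wf (w * t) :: Wf t :: (η ++ Y2).map Wf).Nodup)
    (hp : Y2.length = 0 ∨ (η.length + Y2.length) % 2 = 1)
    (h : OvF w x η Y2) : OvF w x (w * t :: t :: η) Y2 := by
  obtain ⟨-, ht, hg'⟩ := gen_cons.1 hg
  have hη0 : ∀ y ∈ η, y ≠ 0 := fun y hy => hg'.2 y (by simp [hy])
  have hY0 : ∀ y ∈ Y2, y ≠ 0 := fun y hy => hg'.2 y (by simp [hy])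
  unfold OvF at h ⊢
  have hrec := ovS_rec hw x η Y2 hg
  unfold kap at hrec
  rw [prod_fU hw ht η hη0, prod_fU_inv hw ht (η ++ Y2) hg'.2] at hrec
  rw [hrec]
  have hA1 : AA ((w * t :: t :: η).map Wf)
      = (η.map fun y => Wf y - Wf (w ^ 2 * t)).prod * AA (η.map Wf) := by
    simp only [List.map_cons]
    rw [AA_rec _ _ (Wf_omega_cubic hw ht), List.map_map]
    · rfl
    · refine hn.of_cons.sublist ?_
      rw [List.map_append]
      exact ((List.sublist_append_left _ _).cons_cons _).cons_cons _
  have hA3 : AA (wb x :: (w * t :: t :: η ++ Y2).map Wf)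
      = (wb x - Wf (w ^ 2 * t)) * ((η.map fun y => Wf y - Wf (w ^ 2 * t)).prod
        * (Y2.map fun y => Wf y - Wf (w ^ 2 * t)).prod) * AA (wb x :: (η ++ Y2).map Wf) := by
    have hpm : (wb x :: (w * t :: t :: η ++ Y2).map Wf).Perm
        (Wf (w * t) :: Wf t :: wb x :: (η ++ Y2).map Wf) := by
      simp only [List.cons_append, List.map_cons]
      exact (List.Perm.swap _ _ _).trans ((List.Perm.swap _ _ _).cons _)
    rw [AA_perm hpm, AA_rec _ _ (Wf_omega_cubic hw ht), List.map_cons, List.prod_cons, List.map_map,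
      ← List.prod_append, ← List.map_append]
    · rfl
    · exact hpm.nodup_iff.1 hn
  have e1 : (η.map fun y => y ^ ex (η.length + 2 + Y2.length) (η.length + 2)).prod
      = (η.map fun y => y ^ ex (η.length + Y2.length) η.length).prod := by
    rcases η with - | ⟨a, η⟩
    · simp
    · congr 2
      funext y
      congr 1
      simp only [ex, List.length_cons]
      omega
  have e2 : (Y2.map fun y => y ^ ex (η.length + 2 + Y2.length) Y2.length).prod
      = (Y2.map fun y => y ^ ex (η.length + Y2.length) Y2.length).prod * Y2.prod := by
    rcases Y2 with - | ⟨a, Y2⟩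
    · simp
    · rw [← prod_map_pow_succ]
      congr 2
      funext y
      congr 1
      simp only [ex, List.length_cons]
      omega
  rw [hA1, hA3]
  simp only [List.map_cons, List.prod_cons, List.length_cons, List.length_map, List.length_append,
    List.prod_append, List.map_append] at h ⊢
  rw [show η.length + 1 + 1 = η.length + 2 by rfl, e1, e2, ← cc_rec hw x ht η.length Y2.length hp]
  have hth := th_mul_th hw x ht hX
  have i2 : w * (w * t)⁻¹ = t⁻¹ := by
    have hw0 := omega_ne_zero hw
    field_simp
  have hP : η.prod ≠ 0 := List.prod_ne_zero fun h => hη0 _ h rfl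
  have hQ : Y2.prod ≠ 0 := List.prod_ne_zero fun h => hY0 _ h rfl
  rw [i2] at hth ⊢
  generalize (η.map fun y => y ^ ex (η.length + Y2.length) η.length).prod = E at *
  generalize (Y2.map fun y => y ^ ex (η.length + Y2.length) Y2.length).prod = Q at *
  generalize (η.map fun y => Wf y - Wf (w ^ 2 * t)).prod = R1 at *
  generalize (Y2.map fun y => Wf y - Wf (w ^ 2 * t)).prod = R2 at *
  generalize η.prod = P at *
  generalize Y2.prod = Q1 at *
  generalize ovS w x η Y2 = o at *
  generalize AA (η.map Wf) = A1 at *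
  generalize AA (Y2.map Wf) = A2 at *
  generalize AA (wb x :: (η.map Wf ++ Y2.map Wf)) = A3 at *
  generalize th w x (w * t) = t1 at *
  generalize th w x t⁻¹ = t2 at *
  generalize (w * t) ^ ex (η.length + 2 + Y2.length) (η.length + 2) = k1 at *
  generalize t ^ ex (η.length + 2 + Y2.length) (η.length + 2) = k2 at *
  generalize (w * t) ^ (η.length % 2) = k3 at *
  generalize (w ^ 2 * t) ^ η.length = k4 at *
  generalize t⁻¹ ^ ((η.length + Y2.length) % 2) = k5 at *
  generalize (w * t⁻¹) ^ (η.length + Y2.length) = k6 at *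
  generalize cc w x η.length Y2.length = c at *
  generalize wb x - Wf (w ^ 2 * t) = W0 at *
  have hinv : P * Q1 * (P * Q1)⁻¹ = 1 := mul_inv_cancel₀ (mul_ne_zero hP hQ)
  generalize (P * Q1)⁻¹ = i at *
  linear_combination (k1 * k2 * (-w) * k3 * k4 * k5 * k6 * R1 ^ 2 * R2 * E * Q * o * t1 * t2) * hinv
    + (k1 * k2 * (-w) * k3 * k4 * k5 * k6 * R1 ^ 2 * R2 * E * Q * o) * hth
    + (k1 * k2 * (-w) * k3 * k4 * k5 * k6 * R1 ^ 2 * R2 * (w ^ 2 * (x ^ 2 - x + 1) * W0)) * h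

end

end

section

/-- Distinct real parameters larger than one. -/
def Good (L : List ℂ) : Prop := L.Nodup ∧ ∀ y ∈ L, ∃ q : ℝ, 1 < q ∧ y = q

lemma Good.perm {Y Y' : List ℂ} (h : Good Y) (hp : Y.Perm Y') : Good Y' :=
  ⟨hp.nodup_iff.1 h.1, fun y hy => h.2 y (hp.symm.subset hy)⟩

lemma Good.sublist {Y Y' : List ℂ} (h : Good Y) (hs : Y'.Sublist Y) : Good Y' :=
  ⟨h.1.sublist hs, fun y hy => h.2 y (hs.subset hy)⟩

lemma Good.ne_zero {Y : List ℂ} (h : Good Y) : ∀ y ∈ Y, y ≠ 0 := by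
  intro y hy
  obtain ⟨q, hq, rfl⟩ := h.2 y hy
  exact_mod_cast (by linarith : q ≠ 0)

lemma Good.gen {Y : List ℂ} (h : Good Y) : Gen Y := by
  refine ⟨?_, h.ne_zero⟩
  rw [List.nodup_map_iff_inj_on h.1]
  intro a ha b hb hab
  obtain ⟨p, hp, rfl⟩ := h.2 a ha
  obtain ⟨q, hq, rfl⟩ := h.2 b hb
  norm_cast at hab ⊢
  exact (pow_left_inj₀ (by linarith) (by linarith) (by norm_num)).1 hab

lemma Wf_real (q : ℝ) : Wf (q : ℂ) = ((q + q⁻¹ : ℝ) : ℂ) := by simp [Wf]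

lemma wb_real (x : ℝ) : wb (x : ℂ) = (((4 * x - 1 - x ^ 2) / (x ^ 2 - x + 1) : ℝ) : ℂ) := by
  simp [wb]

lemma wb_le (x : ℝ) : (4 * x - 1 - x ^ 2) / (x ^ 2 - x + 1) ≤ 2 := by
  rw [div_le_iff₀ (by nlinarith [sq_nonneg (2 * x - 1)])]
  nlinarith [sq_nonneg (x - 1)]

lemma two_lt_add_inv {q : ℝ} (hq : 1 < q) : 2 < q + q⁻¹ := by
  have h0 : 0 < q := by linarith
  have : q * q⁻¹ = 1 := mul_inv_cancel₀ h0.ne'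
  have h1 : 0 < (q - 1) ^ 2 * q⁻¹ := by
    have : 0 < q - 1 := by linarith
    positivity
  nlinarith

lemma Good.W_nodup {Y : List ℂ} (h : Good Y) (x : ℝ) : (wb (x : ℂ) :: Y.map Wf).Nodup := by
  rw [List.nodup_cons]
  constructor
  · rw [List.mem_map]
    rintro ⟨y, hy, e⟩
    obtain ⟨q, hq, rfl⟩ := h.2 y hy
    rw [Wf_real, wb_real] at e
    norm_cast at e
    have := two_lt_add_inv hq
    have := wb_le x
    linarith
  · rw [List.nodup_map_iff_inj_on h.1]
    intro a ha b hb hab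
    obtain ⟨p, hp, rfl⟩ := h.2 a ha
    obtain ⟨q, hq, rfl⟩ := h.2 b hb
    rw [Wf_real, Wf_real] at hab
    norm_cast at hab ⊢
    have hp0 : p ≠ 0 := by linarith
    have hq0 : q ≠ 0 := by linarith
    field_simp at hab
    have : (p - q) * (p * q - 1) = 0 := by linear_combination hab
    rcases mul_eq_zero.1 this with h | h
    · linarith
    · nlinarith

lemma LaurLe.comp_Wf {g : ℂ → ℂ} {d : ℕ} (hg : PolyLe g d) :
    LaurLe (fun y => y ^ d * g (Wf y)) (2 * d) := by
  obtain ⟨Q, hQ, hg⟩ := hg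
  refine (LaurLe.of_polyLe (f := fun y => ∑ i ∈ Finset.range (d + 1),
    Q.coeff i * (y ^ (d - i) * (y ^ 2 + 1) ^ i)) ?_).congr fun y hy => ?_
  · refine PolyLe.sum _ _ _ fun i hi => ?_
    rw [Finset.mem_range] at hi
    refine PolyLe.const_mul _ (((PolyLe.id.pow (d - i)).mul
      (((PolyLe.id.pow 2).add ((PolyLe.const 1).mono (Nat.zero_le _))).pow i)).mono ?_)
    omega
  · rw [hg, Polynomial.eval_eq_sum_range' (Nat.lt_succ_of_le hQ), Finset.mul_sum]
    refine Finset.sum_congr rfl fun i hi => ?_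
    have hi : i ≤ d := by
      rw [Finset.mem_range] at hi
      omega
    have : y ^ 2 + 1 = y * Wf y := by
      unfold Wf
      field_simp
    rw [this, mul_pow]
    conv_lhs => rw [← Nat.sub_add_cancel hi, pow_add]
    ring

lemma X_ne_zero (x : ℝ) : (x : ℂ) ^ 2 - x + 1 ≠ 0 := by
  have : x ^ 2 - x + 1 ≠ 0 := by nlinarith [sq_nonneg (2 * x - 1)]
  exact_mod_cast this

section
variable {w : ℂ} (hw : w ^ 2 + w + 1 = 0)
include hw

lemma omega_sq_inv : w⁻¹ = w ^ 2 := by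
  have := omega_cube hw
  have := omega_ne_zero hw
  field_simp
  simp_all

lemma omega_im_ne : w.im ≠ 0 := by
  intro h
  have h1 := congrArg Complex.re hw
  simp [pow_two, h] at h1
  nlinarith [sq_nonneg (2 * w.re + 1)]

lemma omega_sq_im : (w ^ 2).im = -w.im := by
  have : w ^ 2 = -w - 1 := by linear_combination hw
  rw [this]
  simp

lemma omega_norm : ‖w‖ = 1 := by
  have := congrArg norm (omega_cube hw)
  rw [norm_pow, norm_one] at this
  exact (pow_eq_one_iff_of_nonneg (norm_nonneg _) (by norm_num)).1 this

lemma Wf_omega_im (q : ℝ) : (Wf (w * q)).im = w.im * (q - q⁻¹) := by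
  unfold Wf
  rw [mul_inv, omega_sq_inv hw, ← Complex.ofReal_inv, Complex.add_im, Complex.im_mul_ofReal,
    Complex.im_mul_ofReal, omega_sq_im hw]
  ring

lemma Wf_omega_im_ne {q : ℝ} (hq : 1 < q) : (Wf (w * q)).im ≠ 0 := by
  rw [Wf_omega_im hw]
  refine mul_ne_zero (omega_im_ne hw) ?_
  have : q⁻¹ < 1 := inv_lt_one_of_one_lt₀ hq
  linarith

lemma x_add_omega_ne (x : ℝ) : (x : ℂ) + w ≠ 0 := by
  intro h
  have := congrArg Complex.im h
  simp at this
  exact omega_im_ne hw this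

lemma OvF_perm (x : ℂ) {Y Y' : List ℂ} (h : Y.Perm Y') (h0 : ∀ y ∈ Y, y ≠ 0) {Y2 : List ℂ}
    (hf : OvF w x Y Y2) : OvF w x Y' Y2 := by
  unfold OvF at hf ⊢
  rw [← ovS_perm hw x h h0, ← h.length_eq, ← (h.map _).prod_eq, ← AA_perm (h.map Wf),
    ← AA_perm (((h.append_right Y2).map Wf).cons (wb x))]
  exact hf

lemma OvF_flip (x : ℂ) (hx1 : x + w ≠ 0) (hx2 : x + w ^ 2 ≠ 0) {Q Y2 : List ℂ} (hg : Gen (Q ++ Y2))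
    {y : ℂ} (hy : y ≠ 0) (hf : OvF w x (y :: Q) Y2) : OvF w x (y⁻¹ :: Q) Y2 := by
  have hfl := ovS_flip hw x hx1 hx2 Q Y2 hg hy
  unfold OvF at hf ⊢
  simp only [List.map_cons, List.prod_cons, List.length_cons, Wf_inv, List.cons_append] at hf ⊢
  rw [← hf]
  have : ovS w x (y⁻¹ :: Q) Y2 = y ^ (2 * ex (Q.length + 1 + Y2.length) (Q.length + 1)) * ovS w x (y :: Q) Y2 := by
    refine mul_left_cancel₀ (pow_ne_zero (2 * (Q.length / 2)) hy) ?_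
    rw [hfl, ← mul_assoc, ← pow_add]
    congr 2
    unfold ex
    omega
  rw [this, inv_pow, two_mul, pow_add]
  have := pow_ne_zero (ex (Q.length + 1 + Y2.length) (Q.length + 1)) hy
  field_simp

lemma OvF_omega (x : ℝ) {q : ℝ} {η Y2 : List ℂ} (hG : Good (q :: (η ++ Y2)))
    (hp : Y2.length = 0 ∨ (η.length + Y2.length) % 2 = 1) (h : OvF w x η Y2) :
    OvF w x (w * q :: q :: η) Y2 ∧ OvF w x (w ^ 2 * q :: q :: η) Y2 := by
  have hq : 1 < q := by
    obtain ⟨q', h1, h2⟩ := hG.2 q (by simp)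
    norm_cast at h2
    rwa [h2]
  have h3 := omega_cube hw
  have him := Wf_omega_im_ne hw hq
  have himq := Wf_omega_im_ne (omega_sq hw) hq
  have hN := hG.W_nodup x
  simp only [List.map_cons] at hN
  have hre : ∀ z ∈ wb (x : ℂ) :: Wf q :: (η ++ Y2).map Wf, z.im = 0 := by
    intro z hz
    rw [← List.map_cons (f := Wf), List.mem_cons, List.mem_map] at hz
    rcases hz with rfl | ⟨y, hy, rfl⟩
    · rw [wb_real, Complex.ofReal_im]
    · obtain ⟨p, _, rfl⟩ := hG.2 y hy
      rw [Wf_real, Complex.ofReal_im]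
  have hnd : ∀ z : ℂ, z.im ≠ 0 → (wb (x : ℂ) :: z :: Wf q :: (η ++ Y2).map Wf).Nodup := by
    intro z hz
    refine (List.Perm.swap _ _ _).nodup_iff.1 (List.nodup_cons.2 ⟨fun hm => hz (hre z hm), hN⟩)
  constructor
  · exact OvF_rec hw x (X_ne_zero x) hG.gen (hnd _ him) hp h
  · have hg : Gen (w ^ 2 * q :: (η ++ Y2)) := by
      have := gen_cons.1 hG.gen
      refine gen_cons.2 ⟨fun z hz => ?_, mul_ne_zero (pow_ne_zero _ (omega_ne_zero hw)) this.2.1, this.2.2⟩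
      have e : (w ^ 2 * (q : ℂ)) ^ 3 = (q : ℂ) ^ 3 := by
        linear_combination (q : ℂ) ^ 3 * (w ^ 3 + 1) * h3
      rw [e]
      exact this.1 z hz
    have e : w * (w ^ 2 * (q : ℂ)) = q := by linear_combination (q : ℂ) * h3
    have := OvF_rec hw x (X_ne_zero x) (t := w ^ 2 * q) hg
      (by rw [e]; exact ((List.Perm.swap _ _ _).cons _).nodup_iff.1 (hnd _ himq)) hp h
    rw [e] at this
    refine OvF_perm hw x (List.Perm.swap _ _ _) ?_ this
    intro y hy
    have := gen_cons.1 hG.gen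
    simp only [List.mem_cons] at hy
    rcases hy with rfl | rfl | hy
    · exact this.2.1
    · exact (gen_cons.1 hg).2.1
    · exact this.2.2.2 y (by simp [hy])

end

end

section

lemma List.nodup_interp {w : ℂ} (hw : w ^ 2 + w + 1 = 0) {Q : List ℂ} (hQ : Good Q) :
    (Q.map (w * ·) ++ Q.map (w ^ 2 * ·) ++ (Q.map (w * ·) ++ Q.map (w ^ 2 * ·)).map (·⁻¹)).Nodup := by
  have hw0 := omega_ne_zero hw
  have hn : ∀ z ∈ Q.map (w * ·) ++ Q.map (w ^ 2 * ·), 1 < ‖z‖ := by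
    intro z hz
    rw [List.mem_append, List.mem_map, List.mem_map] at hz
    rcases hz with ⟨y, hy, rfl⟩ | ⟨y, hy, rfl⟩ <;> obtain ⟨q, hq, rfl⟩ := hQ.2 y hy
    · rw [norm_mul, omega_norm hw, one_mul, Complex.norm_real, Real.norm_of_nonneg (by linarith)]
      exact hq
    · rw [norm_mul, omega_norm (omega_sq hw), one_mul, Complex.norm_real,
        Real.norm_of_nonneg (by linarith)]
      exact hq
  have hB : (Q.map (w * ·) ++ Q.map (w ^ 2 * ·)).Nodup := by
    refine List.nodup_append.2 ⟨hQ.1.map (mul_right_injective₀ hw0),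
      hQ.1.map (mul_right_injective₀ (pow_ne_zero _ hw0)), ?_⟩
    rintro a ha b hb rfl
    rw [List.mem_map] at ha hb
    obtain ⟨y, hy, rfl⟩ := ha
    obtain ⟨y', hy', e⟩ := hb
    obtain ⟨q, hq, rfl⟩ := hQ.2 y hy
    obtain ⟨q', hq', rfl⟩ := hQ.2 y' hy'
    have e2 : w * (q' : ℂ) = q := mul_left_cancel₀ hw0 (by linear_combination e)
    have := congrArg Complex.im e2
    rw [Complex.im_mul_ofReal, Complex.ofReal_im] at this
    rcases mul_eq_zero.1 this with h | h
    · exact omega_im_ne hw h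
    · linarith
  refine List.nodup_append.2 ⟨hB, hB.map inv_injective, ?_⟩
  rintro a ha b hb rfl
  rw [List.mem_map] at hb
  obtain ⟨y, hy, e⟩ := hb
  have h1 := hn _ ha
  have h2 := hn _ hy
  rw [← e, norm_inv] at h1
  have := inv_lt_one_of_one_lt₀ h2
  linarith

section
variable {w : ℂ} (hw : w ^ 2 + w + 1 = 0) (x : ℝ)
include hw

omit hw in
lemma OvF_iff {Q Y2 : List ℂ} {k g : ℂ → ℂ} {A E c : ℂ}
    (hE : E = (Q.map fun y => y ^ ex (Q.length + 1 + Y2.length) (Q.length + 1)).prod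
      * (Y2.map fun y => y ^ ex (Q.length + 1 + Y2.length) Y2.length).prod)
    (hc : c = cc w x (Q.length + 1) Y2.length) (hA : A = AA (Y2.map Wf))
    {y : ℂ} (hy : y ≠ 0) (hk : k (Wf y) = AA (Wf y :: Q.map Wf))
    (hg : g (Wf y) = AA (Wf y :: wb x :: (Q ++ Y2).map Wf))  :
    OvF w x (y :: Q) Y2 ↔ E * (y ^ (Q.length + Y2.length) * ovS w x (y :: Q) Y2)
      = c * A * ((y ^ (Q.length / 2) * k (Wf y)) * (y ^ ((Q.length + Y2.length + 1) / 2) * g (Wf y))) := by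
  unfold OvF
  simp only [List.map_cons, List.prod_cons, List.length_cons, List.cons_append]
  rw [← hc, ← hA, AA_perm (List.Perm.swap (Wf y) (wb x) _), hk, hg]
  have h1 : y ^ (Q.length + Y2.length) = y ^ ((Q.length / 2) + ((Q.length + Y2.length + 1) / 2))
      * y ^ ex (Q.length + 1 + Y2.length) (Q.length + 1) := by
    rw [← pow_add]
    congr 1
    unfold ex
    omega
  rw [h1, pow_add]
  have h2 := pow_ne_zero (Q.length / 2) hy
  have h3 := pow_ne_zero ((Q.length + Y2.length + 1) / 2) hy
  generalize AA (Wf y :: Q.map Wf) = a1 at *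
  generalize AA (Wf y :: wb x :: (Q ++ Y2).map Wf) = a2 at *
  constructor
  · intro h
    rw [hE]
    linear_combination (y ^ (Q.length / 2) * y ^ ((Q.length + Y2.length + 1) / 2)) * h
  · intro h
    refine mul_left_cancel₀ (mul_ne_zero h2 h3) ?_
    rw [hE] at h
    linear_combination h

lemma OvF_step {y : ℂ} {Q Y2 : List ℂ} (hG : Good (y :: (Q ++ Y2))) (hQ : Q ≠ [])
    (hlen : Y2.length ≤ Q.length) (hp : Y2.length = 0 ∨ (Q.length + Y2.length) % 2 = 0)
    (ih : ∀ η q, Q.Perm (q :: η) → OvF w x η Y2) : OvF w x (y :: Q) Y2 := by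
  have hGQ : Good (Q ++ Y2) := hG.sublist (List.sublist_cons_self _ _)
  have hQ0 : 0 < Q.length := List.length_pos_iff.2 hQ
  have hGQ1 : Good Q := hGQ.sublist (List.sublist_append_left _ _)
  obtain ⟨k, hk, hk'⟩ := AA_poly (hGQ1.W_nodup x).of_cons
  obtain ⟨g, hg, hg'⟩ := AA_poly (hGQ.W_nodup x)
  have hP := ovS_laur hw x [] Q Y2
  simp only [List.length_nil, zero_add, List.nil_append] at hP
  set E := (Q.map fun y => y ^ ex (Q.length + 1 + Y2.length) (Q.length + 1)).prod
      * (Y2.map fun y => y ^ ex (Q.length + 1 + Y2.length) Y2.length).prod with hE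
  set A := AA (Y2.map Wf) with hA
  set c := cc w x (Q.length + 1) Y2.length with hc
  have hiff : ∀ z : ℂ, z ≠ 0 → Wf z ∉ wb x :: (Q ++ Y2).map Wf → (OvF w x (z :: Q) Y2 ↔ _) :=
    fun z hz hm => OvF_iff x hE hc hA hz (hk' _ fun h => hm (by
      rw [List.map_append]; exact List.mem_cons_of_mem _ (List.mem_append_left _ h))) (hg' _ hm)
  have hR := (LaurLe.comp_Wf hk).mul (LaurLe.comp_Wf hg)
  obtain ⟨d, hd, hd'⟩ := ((hP.const_mul E).mono (e := Q.length + Y2.length + Q.length) le_rfl).add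
    ((hR.const_mul (-(c * A))).mono (e := Q.length + Y2.length + Q.length) (by
      simp only [List.length_map, List.length_append, List.length_cons]
      omega))
  have hzero : ∀ z, z ≠ 0 → Wf z ∉ wb x :: (Q ++ Y2).map Wf → (OvF w x (z :: Q) Y2 ↔ d z = 0) := by
    intro z hz hm
    rw [hiff z hz hm, hd' z hz]
    simp only [List.length_map, List.length_append, List.length_cons]
    exact ⟨fun h => by linear_combination h, fun h => by linear_combination h⟩
  have him : ∀ z : ℂ, z.im ≠ 0 → z ∉ wb x :: (Q ++ Y2).map Wf := by
    intro z hz hm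
    rw [List.mem_cons, List.mem_map] at hm
    rcases hm with rfl | ⟨y, hy, rfl⟩
    · rw [wb_real, Complex.ofReal_im] at hz
      exact hz rfl
    · obtain ⟨p, _, rfl⟩ := hGQ.2 y hy
      rw [Wf_real, Complex.ofReal_im] at hz
      exact hz rfl
  have hw0 := omega_ne_zero hw
  have hbase : ∀ z ∈ Q.map (w * ·) ++ Q.map (w ^ 2 * ·),
      z ≠ 0 ∧ (Wf z).im ≠ 0 ∧ OvF w x (z :: Q) Y2 := by
    intro z hz
    have hex : ∃ q ∈ Q, z = w * q ∨ z = w ^ 2 * q := by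
      rw [List.mem_append, List.mem_map, List.mem_map] at hz
      rcases hz with ⟨q, hq, rfl⟩ | ⟨q, hq, rfl⟩
      · exact ⟨q, hq, Or.inl rfl⟩
      · exact ⟨q, hq, Or.inr rfl⟩
    obtain ⟨y, hyQ, hz⟩ := hex
    have hy0 := hGQ1.ne_zero y hyQ
    obtain ⟨q, hq, rfl⟩ := hGQ1.2 y hyQ
    have hz0 : z ≠ 0 := by
      rcases hz with rfl | rfl
      · exact mul_ne_zero hw0 hy0
      · exact mul_ne_zero (pow_ne_zero _ hw0) hy0
    have hpm := List.perm_cons_erase hyQ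
    have hl := hpm.length_eq
    rw [List.length_cons] at hl
    have hpm2 : (Q ++ Y2).Perm (q :: (Q.erase q ++ Y2)) := hpm.append_right Y2
    obtain ⟨h1, h2⟩ := OvF_omega hw x (hGQ.perm hpm2) (by omega) (ih _ _ hpm)
    have hpz : ∀ z : ℂ, z ≠ 0 → ∀ u ∈ z :: (q : ℂ) :: Q.erase q, u ≠ 0 := by
      intro z hz u hu
      rcases List.mem_cons.1 hu with rfl | hu
      · exact hz
      · exact hGQ1.ne_zero u (hpm.symm.subset hu)
    refine ⟨hz0, ?_, ?_⟩
    · rcases hz with rfl | rfl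
      · exact Wf_omega_im_ne hw hq
      · exact Wf_omega_im_ne (omega_sq hw) hq
    · refine OvF_perm hw x (hpm.symm.cons z) (hpz z hz0) ?_
      rcases hz with rfl | rfl
      · exact h1
      · exact h2
  have hx2 : (x : ℂ) + w ^ 2 ≠ 0 := x_add_omega_ne (omega_sq hw) x
  have hd0 : ∀ z, d z = 0 := by
    refine hd.eq_zero _ (List.nodup_interp hw hGQ1) ?_ ?_
    · simp only [List.length_append, List.length_map]
      omega
    · intro z hz
      rcases List.mem_append.1 hz with hz | hz
      · obtain ⟨h0, h1, h2⟩ := hbase z hz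
        exact (hzero z h0 (him _ h1)).1 h2
      · rw [List.mem_map] at hz
        obtain ⟨u, hu, rfl⟩ := hz
        obtain ⟨h0, h1, h2⟩ := hbase u hu
        refine (hzero u⁻¹ (inv_ne_zero h0) (by rw [Wf_inv]; exact him _ h1)).1 ?_
        exact OvF_flip hw x (x_add_omega_ne hw x) hx2 hGQ.gen h0 h2
  have hy : y ≠ 0 := hG.ne_zero y (by simp)
  refine (hzero y hy ?_).2 (hd0 y)
  have := ((List.Perm.swap _ _ _).nodup_iff.1 (hG.W_nodup x))
  exact (List.nodup_cons.1 this).1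

omit hw in
lemma cc_swap (hw : w ^ 2 + w + 1 = 0) (hx : x ≠ 0) (n1 n2 : ℕ)
    (hp : n1 = 0 ∨ n2 = 0 ∨ (n1 + n2) % 2 = 1) :
    (-(x : ℂ) * w ^ ((n2 + n1) % 2)) ^ ((n2 + n1) / 2) * (-(x : ℂ) * w ^ (n2 % 2)) ^ (n2 / 2)
      * (-(x : ℂ) * w ^ (n1 % 2)) ^ (n1 / 2) * cc (w ^ 2) (x : ℂ)⁻¹ n2 n1 = cc w x n1 n2 := by
  have hx' : (x : ℂ) ≠ 0 := by exact_mod_cast hx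
  unfold cc
  have h1 : n2 / 2 + n1 / 2 = (n1 + n2) / 2 := by omega
  have hX : -((x : ℂ)⁻¹ ^ 2 - (x : ℂ)⁻¹ + 1) = -((x : ℂ) ^ 2 - x + 1) * ((-x : ℂ)⁻¹ * (-x : ℂ)⁻¹) := by
    field_simp
    ring
  have kw : (w ^ ((n2 + n1) % 2)) ^ ((n2 + n1) / 2) * (w ^ (n2 % 2)) ^ (n2 / 2) * (w ^ (n1 % 2)) ^ (n1 / 2)
      * (w ^ 2) ^ gph n2 n1 = w ^ gph n1 n2 := by
    rw [← pow_mul, ← pow_mul, ← pow_mul, ← pow_mul, ← pow_add, ← pow_add, ← pow_add, pow_omega_mod hw,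
      pow_omega_mod hw (gph n1 n2)]
    congr 1
    unfold gph
    rcases Nat.mod_two_eq_zero_or_one n1 with h | h <;> rcases Nat.mod_two_eq_zero_or_one n2 with h' | h'
    · rw [show (n2 + n1) % 2 = 0 by omega, h, h']; omega
    · rw [show (n2 + n1) % 2 = 1 by omega, h, h']; omega
    · rw [show (n2 + n1) % 2 = 1 by omega, h, h']; omega
    · omega
  rw [← kw, hX, mul_pow, mul_pow, mul_pow, mul_pow, mul_pow, add_comm n2 n1]
  have hm : (-x : ℂ) ^ (n2 / 2) * (-x : ℂ) ^ (n1 / 2) = (-x : ℂ) ^ ((n1 + n2) / 2) := by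
    rw [← pow_add, h1]
  have hi : (-x : ℂ) ^ ((n1 + n2) / 2) * (-x : ℂ)⁻¹ ^ ((n1 + n2) / 2) = 1 := by
    rw [← mul_pow, mul_inv_cancel₀ (neg_ne_zero.2 hx'), one_pow]
  generalize (-x : ℂ) ^ ((n1 + n2) / 2) = a at *
  generalize (-x : ℂ)⁻¹ ^ ((n1 + n2) / 2) = b at *
  generalize (-x : ℂ) ^ (n2 / 2) = a1 at *
  generalize (-x : ℂ) ^ (n1 / 2) = a2 at *
  generalize (w ^ ((n1 + n2) % 2)) ^ ((n1 + n2) / 2) = k1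
  generalize (w ^ (n2 % 2)) ^ (n2 / 2) = k2
  generalize (w ^ (n1 % 2)) ^ (n1 / 2) = k3
  generalize (w ^ 2) ^ gph n2 n1 = k4
  generalize (-((x : ℂ) ^ 2 - x + 1)) ^ ((n1 + n2) / 2) = X
  linear_combination (X * k1 * k2 * k3 * k4 * a * b ^ 2) * hm + (X * k1 * k2 * k3 * k4 * (a * b + 1)) * hi

omit hw in
lemma wb_inv (hx : 0 < x) : wb (x : ℂ)⁻¹ = wb x := by
  have hx' : (x : ℂ) ≠ 0 := by exact_mod_cast hx.ne'
  have h1 := X_ne_zero x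
  have h2 := X_ne_zero x⁻¹
  push_cast at h2
  unfold wb
  rw [div_eq_div_iff h2 h1]
  field_simp
  ring

lemma OvF_reverse (hx : 0 < x) {Y1 Y2 : List ℂ} (hG : Good (Y1 ++ Y2))
    (hp : Y1.length = 0 ∨ Y2.length = 0 ∨ (Y1.length + Y2.length) % 2 = 1)
    (h : OvF (w ^ 2) (x⁻¹ : ℝ) Y2.reverse Y1.reverse) : OvF w x Y1 Y2 := by
  have hx' : (x : ℂ) ≠ 0 := by exact_mod_cast hx.ne'
  have hr := ovS_reverse hw x hx' Y2.reverse Y1.reverse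
    ((hG.perm ((List.perm_append_comm).trans
      ((List.reverse_perm _).symm.append (List.reverse_perm _).symm))).gen)
  unfold OvF at h ⊢
  rw [Complex.ofReal_inv] at h
  simp only [List.reverse_reverse, List.length_reverse] at hr h
  rw [hr, ← cc_swap x hw hx.ne' _ _ hp]
  rw [(((List.reverse_perm Y1).map _).prod_eq), (((List.reverse_perm Y2).map _).prod_eq),
    AA_perm ((List.reverse_perm Y1).map Wf), AA_perm ((List.reverse_perm Y2).map Wf), wb_inv x hx,
    AA_perm ((((List.reverse_perm Y2).append (List.reverse_perm Y1)).trans List.perm_append_comm).map Wf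
      |>.cons (wb x))] at h
  rw [add_comm Y2.length Y1.length] at h ⊢
  generalize (-(x : ℂ) * w ^ ((Y1.length + Y2.length) % 2)) ^ ((Y1.length + Y2.length) / 2) = k1
  generalize (-(x : ℂ) * w ^ (Y2.length % 2)) ^ (Y2.length / 2) = k2
  generalize (-(x : ℂ) * w ^ (Y1.length % 2)) ^ (Y1.length / 2) = k3
  linear_combination k1 * k2 * k3 * h

omit hw in
theorem OvF_main {w : ℂ} (hw : w ^ 2 + w + 1 = 0) {x : ℝ} (hx : 0 < x) {Y1 Y2 : List ℂ}
    (hG : Good (Y1 ++ Y2)) (hp : Y1.length = 0 ∨ Y2.length = 0 ∨ (Y1.length + Y2.length) % 2 = 1) :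
    OvF w x Y1 Y2 := by
  induction hN : Y1.length + Y2.length using Nat.strong_induction_on generalizing w x Y1 Y2 with
  | _ N ih =>
    have main : ∀ {w : ℂ} (hw : w ^ 2 + w + 1 = 0) {x : ℝ} (hx : 0 < x) {Y1 Y2 : List ℂ}
        (hG : Good (Y1 ++ Y2)) (hp : Y2.length = 0 ∨ (Y1.length + Y2.length) % 2 = 1)
        (hN : Y1.length + Y2.length = N) (hlt : Y2.length < Y1.length), OvF w x Y1 Y2 := by
      intro w hw x hx Y1 Y2 hG hp hN hlt
      rcases Y1 with - | ⟨y, Q⟩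
      · simp at hlt
      simp only [List.length_cons] at hN hlt hp
      by_cases hQ : Q = []
      · subst hQ
        have : Y2 = [] := by
          rw [← List.length_eq_zero_iff]
          simp at hlt
          exact List.length_eq_zero_iff.2 hlt
        subst this
        have hne : wb x ≠ Wf y := by
          have := hG.W_nodup x
          simp at this
          exact this
        have hov : ovS w x [y] [] = 1 := by
          have hb1 : Bal [(false, y)] := by simp [Bal]
          have hb2 : ¬ Bal [(true, y)] := by simp [Bal]
          have hb3 : Bal [(false, y⁻¹)] := by simp [Bal]
          have hb4 : Bal ([] : List Site) := by simp [Bal]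
          have hG1 : ∀ y, G w x [(false, y)] = 1 := by
            intro y
            have := G_base (omega_ne_zero hw) (x := (x : ℂ)) [] [y]
            simpa [pairProd] using this
          simp [ovS, sumS, Gb, invS, hb1, hb2, hb3, hb4, hG1, G_nil (omega_ne_zero hw)]
        simp [OvF, hov, AA_nil, AA_singleton, AA_pair hne, cc, gph, ex]
      · refine OvF_step hw x hG hQ (by omega) (by omega) fun η q hpm => ?_
        have hl := hpm.length_eq
        rw [List.length_cons] at hl
        have hG2 : Good (η ++ Y2) := by
          have h1 : Good (Q ++ Y2) := hG.sublist (List.sublist_cons_self _ _)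
          have h2 := h1.perm (hpm.append_right Y2)
          exact h2.sublist (List.sublist_cons_self _ _)
        exact ih (η.length + Y2.length) (by omega) hw hx hG2 (by omega) rfl
    by_cases hlt : Y2.length < Y1.length
    · refine main hw hx hG (by omega) hN hlt
    · by_cases h0 : N = 0
      · have e1 : Y1 = [] := List.length_eq_zero_iff.1 (by omega)
        have e2 : Y2 = [] := List.length_eq_zero_iff.1 (by omega)
        subst e1 e2
        have hb4 : Bal ([] : List Site) := by simp [Bal]
        simp [OvF, ovS, sumS, Gb, invS, hb4, G_nil (omega_ne_zero hw), AA_nil, AA_singleton, cc, gph]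
      · refine OvF_reverse hw x hx hG hp (main (omega_sq hw) (inv_pos.2 hx) ?_ ?_ ?_ ?_)
        · exact hG.perm ((List.perm_append_comm).trans
            ((List.reverse_perm _).symm.append (List.reverse_perm _).symm))
        · simp only [List.length_reverse]
          omega
        · simp only [List.length_reverse]
          omega
        · simp only [List.length_reverse]
          omega

end

end

section
open Filter Topology

lemma detOf_map (f : ℕ → ℂ → ℂ) (φ : ℂ → ℂ) (U : List ℂ) :
    detOf f (U.map φ) = detOf (fun j u => f j (φ u)) U := by
  induction U generalizing f with
  | nil => rfl
  | cons a U ih =>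
    rw [List.map_cons, detOf_cons, detOf_cons, List.length_map]
    refine Finset.sum_congr rfl fun j _ => ?_
    rw [ih]

lemma detOf_col_mul (e : ℕ → ℂ) (f : ℕ → ℂ → ℂ) (U : List ℂ) :
    detOf (fun j u => e j * f j u) U = (∏ j ∈ Finset.range U.length, e j) * detOf f U := by
  unfold detOf
  rw [Finset.prod_range]
  exact Matrix.det_mul_row (fun j : Fin U.length => e j) _

lemma detOf_continuous (g : ℕ → ℂ → ℂ → ℂ) (U : List ℂ)
    (hg : ∀ j u, ContinuousAt (fun ε => g j u ε) 0) :
    ContinuousAt (fun ε => detOf (fun j u => g j u ε) U) 0 := by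
  unfold detOf
  have : ContinuousAt (fun ε => Matrix.of fun i j : Fin U.length => g j (U.get i) ε) 0 :=
    continuousAt_pi.2 fun i => continuousAt_pi.2 fun j => hg _ _
  exact (Continuous.matrix_det continuous_id).continuousAt.comp this

lemma detOf_powF_scale {ε : ℂ} (U : List ℂ) :
    detOf powF (U.map fun u => 2 + ε * u) = (∏ j ∈ Finset.range U.length, ε ^ j) * detOf powF U := by
  rw [detOf_map, ← detOf_col_mul]
  refine detOf_triangular (fun j k => 2 ^ (j - k) * (j.choose k)) (fun j u => ?_) U
  simp only [powF]
  rw [add_comm 2, add_pow, Finset.sum_range_succ, Nat.sub_self, Nat.choose_self, add_comm]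
  simp only [pow_zero, mul_one, Nat.cast_one, mul_pow]
  congr 1
  refine Finset.sum_congr rfl fun k _ => ?_
  ring

lemma detOf_scale_div {ε : ℂ} (hε : ε ≠ 0) {f g : ℕ → ℂ → ℂ} (U : List ℂ)
    (h : ∀ j u, f j (2 + ε * u) = ε ^ j * g j u) :
    detOf f (U.map fun u => 2 + ε * u) / detOf powF (U.map fun u => 2 + ε * u)
      = detOf g U / detOf powF U := by
  rw [detOf_powF_scale, detOf_map]
  simp only [h]
  rw [detOf_col_mul, mul_div_mul_left]
  exact Finset.prod_ne_zero_iff.2 fun j _ => pow_ne_zero _ hε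

section
variable {ρ : ℕ → ℂ → ℂ} (hρ : ∀ j, Continuous (ρ j))
  (hp : ∀ j, ∃ a : ℕ → ℂ, ∀ u, (u - 2) ^ j * ρ j u = cub j u + ∑ k ∈ Finset.range j, a k * cub k u)

include hp in
lemma detOf_adapted (L : List ℂ) : detOf (fun j u => (u - 2) ^ j * ρ j u) L = detOf cub L := by
  choose a ha using hp
  exact detOf_triangular a ha L

include hρ hp

lemma AA_limit {U : List ℂ} (hU : U.Nodup) :
    Tendsto (fun ε : ℂ => AA (U.map fun u => 2 + ε * u)) (𝓝[≠] 0)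
      (𝓝 (∏ j ∈ Finset.range U.length, ρ j 2)) := by
  have hc := (detOf_continuous (fun j u ε => u ^ j * ρ j (2 + ε * u)) U fun j u =>
    (continuous_const.mul ((hρ j).comp (by fun_prop))).continuousAt).div_const (detOf powF U)
  have hlim : detOf (fun j u => u ^ j * ρ j (2 + 0 * u)) U / detOf powF U
      = ∏ j ∈ Finset.range U.length, ρ j 2 := by
    have : (fun (j : ℕ) (u : ℂ) => u ^ j * ρ j (2 + 0 * u)) = fun j u => ρ j 2 * powF j u := by
      funext j u
      rw [zero_mul, add_zero, powF, mul_comm]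
    rw [this, detOf_col_mul, mul_div_assoc, div_self (detOf_pow_ne_zero hU), mul_one]
  have hc' := hc.tendsto
  rw [hlim] at hc'
  refine (hc'.mono_left nhdsWithin_le_nhds).congr' ?_
  filter_upwards [self_mem_nhdsWithin] with ε hε
  rw [AA, ← detOf_adapted hp]
  refine (detOf_scale_div hε U fun j u => ?_).symm
  rw [add_sub_cancel_left, mul_pow, mul_assoc]

omit hp in
lemma detOf_skip_limit {U : List ℂ} {m : ℕ} (hm : m < U.length) :
    Tendsto (fun ε : ℂ => detOf (fun k u => (u - 2) ^ (skipIdx m k) * ρ (skipIdx m k) u)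
      (U.map fun u => 2 + ε * u) / detOf powF (U.map fun u => 2 + ε * u)) (𝓝[≠] 0) (𝓝 0) := by
  set g : ℕ → ℂ → ℂ → ℂ := fun k u ε => (if k < m then 1 else ε) *
    (u ^ (skipIdx m k) * ρ (skipIdx m k) (2 + ε * u)) with hg
  have hc := (detOf_continuous g U fun j u => by
    simp only [hg]
    split_ifs
    · exact (continuous_const.mul (continuous_const.mul
        ((hρ _).comp (by fun_prop)))).continuousAt
    · exact (continuous_id.mul (continuous_const.mul
        ((hρ _).comp (by fun_prop)))).continuousAt).div_const (detOf powF U)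
  have hlim : detOf (fun j u => g j u 0) U / detOf powF U = 0 := by
    simp only [hg]
    rw [detOf_col_mul (fun k => if k < m then 1 else 0) (fun k u =>
      u ^ (skipIdx m k) * ρ (skipIdx m k) (2 + 0 * u)), Finset.prod_eq_zero (Finset.mem_range.2 hm)]
    · simp
    · simp
  have hc' := hc.tendsto
  rw [hlim] at hc'
  refine (hc'.mono_left nhdsWithin_le_nhds).congr' ?_
  filter_upwards [self_mem_nhdsWithin] with ε hε
  refine (detOf_scale_div hε U fun j u => ?_).symm
  simp only [hg, skipIdx]
  rw [add_sub_cancel_left, mul_pow]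
  split_ifs
  · ring
  · ring

lemma AA_cons_limit {U : List ℂ} (hU : U.Nodup) (h0 : (0 : ℂ) ∉ U) (b : ℂ) :
    Tendsto (fun ε : ℂ => AA (b :: U.map fun u => 2 + ε * u)) (𝓝[≠] 0)
      (𝓝 ((∏ j ∈ Finset.range U.length, ρ j 2) * ρ U.length b)) := by
  by_cases hb : b = 2
  · subst hb
    have := AA_limit hρ hp (List.nodup_cons.2 ⟨h0, hU⟩)
    rw [List.length_cons, Finset.prod_range_succ] at this
    refine this.congr fun ε => ?_
    rw [List.map_cons, mul_zero, add_zero]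
  · have hb2 : 2 - b ≠ 0 := sub_ne_zero.2 (Ne.symm hb)
    have hden : Tendsto (fun ε : ℂ => ((U.map fun u => 2 + ε * u).map fun u => u - b).prod) (𝓝[≠] 0)
        (𝓝 ((2 - b) ^ U.length)) := by
      have : Continuous fun ε : ℂ => ((U.map fun u => 2 + ε * u).map fun u => u - b).prod := by
        simp only [List.map_map]
        exact continuous_list_prod _ fun u _ => by
          simp only [Function.comp_def]
          fun_prop
      have h := this.tendsto 0
      simp only [zero_mul, add_zero, List.map_const', List.map_replicate, List.prod_replicate] at h
      exact h.mono_left nhdsWithin_le_nhds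
    have hterm : ∀ m ∈ Finset.range (U.length + 1), Tendsto (fun ε : ℂ =>
        (-1) ^ m * ((b - 2) ^ m * ρ m b) *
          (detOf (fun k u => (u - 2) ^ (skipIdx m k) * ρ (skipIdx m k) u)
            (U.map fun u => 2 + ε * u) / detOf powF (U.map fun u => 2 + ε * u))) (𝓝[≠] 0)
        (𝓝 (if m = U.length then (-1) ^ m * ((b - 2) ^ m * ρ m b) *
          (∏ j ∈ Finset.range U.length, ρ j 2) else 0)) := by
      intro m hm
      rw [Finset.mem_range] at hm
      split_ifs with h
      · refine Tendsto.const_mul _ ?_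
        refine (AA_limit hρ hp hU).congr fun ε => ?_
        rw [AA, ← detOf_adapted hp]
        congr 1
        refine detOf_congr _ fun j hj u _ => ?_
        rw [List.length_map] at hj
        rw [skipIdx, if_pos (by omega)]
      · simpa using (detOf_skip_limit hρ (m := m) (by omega : m < U.length)).const_mul
          ((-1) ^ m * ((b - 2) ^ m * ρ m b))
    have hs := (tendsto_finsetSum _ hterm).div hden (pow_ne_zero _ hb2)
    rw [Finset.sum_ite_eq' _ U.length, if_pos (Finset.mem_range.2 (Nat.lt_succ_self _))] at hs
    have e : (-1) ^ U.length * ((b - 2) ^ U.length * ρ U.length b) *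
          (∏ j ∈ Finset.range U.length, ρ j 2) / (2 - b) ^ U.length
        = (∏ j ∈ Finset.range U.length, ρ j 2) * ρ U.length b := by
      rw [← mul_assoc, ← mul_pow]
      have : -1 * (b - 2) = 2 - b := by ring
      rw [this]
      field_simp
    rw [e] at hs
    refine hs.congr fun ε => ?_
    rw [AA, detOf_pow_cons, ← detOf_adapted hp, detOf_cons, List.length_map, mul_comm, ← div_div,
      Finset.sum_div]
    simp only [Pi.div_apply, mul_div_assoc]

end

end

section
open Filter Topology

def yPath (u h : ℝ) : ℝ := 1 + h ^ 2 * u / 2 + h * √(u + h ^ 2 * u ^ 2 / 4)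

lemma yPath_quad {u : ℝ} (hu : 0 < u) (h : ℝ) :
    yPath u h * (2 + h ^ 2 * u - yPath u h) = 1 := by
  have hs : √(u + h ^ 2 * u ^ 2 / 4) ^ 2 = u + h ^ 2 * u ^ 2 / 4 := Real.sq_sqrt (by positivity)
  rw [yPath]
  linear_combination (-h ^ 2) * hs

lemma yPath_ne_zero {u : ℝ} (hu : 0 < u) (h : ℝ) : yPath u h ≠ 0 := by
  intro h0
  have := yPath_quad hu h
  rw [h0, zero_mul] at this
  exact zero_ne_one this

lemma yPath_add_inv {u : ℝ} (hu : 0 < u) (h : ℝ) : yPath u h + (yPath u h)⁻¹ = 2 + h ^ 2 * u := by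
  rw [← eq_inv_of_mul_eq_one_right (yPath_quad hu h)]
  ring

lemma one_lt_yPath {u h : ℝ} (hu : 0 < u) (hh : 0 < h) : 1 < yPath u h := by
  have : 0 < h * √(u + h ^ 2 * u ^ 2 / 4) := mul_pos hh (Real.sqrt_pos.2 (by positivity))
  have : 0 < h ^ 2 * u / 2 := by positivity
  rw [yPath]
  linarith

lemma yPath_zero (u : ℝ) : yPath u 0 = 1 := by simp [yPath]

lemma yPath_continuous (u : ℝ) : Continuous (yPath u) := by
  unfold yPath
  fun_prop

def yList (U : List ℝ) (h : ℝ) : List ℂ := U.map fun u => (yPath u h : ℂ)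

lemma yList_zero (U : List ℝ) : yList U 0 = List.replicate U.length 1 := by
  simp only [yList, yPath_zero, Complex.ofReal_one, List.map_const']

lemma yList_Wf {U : List ℝ} (hU : ∀ u ∈ U, 0 < u) (h : ℝ) :
    (yList U h).map Wf = (U.map ((↑) : ℝ → ℂ)).map fun u => 2 + ((h ^ 2 : ℝ) : ℂ) * u := by
  simp only [yList, List.map_map]
  refine List.map_congr_left fun u hu => ?_
  simp only [Function.comp, Wf_real, yPath_add_inv (hU u hu)]
  push_cast
  ring

lemma yList_good {U : List ℝ} (hU : ∀ u ∈ U, 0 < u) (hn : U.Nodup) {h : ℝ} (hh : 0 < h) :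
    Good (yList U h) := by
  refine ⟨?_, ?_⟩
  · refine List.Nodup.map_on (fun u hu v hv huv => ?_) hn
    have huv' : yPath u h = yPath v h := Complex.ofReal_injective huv
    have h1 := yPath_add_inv (hU u hu) h
    rw [huv', yPath_add_inv (hU v hv) h] at h1
    have : h ^ 2 * v = h ^ 2 * u := by linarith
    exact (mul_left_cancel₀ (pow_ne_zero 2 hh.ne') this).symm
  · intro y hy
    obtain ⟨u, hu, rfl⟩ := List.mem_map.1 hy
    exact ⟨_, one_lt_yPath (hU u hu) hh, rfl⟩

lemma sumS_continuous (fs : List (ℝ → ℂ)) (F : ℝ → List Site → ℂ)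
    (hF : ∀ v : List Bool, v.length = fs.length →
      Continuous fun h => F h (v.zip (fs.map fun f => f h))) :
    Continuous fun h => sumS (fs.map fun f => f h) (F h) := by
  induction fs generalizing F with
  | nil => simpa [sumS] using hF [] rfl
  | cons f fs ih =>
    simp only [List.map_cons, sumS]
    refine (ih (fun h l => F h ((true, f h) :: l)) fun v hv => ?_).add
      (ih (fun h l => F h ((false, f h) :: l)) fun v hv => ?_)
    · simpa using hF (true :: v) (by simp [hv])
    · simpa using hF (false :: v) (by simp [hv])

lemma bal_zip (v : List Bool) (Y : List ℂ) (h : v.length = Y.length) :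
    Bal (v.zip Y) ↔ v.count true = v.length / 2 := by
  have e : v.count true = (v.zip Y).countP fun z => z.1 := by
    conv_lhs => rw [← List.map_fst_zip (l₁ := v) (l₂ := Y) h.le]
    rw [List.count, List.countP_map]
    congr 1
    funext z
    simp
  rw [Bal, List.length_zip, ← h, min_self, e]

lemma Gb_zip_continuous (w x : ℂ) (fs : List (ℝ → ℂ)) (hfs : ∀ f ∈ fs, Continuous f)
    (v : List Bool) (hv : v.length = fs.length) :
    Continuous fun h => Gb w x (v.zip (fs.map fun f => f h)) := by
  have hb : ∀ h, Bal (v.zip (fs.map fun f => f h)) ↔ v.count true = v.length / 2 :=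
    fun h => bal_zip _ _ (by simpa using hv)
  simp only [Gb, hb]
  split_ifs
  · set Y : ℕ → ℝ → ℂ := fun i => if hi : i < fs.length then fs[i] else fun _ => 0 with hY
    have hc := G_continuousOn w x v Y fun i => by
      simp only [hY]
      split_ifs with hi
      · exact hfs _ (List.getElem_mem hi)
      · exact continuous_const
    refine hc.congr fun h => ?_
    congr 1
    refine List.ext_getElem (by simp [hv]) fun i h1 h2 => ?_
    have : i < fs.length := by simpa [hv] using h1
    simp [hY, this]
  · exact continuous_const

lemma invS_zip (v : List Bool) (Y : List ℂ) : invS (v.zip Y) = v.zip (Y.map (·⁻¹)) := by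
  rw [invS, List.zip_map_right]
  rfl

lemma ovS_continuous (w x : ℂ) {U1 U2 : List ℝ} (h1 : ∀ u ∈ U1, 0 < u) (h2 : ∀ u ∈ U2, 0 < u) :
    Continuous fun h => ovS w x (yList U1 h) (yList U2 h) := by
  have key : ∀ U : List ℝ, ∀ h, yList U h =
      (U.map fun u => fun h : ℝ => (yPath u h : ℂ)).map fun f => f h := by
    intro U h
    simp [yList]
  have hc : ∀ U : List ℝ, ∀ f ∈ U.map (fun u => fun h : ℝ => (yPath u h : ℂ)), Continuous f := by
    intro U f hf
    obtain ⟨u, -, rfl⟩ := List.mem_map.1 hf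
    exact Complex.continuous_ofReal.comp (yPath_continuous u)
  have hci : ∀ U : List ℝ, (∀ u ∈ U, 0 < u) →
      ∀ f ∈ U.map (fun u => fun h : ℝ => (yPath u h : ℂ)⁻¹), Continuous f := by
    intro U hU f hf
    obtain ⟨u, hu, rfl⟩ := List.mem_map.1 hf
    exact (Complex.continuous_ofReal.comp (yPath_continuous u)).inv₀ fun h =>
      Complex.ofReal_ne_zero.2 (yPath_ne_zero (hU u hu) h)
  simp only [ovS, key]
  refine sumS_continuous _ _ fun v1 hv1 => sumS_continuous _ _ fun v2 hv2 => ?_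
  rw [List.length_map] at hv1 hv2
  refine (Continuous.mul ?_ ?_).mul ?_
  · have := Gb_zip_continuous w x ((U1 ++ U2).map fun u => fun h : ℝ => (yPath u h : ℂ)⁻¹)
      (hci _ fun u hu => (List.mem_append.1 hu).elim (h1 u) (h2 u)) (v1 ++ v2) (by simp [hv1, hv2])
    refine this.congr fun h => ?_
    congr 1
    rw [List.map_append, List.map_append, List.zip_append (by simp [hv1]), invS_append,
      invS_zip, invS_zip]
    simp [List.map_map, Function.comp_def]
  · exact Gb_zip_continuous w x _ (hc U1) v1 (by simpa using hv1)
  · exact Gb_zip_continuous w x _ (hc U2) v2 (by simpa using hv2)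

lemma yList_prod_continuous (U : List ℝ) (k : ℕ) :
    Continuous fun h => ((yList U h).map (· ^ k)).prod := by
  simp only [yList, List.map_map]
  exact continuous_list_prod _ fun u _ => (Complex.continuous_ofReal.comp (yPath_continuous u)).pow k

def prodTwo (ρ : ℕ → ℂ → ℂ) (n : ℕ) : ℂ := ∏ j ∈ Finset.range n, ρ j 2

section
variable {w : ℂ} (hw : w ^ 2 + w + 1 = 0) {ρ : ℕ → ℂ → ℂ} (hρ : ∀ j, Continuous (ρ j))
  (hp : ∀ j, ∃ a : ℕ → ℂ, ∀ u, (u - 2) ^ j * ρ j u = cub j u + ∑ k ∈ Finset.range j, a k * cub k u)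

include hw hρ hp

lemma ovS_ones {x : ℝ} (hx : 0 < x) (n1 n2 : ℕ) (hn : n1 = 0 ∨ n2 = 0 ∨ (n1 + n2) % 2 = 1) :
    ovS w x (List.replicate n1 1) (List.replicate n2 1)
      = cc w x n1 n2 * prodTwo ρ n1 * prodTwo ρ n2 *
        (prodTwo ρ (n1 + n2) * ρ (n1 + n2) (wb x)) := by
  set U1 : List ℝ := (List.range n1).map fun k : ℕ => (k + 1 : ℝ)
  set U2 : List ℝ := (List.range n2).map fun k : ℕ => (n1 + k + 1 : ℝ)
  have l1 : U1.length = n1 := by simp [U1]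
  have l2 : U2.length = n2 := by simp [U2]
  have p1 : ∀ u ∈ U1, 0 < u := by
    intro u hu
    obtain ⟨k, -, rfl⟩ := List.mem_map.1 hu
    positivity
  have p2 : ∀ u ∈ U2, 0 < u := by
    intro u hu
    obtain ⟨k, -, rfl⟩ := List.mem_map.1 hu
    positivity
  have p12 : ∀ u ∈ U1 ++ U2, 0 < u := fun u hu => (List.mem_append.1 hu).elim (p1 u) (p2 u)
  have nd : (U1 ++ U2).Nodup := by
    have : U1 ++ U2 = (List.range (n1 + n2)).map fun k : ℕ => (k + 1 : ℝ) := by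
      rw [List.range_add, List.map_append, List.map_map]
      simp [U1, U2, Function.comp_def]
    rw [this]
    refine List.Nodup.map (fun a b hab => ?_) List.nodup_range
    have : (a : ℝ) = b := by simpa using hab
    exact_mod_cast this
  have nd1 := nd.sublist (List.sublist_append_left U1 U2)
  have nd2 := nd.sublist (List.sublist_append_right U1 U2)
  have cast_nd : ∀ {U : List ℝ}, U.Nodup → (U.map ((↑) : ℝ → ℂ)).Nodup := fun h =>
    h.map Complex.ofReal_injective
  have h0 : (0 : ℂ) ∉ (U1 ++ U2).map ((↑) : ℝ → ℂ) := by
    intro h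
    obtain ⟨u, hu, h⟩ := List.mem_map.1 h
    exact (p12 u hu).ne' (Complex.ofReal_eq_zero.1 h)
  have hsq : Tendsto (fun h : ℝ => ((h ^ 2 : ℝ) : ℂ)) (𝓝[>] 0) (𝓝[≠] 0) := by
    refine tendsto_nhdsWithin_iff.2 ⟨?_, ?_⟩
    · have : Continuous fun h : ℝ => ((h ^ 2 : ℝ) : ℂ) := by fun_prop
      simpa using (this.tendsto 0).mono_left nhdsWithin_le_nhds
    · filter_upwards [self_mem_nhdsWithin] with h hh
      have hh' : (0 : ℝ) < h := hh
      simpa using hh'.ne'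
  have a1 := (AA_limit hρ hp (cast_nd nd1)).comp hsq
  have a2 := (AA_limit hρ hp (cast_nd nd2)).comp hsq
  have a3 := (AA_cons_limit hρ hp (cast_nd nd) h0 (wb x)).comp hsq
  have hR := ((a1.const_mul (cc w x n1 n2)).mul a2).mul a3
  have hL := ((((yList_prod_continuous U1 (ex (n1 + n2) n1)).mul
    (yList_prod_continuous U2 (ex (n1 + n2) n2))).mul (ovS_continuous w x p1 p2)).tendsto 0).mono_left
    (nhdsWithin_le_nhds (s := Set.Ioi 0))
  have e := tendsto_nhds_unique_of_eventuallyEq hL hR ?_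
  · simpa [yList_zero, l1, l2, prodTwo] using e
  · filter_upwards [self_mem_nhdsWithin] with h hh
    have hg : Good (yList U1 h ++ yList U2 h) := by
      simpa [yList] using yList_good p12 nd hh
    have := OvF_main hw hx hg (by simpa [yList, l1, l2] using hn)
    rw [OvF, yList_Wf p1, yList_Wf p2, List.map_append, yList_Wf p1, yList_Wf p2] at this
    simpa [yList, l1, l2] using this

end

end

section
open Filter Topology

def on (v : List Bool) : List Site := v.map fun a => (a, 1)

lemma on_append (v v' : List Bool) : on (v ++ v') = on v ++ on v' := List.map_append ..

lemma on_cons (a : Bool) (v : List Bool) : on (a :: v) = (a, 1) :: on v := rfl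

lemma on_reverse (v : List Bool) : on v.reverse = (on v).reverse := by simp [on]

lemma eq_zero_of_right {f : ℂ → ℂ} {D : ℂ} (hf : HasDerivAt f D 1)
    (h : ∀ y : ℝ, 1 < y → f y = 0) : D = 0 := by
  have h1 : HasDerivAt (fun y : ℝ => f y) D 1 := by
    have : HasDerivAt f D ((1 : ℝ) : ℂ) := by simpa using hf
    exact this.comp_ofReal
  have h0 : f ((1 : ℝ) : ℂ) = 0 := by
    have hc := h1.continuousAt.tendsto.mono_left (nhdsWithin_le_nhds (s := Set.Ioi 1))
    refine tendsto_nhds_unique (hc.congr' ?_) tendsto_const_nhds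
    filter_upwards [self_mem_nhdsWithin] with y hy
    exact h y hy
  refine (uniqueDiffWithinAt_Ioi (1 : ℝ)).eq_deriv _ (h1.hasDerivWithinAt (s := Set.Ioi 1)) ?_
  exact (hasDerivWithinAt_const _ _ (0 : ℂ)).congr (fun y hy => h y hy) h0

def uList (n : ℕ) : List ℝ := (List.range n).map fun k : ℕ => (k + 1 : ℝ)

lemma uList_pos (n : ℕ) : ∀ u ∈ uList n, 0 < u := by
  intro u hu
  obtain ⟨k, -, rfl⟩ := List.mem_map.1 hu
  positivity

lemma uList_nodup (n : ℕ) : (uList n).Nodup := by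
  refine List.Nodup.map (fun a b hab => ?_) List.nodup_range
  have : (a : ℝ) = b := by simpa using hab
  exact_mod_cast this

lemma uList_length (n : ℕ) : (uList n).length = n := by simp [uList]

lemma eventually_gen (n : ℕ) {y : ℝ} (hy : 1 < y) :
    ∀ᶠ h in 𝓝[>] (0 : ℝ), Gen ((y : ℂ) :: yList (uList n) h) ∧
      Gen ((y : ℂ)⁻¹ :: yList (uList n) h) := by
  have h1 : ∀ᶠ h in 𝓝[>] (0 : ℝ), ∀ u ∈ {u | u ∈ uList n}, yPath u h < y := by
    refine (Filter.eventually_all_finite (List.finite_toSet _)).2 fun u _ => ?_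
    have := ((yPath_continuous u).tendsto 0).mono_left (nhdsWithin_le_nhds (s := Set.Ioi 0))
    rw [yPath_zero] at this
    exact this.eventually (gt_mem_nhds hy)
  filter_upwards [h1, self_mem_nhdsWithin] with h h1 hh
  have hg := yList_good (uList_pos n) (uList_nodup n) hh
  have hG := hg.gen
  have key : ∀ t : ℝ, 0 < t → (∀ u ∈ uList n, t ≠ yPath u h) → Gen ((t : ℂ) :: yList (uList n) h) := by
    intro t ht hne
    refine ⟨?_, ?_⟩
    · rw [List.map_cons, List.nodup_cons]
      refine ⟨fun hm => ?_, hG.1⟩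
      obtain ⟨z, hz, hz'⟩ := List.mem_map.1 hm
      obtain ⟨u, hu, rfl⟩ := List.mem_map.1 hz
      have h3 : yPath u h ^ 3 = t ^ 3 := by exact_mod_cast hz'
      have hu1 := one_lt_yPath (uList_pos n u hu) hh
      exact hne u hu ((pow_left_inj₀ (by linarith) ht.le (by norm_num)).1 h3).symm
    · intro z hz
      rcases List.mem_cons.1 hz with rfl | hz
      · exact Complex.ofReal_ne_zero.2 ht.ne'
      · exact hG.2 z hz
  refine ⟨key y (by linarith) fun u hu => (h1 u hu).ne', ?_⟩
  have := key y⁻¹ (by positivity) fun u hu => ?_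
  · simpa using this
  · have hu1 := one_lt_yPath (uList_pos n u hu) hh
    have : y⁻¹ < 1 := inv_lt_one_of_one_lt₀ hy
    linarith

lemma Gb_front_tendsto (w x : ℂ) (a : Bool) (y : ℂ) (q : List Bool) :
    Tendsto (fun h => Gb w x ((a, y) :: q.zip (yList (uList q.length) h))) (𝓝[>] 0)
      (𝓝 (Gb w x ((a, y) :: on q))) := by
  have hc := Gb_zip_continuous w x
    ((fun _ => y) :: (uList q.length).map fun u => fun h : ℝ => (yPath u h : ℂ))
    (by
      intro f hf
      rcases List.mem_cons.1 hf with rfl | hf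
      · exact continuous_const
      · obtain ⟨u, -, rfl⟩ := List.mem_map.1 hf
        exact Complex.continuous_ofReal.comp (yPath_continuous u))
    (a :: q) (by simp [uList_length])
  have h0 : q.zip (yList (uList q.length) 0) = on q := by
    rw [yList_zero, uList_length]
    refine List.ext_getElem (by simp [on]) fun i _ _ => by simp [on]
  have := (hc.tendsto 0).mono_left (nhdsWithin_le_nhds (s := Set.Ioi 0))
  rw [← h0]
  simpa [yList, List.map_map, Function.comp_def] using this

lemma zip_snd {q : List Bool} (h : ℝ) :
    (q.zip (yList (uList q.length) h)).map Prod.snd = yList (uList q.length) h :=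
  List.map_snd_zip (by simp [yList, uList_length])

section
variable {w : ℂ} (hw : w ^ 2 + w + 1 = 0) (x : ℂ)
include hw

lemma Gb_flip_up (q : List Bool) {y : ℝ} (hy : 1 < y) :
    (y : ℂ) ^ q.length * Gb w x ((false, (y : ℂ)⁻¹) :: on q)
      = (y : ℂ) ^ (1 - (q.length + 1) % 2) * Gb w x ((false, (y : ℂ)) :: on q) := by
  refine tendsto_nhds_unique_of_eventuallyEq ((Gb_front_tendsto w x _ _ q).const_mul _)
    ((Gb_front_tendsto w x _ _ q).const_mul _) ?_
  filter_upwards [eventually_gen q.length hy] with h hg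
  have e := flip_up hw x (q.zip (yList (uList q.length) h)) (y := y) (by rw [zip_snd]; exact hg.1)
    (by rw [zip_snd]; exact hg.2)
  have hl : (q.zip (yList (uList q.length) h)).length = q.length := by simp [yList, uList_length]
  rw [hl] at e
  have hbb := bal_param [] (q.zip (yList (uList q.length) h)) false y (y : ℂ)⁻¹
  simp only [List.nil_append] at hbb
  unfold Gb
  by_cases hb : Bal ((false, (y : ℂ)) :: q.zip (yList (uList q.length) h))
  · have hb' := (bal_param [] (q.zip (yList (uList q.length) h)) false y (y : ℂ)⁻¹)
    rw [if_pos hb, if_pos (hbb.1 hb), e hb]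
  · rw [if_neg hb, if_neg fun h => hb (hbb.2 h), mul_zero, mul_zero]

lemma Gb_flip_down (q : List Bool) {y : ℝ} (hy : 1 < y) :
    (y : ℂ) ^ q.length * (y * th w x y) * Gb w x ((true, (y : ℂ)⁻¹) :: on q)
      = (y : ℂ) ^ (1 - (q.length + 1) % 2) * ((x + w) - (x + w ^ 2) * y) *
        Gb w x ((true, (y : ℂ)) :: on q) := by
  refine tendsto_nhds_unique_of_eventuallyEq ((Gb_front_tendsto w x _ _ q).const_mul _)
    ((Gb_front_tendsto w x _ _ q).const_mul _) ?_
  filter_upwards [eventually_gen q.length hy] with h hg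
  have e := flip_down hw x (q.zip (yList (uList q.length) h)) (y := y) ((gen_cons.1 hg.1).2.1)
    (by rw [zip_snd]; exact (List.nodup_cons.1 hg.1.nodup).2)
  have hl : (q.zip (yList (uList q.length) h)).length = q.length := by simp [yList, uList_length]
  rw [hl] at e
  have hbb := bal_param [] (q.zip (yList (uList q.length) h)) true y (y : ℂ)⁻¹
  simp only [List.nil_append] at hbb
  unfold Gb
  by_cases hb : Bal ((true, (y : ℂ)) :: q.zip (yList (uList q.length) h))
  · rw [if_pos hb, if_pos (hbb.1 hb), e hb]
  · rw [if_neg hb, if_neg fun h => hb (hbb.2 h), mul_zero, mul_zero]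

lemma Gb_rev_front (hx : x ≠ 0) (a : Bool) (q : List Bool) {y : ℝ} (hy : 1 < y) :
    Gb w x ((on q).reverse ++ [(a, (y : ℂ))])
      = (-x * w ^ ((q.length + 1) % 2)) ^ ((q.length + 1) / 2) *
        Gb (w ^ 2) x⁻¹ ((a, (y : ℂ)) :: on q) := by
  have hR := (Gb_front_tendsto (w ^ 2) x⁻¹ a y q).const_mul
    ((-x * w ^ ((q.length + 1) % 2)) ^ ((q.length + 1) / 2))
  have hc := Gb_zip_continuous w x
    (((uList q.length).map fun u => fun h : ℝ => (yPath u h : ℂ)).reverse ++ [fun _ : ℝ => (y : ℂ)])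
    (by
      intro f hf
      rcases List.mem_append.1 hf with hf | hf
      · obtain ⟨u, -, rfl⟩ := List.mem_map.1 (List.mem_reverse.1 hf)
        exact Complex.continuous_ofReal.comp (yPath_continuous u)
      · rw [List.mem_singleton.1 hf]
        exact continuous_const)
    (q.reverse ++ [a]) (by simp [uList_length])
  have hz : ∀ h, (q.reverse ++ [a]).zip
      ((((uList q.length).map fun u => fun h : ℝ => (yPath u h : ℂ)).reverse ++
        [fun _ : ℝ => (y : ℂ)]).map fun f : ℝ → ℂ => f h)
      = ((a, (y : ℂ)) :: q.zip (yList (uList q.length) h)).reverse := by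
    intro h
    rw [List.map_append, List.map_reverse, List.zip_append (by simp [uList_length]),
      List.reverse_cons]
    congr 1
    · rw [List.zip, ← List.reverse_zipWith (by simp [uList_length])]
      simp [yList, List.map_map, Function.comp_def]
  have h0 : q.zip (yList (uList q.length) 0) = on q := by
    rw [yList_zero, uList_length]
    refine List.ext_getElem (by simp [on]) fun i _ _ => by simp [on]
  simp only [hz] at hc
  have hL := (hc.tendsto 0).mono_left (nhdsWithin_le_nhds (s := Set.Ioi 0))
  rw [h0, List.reverse_cons] at hL
  refine tendsto_nhds_unique_of_eventuallyEq hL hR ?_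
  filter_upwards [eventually_gen q.length hy] with h hg
  rw [Gb_reverse hw x hx _ (by rw [List.map_cons, zip_snd]; exact hg.1)]
  simp [yList, uList_length]

end

def dG (w x : ℂ) (p q : List Bool) (a : Bool) : ℂ :=
  deriv (fun t => Gb w x (on p ++ (a, t) :: on q)) 1

section
variable {w : ℂ} (hw : w ^ 2 + w + 1 = 0) (x : ℂ)
include hw

lemma dG_hasDerivAt (p q : List Bool) (a : Bool) :
    HasDerivAt (fun t => Gb w x (on p ++ (a, t) :: on q)) (dG w x p q a) 1 := by
  obtain ⟨Q, -, h⟩ := Gb_slot hw x (on p) (on q) a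
  have : (fun t => Gb w x (on p ++ (a, t) :: on q)) = fun t => Q.eval t := funext h
  rw [dG, this]
  exact Q.differentiable.differentiableAt.hasDerivAt

lemma dG_bond (p q : List Bool) (a b : Bool) :
    (w - 1) * (dG w x (p ++ [a]) q b - dG w x p (b :: q) a)
      = if a = b then -w ^ 2 * Gb w x (on (p ++ a :: b :: q))
        else w ^ 2 * Gb w x (on (p ++ b :: a :: q)) +
          (if a then 1 else w) * Gb w x (on (p ++ a :: b :: q)) := by
  have h1 := dG_hasDerivAt hw x (p ++ [a]) q b
  have h2 := dG_hasDerivAt hw x p (b :: q) a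
  have h3 := dG_hasDerivAt hw x p (a :: q) b
  simp only [on_append, on_cons, List.append_assoc, List.cons_append, List.nil_append,
    show on [] = [] from rfl] at h1 h2 h3 ⊢
  have hE := fun s => Gb_exch (x := x) hw (on p) (on q) a b s 1
  simp only [ExchAt] at hE
  have hid : HasDerivAt (fun s : ℂ => s) 1 1 := hasDerivAt_id _
  have hL := (hid.const_sub (w * 1)).mul h1
  by_cases hab : a = b
  · simp only [if_pos hab] at hE ⊢
    subst hab
    have hR := ((hid.const_mul w).sub_const 1).mul h2
    have := hL.unique (hR.congr_of_eventuallyEq (Eventually.of_forall hE))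
    linear_combination this + Gb w x (on p ++ (a, 1) :: (a, 1) :: on q) * hw
  · simp only [if_neg hab] at hE ⊢
    have hM : HasDerivAt (fun s : ℂ => if a then (1 : ℂ) else s) (if a then 0 else 1) 1 := by
      cases a
      · simpa using hid
      · simpa using hasDerivAt_const (1 : ℂ) (1 : ℂ)
    have hR := ((hM.const_mul (w - 1)).mul h2).add (((hid.sub_const 1).const_mul (w ^ 2)).mul h3)
    have := hL.unique (hR.congr_of_eventuallyEq (Eventually.of_forall hE))
    cases a
    · simp at this ⊢
      linear_combination this
    · simp at this ⊢
      linear_combination this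

lemma dG_left_up (q : List Bool) :
    2 * dG w x [] q false = (q.length - (1 - (q.length + 1) % 2 : ℕ) : ℂ) * Gb w x (on (false :: q)) := by
  have h := dG_hasDerivAt hw x [] q false
  simp only [show on [] = [] from rfl, List.nil_append] at h
  have hi : HasDerivAt (fun y : ℂ => y⁻¹) (-1) 1 := by simpa using hasDerivAt_inv (one_ne_zero (α := ℂ))
  have h' : HasDerivAt (fun y : ℂ => Gb w x ((false, y⁻¹) :: on q)) (dG w x [] q false * -1) 1 := by
    refine HasDerivAt.comp (h₂ := fun t => Gb w x ((false, t) :: on q)) 1 ?_ hi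
    simpa using h
  have := eq_zero_of_right ((((hasDerivAt_id (1 : ℂ)).fun_pow q.length).mul h').sub
    (((hasDerivAt_id (1 : ℂ)).fun_pow (1 - (q.length + 1) % 2)).mul h)) fun y hy => by
      simp only [Pi.sub_apply, Pi.mul_apply, id]
      rw [Gb_flip_up hw x q hy, sub_self]
  simp only [id, one_pow, inv_one, mul_one, one_mul, on_cons] at this ⊢
  linear_combination -this

lemma dG_left_down (q : List Bool) :
    2 * (w - w ^ 2) * dG w x [] q true
      = ((q.length + 1 - (1 - (q.length + 1) % 2 : ℕ) : ℂ) * (w - w ^ 2) + (2 * x - 1)) *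
        Gb w x (on (true :: q)) := by
  have h := dG_hasDerivAt hw x [] q true
  simp only [show on [] = [] from rfl, List.nil_append] at h
  have hid := hasDerivAt_id (1 : ℂ)
  have hi : HasDerivAt (fun y : ℂ => y⁻¹) (-1) 1 := by simpa using hasDerivAt_inv (one_ne_zero (α := ℂ))
  have h' : HasDerivAt (fun y : ℂ => Gb w x ((true, y⁻¹) :: on q)) (dG w x [] q true * -1) 1 := by
    refine HasDerivAt.comp (h₂ := fun t => Gb w x ((true, t) :: on q)) 1 ?_ hi
    simpa using h
  have hth : HasDerivAt (fun y => th w x y) (x + w) 1 := by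
    simpa [th] using (hid.const_mul (x + w)).sub_const (x + w ^ 2)
  have := eq_zero_of_right ((((hid.fun_pow q.length).mul (hid.mul hth)).mul h').sub
    (((hid.fun_pow (1 - (q.length + 1) % 2)).mul ((hid.const_mul (x + w ^ 2)).const_sub (x + w))).mul h))
    fun y hy => by
      simp only [Pi.sub_apply, Pi.mul_apply, id]
      rw [Gb_flip_down hw x q hy, sub_self]
  simp only [Pi.mul_apply, id, one_pow, inv_one, mul_one, one_mul, on_cons, th] at this ⊢
  linear_combination -this + Gb w x ((true, 1) :: on q) * hw

lemma dG_reverse (hx : x ≠ 0) (a : Bool) (q : List Bool) :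
    dG w x q.reverse [] a = (-x * w ^ ((q.length + 1) % 2)) ^ ((q.length + 1) / 2) *
      dG (w ^ 2) x⁻¹ [] q a ∧
    Gb w x (on (q.reverse ++ [a])) = (-x * w ^ ((q.length + 1) % 2)) ^ ((q.length + 1) / 2) *
      Gb (w ^ 2) x⁻¹ (on (a :: q)) := by
  have h := dG_hasDerivAt hw x q.reverse [] a
  have h' := (dG_hasDerivAt (omega_sq hw) x⁻¹ [] q a).const_mul
    ((-x * w ^ ((q.length + 1) % 2)) ^ ((q.length + 1) / 2))
  have e := h.sub h'
  have hz : ∀ y : ℝ, 1 < y → ((fun t => Gb w x (on q.reverse ++ (a, t) :: on [])) - fun t =>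
      (-x * w ^ ((q.length + 1) % 2)) ^ ((q.length + 1) / 2) *
        Gb (w ^ 2) x⁻¹ (on [] ++ (a, t) :: on q)) (y : ℂ) = 0 := by
    intro y hy
    have := Gb_rev_front hw x hx a q hy
    simp only [Pi.sub_apply, on_reverse, show on [] = [] from rfl, List.nil_append]
    rw [this, sub_self]
  refine ⟨sub_eq_zero.1 (eq_zero_of_right e hz), ?_⟩
  have hc := e.continuousAt.tendsto.comp
    ((Complex.continuous_ofReal.tendsto 1).mono_left (nhdsWithin_le_nhds (s := Set.Ioi 1)))
  have := tendsto_nhds_unique (hc.congr' (f₂ := fun _ => (0 : ℂ)) (by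
    filter_upwards [self_mem_nhdsWithin] with y hy
    exact hz y hy)) tendsto_const_nhds
  rw [Pi.sub_apply] at this
  rw [on_append]
  exact sub_eq_zero.1 this

end

end

section
open Filter Topology

/-- The value of `σ^z` on a letter. -/
def sg (a : Bool) : ℂ := if a then -1 else 1

def hopP (f : List Bool → ℂ) (p : List Bool) : List Bool → ℂ
  | a :: b :: q => (if a = b then 0 else f (p ++ b :: a :: q)) + hopP f (p ++ [a]) (b :: q)
  | _ => 0

def zzP : List Bool → ℂ
  | a :: b :: q => sg a * sg b + zzP (b :: q)
  | _ => 0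

section
variable {w : ℂ} (hw : w ^ 2 + w + 1 = 0) (x : ℂ)
include hw

lemma dG_telescope (p : List Bool) (a : Bool) (q : List Bool) :
    ∃ p' c, p' ++ [c] = p ++ a :: q ∧ (w - 1) * (dG w x p' [] c - dG w x p q a)
      = w ^ 2 * (hopP (fun v => Gb w x (on v)) p (a :: q) +
        (-zzP (a :: q) / 4 - 3 / 4 * q.length + (w - w ^ 2) / 4 * (sg c - sg a)) *
          Gb w x (on (p ++ a :: q))) := by
  induction q generalizing p a with
  | nil => exact ⟨p, a, rfl, by simp [hopP, zzP]⟩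
  | cons b q ih =>
    obtain ⟨p', c, h1, h2⟩ := ih (p ++ [a]) b
    refine ⟨p', c, by rw [h1]; simp, ?_⟩
    have h3 := dG_bond hw x p q a b
    rw [List.append_assoc, List.singleton_append] at h2
    simp only [hopP, zzP, List.length_cons, Nat.cast_add, Nat.cast_one] at h2 ⊢
    generalize dG w x p' [] c = A at *
    generalize dG w x (p ++ [a]) q b = B at *
    generalize dG w x p (b :: q) a = B' at *
    generalize Gb w x (on (p ++ a :: b :: q)) = F at *
    generalize hopP (fun v => Gb w x (on v)) (p ++ [a]) (b :: q) = H at *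
    generalize zzP (b :: q) = Z at *
    have h4 := omega_cube hw
    cases a <;> cases b
    · simp [sg] at h2 h3 ⊢
      linear_combination h2 + h3
    · simp [sg] at h2 h3 ⊢
      linear_combination h2 + h3 + F / 2 * hw + (1 - w) * F / 2 * h4
    · simp [sg] at h2 h3 ⊢
      linear_combination h2 + h3 + F / 2 * hw + (w - 1) * F / 2 * h4
    · simp [sg] at h2 h3 ⊢
      linear_combination h2 + h3

lemma dG_left (a : Bool) (q : List Bool) :
    2 * (w - w ^ 2) * dG w x [] q a
      = ((q.length + 1 / 2 - (1 - (q.length + 1) % 2 : ℕ) - sg a / 2 : ℂ) * (w - w ^ 2) +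
        (1 - sg a) / 2 * (2 * x - 1)) * Gb w x (on (a :: q)) := by
  cases a
  · have := dG_left_up hw x q
    simp only [sg, Bool.false_eq_true, if_false]
    linear_combination (w - w ^ 2) * this
  · have := dG_left_down hw x q
    simp only [sg, if_true]
    linear_combination this

lemma dG_right (hx : x ≠ 0) (p : List Bool) (c : Bool) :
    2 * (w - w ^ 2) * dG w x p [] c
      = ((p.length + 1 / 2 - (1 - (p.length + 1) % 2 : ℕ) - sg c / 2 : ℂ) * (w - w ^ 2) -
        (1 - sg c) / 2 * (2 * x⁻¹ - 1)) * Gb w x (on (p ++ [c])) := by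
  obtain ⟨h1, h2⟩ := dG_reverse hw x hx c p.reverse
  have h3 := dG_left (omega_sq hw) x⁻¹ c p.reverse
  rw [List.reverse_reverse, List.length_reverse] at h1 h2
  rw [List.length_reverse] at h3
  rw [h1, h2]
  have e : (w ^ 2) ^ 2 = w := by linear_combination w * omega_cube hw
  rw [e] at h3
  generalize (-x * w ^ ((p.length + 1) % 2)) ^ ((p.length + 1) / 2) = K at *
  linear_combination (-K) * h3

lemma word_eigen (hx : x ≠ 0) (a c : Bool) (q p : List Bool) (h : p ++ [c] = a :: q) :
    -hopP (fun v => Gb w x (on v)) [] (a :: q) + (zzP (a :: q) / 4 + 1 / 2 * (1 / 2 - x) * sg a +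
      1 / 2 * (1 / 2 - 1 / x) * sg c) * Gb w x (on (a :: q))
      = (-(3 * (q.length + 1) - 1) / 4 - (1 - x) ^ 2 / (2 * x)) * Gb w x (on (a :: q)) := by
  obtain ⟨p', c', h1, h2⟩ := dG_telescope hw x [] a q
  rw [List.nil_append, ← h] at h1
  obtain ⟨rfl, h5⟩ := List.append_inj' h1 rfl
  obtain rfl := (List.cons.inj h5).1
  have h3 := dG_left hw x a q
  have h4 := dG_right hw x hx p' c'
  have hl : p'.length = q.length := by simpa using congrArg List.length h
  rw [hl, h] at h4
  rw [List.nil_append] at h2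
  generalize dG w x p' [] c' = L at *
  generalize dG w x [] q a = L0 at *
  generalize hopP (fun v => Gb w x (on v)) [] (a :: q) = H at *
  generalize Gb w x (on (a :: q)) = F at *
  generalize zzP (a :: q) = Z at *
  have h5 := omega_cube hw
  have hh : H = (Z / 4 + 3 / 4 * q.length + (1 - sg c') / 4 * (2 * x⁻¹ - 1) +
      (1 - sg a) / 4 * (2 * x - 1)) * F := by
    linear_combination (-H + (Z / 4 + 3 / 4 * q.length - (w - w ^ 2) / 4 * (sg c' - sg a)) * F) * h5
      + (-w) * h2 - 1 / 2 * (h4 - h3)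
  rw [hh]
  field_simp
  ring

end

end

section
open Filter Topology

lemma siteOp_mulVec {N : ℕ} (i : Fin N) (A : Matrix (Fin 2) (Fin 2) ℂ) (f : Conf N → ℂ) (α : Conf N) :
    (siteOp N i A).mulVec f α = ∑ s, A (α i) s * f (Function.update α i s) := by
  have h : ∀ β : Conf N, siteOp N i A α β * f β
      = ∑ s, if β = Function.update α i s then A (α i) s * f (Function.update α i s) else 0 := by
    intro β
    rw [siteOp, Matrix.of_apply, Finset.prod_boole]
    by_cases hb : ∀ j ∈ Finset.univ.erase i, α j = β j
    · have hβ : β = Function.update α i (β i) := by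
        funext j
        by_cases hj : j = i
        · subst hj; simp
        · rw [Function.update_of_ne hj]
          exact (hb j (by simp [hj])).symm
      rw [if_pos hb, Finset.sum_eq_single (β i)]
      · rw [if_pos hβ, ← hβ, mul_one]
      · intro s _ hs
        rw [if_neg]
        intro e
        exact hs (by rw [e]; simp)
      · simp
    · rw [if_neg hb, mul_zero, zero_mul, Finset.sum_eq_zero]
      intro s _
      rw [if_neg]
      intro e
      refine hb fun j hj => ?_
      rw [e, Function.update_of_ne (by simpa using hj)]
  simp only [Matrix.mulVec, dotProduct, h]
  rw [Finset.sum_comm]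
  refine Finset.sum_congr rfl fun s _ => ?_
  rw [Finset.sum_ite_eq' Finset.univ]
  simp

def bl (s : Fin 2) : Bool := decide (s = 1)

lemma bl_inj {s t : Fin 2} : bl s = bl t ↔ s = t := by
  revert s t
  decide

def sgF (s : Fin 2) : ℂ := sg (bl s)

lemma sgF_zero : sgF 0 = 1 := by simp [sgF, sg, bl]

lemma sgF_one : sgF 1 = -1 := by simp [sgF, sg, bl]

lemma pauliZ_mulVec {N : ℕ} (i : Fin N) (f : Conf N → ℂ) (α : Conf N) :
    (siteOp N i pauliZ).mulVec f α = sgF (α i) * f α := by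
  rw [siteOp_mulVec, Fin.sum_univ_two]
  have e : ∀ s, α i = s → Function.update α i s = α := by
    intro s hs
    rw [← hs, Function.update_eq_self]
  rcases (show ∀ s : Fin 2, s = 0 ∨ s = 1 by decide) (α i) with h | h
  · rw [h, e 0 h, sgF_zero]
    simp [pauliZ]
  · rw [h, e 1 h, sgF_one]
    simp [pauliZ]

lemma bond_mulVec {N : ℕ} {i j : Fin N} (hij : i ≠ j) (f : Conf N → ℂ) (α : Conf N) :
    ((siteOp N i pauliX * siteOp N j pauliX + siteOp N i pauliY * siteOp N j pauliY
      - (1 / 2 : ℂ) • (siteOp N i pauliZ * siteOp N j pauliZ)).mulVec f) α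
      = (if α i = α j then 0 else 2 * f (Function.update (Function.update α i (α j)) j (α i)))
        - 1 / 2 * (sgF (α i) * sgF (α j) * f α) := by
  simp only [Matrix.sub_mulVec, Matrix.add_mulVec, Matrix.smul_mulVec, ← Matrix.mulVec_mulVec,
    Pi.sub_apply, Pi.add_apply, Pi.smul_apply, smul_eq_mul, pauliZ_mulVec]
  simp only [siteOp_mulVec, Fin.sum_univ_two, Function.update_of_ne hij.symm]
  have h2 : ∀ s : Fin 2, s = 0 ∨ s = 1 := by decide
  rcases h2 (α i) with h | h <;> rcases h2 (α j) with h' | h' <;> rw [h, h'] <;>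
    simp [pauliX, pauliY, sgF_zero, sgF_one]
  all_goals ring_nf
  all_goals simp
  all_goals ring

lemma hopP_eq (f : List Bool → ℂ) (p v : List Bool) :
    hopP f p v = ∑ i ∈ Finset.range (v.length - 1), if v.getD i true = v.getD (i + 1) true then 0
      else f (p ++ (v.set i (v.getD (i + 1) true)).set (i + 1) (v.getD i true)) := by
  induction v generalizing p with
  | nil => simp [hopP]
  | cons a v ih =>
    cases v with
    | nil => simp [hopP]
    | cons b q =>
      rw [hopP, ih]
      simp only [List.length_cons, Nat.add_sub_cancel]
      rw [Finset.sum_range_succ', add_comm]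
      simp

lemma zzP_eq (v : List Bool) :
    zzP v = ∑ i ∈ Finset.range (v.length - 1), sg (v.getD i true) * sg (v.getD (i + 1) true) := by
  induction v with
  | nil => simp [zzP]
  | cons a v ih =>
    cases v with
    | nil => simp [zzP]
    | cons b q =>
      rw [zzP, ih]
      simp only [List.length_cons, Nat.add_sub_cancel]
      rw [Finset.sum_range_succ', add_comm]
      simp

def wd {N : ℕ} (α : Conf N) : List Bool := List.ofFn fun i => bl (α i)

lemma wd_length {N : ℕ} (α : Conf N) : (wd α).length = N := by simp [wd]

lemma wd_getD {N : ℕ} (α : Conf N) {i : ℕ} (hi : i < N) : (wd α).getD i true = bl (α ⟨i, hi⟩) := by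
  simp [wd, hi]

lemma wd_set {N : ℕ} (α : Conf N) (i : Fin N) (s : Fin 2) :
    (wd α).set i (bl s) = wd (Function.update α i s) := by
  refine List.ext_getElem (by simp [wd]) fun k h1 h2 => ?_
  have hk : k < N := by simpa [wd] using h2
  rw [List.getElem_set]
  split_ifs with h
  · have : (⟨k, hk⟩ : Fin N) = i := Fin.ext h.symm
    simp [wd, this]
  · have : (⟨k, hk⟩ : Fin N) ≠ i := fun e => h (by rw [← e])
    simp [wd, Function.update_of_ne this]

lemma XXZ_mulVec {n : ℕ} (x : ℝ) (F : List Bool → ℂ) (α : Conf (n + 1)) :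
    (XXZ (n + 1) n.succ_pos x).mulVec (fun β => F (wd β)) α
      = -hopP F [] (wd α) + (zzP (wd α) / 4 + 1 / 2 * (1 / 2 - x) * sgF (α 0) +
        1 / 2 * (1 / 2 - 1 / x) * sgF (α (Fin.last n))) * F (wd α) := by
  have hne : ∀ i : Fin (n + 1 - 1), (⟨i.1, by omega⟩ : Fin (n + 1)) ≠ ⟨i.1 + 1, by omega⟩ := by
    intro i h
    have := congrArg Fin.val h
    simp at this
  rw [XXZ, Matrix.add_mulVec, Matrix.add_mulVec, Matrix.smul_mulVec, Matrix.smul_mulVec,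
    Matrix.smul_mulVec, Matrix.sum_mulVec]
  simp only [Pi.add_apply, Pi.smul_apply, Finset.sum_apply, smul_eq_mul]
  rw [Finset.sum_congr rfl fun i _ => bond_mulVec (hne i) _ α, pauliZ_mulVec, pauliZ_mulVec,
    hopP_eq, zzP_eq, wd_length, Finset.sum_range, Finset.sum_range, Finset.sum_sub_distrib,
    ← Finset.mul_sum, ← Finset.sum_mul]
  have e1 : ∀ i : Fin (n + 1 - 1), (if (wd α).getD i true = (wd α).getD (i + 1) true then 0
      else F ([] ++ ((wd α).set i ((wd α).getD (i + 1) true)).set (i + 1) ((wd α).getD i true)))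
      = 1 / 2 * (if α ⟨i.1, by omega⟩ = α ⟨i.1 + 1, by omega⟩ then 0 else 2 * F (wd
        (Function.update (Function.update α ⟨i.1, by omega⟩ (α ⟨i.1 + 1, by omega⟩))
          ⟨i.1 + 1, by omega⟩ (α ⟨i.1, by omega⟩)))) := by
    intro i
    have h1 : i.1 < n + 1 := by omega
    have h2 : i.1 + 1 < n + 1 := by omega
    rw [wd_getD α h1, wd_getD α h2]
    by_cases h : α ⟨i.1, h1⟩ = α ⟨i.1 + 1, h2⟩
    · rw [if_pos (bl_inj.2 h), if_pos h, mul_zero]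
    · rw [if_neg fun e => h (bl_inj.1 e), if_neg h, wd_set α ⟨i.1, h1⟩, wd_set _ ⟨i.1 + 1, h2⟩,
        List.nil_append]
      ring
  have e2 : ∀ i : Fin (n + 1 - 1), sg ((wd α).getD i true) * sg ((wd α).getD (i + 1) true)
      = sgF (α ⟨i.1, by omega⟩) * sgF (α ⟨i.1 + 1, by omega⟩) := by
    intro i
    rw [wd_getD α (by omega), wd_getD α (by omega)]
    rfl
  rw [Finset.sum_congr rfl fun i _ => e1 i, Finset.sum_congr rfl fun i _ => e2 i, ← Finset.mul_sum]
  have e3 : (⟨n + 1 - 1, by omega⟩ : Fin (n + 1)) = Fin.last n := rfl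
  have e4 : (⟨0, n.succ_pos⟩ : Fin (n + 1)) = 0 := rfl
  rw [e3, e4, pL, pR]
  push_cast
  ring

lemma XXZ_eigen {w : ℂ} (hw : w ^ 2 + w + 1 = 0) {n : ℕ} {x : ℝ} (hx : x ≠ 0) :
    (XXZ (n + 1) n.succ_pos x).mulVec (fun β => Gb w x (on (wd β)))
      = ((E0 (n + 1) x : ℝ) : ℂ) • fun β => Gb w x (on (wd β)) := by
  funext α
  rw [XXZ_mulVec x (fun v => Gb w x (on v)), Pi.smul_apply, smul_eq_mul, E0]
  have h1 : wd α = bl (α 0) :: List.ofFn fun i : Fin n => bl (α i.succ) := by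
    rw [wd, List.ofFn_succ]
  have h2 : wd α = (List.ofFn fun i : Fin n => bl (α i.castSucc)) ++ [bl (α (Fin.last n))] := by
    rw [wd, List.ofFn_succ', List.concat_eq_append]
  have := word_eigen hw x (Complex.ofReal_ne_zero.2 hx) _ _ _ _ (h2.symm.trans h1)
  rw [← h1, List.length_ofFn] at this
  simp only [sgF]
  rw [this]
  push_cast
  ring

end

section
open Filter Topology

lemma wd_append {N1 N2 : ℕ} (α : Conf N1) (β : Conf N2) : wd (Fin.append α β) = wd α ++ wd β := by
  rw [wd, wd, wd, ← List.ofFn_fin_append]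
  congr 1
  funext i
  refine Fin.addCases (fun i => ?_) (fun i => ?_) i <;> simp

lemma wd_cons {N : ℕ} (s : Fin 2) (α : Conf N) : wd (Fin.cons s α : Conf (N + 1)) = bl s :: wd α := by
  simp [wd, List.ofFn_succ]

lemma sumS_ones (N : ℕ) (f : List Site → ℂ) :
    sumS (List.replicate N 1) f = ∑ α : Conf N, f (on (wd α)) := by
  induction N generalizing f with
  | zero =>
    rw [Fintype.sum_unique]
    simp [sumS, wd, on]
  | succ N ih =>
    rw [List.replicate_succ, sumS, ih, ih,
      ← Fintype.sum_equiv (Fin.consEquiv fun _ : Fin (N + 1) => Fin 2)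
        (fun p => f (on (wd (Fin.cons p.1 p.2 : Conf (N + 1))))) _ (fun _ => rfl),
      Fintype.sum_prod_type, Fin.sum_univ_two, add_comm]
    simp [wd_cons, on_cons, bl]

lemma invS_on (v : List Bool) : invS (on v) = on v := by simp [invS, on]

def bs (w x : ℂ) (N : ℕ) : ℂ := Gb w x (on (wd (baseState N)))

lemma pairProd_replicate_ne {f : ℂ → ℂ → ℂ} (h : f 1 1 ≠ 0) (n : ℕ) :
    pairProd f (List.replicate n 1) ≠ 0 := by
  induction n with
  | zero => simp [pairProd]
  | succ n ih =>
    rw [List.replicate_succ, pairProd]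
    refine mul_ne_zero ?_ ih
    simp [h]

lemma wd_baseState (N : ℕ) :
    wd (baseState N) = List.replicate (N / 2) true ++ List.replicate (N - N / 2) false := by
  refine List.ext_getElem (by simp [wd]; omega) fun i h1 h2 => ?_
  rw [List.getElem_append]
  simp only [wd, List.getElem_ofFn, baseState, List.length_replicate, List.getElem_replicate]
  split_ifs <;> simp [bl]

section
variable {w : ℂ} (hw : w ^ 2 + w + 1 = 0)
include hw

lemma bs_ne_zero (x : ℂ) (N : ℕ) : bs w x N ≠ 0 := by
  have h1 : w - 1 ≠ 0 := omega_sub_one_ne hw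
  have h2 : w ^ 2 - 1 ≠ 0 := omega_sub_one_ne (omega_sq hw)
  have e : on (wd (baseState N)) = (List.replicate (N / 2) (1 : ℂ)).map (fun y => (true, y)) ++
      (List.replicate (N - N / 2) (1 : ℂ)).map (fun y => (false, y)) := by
    simp [wd_baseState, on]
  have hb : Bal (on (wd (baseState N))) := by
    rw [e]
    simp [Bal, List.countP_replicate]
    omega
  rw [bs, Gb, if_pos hb, e, G_base (omega_ne_zero hw)]
  refine mul_ne_zero (mul_ne_zero ?_ (pairProd_replicate_ne ?_ _)) (pairProd_replicate_ne ?_ _)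
  · rw [List.map_replicate, List.prod_replicate]
    refine pow_ne_zero _ (mul_ne_zero (by simp) ?_)
    have : th w x 1 = -w * (w - 1) := by simp only [th]; ring
    rw [this]
    exact mul_ne_zero (neg_ne_zero.2 (omega_ne_zero hw)) h1
  · have : fD w 1 1 = -(w - 1) ^ 2 := by simp only [fD]; ring
    rw [this]
    exact neg_ne_zero.2 (pow_ne_zero _ h1)
  · have : fU w 1 1 = -(w ^ 2 - 1) ^ 2 := by simp only [fU]; ring
    rw [this]
    exact neg_ne_zero.2 (pow_ne_zero _ h2)

lemma groundState_eq {N : ℕ} (hN : 1 ≤ N) {x : ℝ} (hx : x ≠ 0) {ψ : Conf N → ℂ}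
    (h : IsGroundState N x ψ) (α : Conf N) : Gb w x (on (wd α)) = bs w x N * ψ α := by
  obtain ⟨n, rfl⟩ : ∃ n, N = n + 1 := ⟨N - 1, by omega⟩
  rw [IsGroundState, dif_pos n.succ_pos] at h
  obtain ⟨-, h1, h2⟩ := h
  obtain ⟨c, hc⟩ := h1 _ (XXZ_eigen hw hx)
  have h3 := congrFun hc (baseState (n + 1))
  have h4 := congrFun hc α
  simp only [Pi.smul_apply, smul_eq_mul, h2, mul_one] at h3 h4
  rw [h4, bs, h3]

lemma overlap_eq {N1 N2 : ℕ} (h1 : 1 ≤ N1) (h2 : 1 ≤ N2) {x : ℝ} (hx : x ≠ 0)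
    {ψ : Conf (N1 + N2) → ℂ} {ψ1 : Conf N1 → ℂ} {ψ2 : Conf N2 → ℂ}
    (hψ : IsGroundState (N1 + N2) x ψ) (hψ1 : IsGroundState N1 x ψ1) (hψ2 : IsGroundState N2 x ψ2) :
    ovS w x (List.replicate N1 1) (List.replicate N2 1)
      = bs w x (N1 + N2) * bs w x N1 * bs w x N2 * overlap N1 N2 ψ ψ1 ψ2 := by
  rw [ovS, sumS_ones, overlap, Finset.mul_sum]
  refine Finset.sum_congr rfl fun α _ => ?_
  rw [sumS_ones, Finset.mul_sum]
  refine Finset.sum_congr rfl fun β _ => ?_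
  rw [← on_append, invS_on, ← wd_append, groundState_eq hw (by omega) hx hψ,
    groundState_eq hw h1 hx hψ1, groundState_eq hw h2 hx hψ2]
  ring

lemma selfOverlap_eq {M : ℕ} (hM : 1 ≤ M) {x : ℝ} (hx : x ≠ 0) {ψ : Conf M → ℂ}
    (hψ : IsGroundState M x ψ) :
    ovS w x (List.replicate M 1) [] = bs w x M ^ 2 * selfOverlap M ψ := by
  rw [ovS, sumS_ones, selfOverlap, Finset.mul_sum]
  refine Finset.sum_congr rfl fun α _ => ?_
  have hb : Gb w x [] = 1 := by
    rw [Gb, if_pos (by simp [Bal]), G_nil (omega_ne_zero hw)]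
  rw [sumS, List.append_nil, invS_on, hb, groundState_eq hw hM hx hψ]
  ring

lemma cc_ratio (x : ℂ) {n1 n2 : ℕ} (h : (n1 + n2) % 2 = 1) :
    cc w x n1 n2 ^ 2 = cc w x n1 0 * cc w x n2 0 * cc w x (n1 + n2) 0 := by
  have h3 := omega_cube hw
  simp only [cc, gph, add_zero, Nat.zero_mod, Nat.zero_div, zero_mul, mul_zero]
  have e : (n1 + n2) / 2 = n1 / 2 + n2 / 2 := by omega
  have k : ∀ m, w ^ (3 * m) = 1 := fun m => by rw [pow_mul, h3, one_pow]
  rcases Nat.mod_two_eq_zero_or_one n1 with h1 | h1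
  · have h2 : n2 % 2 = 1 := by omega
    rw [h, h1, h2, e]
    simp only [zero_mul, one_mul, zero_add, pow_zero, mul_one]
    generalize n1 / 2 = a
    generalize n2 / 2 = b
    have : (w ^ (2 * a + b)) ^ 2 = w ^ b * w ^ (a + b) * w ^ (3 * a) := by
      rw [← pow_mul, ← pow_add, ← pow_add]
      congr 1
      ring
    rw [k] at this
    linear_combination ((-(x ^ 2 - x + 1)) ^ (a + b)) ^ 2 * this
  · have h2 : n2 % 2 = 0 := by omega
    rw [h, h1, h2, e]
    simp only [zero_mul, one_mul, add_zero, pow_zero, mul_one]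
    generalize n1 / 2 = a
    generalize n2 / 2 = b
    have : (w ^ (a + 2 * b)) ^ 2 = w ^ a * w ^ (a + b) * w ^ (3 * b) := by
      rw [← pow_mul, ← pow_add, ← pow_add]
      congr 1
      ring
    rw [k] at this
    linear_combination ((-(x ^ 2 - x + 1)) ^ (a + b)) ^ 2 * this

lemma cc_ne_zero (x : ℝ) (n1 n2 : ℕ) : cc w x n1 n2 ≠ 0 :=
  mul_ne_zero (pow_ne_zero _ (neg_ne_zero.2 (X_ne_zero x))) (pow_ne_zero _ (omega_ne_zero hw))

theorem fidelity_eq {ρ : ℕ → ℂ → ℂ} (hρ : ∀ j, Continuous (ρ j))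
    (hp : ∀ j, ∃ a : ℕ → ℂ, ∀ u, (u - 2) ^ j * ρ j u = cub j u + ∑ k ∈ Finset.range j, a k * cub k u)
    (hρ2 : ∀ j, ρ j 2 ≠ 0) {N1 N2 : ℕ} (h1 : 1 ≤ N1) (h2 : 1 ≤ N2) (h12 : (N1 + N2) % 2 = 1)
    {x : ℝ} (hx : 0 < x)
    {ψ : Conf (N1 + N2) → ℂ} {ψ1 : Conf N1 → ℂ} {ψ2 : Conf N2 → ℂ}
    (hψ : IsGroundState (N1 + N2) x ψ) (hψ1 : IsGroundState N1 x ψ1) (hψ2 : IsGroundState N2 x ψ2)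
    (hr1 : ρ N1 (wb x) ≠ 0) (hr2 : ρ N2 (wb x) ≠ 0) (hrN : ρ (N1 + N2) (wb x) ≠ 0) :
    overlap N1 N2 ψ ψ1 ψ2 ^ 2 / (selfOverlap N1 ψ1 * selfOverlap N2 ψ2 * selfOverlap (N1 + N2) ψ)
      = ρ (N1 + N2) (wb x) / (ρ N1 (wb x) * ρ N2 (wb x)) := by
  have e12 := ovS_ones hw hρ hp hx N1 N2 (Or.inr (Or.inr h12))
  have e1 := ovS_ones hw hρ hp hx N1 0 (Or.inr (Or.inl rfl))
  have e2 := ovS_ones hw hρ hp hx N2 0 (Or.inr (Or.inl rfl))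
  have eN := ovS_ones hw hρ hp hx (N1 + N2) 0 (Or.inr (Or.inl rfl))
  rw [List.replicate_zero, selfOverlap_eq hw (by assumption) hx.ne' (by assumption)] at e1 e2
  rw [List.replicate_zero, selfOverlap_eq hw (by omega) hx.ne' hψ] at eN
  rw [overlap_eq hw h1 h2 hx.ne' hψ hψ1 hψ2] at e12
  have hc := cc_ratio hw x h12
  have P : ∀ n, prodTwo ρ n ≠ 0 := fun n => Finset.prod_ne_zero_iff.2 fun j _ => hρ2 j
  have P0 : prodTwo ρ 0 = 1 := by simp [prodTwo]
  have hb1 := bs_ne_zero hw x N1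
  have hb2 := bs_ne_zero hw x N2
  have hbN := bs_ne_zero hw x (N1 + N2)
  have hc1 := cc_ne_zero hw x N1 0
  have hc2 := cc_ne_zero hw x N2 0
  have hcN := cc_ne_zero hw x (N1 + N2) 0
  have hp1 := P N1
  have hp2 := P N2
  have hpN := P (N1 + N2)
  rw [add_zero, P0] at e1 e2 eN
  generalize overlap N1 N2 ψ ψ1 ψ2 = O at *
  generalize selfOverlap N1 ψ1 = S1 at *
  generalize selfOverlap N2 ψ2 = S2 at *
  generalize selfOverlap (N1 + N2) ψ = SN at *
  generalize bs w x N1 = b1 at *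
  generalize bs w x N2 = b2 at *
  generalize bs w x (N1 + N2) = bN at *
  generalize prodTwo ρ N1 = p1 at *
  generalize prodTwo ρ N2 = p2 at *
  generalize prodTwo ρ (N1 + N2) = pN at *
  generalize ρ N1 (wb x) = r1 at *
  generalize ρ N2 (wb x) = r2 at *
  generalize ρ (N1 + N2) (wb x) = rN at *
  generalize cc w x N1 0 = c1 at *
  generalize cc w x N2 0 = c2 at *
  generalize cc w x (N1 + N2) 0 = cN at *
  generalize cc w x N1 N2 = c at *
  have E1 : S1 = c1 * p1 ^ 2 * r1 / b1 ^ 2 := by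
    rw [eq_div_iff (pow_ne_zero 2 hb1)]
    linear_combination e1
  have E2 : S2 = c2 * p2 ^ 2 * r2 / b2 ^ 2 := by
    rw [eq_div_iff (pow_ne_zero 2 hb2)]
    linear_combination e2
  have EN : SN = cN * pN ^ 2 * rN / bN ^ 2 := by
    rw [eq_div_iff (pow_ne_zero 2 hbN)]
    linear_combination eN
  have E : O ^ 2 = c1 * c2 * cN * (p1 * p2 * pN * rN) ^ 2 / (bN * b1 * b2) ^ 2 := by
    rw [eq_div_iff (pow_ne_zero 2 (mul_ne_zero (mul_ne_zero hbN hb1) hb2)), ← hc]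
    linear_combination (bN * b1 * b2 * O + c * p1 * p2 * (pN * rN)) * e12
  rw [E, E1, E2, EN]
  field_simp

end

end

section
open Filter Topology

/-- The trigonometric integral `∫₀ᵀ (cos t - cos T)ⁿ cos (δ t) dt`. -/
def KK (n : ℕ) (δ T : ℝ) : ℝ :=
  ∫ t in (0 : ℝ)..T, (Real.cos t - Real.cos T) ^ n * Real.cos (δ * t)

lemma KK_succ (n : ℕ) (δ T : ℝ) :
    KK (n + 1) δ T = 1 / 2 * KK n (δ + 1) T + 1 / 2 * KK n (δ - 1) T - Real.cos T * KK n δ T := by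
  have hI : ∀ d : ℝ, IntervalIntegrable
      (fun t => (Real.cos t - Real.cos T) ^ n * Real.cos (d * t)) MeasureTheory.volume 0 T :=
    fun d => Continuous.intervalIntegrable (by fun_prop) _ _
  unfold KK
  rw [← intervalIntegral.integral_const_mul, ← intervalIntegral.integral_const_mul,
    ← intervalIntegral.integral_const_mul,
    ← intervalIntegral.integral_add ((hI _).const_mul _) ((hI _).const_mul _),
    ← intervalIntegral.integral_sub (((hI _).const_mul _).add ((hI _).const_mul _))
      ((hI _).const_mul _)]
  congr 1
  ext t
  rw [add_mul, sub_mul, one_mul, Real.cos_add, Real.cos_sub]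
  ring

lemma KK_zero {δ : ℝ} (h : δ ≠ 0) (T : ℝ) : KK 0 δ T = 1 / δ * Real.sin (δ * T) := by
  unfold KK
  simp only [pow_zero, one_mul]
  rw [intervalIntegral.integral_comp_mul_left (fun t => Real.cos t) h]
  simp

/-- Sine sums with frequencies `δ + n - 2 i`, `i ≤ n`, with leading coefficient `c`. -/
def SinSpan (G : ℝ → ℝ) (n : ℕ) (δ c : ℝ) : Prop :=
  ∃ κ : ℕ → ℝ, κ 0 = c ∧
    ∀ T, G T = ∑ i ∈ Finset.range (n + 1), κ i * Real.sin ((δ + n - 2 * i) * T)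

lemma KK_sinSpan (n : ℕ) (δ : ℝ) (h : ∀ m : ℤ, δ + m ≠ 0) :
    SinSpan (KK n δ) n δ ((-1 / 2) ^ n * n.factorial / ∏ k ∈ Finset.range (n + 1), (δ + k)) := by
  induction n generalizing δ with
  | zero =>
    refine ⟨fun _ => 1 / δ, by simp, fun T => ?_⟩
    have := h 0
    rw [KK_zero (by simpa using this)]
    simp
  | succ n ih =>
    obtain ⟨κ, hκ, e⟩ := ih δ h
    obtain ⟨κp, hκp, ep⟩ := ih (δ + 1) (fun m => by
      have := h (m + 1); push_cast at this; convert this using 1; ring)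
    obtain ⟨κm, hκm, em⟩ := ih (δ - 1) (fun m => by
      have := h (m - 1); push_cast at this; convert this using 1; ring)
    refine ⟨fun i => (if i < n + 1 then 1 / 2 * κp i - 1 / 2 * κ i else 0)
      + (if i = 0 then 0 else 1 / 2 * κm (i - 1) - 1 / 2 * κ (i - 1)), ?_, fun T => ?_⟩
    · simp only [Nat.succ_pos, if_true, hκ, hκp, add_zero]
      have h1 : ∏ k ∈ Finset.range (n + 1 + 1), (δ + k)
          = (∏ k ∈ Finset.range (n + 1), (δ + 1 + k)) * δ := by
        rw [Finset.prod_range_succ']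
        push_cast
        congr 1
        · exact Finset.prod_congr rfl fun k _ => by ring
        · ring
      have h2 := Finset.prod_range_succ (fun k : ℕ => δ + (k : ℝ)) (n + 1)
      have hδ : δ ≠ 0 := by simpa using h 0
      have hn : δ + ((n + 1 : ℕ) : ℝ) ≠ 0 := by exact_mod_cast h ((n + 1 : ℕ) : ℤ)
      have hA : ∏ k ∈ Finset.range (n + 1), (δ + 1 + (k : ℝ)) ≠ 0 :=
        Finset.prod_ne_zero_iff.2 fun k _ => by
          have := h (1 + k); push_cast at this; rwa [add_assoc]
      have hB : ∏ k ∈ Finset.range (n + 1), (δ + (k : ℝ)) ≠ 0 :=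
        Finset.prod_ne_zero_iff.2 fun k _ => by exact_mod_cast h (k : ℤ)
      rw [h1]
      rw [h1] at h2
      have h3 : ∏ k ∈ Finset.range (n + 1), (δ + 1 + (k : ℝ))
          = (∏ k ∈ Finset.range (n + 1), (δ + (k : ℝ))) * (δ + ((n + 1 : ℕ) : ℝ)) / δ := by
        rw [eq_div_iff hδ]; exact h2
      rw [h3]
      rw [Nat.factorial_succ]
      push_cast at hn ⊢
      generalize ∏ k ∈ Finset.range (n + 1), (δ + (k : ℝ)) = B at *
      field_simp
      ring
    · rw [KK_succ, e, ep, em]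
      have hs1 : ∑ i ∈ Finset.range (n + 1 + 1),
          (if i < n + 1 then 1 / 2 * κp i - 1 / 2 * κ i else 0)
            * Real.sin ((δ + ((n + 1 : ℕ) : ℝ) - 2 * (i : ℝ)) * T)
          = ∑ i ∈ Finset.range (n + 1), (1 / 2 * κp i - 1 / 2 * κ i)
            * Real.sin ((δ + ((n + 1 : ℕ) : ℝ) - 2 * (i : ℝ)) * T) := by
        rw [Finset.sum_range_succ, if_neg (by omega), zero_mul, add_zero]
        exact Finset.sum_congr rfl fun i hi => by rw [if_pos (Finset.mem_range.1 hi)]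
      have hs2 : ∑ i ∈ Finset.range (n + 1 + 1),
          (if i = 0 then 0 else 1 / 2 * κm (i - 1) - 1 / 2 * κ (i - 1))
            * Real.sin ((δ + ((n + 1 : ℕ) : ℝ) - 2 * (i : ℝ)) * T)
          = ∑ i ∈ Finset.range (n + 1), (1 / 2 * κm i - 1 / 2 * κ i)
            * Real.sin ((δ + ((n + 1 : ℕ) : ℝ) - 2 * ((i + 1 : ℕ) : ℝ)) * T) := by
        rw [Finset.sum_range_succ', if_pos rfl, zero_mul, add_zero]
        exact Finset.sum_congr rfl fun i hi => by rw [if_neg (by omega)]; rfl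
      have hd : ∀ (f g s : ℕ → ℝ) (R : Finset ℕ), ∑ i ∈ R, (f i + g i) * s i
          = ∑ i ∈ R, f i * s i + ∑ i ∈ R, g i * s i := fun f g s R => by
        simp only [add_mul, Finset.sum_add_distrib]
      beta_reduce
      rw [hd (fun i => if i < n + 1 then 1 / 2 * κp i - 1 / 2 * κ i else 0)
        (fun i => if i = 0 then 0 else 1 / 2 * κm (i - 1) - 1 / 2 * κ (i - 1))]
      rw [hs1, hs2, Finset.mul_sum, Finset.mul_sum, Finset.mul_sum, ← Finset.sum_add_distrib,
        ← Finset.sum_sub_distrib, ← Finset.sum_add_distrib]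
      refine Finset.sum_congr rfl fun i _ => ?_
      have e1 : (δ + ((n + 1 : ℕ) : ℝ) - 2 * (i : ℝ)) * T = (δ + n - 2 * i) * T + T := by
        push_cast; ring
      have e2 : (δ + ((n + 1 : ℕ) : ℝ) - 2 * ((i + 1 : ℕ) : ℝ)) * T = (δ + n - 2 * i) * T - T := by
        push_cast; ring
      have e3 : (δ + 1 + (n : ℝ) - 2 * (i : ℝ)) * T = (δ + n - 2 * i) * T + T := by ring
      have e4 : (δ - 1 + (n : ℝ) - 2 * (i : ℝ)) * T = (δ + n - 2 * i) * T - T := by ring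
      rw [e1, e2, e3, e4, Real.sin_add, Real.sin_sub]
      ring

/-- Multiples `sin φ · Σ_{k ≤ n} a_k cub_k (2 cos φ)` with leading coefficient `c`. -/
def CubSpan (F : ℝ → ℝ) (n : ℕ) (c : ℝ) : Prop :=
  ∃ a : ℕ → ℝ, a n = c ∧ ∀ φ, F φ = Real.sin φ *
    ∑ k ∈ Finset.range (n + 1), a k * ((2 * Real.cos φ) ^ (k % 2) * (2 * Real.cos (3 * φ)) ^ (k / 2))

namespace CubSpan

variable {F G : ℝ → ℝ} {n m : ℕ} {c d : ℝ}

lemma add (hF : CubSpan F n c) (hG : CubSpan G n d) : CubSpan (fun φ => F φ + G φ) n (c + d) := by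
  obtain ⟨a, ha, e⟩ := hF
  obtain ⟨b, hb, f⟩ := hG
  refine ⟨fun k => a k + b k, by simp [ha, hb], fun φ => ?_⟩
  simp only [e, f, add_mul, Finset.sum_add_distrib]
  ring

lemma smul (r : ℝ) (hF : CubSpan F n c) : CubSpan (fun φ => r * F φ) n (r * c) := by
  obtain ⟨a, ha, e⟩ := hF
  refine ⟨fun k => r * a k, by simp [ha], fun φ => ?_⟩
  simp only [e, mul_assoc, ← Finset.mul_sum]
  ring

lemma lift (hF : CubSpan F n c) (h : n < m) : CubSpan F m 0 := by
  obtain ⟨a, ha, e⟩ := hF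
  refine ⟨fun k => if k < n + 1 then a k else 0, if_neg (by omega), fun φ => ?_⟩
  rw [e]
  congr 1
  refine Finset.sum_subset_zero_on_sdiff (Finset.range_mono (by omega)) (fun k hk => ?_)
    (fun k hk => ?_)
  · rw [Finset.mem_sdiff, Finset.mem_range, Finset.mem_range] at hk
    beta_reduce
    rw [if_neg hk.2, zero_mul]
  · beta_reduce
    rw [if_pos (Finset.mem_range.1 hk)]

lemma mul_cos (hF : CubSpan F n c) :
    CubSpan (fun φ => 2 * Real.cos (3 * φ) * F φ) (n + 2) c := by
  obtain ⟨a, ha, e⟩ := hF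
  refine ⟨fun k => if k < 2 then 0 else a (k - 2), by simp [ha], fun φ => ?_⟩
  beta_reduce
  have hs : ∀ g : ℕ → ℝ, (∀ k < 2, g k = 0) →
      ∑ k ∈ Finset.range (n + 2 + 1), g k = ∑ k ∈ Finset.range (n + 1), g (k + 2) := by
    intro g hg
    rw [show n + 2 + 1 = (n + 1) + 1 + 1 by omega, Finset.sum_range_succ' g,
      Finset.sum_range_succ' (fun k => g (k + 1)), hg 0 (by omega), hg (0 + 1) (by omega)]
    simp
  rw [e, hs _ fun k hk => by rw [if_pos hk, zero_mul], mul_left_comm, Finset.mul_sum]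
  congr 1
  refine Finset.sum_congr rfl fun k _ => ?_
  rw [if_neg (by omega), show (k + 2) % 2 = k % 2 by omega,
    show (k + 2) / 2 = k / 2 + 1 by omega, show k + 2 - 2 = k by omega]
  ring

lemma congr (hF : CubSpan F n c) (h : ∀ φ, G φ = F φ) : CubSpan G n c := by
  obtain ⟨a, ha, e⟩ := hF
  exact ⟨a, ha, fun φ => (h φ).trans (e φ)⟩

lemma sum {f : ℕ → ℝ → ℝ} {s : ℕ → ℝ} (hf : ∀ i, CubSpan (f i) n (s i)) (N : ℕ) :
    CubSpan (fun φ => ∑ i ∈ Finset.range N, f i φ) n (∑ i ∈ Finset.range N, s i) := by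
  induction N with
  | zero => exact ⟨fun _ => 0, by simp, fun φ => by simp⟩
  | succ N ih => simpa [Finset.sum_range_succ] using ih.add (hf N)

lemma sin_one (m : ℕ) : CubSpan (fun φ => Real.sin ((3 * m + 1) * φ)) (2 * m) 1 := by
  induction m using Nat.twoStepInduction with
  | zero => exact ⟨fun _ => 1, rfl, fun φ => by simp⟩
  | one =>
    refine ⟨fun k => if k = 0 then 0 else 1, rfl, fun φ => ?_⟩
    have e : Real.sin ((3 * ((1 : ℕ) : ℝ) + 1) * φ) = Real.sin (3 * φ + φ) := by
      congr 1; push_cast; ring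
    have h2 : Real.sin (3 * φ) = Real.sin (2 * φ + φ) := by congr 1; ring
    have h3 : Real.cos (3 * φ) = Real.cos (2 * φ + φ) := by congr 1; ring
    simp only [Finset.sum_range_succ, Finset.sum_range_zero]
    norm_num
    rw [show (4 : ℝ) * φ = 3 * φ + φ by ring, Real.sin_add, h2, Real.sin_add, h3, Real.cos_add,
      Real.sin_two_mul, Real.cos_two_mul]
    have := Real.sin_sq_add_cos_sq φ
    generalize Real.sin φ = a at *
    generalize Real.cos φ = b at *
    grind
  | more m h0 h1 =>
    have := (h1.mul_cos).add ((h0.smul (-1)).lift (show 2 * m < 2 * (m + 1) + 2 by omega))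
    rw [add_zero] at this
    refine this.congr fun φ => ?_
    have e0 : ((3 : ℝ) * (m : ℝ) + 1) * φ = (3 * ((m + 1 : ℕ) : ℝ) + 1) * φ - 3 * φ := by
      push_cast; ring
    have e2 : ((3 : ℝ) * ((m + 2 : ℕ) : ℝ) + 1) * φ = (3 * ((m + 1 : ℕ) : ℝ) + 1) * φ + 3 * φ := by
      push_cast; ring
    rw [e0, e2, Real.sin_add, Real.sin_sub]
    ring

lemma sin_two (m : ℕ) : CubSpan (fun φ => Real.sin ((3 * m + 2) * φ)) (2 * m + 1) 1 := by
  induction m using Nat.twoStepInduction with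
  | zero =>
    refine ⟨fun k => if k = 1 then 1 else 0, rfl, fun φ => ?_⟩
    simp [Real.sin_two_mul]
    ring
  | one =>
    refine ⟨fun k => if k = 0 ∨ k = 3 then 1 else 0, rfl, fun φ => ?_⟩
    have h2 : Real.sin (3 * φ) = Real.sin (2 * φ + φ) := by congr 1; ring
    have h3 : Real.cos (3 * φ) = Real.cos (2 * φ + φ) := by congr 1; ring
    simp only [Finset.sum_range_succ, Finset.sum_range_zero]
    norm_num
    rw [show (5 : ℝ) * φ = 3 * φ + 2 * φ by ring, Real.sin_add, h2, Real.sin_add, h3, Real.cos_add,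
      Real.sin_two_mul, Real.cos_two_mul]
    have := Real.sin_sq_add_cos_sq φ
    generalize Real.sin φ = a at *
    generalize Real.cos φ = b at *
    grind
  | more m h0 h1 =>
    have := (h1.mul_cos).add ((h0.smul (-1)).lift (show 2 * m + 1 < 2 * (m + 1) + 1 + 2 by omega))
    rw [add_zero] at this
    refine this.congr fun φ => ?_
    have e0 : ((3 : ℝ) * (m : ℝ) + 2) * φ = (3 * ((m + 1 : ℕ) : ℝ) + 2) * φ - 3 * φ := by
      push_cast; ring
    have e2 : ((3 : ℝ) * ((m + 2 : ℕ) : ℝ) + 2) * φ = (3 * ((m + 1 : ℕ) : ℝ) + 2) * φ + 3 * φ := by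
      push_cast; ring
    rw [e0, e2, Real.sin_add, Real.sin_sub]
    ring

end CubSpan

/-- The twist attached to a chain of length `n`. -/
def dl (n : ℕ) : ℝ := if n % 2 = 0 then 2 / 3 else 1 / 3

lemma sin_freq_cubSpan (n i : ℕ) (hi : i ≤ n) :
    CubSpan (fun φ => Real.sin ((dl n + n - 2 * i) * (3 * φ / 2))) n (if i = 0 then 1 else 0) := by
  obtain ⟨M, rfl | rfl⟩ : ∃ M, n = 2 * M ∨ n = 2 * M + 1 := ⟨n / 2, by omega⟩
  · have hd : dl (2 * M) = 2 / 3 := if_pos (by omega)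
    rw [hd]
    by_cases h : i ≤ M
    · have h1 := CubSpan.sin_one (M - i)
      have h2 : CubSpan (fun φ => Real.sin ((3 * ((M - i : ℕ) : ℝ) + 1) * φ)) (2 * M)
          (if i = 0 then 1 else 0) := by
        by_cases h0 : i = 0
        · subst h0; simpa using h1
        · rw [if_neg h0]; exact h1.lift (by omega)
      refine h2.congr fun φ => ?_
      rw [Nat.cast_sub h]
      congr 1; push_cast; ring
    · rw [if_neg (by omega)]
      have h1 := ((CubSpan.sin_two (i - M - 1)).smul (-1)).lift (show _ < 2 * M by omega)
      refine h1.congr fun φ => ?_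
      rw [neg_one_mul, ← Real.sin_neg, show i - M - 1 = i - (M + 1) by omega,
        Nat.cast_sub (by omega)]
      congr 1; push_cast; ring
  · have hd : dl (2 * M + 1) = 1 / 3 := if_neg (by omega)
    rw [hd]
    by_cases h : i ≤ M
    · have h1 := CubSpan.sin_two (M - i)
      have h2 : CubSpan (fun φ => Real.sin ((3 * ((M - i : ℕ) : ℝ) + 2) * φ)) (2 * M + 1)
          (if i = 0 then 1 else 0) := by
        by_cases h0 : i = 0
        · subst h0; simpa using h1
        · rw [if_neg h0]; exact h1.lift (by omega)
      refine h2.congr fun φ => ?_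
      rw [Nat.cast_sub h]
      congr 1; push_cast; ring
    · rw [if_neg (by omega)]
      have h1 := ((CubSpan.sin_one (i - M - 1)).smul (-1)).lift (show _ < 2 * M + 1 by omega)
      refine h1.congr fun φ => ?_
      rw [neg_one_mul, ← Real.sin_neg, show i - M - 1 = i - (M + 1) by omega,
        Nat.cast_sub (by omega)]
      congr 1; push_cast; ring

lemma dl_add_ne_zero (n : ℕ) (m : ℤ) : dl n + m ≠ 0 := by
  intro h
  unfold dl at h
  split_ifs at h
  · have : (2 + 3 * m : ℤ) = 0 := by exact_mod_cast (by linarith : (2 : ℝ) + 3 * m = 0)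
    omega
  · have : (1 + 3 * m : ℤ) = 0 := by exact_mod_cast (by linarith : (1 : ℝ) + 3 * m = 0)
    omega

/-- The leading coefficient of `KK n (dl n)`. -/
def lamK (n : ℕ) : ℝ :=
  (-1 / 2) ^ n * n.factorial / ∏ k ∈ Finset.range (n + 1), (dl n + k)

lemma dl_pos (n : ℕ) : 0 < dl n := by
  unfold dl; split_ifs <;> norm_num

lemma lamK_ne_zero (n : ℕ) : lamK n ≠ 0 := by
  have h := dl_pos n
  have : ∏ k ∈ Finset.range (n + 1), (dl n + (k : ℝ)) ≠ 0 :=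
    Finset.prod_ne_zero_iff.2 fun k _ => by positivity
  unfold lamK
  have := Nat.factorial_ne_zero n
  positivity

lemma KK_cubSpan (n : ℕ) : CubSpan (fun φ => KK n (dl n) (3 * φ / 2)) n (lamK n) := by
  obtain ⟨κ, h0, e⟩ := KK_sinSpan n (dl n) (dl_add_ne_zero n)
  have h : ∀ i, CubSpan (fun φ => if i ≤ n then κ i * Real.sin ((dl n + n - 2 * i) * (3 * φ / 2))
      else 0) n (if i = 0 then lamK n else 0) := by
    intro i
    by_cases hi : i ≤ n
    · simp only [if_pos hi]
      have := (sin_freq_cubSpan n i hi).smul (κ i)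
      convert this using 1
      by_cases h : i = 0
      · subst h; simp [h0, lamK]
      · simp [h]
    · simp only [if_neg hi]
      rw [if_neg (by omega)]
      exact ⟨fun _ => 0, rfl, fun φ => by simp⟩
  have := CubSpan.sum h (n + 1)
  rw [Finset.sum_ite_eq' (Finset.range (n + 1)) 0 (fun _ => lamK n),
    if_pos (Finset.mem_range.2 (by omega))] at this
  refine this.congr fun φ => ?_
  rw [e]
  exact Finset.sum_congr rfl fun i hi => by
    rw [if_pos (by have := Finset.mem_range.1 hi; omega)]

end

section
open Filter Topology

lemma X_sub_pow_dvd_of_bound (n : ℕ) (b : ℝ) (P : Polynomial ℝ) (c : ℝ)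
    (h : ∀ᶠ s in 𝓝[<] b, |P.eval s| ≤ c * |s - b| ^ n) :
    (Polynomial.X - Polynomial.C b) ^ n ∣ P := by
  induction n generalizing P with
  | zero => simp
  | succ n ih =>
    have h0 : P.eval b = 0 := by
      have h1 : Tendsto (fun s => P.eval s) (𝓝[<] b) (𝓝 (P.eval b)) :=
        P.continuous.continuousWithinAt
      have h2 : Tendsto (fun s : ℝ => c * |s - b| ^ (n + 1)) (𝓝[<] b) (𝓝 0) := by
        have : Continuous (fun s : ℝ => c * |s - b| ^ (n + 1)) := by fun_prop
        have := this.continuousWithinAt (s := Set.Iio b) (x := b)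
        simpa [ContinuousWithinAt] using this
      exact tendsto_nhds_unique h1 (squeeze_zero_norm' (by simpa using h) h2)
    obtain ⟨R, rfl⟩ := Polynomial.dvd_iff_isRoot.2 h0
    rw [pow_succ']
    refine mul_dvd_mul_left _ (ih R ?_)
    filter_upwards [h, self_mem_nhdsWithin] with s hs hsb
    have hpos : 0 < |s - b| := abs_pos.2 (sub_ne_zero.2 (ne_of_lt hsb))
    rw [Polynomial.eval_mul, abs_mul, pow_succ, ← mul_assoc] at hs
    simp only [Polynomial.eval_sub, Polynomial.eval_X, Polynomial.eval_C] at hs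
    rw [mul_comm] at hs
    exact le_of_mul_le_mul_right hs hpos

lemma abs_KK_le (n : ℕ) (δ : ℝ) {T : ℝ} (hT : 0 ≤ T) :
    |KK n δ T| ≤ (T ^ 2 / 2) ^ n * T := by
  have := intervalIntegral.norm_integral_le_of_norm_le_const (a := 0) (b := T)
    (f := fun t => (Real.cos t - Real.cos T) ^ n * Real.cos (δ * t)) (C := (T ^ 2 / 2) ^ n) ?_
  · simpa [KK, abs_of_nonneg hT] using this
  · intro t ht
    rw [Set.uIoc_of_le hT] at ht
    have h1 : |Real.cos t - Real.cos T| ≤ T ^ 2 / 2 := by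
      have a1 := Real.one_sub_sq_div_two_le_cos (x := T)
      have a2 := Real.one_sub_sq_div_two_le_cos (x := t)
      have a3 := Real.cos_le_one T
      have a4 := Real.cos_le_one t
      have : t ^ 2 ≤ T ^ 2 := by nlinarith [ht.1, ht.2]
      rw [abs_le]; constructor <;> linarith
    rw [norm_mul, norm_pow, Real.norm_eq_abs, Real.norm_eq_abs]
    calc _ ≤ (T ^ 2 / 2) ^ n * 1 := by
          gcongr
          exact Real.abs_cos_le_one _
      _ = _ := mul_one _

/-- The basis polynomials `X^{j mod 2} (X³ - 3 X)^{⌊j/2⌋}`. -/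
def cubP (j : ℕ) : Polynomial ℝ :=
  Polynomial.X ^ (j % 2) * (Polynomial.X ^ 3 - 3 * Polynomial.X) ^ (j / 2)

lemma cubP_eval_cos (j : ℕ) (φ : ℝ) : (cubP j).eval (2 * Real.cos φ)
    = (2 * Real.cos φ) ^ (j % 2) * (2 * Real.cos (3 * φ)) ^ (j / 2) := by
  have : (2 * Real.cos φ) ^ 3 - 3 * (2 * Real.cos φ) = 2 * Real.cos (3 * φ) := by
    rw [Real.cos_three_mul]; ring
  simp [cubP, this]

lemma exists_rho (n : ℕ) : ∃ Q : Polynomial ℝ,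
    (∃ a : ℕ → ℝ, (Polynomial.X - Polynomial.C 2) ^ n * Q
      = cubP n + ∑ k ∈ Finset.range n, Polynomial.C (a k) * cubP k) ∧
    ∀ φ, KK n (dl n) (3 * φ / 2)
      = lamK n * Real.sin φ * ((2 * Real.cos φ - 2) ^ n * Q.eval (2 * Real.cos φ)) := by
  obtain ⟨a, ha, e⟩ := KK_cubSpan n
  have hl := lamK_ne_zero n
  set P : Polynomial ℝ := cubP n + ∑ k ∈ Finset.range n, Polynomial.C (a k / lamK n) * cubP k
    with hP
  have hPe : ∀ φ, KK n (dl n) (3 * φ / 2) = lamK n * Real.sin φ * P.eval (2 * Real.cos φ) := by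
    intro φ
    have e' := e φ
    beta_reduce at e'
    rw [e', Finset.sum_range_succ, ha, hP, Polynomial.eval_add, Polynomial.eval_finsetSum]
    simp only [Polynomial.eval_mul, Polynomial.eval_C, cubP_eval_cos]
    rw [mul_comm (lamK n) (Real.sin φ), mul_assoc (Real.sin φ)]
    congr 1
    rw [add_comm, mul_add, Finset.mul_sum]
    congr 1
    exact Finset.sum_congr rfl fun k _ => by field_simp
  have hd : (Polynomial.X - Polynomial.C 2) ^ n ∣ P := by
    refine X_sub_pow_dvd_of_bound n 2 P
      ((1 / |lamK n|) * (3 * (9 / 8) ^ n * (5 / 2) ^ n)) ?_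
    have hI : Set.Ioo (1 : ℝ) 2 ∈ 𝓝[<] (2 : ℝ) := Ioo_mem_nhdsLT (by norm_num)
    filter_upwards [hI] with s hs
    set φ := Real.arccos (s / 2) with hφ
    have hc : 2 * Real.cos φ = s := by
      rw [hφ, Real.cos_arccos (by linarith [hs.1]) (by linarith [hs.2])]; ring
    have h0 : 0 < φ := Real.arccos_pos.2 (by linarith [hs.2])
    have hle : φ ≤ Real.pi / 2 := Real.arccos_le_pi_div_two.2 (by linarith [hs.1])
    have hsin : 2 / Real.pi * φ ≤ Real.sin φ := Real.mul_le_sin h0.le hle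
    have hpi := Real.pi_gt_three
    have hpi' := Real.pi_lt_d2
    have hsin' : φ / 2 ≤ Real.sin φ := by
      refine le_trans ?_ hsin
      rw [div_mul_eq_mul_div, le_div_iff₀ Real.pi_pos]
      nlinarith
    have hphi2 : φ ^ 2 ≤ (5 / 2) * |s - 2| := by
      have h2 := Real.mul_le_sin (x := φ / 2) (by positivity) (by linarith)
      have h3 : φ / Real.pi ≤ Real.sin (φ / 2) := by
        convert h2 using 1; field_simp
      have h4 : s = 2 - 4 * Real.sin (φ / 2) ^ 2 := by
        rw [← hc]
        have : Real.cos φ = 2 * Real.cos (φ / 2) ^ 2 - 1 := by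
          rw [← Real.cos_two_mul]; congr 1; ring
        rw [this]
        have := Real.cos_sq_add_sin_sq (φ / 2)
        nlinarith
      have h5 : φ ≤ Real.pi * Real.sin (φ / 2) := by
        rwa [div_le_iff₀ Real.pi_pos, mul_comm] at h3
      rw [h4]
      rw [show (2 : ℝ) - 4 * Real.sin (φ / 2) ^ 2 - 2 = -(4 * Real.sin (φ / 2) ^ 2) by ring,
        abs_neg, abs_of_nonneg (by positivity)]
      have h6 : φ ^ 2 ≤ (Real.pi * Real.sin (φ / 2)) ^ 2 := by gcongr
      have : Real.pi ^ 2 ≤ 10 := by nlinarith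
      nlinarith [sq_nonneg (Real.sin (φ / 2))]
    have hK := abs_KK_le n (dl n) (T := 3 * φ / 2) (by positivity)
    rw [hPe, hc, abs_mul, abs_mul, abs_of_pos (by linarith : 0 < Real.sin φ)] at hK
    have hl' : 0 < |lamK n| := abs_pos.2 hl
    have key : |lamK n| * (φ / 2) * |P.eval s| ≤ ((9 / 8) ^ n * (5 / 2) ^ n * |s - 2| ^ n)
        * (3 * (φ / 2)) := by
      calc |lamK n| * (φ / 2) * |P.eval s| ≤ |lamK n| * Real.sin φ * |P.eval s| := by gcongr
        _ ≤ ((3 * φ / 2) ^ 2 / 2) ^ n * (3 * φ / 2) := hK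
        _ = ((9 / 8) * φ ^ 2) ^ n * (3 * (φ / 2)) := by ring
        _ ≤ ((9 / 8) * ((5 / 2) * |s - 2|)) ^ n * (3 * (φ / 2)) := by gcongr
        _ = _ := by rw [mul_pow, mul_pow]; ring
    rw [one_div, mul_assoc, ← div_eq_inv_mul, le_div_iff₀ hl']
    refine le_of_mul_le_mul_right ?_ (half_pos h0)
    calc _ = |lamK n| * (φ / 2) * |P.eval s| := by ring
      _ ≤ _ := key
      _ = _ := by ring
  obtain ⟨Q, hQ⟩ := hd
  refine ⟨Q, ⟨_, hQ.symm.trans hP⟩, fun φ => ?_⟩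
  rw [hPe, hQ]
  simp

end

section
open Filter Topology

/-- The moments `∫₀ᵀ (cos t - cos T)ⁿ cos (t/2) sin²ᵏ (t/2) dt`. -/
def Mom (n k : ℕ) (T : ℝ) : ℝ :=
  ∫ t in (0 : ℝ)..T, (Real.cos t - Real.cos T) ^ n * (Real.cos (t / 2) * Real.sin (t / 2) ^ (2 * k))

lemma Mom_intervalIntegrable (n k : ℕ) (T : ℝ) : IntervalIntegrable (fun t =>
    (Real.cos t - Real.cos T) ^ n * (Real.cos (t / 2) * Real.sin (t / 2) ^ (2 * k)))
    MeasureTheory.volume 0 T :=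
  Continuous.intervalIntegrable (by fun_prop) _ _

lemma cos_sub_cos_half (t T : ℝ) : Real.cos t - Real.cos T
    = 2 * (Real.sin (T / 2) ^ 2 - Real.sin (t / 2) ^ 2) := by
  have h : ∀ y : ℝ, Real.cos y = 1 - 2 * Real.sin (y / 2) ^ 2 := fun y => by
    have := Real.cos_sq_add_sin_sq (y / 2)
    have h2 : Real.cos y = 2 * Real.cos (y / 2) ^ 2 - 1 := by
      rw [← Real.cos_two_mul]; congr 1; ring
    rw [h2]; linarith
  rw [h t, h T]; ring

lemma Mom_succ_right (n k : ℕ) (T : ℝ) :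
    (2 * n + 2 * k + 3) * Mom n (k + 1) T = (2 * k + 1) * Real.sin (T / 2) ^ 2 * Mom n k T := by
  have hd : ∀ t ∈ Set.uIcc (0 : ℝ) T, HasDerivAt
      (fun t => (Real.cos t - Real.cos T) ^ (n + 1) * Real.sin (t / 2) ^ (2 * k + 1))
      ((2 * k + 1) * Real.sin (T / 2) ^ 2 * ((Real.cos t - Real.cos T) ^ n
        * (Real.cos (t / 2) * Real.sin (t / 2) ^ (2 * k)))
        - (2 * n + 2 * k + 3) * ((Real.cos t - Real.cos T) ^ n
        * (Real.cos (t / 2) * Real.sin (t / 2) ^ (2 * (k + 1))))) t := by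
    intro t _
    have h1 := ((Real.hasDerivAt_cos t).sub_const (Real.cos T)).pow (n + 1)
    have h2 := ((Real.hasDerivAt_sin (t / 2)).comp t ((hasDerivAt_id t).div_const 2)).pow (2 * k + 1)
    have h3 := h1.mul h2
    refine h3.congr_deriv ?_
    simp only [Function.comp, id, Pi.pow_apply, Nat.add_sub_cancel]
    have hs : Real.sin t = 2 * Real.sin (t / 2) * Real.cos (t / 2) := by
      rw [← Real.sin_two_mul]; congr 1; ring
    have hc := cos_sub_cos_half t T
    rw [hs, pow_succ (Real.cos t - Real.cos T) n]
    push_cast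
    have e1 : Real.sin (t / 2) ^ (2 * (k + 1))
      = Real.sin (t / 2) ^ (2 * k) * Real.sin (t / 2) ^ 2 := by rw [mul_add, pow_add]
    rw [e1]
    have : Real.sin (T / 2) ^ 2 = (Real.cos t - Real.cos T) / 2 + Real.sin (t / 2) ^ 2 := by
      rw [hc]; ring
    rw [this]
    generalize (Real.cos t - Real.cos T) ^ n = A
    generalize Real.cos t - Real.cos T = B
    rw [pow_succ (Real.sin (t / 2)) (2 * k)]
    ring
  have hI := intervalIntegral.integral_eq_sub_of_hasDerivAt hd
    (((Mom_intervalIntegrable n k T).const_mul _).sub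
      ((Mom_intervalIntegrable n (k + 1) T).const_mul _))
  rw [intervalIntegral.integral_sub ((Mom_intervalIntegrable n k T).const_mul _)
      ((Mom_intervalIntegrable n (k + 1) T).const_mul _),
    intervalIntegral.integral_const_mul, intervalIntegral.integral_const_mul] at hI
  simp at hI
  unfold Mom
  linarith

lemma Mom_succ_left (n : ℕ) (T : ℝ) :
    (2 * n + 3) * Mom (n + 1) 0 T = 4 * Real.sin (T / 2) ^ 2 * (n + 1) * Mom n 0 T := by
  have h : Mom (n + 1) 0 T = 2 * Real.sin (T / 2) ^ 2 * Mom n 0 T - 2 * Mom n 1 T := by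
    unfold Mom
    rw [← intervalIntegral.integral_const_mul, ← intervalIntegral.integral_const_mul,
      ← intervalIntegral.integral_sub ((Mom_intervalIntegrable n 0 T).const_mul _)
      ((Mom_intervalIntegrable n 1 T).const_mul _)]
    congr 1
    ext t
    rw [pow_succ, cos_sub_cos_half t T]
    ring
  have h2 := Mom_succ_right n 0 T
  push_cast at h2
  simp only [zero_add, mul_zero, one_mul, add_zero] at h2
  rw [h]
  linear_combination (-2) * h2

lemma Mom_zero (T : ℝ) : Mom 0 0 T = 2 * Real.sin (T / 2) := by
  unfold Mom
  simp only [pow_zero, one_mul, mul_zero, mul_one]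
  rw [intervalIntegral.integral_comp_div (fun t => Real.cos t) (by norm_num : (2 : ℝ) ≠ 0)]
  simp

lemma Mom_closed (n : ℕ) (T : ℝ) : Mom n 0 T * ∏ k ∈ Finset.range (n + 1), ((1 / 2 : ℝ) + k)
    = Real.sin (T / 2) ^ (2 * n + 1) * 2 ^ n * n.factorial := by
  induction n with
  | zero => simp [Mom_zero]; ring
  | succ n ih =>
    rw [Finset.prod_range_succ, Nat.factorial_succ]
    have h := Mom_succ_left n T
    generalize ∏ k ∈ Finset.range (n + 1), ((1 / 2 : ℝ) + k) = Q at *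
    generalize Mom (n + 1) 0 T = M' at *
    generalize Mom n 0 T = M at *
    rw [show 2 * (n + 1) + 1 = 2 * n + 1 + 2 by ring, pow_add _ (2 * n + 1), pow_succ]
    push_cast
    linear_combination (Q / 2) * h + (2 * Real.sin (T / 2) ^ 2 * (n + 1)) * ih

lemma abs_cos_sub_le (u : ℝ) : |Real.cos u - (1 - u ^ 2 / 2)| ≤ 3 * u ^ 4 := by
  by_cases h : |u| ≤ 1
  · refine (Real.cos_bound h).trans ?_
    rw [Even.pow_abs (by decide)]
    have : 0 ≤ u ^ 4 := by positivity
    linarith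
  · push Not at h
    have h2 : 1 < u ^ 2 := by rw [← sq_abs]; nlinarith
    have h4 : u ^ 4 = u ^ 2 * u ^ 2 := by ring
    have := Real.cos_le_one u
    have := Real.neg_one_le_cos u
    rw [abs_le]
    constructor <;> nlinarith

lemma abs_cos_twist_le {d t : ℝ} (hd : 0 ≤ d) (hd1 : d ≤ 1) :
    |Real.cos (d * t) - Real.cos (t / 2)
      - (1 / 2 - 2 * d ^ 2) * (Real.cos (t / 2) * Real.sin (t / 2) ^ 2)| ≤ 7 * t ^ 4 := by
  have h1 := abs_cos_sub_le (d * t)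
  have h2 := abs_cos_sub_le (t / 2)
  have h3 := abs_cos_sub_le t
  have h4 : Real.sin (t / 2) ^ 2 = (1 - Real.cos t) / 2 := by
    have := cos_sub_cos_half 0 t
    simp at this
    linarith
  have h5 : 0 ≤ 1 - Real.cos (t / 2) := by linarith [Real.cos_le_one (t / 2)]
  have h6 : 1 - Real.cos (t / 2) ≤ t ^ 2 / 8 := by
    linarith [Real.one_sub_sq_div_two_le_cos (x := t / 2)]
  have h7 : Real.sin (t / 2) ^ 2 ≤ t ^ 2 / 4 := by
    rw [h4]; linarith [Real.one_sub_sq_div_two_le_cos (x := t)]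
  have h8 : Real.sin (t / 2) ^ 2 * (1 - Real.cos (t / 2)) ≤ t ^ 4 / 32 := by
    calc _ ≤ t ^ 2 / 4 * (t ^ 2 / 8) := by gcongr
      _ = _ := by ring
  have h9 : 0 ≤ Real.sin (t / 2) ^ 2 * (1 - Real.cos (t / 2)) := by positivity
  have hc : |(1 / 2 - 2 * d ^ 2)| ≤ 3 / 2 := by
    rw [abs_le]; constructor <;> nlinarith
  have hd4 : (d * t) ^ 4 ≤ t ^ 4 := by
    rw [mul_pow]
    have : d ^ 4 ≤ 1 := pow_le_one₀ hd hd1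
    have : 0 ≤ t ^ 4 := by positivity
    nlinarith
  have key : Real.cos (d * t) - Real.cos (t / 2)
      - (1 / 2 - 2 * d ^ 2) * (Real.cos (t / 2) * Real.sin (t / 2) ^ 2)
      = (Real.cos (d * t) - (1 - (d * t) ^ 2 / 2)) - (Real.cos (t / 2) - (1 - (t / 2) ^ 2 / 2))
      + (1 / 2 - 2 * d ^ 2) * ((Real.cos t - (1 - t ^ 2 / 2)) / 2
        + Real.sin (t / 2) ^ 2 * (1 - Real.cos (t / 2))) := by
    have : Real.sin (t / 2) ^ 2 * (1 - Real.cos (t / 2)) = (1 - Real.cos t) / 2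
      - Real.cos (t / 2) * Real.sin (t / 2) ^ 2 := by rw [mul_sub, mul_one, h4]; ring
    rw [this]
    ring
  rw [key]
  have hE : |(Real.cos t - (1 - t ^ 2 / 2)) / 2 + Real.sin (t / 2) ^ 2 * (1 - Real.cos (t / 2))|
      ≤ 3 / 2 * t ^ 4 + t ^ 4 / 32 := by
    refine (abs_add_le _ _).trans (add_le_add ?_ ?_)
    · rw [abs_div, abs_of_pos (by norm_num : (0 : ℝ) < 2)]; linarith
    · rwa [abs_of_nonneg h9]
  have hP := mul_le_mul hc hE (abs_nonneg _) (by norm_num)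
  rw [← abs_mul] at hP
  refine (abs_add_le _ _).trans ?_
  refine (add_le_add (abs_sub _ _) hP).trans ?_
  have h10 : (t / 2) ^ 4 = t ^ 4 / 16 := by ring
  rw [h10] at h2
  have : 0 ≤ t ^ 4 := by positivity
  linarith

end

section
open Filter Topology

lemma abs_KK_sub_Mom_le (n : ℕ) {d T : ℝ} (hd : 0 ≤ d) (hd1 : d ≤ 1) (hT : 0 ≤ T)
    (hT1 : T < Real.pi) :
    |KK n d T - Mom n 0 T - (1 / 2 - 2 * d ^ 2) * Mom n 1 T|
      ≤ 700 / Real.cos (T / 2) * Mom n 2 T := by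
  have hcT : 0 < Real.cos (T / 2) := Real.cos_pos_of_mem_Ioo ⟨by linarith, by linarith⟩
  have hK : IntervalIntegrable (fun t => (Real.cos t - Real.cos T) ^ n * Real.cos (d * t))
      MeasureTheory.volume 0 T := Continuous.intervalIntegrable (by fun_prop) _ _
  have h0 := Mom_intervalIntegrable n 0 T
  have h1 := Mom_intervalIntegrable n 1 T
  have h2 := Mom_intervalIntegrable n 2 T
  unfold KK Mom
  rw [← intervalIntegral.integral_const_mul, ← intervalIntegral.integral_const_mul,
    ← intervalIntegral.integral_sub hK h0, ← intervalIntegral.integral_sub (hK.sub h0)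
      (h1.const_mul _), ← Real.norm_eq_abs]
  refine intervalIntegral.norm_integral_le_of_norm_le hT ?_ (h2.const_mul _)
  filter_upwards with t ht
  have ht0 : 0 ≤ t := ht.1.le
  have htπ : t ≤ Real.pi := ht.2.trans hT1.le
  have hcos : 0 ≤ Real.cos t - Real.cos T :=
    sub_nonneg.2 (Real.cos_le_cos_of_nonneg_of_le_pi ht0 hT1.le ht.2)
  have hhalf : Real.cos (T / 2) ≤ Real.cos (t / 2) :=
    Real.cos_le_cos_of_nonneg_of_le_pi (by linarith) (by linarith) (by linarith [ht.2])
  have hs : t ≤ Real.pi * Real.sin (t / 2) := by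
    have h2 := Real.mul_le_sin (x := t / 2) (by linarith) (by linarith)
    have h3 : t / Real.pi ≤ Real.sin (t / 2) := by
      convert h2 using 1; field_simp
    rwa [div_le_iff₀ Real.pi_pos, mul_comm] at h3
  have ht4 : t ^ 4 ≤ 100 * Real.sin (t / 2) ^ 4 := by
    have h4 : t ^ 4 ≤ (Real.pi * Real.sin (t / 2)) ^ 4 := by gcongr
    have h5 : Real.pi ^ 4 ≤ 3.15 ^ 4 := by
      gcongr
      exact Real.pi_lt_d2.le
    have h6 : Real.pi ^ 4 ≤ 100 := h5.trans (by norm_num)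
    rw [mul_pow] at h4
    refine h4.trans ?_
    gcongr
  have hb := abs_cos_twist_le (t := t) hd hd1
  rw [Real.norm_eq_abs]
  have e : (Real.cos t - Real.cos T) ^ n * Real.cos (d * t)
      - (Real.cos t - Real.cos T) ^ n * (Real.cos (t / 2) * Real.sin (t / 2) ^ (2 * 0))
      - (1 / 2 - 2 * d ^ 2) * ((Real.cos t - Real.cos T) ^ n
        * (Real.cos (t / 2) * Real.sin (t / 2) ^ (2 * 1)))
      = (Real.cos t - Real.cos T) ^ n * (Real.cos (d * t) - Real.cos (t / 2)
      - (1 / 2 - 2 * d ^ 2) * (Real.cos (t / 2) * Real.sin (t / 2) ^ 2)) := by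
    rw [mul_zero, pow_zero, mul_one 2]; ring
  rw [e, abs_mul, abs_of_nonneg (pow_nonneg hcos n)]
  calc _ ≤ (Real.cos t - Real.cos T) ^ n * (700 * Real.sin (t / 2) ^ 4) := by
        gcongr
        linarith
    _ ≤ (Real.cos t - Real.cos T) ^ n * (700 * Real.sin (t / 2) ^ 4)
        * (Real.cos (t / 2) / Real.cos (T / 2)) := by
        refine le_mul_of_one_le_right (by positivity) ?_
        rwa [le_div_iff₀ hcT, one_mul]
    _ = _ := by
        rw [show 2 * 2 = 4 by norm_num]
        ring

lemma Mom_one (n : ℕ) (T : ℝ) :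
    Mom n 1 T = Real.sin (T / 2) ^ 2 / (2 * n + 3) * Mom n 0 T := by
  have h := Mom_succ_right n 0 T
  have hn : (2 * (n : ℝ) + 3) ≠ 0 := by positivity
  simp only [Nat.cast_zero, mul_zero, zero_add, add_zero, one_mul] at h
  rw [div_mul_eq_mul_div, eq_div_iff hn]
  linarith

lemma Mom_two (n : ℕ) (T : ℝ) :
    Mom n 2 T = 3 * Real.sin (T / 2) ^ 4 / ((2 * n + 3) * (2 * n + 5)) * Mom n 0 T := by
  have h := Mom_succ_right n 1 T
  rw [Mom_one] at h
  have hn : (2 * (n : ℝ) + 3) ≠ 0 := by positivity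
  have hn' : (2 * (n : ℝ) + 5) ≠ 0 := by positivity
  have : (2 * (n : ℝ) + 5) * Mom n 2 T = 3 * Real.sin (T / 2) ^ 2
      * (Real.sin (T / 2) ^ 2 / (2 * n + 3) * Mom n 0 T) := by
    push_cast at h
    linear_combination h
  field_simp at this ⊢
  linear_combination this

/-- Ratio of Pochhammer symbols. -/
def gR (n : ℕ) : ℝ :=
  (∏ k ∈ Finset.range (n + 1), (dl n + k)) / ∏ k ∈ Finset.range (n + 1), ((1 / 2 : ℝ) + k)

/-- `sin (3 φ / 4) / sin (φ / 2)`, continuously extended. -/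
def hR (φ : ℝ) : ℝ := 3 / 2 * Real.sinc (3 * φ / 4) / Real.sinc (φ / 2)

lemma hR_eq {φ : ℝ} (h0 : φ ≠ 0) : hR φ = Real.sin (3 * φ / 4) / Real.sin (φ / 2) := by
  rw [hR, Real.sinc_of_ne_zero (by simpa using h0), Real.sinc_of_ne_zero (by simpa using h0)]
  field_simp
  ring

lemma Mom_pos (n : ℕ) {T : ℝ} (hT : 0 < T) (hT1 : T < Real.pi) : 0 < Mom n 0 T := by
  have hS : 0 < Real.sin (T / 2) := Real.sin_pos_of_pos_of_lt_pi (by linarith) (by linarith)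
  have h := Mom_closed n T
  have hP : 0 < ∏ k ∈ Finset.range (n + 1), ((1 / 2 : ℝ) + k) :=
    Finset.prod_pos fun k _ => by positivity
  have : 0 < Real.sin (T / 2) ^ (2 * n + 1) * 2 ^ n * n.factorial := by
    have := n.factorial_pos
    positivity
  rw [← h] at this
  exact pos_of_mul_pos_left this hP.le

lemma dl_le_one (n : ℕ) : dl n ≤ 1 := by
  unfold dl; split_ifs <;> norm_num

lemma abs_beta_le (n : ℕ) {T : ℝ} (hT : 0 < T) (hT1 : T < Real.pi) :
    |KK n (dl n) T / Mom n 0 T - 1 - (1 / 2 - 2 * dl n ^ 2) * Real.sin (T / 2) ^ 2 / (2 * n + 3)|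
      ≤ 2100 * Real.sin (T / 2) ^ 4 / Real.cos (T / 2) / (2 * n + 3) ^ 2 := by
  have hM := Mom_pos n hT hT1
  have hcT : 0 < Real.cos (T / 2) := Real.cos_pos_of_mem_Ioo ⟨by linarith, by linarith⟩
  have h := abs_KK_sub_Mom_le n (dl_pos n).le (dl_le_one n) hT.le hT1
  rw [Mom_one, Mom_two] at h
  have e : KK n (dl n) T / Mom n 0 T - 1
      - (1 / 2 - 2 * dl n ^ 2) * Real.sin (T / 2) ^ 2 / (2 * n + 3)
      = (KK n (dl n) T - Mom n 0 T - (1 / 2 - 2 * dl n ^ 2)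
        * (Real.sin (T / 2) ^ 2 / (2 * n + 3) * Mom n 0 T)) / Mom n 0 T := by
    have hn : (2 * (n : ℝ) + 3) ≠ 0 := by positivity
    field_simp
  rw [e, abs_div, abs_of_pos hM, div_le_iff₀ hM]
  refine h.trans ?_
  rw [← mul_assoc]
  gcongr ?_ * _
  have : 3 * Real.sin (T / 2) ^ 4 / ((2 * n + 3) * (2 * n + 5))
      ≤ 3 * Real.sin (T / 2) ^ 4 / (2 * n + 3) ^ 2 := by
    rw [sq]
    gcongr
    norm_num
  calc _ ≤ 700 / Real.cos (T / 2) * (3 * Real.sin (T / 2) ^ 4 / (2 * n + 3) ^ 2) := by gcongr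
    _ = _ := by ring

lemma hR_continuousAt : ContinuousAt hR 0 := by
  unfold hR
  refine ContinuousAt.div ?_ ?_ ?_
  · exact (by fun_prop : Continuous fun φ : ℝ => 3 / 2 * Real.sinc (3 * φ / 4)).continuousAt
  · exact (by fun_prop : Continuous fun φ : ℝ => Real.sinc (φ / 2)).continuousAt
  · simp

section

variable {n : ℕ} {Q : Polynomial ℝ} (hQ : ∀ φ, KK n (dl n) (3 * φ / 2)
      = lamK n * Real.sin φ * ((2 * Real.cos φ - 2) ^ n * Q.eval (2 * Real.cos φ)))

include hQ

lemma rho_eq_of_pos {φ : ℝ} (h0 : 0 < φ) (h1 : φ < 2 * Real.pi / 3) :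
    Q.eval (2 * Real.cos φ) = KK n (dl n) (3 * φ / 2) / Mom n 0 (3 * φ / 2)
      * (hR φ ^ (2 * n + 1) * gR n / (2 * Real.cos (φ / 2))) := by
  have hM := Mom_pos n (T := 3 * φ / 2) (by linarith) (by linarith)
  have hc : 0 < Real.cos (φ / 2) := Real.cos_pos_of_mem_Ioo ⟨by linarith, by linarith⟩
  have hs : 0 < Real.sin (φ / 2) := Real.sin_pos_of_pos_of_lt_pi (by linarith) (by linarith)
  have hP : 0 < ∏ k ∈ Finset.range (n + 1), ((1 / 2 : ℝ) + k) :=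
    Finset.prod_pos fun k _ => by positivity
  have hd := dl_pos n
  have hPd : 0 < ∏ k ∈ Finset.range (n + 1), (dl n + k) :=
    Finset.prod_pos fun k _ => by positivity
  have hf : (0 : ℝ) < n.factorial := by exact_mod_cast n.factorial_pos
  have hcl := Mom_closed n (3 * φ / 2)
  have hcos : 2 * Real.cos φ - 2 = -4 * Real.sin (φ / 2) ^ 2 := by
    have := cos_sub_cos_half φ 0
    simp at this
    linarith
  have hsin : Real.sin φ = 2 * Real.sin (φ / 2) * Real.cos (φ / 2) := by
    rw [← Real.sin_two_mul]; congr 1; ring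
  have hK := hQ φ
  rw [hcos, hsin, lamK] at hK
  rw [hK, hR_eq h0.ne', gR]
  rw [show 3 * φ / 2 / 2 = 3 * φ / 4 by ring] at hcl
  have h4 : ((-1 / 2 : ℝ)) ^ n * (-4 * Real.sin (φ / 2) ^ 2) ^ n
      = 2 ^ n * Real.sin (φ / 2) ^ (2 * n) := by
    rw [← mul_pow, pow_mul, ← mul_pow]; congr 1; ring
  generalize Real.sin (3 * φ / 4) = S at *
  rw [div_pow S, pow_succ (Real.sin (φ / 2)) (2 * n)]
  generalize (-4 * Real.sin (φ / 2) ^ 2) ^ n = A at *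
  have hs2 : 0 < Real.sin (φ / 2) ^ (2 * n) := by positivity
  generalize Real.sin (φ / 2) ^ (2 * n) = Bb at *
  generalize ∏ k ∈ Finset.range (n + 1), ((1 / 2 : ℝ) + k) = P1 at *
  generalize ∏ k ∈ Finset.range (n + 1), (dl n + k) = P2 at *
  generalize Mom n 0 (3 * φ / 2) = M at *
  generalize (n.factorial : ℝ) = f at *
  generalize Polynomial.eval (2 * Real.cos φ) Q = q
  have hSn : S ^ (2 * n + 1) = M * P1 / (2 ^ n * f) := by
    rw [eq_div_iff (by positivity)]; linarith
  rw [hSn]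
  have h2n : (2 : ℝ) ^ n ≠ 0 := by positivity
  have e : (-1 / 2 : ℝ) ^ n * f / P2 * (2 * Real.sin (φ / 2) * Real.cos (φ / 2)) * (A * q)
      = (2 ^ n * Bb) * f / P2 * (2 * Real.sin (φ / 2) * Real.cos (φ / 2)) * q := by
    rw [← h4]; ring
  rw [e]
  field_simp

lemma rho_two : Q.eval 2 = hR 0 ^ (2 * n + 1) * gR n / 2 := by
  have h1 : Tendsto (fun φ => Q.eval (2 * Real.cos φ)) (𝓝[>] 0) (𝓝 (Q.eval 2)) := by
    have : Continuous fun φ => Q.eval (2 * Real.cos φ) := Q.continuous.comp (by fun_prop)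
    have := this.continuousWithinAt (s := Set.Ioi 0) (x := 0)
    simpa [ContinuousWithinAt] using this
  have hB : Tendsto (fun φ => KK n (dl n) (3 * φ / 2) / Mom n 0 (3 * φ / 2)) (𝓝[>] 0) (𝓝 1) := by
    have hl : Tendsto (fun φ => (1 / 2 - 2 * dl n ^ 2) * Real.sin (3 * φ / 2 / 2) ^ 2 / (2 * n + 3))
        (𝓝[>] 0) (𝓝 0) := by
      have : Continuous fun φ => (1 / 2 - 2 * dl n ^ 2) * Real.sin (3 * φ / 2 / 2) ^ 2
        / (2 * n + 3) := by fun_prop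
      have := this.continuousWithinAt (s := Set.Ioi 0) (x := 0)
      simpa [ContinuousWithinAt] using this
    have hr : Tendsto (fun φ => 2100 * Real.sin (3 * φ / 2 / 2) ^ 4 / Real.cos (3 * φ / 2 / 2)
        / (2 * n + 3) ^ 2) (𝓝[>] 0) (𝓝 0) := by
      have : ContinuousAt (fun φ => 2100 * Real.sin (3 * φ / 2 / 2) ^ 4 / Real.cos (3 * φ / 2 / 2)
        / (2 * (n : ℝ) + 3) ^ 2) 0 := by
        refine ContinuousAt.div_const (ContinuousAt.div ?_ ?_ (by simp)) _
        · exact (by fun_prop : Continuous fun φ : ℝ =>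
            2100 * Real.sin (3 * φ / 2 / 2) ^ 4).continuousAt
        · exact (by fun_prop : Continuous fun φ : ℝ => Real.cos (3 * φ / 2 / 2)).continuousAt
      have := this.continuousWithinAt (s := Set.Ioi 0)
      simpa [ContinuousWithinAt] using this
    have h3 : Tendsto (fun φ => KK n (dl n) (3 * φ / 2) / Mom n 0 (3 * φ / 2) - 1
        - (1 / 2 - 2 * dl n ^ 2) * Real.sin (3 * φ / 2 / 2) ^ 2 / (2 * n + 3)) (𝓝[>] 0) (𝓝 0) := by
      refine squeeze_zero_norm' ?_ hr
      have hI : Set.Ioo (0 : ℝ) (2 * Real.pi / 3) ∈ 𝓝[>] (0 : ℝ) :=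
        Ioo_mem_nhdsGT (by positivity)
      filter_upwards [hI] with φ hφ
      exact abs_beta_le n (by linarith [hφ.1]) (by linarith [hφ.2])
    have := (h3.add hl).add_const 1
    simpa using this
  have hH : Tendsto (fun φ => hR φ ^ (2 * n + 1) * gR n / (2 * Real.cos (φ / 2))) (𝓝[>] 0)
      (𝓝 (hR 0 ^ (2 * n + 1) * gR n / 2)) := by
    have : ContinuousAt (fun φ => hR φ ^ (2 * n + 1) * gR n / (2 * Real.cos (φ / 2))) 0 := by
      refine ContinuousAt.div ((hR_continuousAt.pow _).mul_const _) ?_ (by simp)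
      exact (by fun_prop : Continuous fun φ : ℝ => 2 * Real.cos (φ / 2)).continuousAt
    have := this.continuousWithinAt (s := Set.Ioi 0)
    simpa [ContinuousWithinAt] using this
  have h2 := hB.mul hH
  rw [one_mul] at h2
  refine tendsto_nhds_unique_of_eventuallyEq h1 h2 ?_
  have hI : Set.Ioo (0 : ℝ) (2 * Real.pi / 3) ∈ 𝓝[>] (0 : ℝ) := Ioo_mem_nhdsGT (by positivity)
  filter_upwards [hI] with φ hφ
  exact rho_eq_of_pos hQ hφ.1 hφ.2

lemma rho_asymptotic {φ : ℝ} (h1 : |φ| < 2 * Real.pi / 3) :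
    ∃ β : ℝ, |β - 1 - (1 / 2 - 2 * dl n ^ 2) * Real.sin (3 * φ / 4) ^ 2 / (2 * n + 3)|
      ≤ 2100 * Real.sin (3 * φ / 4) ^ 4 / Real.cos (3 * φ / 4) / (2 * n + 3) ^ 2 ∧
    Q.eval (2 * Real.cos φ) = β * (hR φ ^ (2 * n + 1) * gR n / (2 * Real.cos (φ / 2))) := by
  rcases lt_trichotomy φ 0 with h | h | h
  · rw [abs_of_neg h] at h1
    refine ⟨_, ?_, by
      have := rho_eq_of_pos hQ (neg_pos.2 h) h1
      rw [Real.cos_neg, neg_div, Real.cos_neg] at this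
      rw [this]
      congr 4
      simp only [hR, mul_neg, neg_div, Real.sinc_neg]⟩
    have := abs_beta_le n (T := 3 * (-φ) / 2) (by linarith) (by linarith)
    rw [show 3 * (-φ) / 2 / 2 = -(3 * φ / 4) by ring, Real.sin_neg, Real.cos_neg,
      Even.neg_pow (by decide), Even.neg_pow (by decide)] at this
    exact this
  · subst h
    refine ⟨1, by simp, ?_⟩
    have := rho_two hQ
    simpa using this
  · rw [abs_of_pos h] at h1
    refine ⟨_, ?_, rho_eq_of_pos hQ h h1⟩
    have := abs_beta_le n (T := 3 * φ / 2) (by linarith) (by linarith)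
    rwa [show 3 * φ / 2 / 2 = 3 * φ / 4 by ring] at this

end

end

section
open Filter Topology

/-- Ratio of the Pochhammer symbols `(δ)ₙ₊₁` and `(1/2)ₙ₊₁`. -/
def gD (δ : ℝ) (n : ℕ) : ℝ :=
  (∏ k ∈ Finset.range (n + 1), (δ + k)) / ∏ k ∈ Finset.range (n + 1), ((1 / 2 : ℝ) + k)

lemma gD_pos {δ : ℝ} (h : 0 < δ) (n : ℕ) : 0 < gD δ n :=
  div_pos (Finset.prod_pos fun k _ => by positivity) (Finset.prod_pos fun k _ => by positivity)

lemma abs_log_ratio_le {y : ℝ} (h : |y| ≤ 1 / 2) :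
    |Real.log (1 + y) - Real.log (1 - y) - 2 * y| ≤ 4 * |y| ^ 3 := by
  have h1 := Real.abs_log_sub_add_sum_range_le (x := y) (by linarith) 2
  have h2 := Real.abs_log_sub_add_sum_range_le (x := -y) (by rw [abs_neg]; linarith) 2
  simp only [Finset.sum_range_succ, Finset.sum_range_zero] at h1 h2
  norm_num at h1 h2
  have hb : |y| ^ 3 / (1 - |y|) ≤ 2 * |y| ^ 3 := by
    rw [div_le_iff₀ (by linarith)]
    nlinarith [pow_nonneg (abs_nonneg y) 3]
  have a1 := abs_le.1 (h1.trans hb)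
  have a2 := abs_le.1 (h2.trans hb)
  rw [abs_le]
  constructor <;> linarith [a1.1, a1.2, a2.1, a2.2]

lemma tendsto_mul_sub_of_step {e : ℕ → ℝ} {L : ℝ} (hL : Tendsto e atTop (𝓝 L))
    (hs : ∀ n, |e (n + 1) - e n| ≤ 1 / ((n : ℝ) + 1) ^ 3) :
    Tendsto (fun n : ℕ => (n : ℝ) * (e n - L)) atTop (𝓝 0) := by
  have hv : ∀ n : ℕ, 1 / ((n : ℝ) + 1 + 1) ^ 3
      ≤ 1 / ((n : ℝ) + 1) ^ 2 - 1 / ((n : ℝ) + 1 + 1) ^ 2 := by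
    intro n
    rw [div_sub_div _ _ (by positivity) (by positivity), div_le_div_iff₀ (by positivity)
      (by positivity)]
    have : (0 : ℝ) ≤ n := by positivity
    generalize (n : ℝ) = z at *
    have h2 : (0 : ℝ) ≤ (z + 1 + 1) ^ 2 := by positivity
    have : (1 * (z + 1 + 1) ^ 2 - (z + 1) ^ 2 * 1) * (z + 1 + 1) ^ 3
        - 1 * ((z + 1) ^ 2 * (z + 1 + 1) ^ 2)
        = (z + 1 + 1) ^ 2 * ((2 * z + 3) * (z + 2) - (z + 1) ^ 2) := by ring
    have h3 : 0 ≤ (2 * z + 3) * (z + 2) - (z + 1) ^ 2 := by nlinarith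
    nlinarith [mul_nonneg h2 h3]
  have hL' : Tendsto (fun n => e (n + 1)) atTop (𝓝 L) := hL.comp (tendsto_add_atTop_nat 1)
  have hv0 : Tendsto (fun n : ℕ => 1 / ((n : ℝ) + 1) ^ 2) atTop (𝓝 0) := by
    have := (tendsto_one_div_add_atTop_nhds_zero_nat (𝕜 := ℝ)).pow 2
    simpa using this
  have hle : ∀ n : ℕ, |e (n + 1) - L| ≤ 1 / ((n : ℝ) + 1) ^ 2 := by
    intro n
    have hA : Antitone fun n : ℕ => e (n + 1) + 1 / ((n : ℝ) + 1) ^ 2 := by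
      refine antitone_nat_of_succ_le fun n => ?_
      have := abs_le.1 (hs (n + 1))
      have h := hv n
      push_cast at this ⊢
      linarith [this.2]
    have hM : Monotone fun n : ℕ => e (n + 1) - 1 / ((n : ℝ) + 1) ^ 2 := by
      refine monotone_nat_of_le_succ fun n => ?_
      have := abs_le.1 (hs (n + 1))
      have h := hv n
      push_cast at this ⊢
      linarith [this.1]
    have h1 := hA.le_of_tendsto (by simpa using hL'.add hv0) n
    have h2 := hM.ge_of_tendsto (by simpa using hL'.sub hv0) n
    rw [abs_le]
    constructor <;> linarith
  rw [← tendsto_add_atTop_iff_nat 1]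
  refine squeeze_zero_norm (a := fun n : ℕ => 1 / ((n : ℝ) + 1)) (fun n => ?_)
    tendsto_one_div_add_atTop_nhds_zero_nat
  rw [Real.norm_eq_abs, abs_mul, Nat.abs_cast]
  calc _ ≤ ((n + 1 : ℕ) : ℝ) * (1 / ((n : ℝ) + 1) ^ 2) := by
        gcongr
        exact hle n
    _ = _ := by push_cast; field_simp

lemma tendsto_log_gD {δ : ℝ} (h0 : 0 < δ) (h1 : δ < 1) :
    Tendsto (fun n : ℕ => (n : ℝ) * (Real.log (gD δ n) - (δ - 1 / 2) * Real.log n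
      - (Real.log (Real.Gamma (1 / 2)) - Real.log (Real.Gamma δ)))) atTop
      (𝓝 ((δ - 1 / 2) * (δ + 3 / 2) / 2)) := by
  set c : ℝ := (δ + 3 / 2) / 2 with hc
  set L : ℝ := Real.log (Real.Gamma (1 / 2)) - Real.log (Real.Gamma δ)
  set e : ℕ → ℝ := fun n => Real.log (gD δ n) - (δ - 1 / 2) * Real.log (n + c) with he
  have hlog : ∀ n : ℕ, 0 < n → Real.log ((n : ℝ) + c) - Real.log n = Real.log (1 + c / n) := by
    intro n hn
    have : (0 : ℝ) < n := by exact_mod_cast hn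
    rw [← Real.log_div (by positivity) (by positivity)]
    congr 1
    field_simp
  have hshift : Tendsto (fun n : ℕ => (n : ℝ) * (Real.log ((n : ℝ) + c) - Real.log n)) atTop
      (𝓝 c) := by
    refine ((Real.tendsto_mul_log_one_add_div_atTop c).comp tendsto_natCast_atTop_atTop).congr' ?_
    filter_upwards [eventually_gt_atTop 0] with n hn
    simp only [Function.comp]
    rw [hlog n hn]
  have hshift0 : Tendsto (fun n : ℕ => Real.log ((n : ℝ) + c) - Real.log n) atTop (𝓝 0) := by
    have := hshift.mul (tendsto_one_div_atTop_nhds_zero_nat (𝕜 := ℝ))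
    rw [mul_zero] at this
    refine this.congr' ?_
    filter_upwards [eventually_gt_atTop 0] with n hn
    have : (n : ℝ) ≠ 0 := by exact_mod_cast hn.ne'
    field_simp
  have heL : Tendsto e atTop (𝓝 L) := by
    have g1 := (Real.GammaSeq_tendsto_Gamma (1 / 2)).log
      (Real.Gamma_pos_of_pos (by norm_num)).ne'
    have g2 := (Real.GammaSeq_tendsto_Gamma δ).log (Real.Gamma_pos_of_pos h0).ne'
    have := (g1.sub g2).sub (hshift0.const_mul (δ - 1 / 2))
    rw [mul_zero, sub_zero] at this
    refine this.congr' ?_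
    filter_upwards [eventually_gt_atTop 0] with n hn
    have hn' : (0 : ℝ) < n := by exact_mod_cast hn
    have hP1 : 0 < ∏ k ∈ Finset.range (n + 1), ((1 / 2 : ℝ) + k) :=
      Finset.prod_pos fun k _ => by positivity
    have hP2 : 0 < ∏ k ∈ Finset.range (n + 1), (δ + k) :=
      Finset.prod_pos fun k _ => by positivity
    have hf : (0 : ℝ) < n.factorial := by exact_mod_cast n.factorial_pos
    simp only [he, gD, Real.GammaSeq]
    rw [Real.log_div (by positivity) hP1.ne', Real.log_div (by positivity) hP2.ne',
      Real.log_div hP2.ne' hP1.ne', Real.log_mul (by positivity) (by positivity),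
      Real.log_mul (by positivity) (by positivity), Real.log_rpow hn', Real.log_rpow hn']
    ring
  have hstep : ∀ n, |e (n + 1) - e n| ≤ 1 / ((n : ℝ) + 1) ^ 3 := by
    intro n
    set z : ℝ := n + c + 1 / 2 with hz
    set u : ℝ := (δ - 1 / 2) / 2 with hu
    have hzn : (n : ℝ) + 1 ≤ z := by rw [hz, hc]; linarith
    have hn0 : (0 : ℝ) ≤ n := by positivity
    have hz1 : 1 ≤ z := by linarith
    have hu1 : |u| ≤ 1 / 2 := by rw [abs_le, hu]; constructor <;> linarith
    have hg : gD δ (n + 1) = gD δ n * ((z + u) / (z - u)) := by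
      unfold gD
      rw [Finset.prod_range_succ _ (n + 1), Finset.prod_range_succ _ (n + 1), mul_div_mul_comm]
      congr 2
      · rw [hz, hu, hc]; push_cast; ring
      · rw [hz, hu, hc]; push_cast; ring
    have hzu : 0 < z + u := by linarith [(abs_le.1 hu1).1]
    have hzu' : 0 < z - u := by linarith [(abs_le.1 hu1).2]
    have hz0 : 0 < z := by linarith
    have y1 := abs_log_ratio_le (y := u / z) (by
      rw [abs_div, abs_of_pos hz0, div_le_iff₀ hz0]; nlinarith [abs_nonneg u])
    have y2 := abs_log_ratio_le (y := 1 / 2 / z) (by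
      rw [abs_div, abs_of_pos hz0, div_le_iff₀ hz0, abs_of_pos (by norm_num)]; nlinarith)
    have hE : e (n + 1) - e n
        = (Real.log (1 + u / z) - Real.log (1 - u / z) - 2 * (u / z))
          - 2 * u * (Real.log (1 + 1 / 2 / z) - Real.log (1 - 1 / 2 / z) - 2 * (1 / 2 / z)) := by
      have q1 : 1 + u / z = (z + u) / z := by field_simp
      have q2 : 1 - u / z = (z - u) / z := by field_simp
      have q3 : 1 + 1 / 2 / z = (z + 1 / 2) / z := by field_simp
      have q4 : 1 - 1 / 2 / z = (z - 1 / 2) / z := by field_simp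
      rw [q1, q2, q3, q4, Real.log_div hzu.ne' hz0.ne', Real.log_div hzu'.ne' hz0.ne',
        Real.log_div (by linarith) hz0.ne', Real.log_div (by linarith) hz0.ne']
      simp only [he]
      rw [hg, Real.log_mul (gD_pos h0 n).ne' (by positivity), Real.log_div hzu.ne' hzu'.ne']
      have p1 : ((n + 1 : ℕ) : ℝ) + c = z + 1 / 2 := by rw [hz]; push_cast; ring
      have p2 : (n : ℝ) + c = z - 1 / 2 := by rw [hz]; ring
      rw [p1, p2, hu]
      ring
    rw [hE]
    have b1 : 4 * |u / z| ^ 3 ≤ 1 / 2 / z ^ 3 := by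
      rw [abs_div, abs_of_pos hz0, div_pow, ← mul_div_assoc]
      gcongr
      have : |u| ^ 3 ≤ (1 / 2) ^ 3 := by gcongr
      linarith
    have b2 : 4 * |1 / 2 / z| ^ 3 ≤ 1 / 2 / z ^ 3 := by
      rw [abs_div, abs_of_pos hz0, div_pow, ← mul_div_assoc]
      gcongr
      norm_num
    have b3 : |2 * u| ≤ 1 := by rw [abs_mul, abs_of_pos (by norm_num : (0 : ℝ) < 2)]; linarith
    have hz3 : 1 / z ^ 3 ≤ 1 / ((n : ℝ) + 1) ^ 3 := by gcongr
    refine le_trans ?_ hz3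
    refine (abs_sub _ _).trans ?_
    rw [abs_mul (2 * u)]
    have b4 := mul_le_mul b3 (y2.trans b2) (abs_nonneg _) zero_le_one
    calc _ ≤ 1 / 2 / z ^ 3 + 1 * (1 / 2 / z ^ 3) := add_le_add (y1.trans b1) b4
      _ = _ := by ring
  have h2 := (tendsto_mul_sub_of_step heL hstep).add (hshift.const_mul (δ - 1 / 2))
  rw [zero_add] at h2
  have e3 : (δ - 1 / 2) * (δ + 3 / 2) / 2 = (δ - 1 / 2) * c := by rw [hc]; ring
  rw [e3]
  refine h2.congr fun n => ?_
  simp only [he]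
  ring

end

section
open Filter Topology

lemma log_bound_of_near_one {β a A K : ℝ} {n : ℕ} (ha : |a| ≤ A) (hK : 0 ≤ K)
    (h : |β - 1 - a / (2 * n + 3)| ≤ K / (2 * n + 3) ^ 2) (hn : 2 * (A + K) ≤ 2 * n + 3) :
    0 < β ∧ |n * Real.log β - a / 2| ≤ (2 * (A + K) ^ 2 + K + 2 * A) / (2 * n + 3) := by
  have hA : 0 ≤ A := (abs_nonneg a).trans ha
  set m : ℝ := 2 * n + 3 with hm
  have hn0 : (0 : ℝ) ≤ n := by positivity
  have hm1 : 1 ≤ m := by linarith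
  have hm0 : 0 < m := by linarith
  have hKm : K / m ^ 2 ≤ K / m := by
    refine div_le_div_of_nonneg_left hK hm0 ?_
    nlinarith
  have hb : |β - 1| ≤ (A + K) / m := by
    have h1 : |a / m| ≤ A / m := by rw [abs_div, abs_of_pos hm0]; gcongr
    calc |β - 1| = |(β - 1 - a / m) + a / m| := by congr 1; ring
      _ ≤ K / m + A / m := (abs_add_le _ _).trans (add_le_add (h.trans hKm) h1)
      _ = _ := by ring
  have hb2 : |β - 1| ≤ 1 / 2 := by
    refine hb.trans ?_
    rw [div_le_iff₀ hm0]; linarith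
  have hlog : |Real.log β - (β - 1)| ≤ 2 * ((A + K) / m) ^ 2 := by
    have h1 := Real.abs_log_sub_add_sum_range_le (x := -(β - 1)) (by rw [abs_neg]; linarith) 1
    simp only [Finset.sum_range_one, abs_neg] at h1
    have h2 : |β - 1| ^ (1 + 1) / (1 - |β - 1|) ≤ 2 * ((A + K) / m) ^ 2 := by
      rw [div_le_iff₀ (by linarith)]
      have : |β - 1| ^ 2 ≤ ((A + K) / m) ^ 2 := by gcongr
      nlinarith [sq_nonneg ((A + K) / m)]
    have e : Real.log β - (β - 1)
        = (-(β - 1)) ^ (0 + 1) / (((0 : ℕ) : ℝ) + 1) + Real.log (1 - -(β - 1)) := by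
      rw [show (1 : ℝ) - -(β - 1) = β by ring]
      norm_num
      ring
    rw [e]
    exact h1.trans h2
  refine ⟨by linarith [(abs_le.1 hb2).1], ?_⟩
  have e : n * Real.log β - a / 2 = n * (Real.log β - (β - 1)) + n * (β - 1 - a / m)
      + (n * (a / m) - a / 2) := by ring
  have hnm : (n : ℝ) ≤ m / 2 := by rw [hm]; linarith
  have t1 : |n * (Real.log β - (β - 1))| ≤ (A + K) ^ 2 / m := by
    rw [abs_mul, Nat.abs_cast]
    calc _ ≤ m / 2 * (2 * ((A + K) / m) ^ 2) := by gcongr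
      _ = _ := by field_simp
  have t2 : |n * (β - 1 - a / m)| ≤ K / m := by
    rw [abs_mul, Nat.abs_cast]
    calc _ ≤ m / 2 * (K / m ^ 2) := by gcongr
      _ = K / m / 2 := by field_simp
      _ ≤ K / m := half_le_self (by positivity)
  have t3 : |n * (a / m) - a / 2| ≤ 2 * A / m := by
    have : n * (a / m) - a / 2 = -(3 / 2 * a / m) := by
      rw [hm]; field_simp; ring
    rw [this, abs_neg, abs_div, abs_of_pos hm0, abs_mul, abs_of_pos (by norm_num : (0 : ℝ) < 3 / 2)]
    gcongr
    norm_num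
  rw [e]
  refine (abs_add_le _ _).trans (le_trans (add_le_add ((abs_add_le _ _).trans
    (add_le_add t1 t2)) t3) ?_)
  rw [← add_div, ← add_div]
  gcongr
  nlinarith [sq_nonneg (A + K)]

/-- The coefficient of `1 / n` in the expansion of `log ρₙ`. -/
def kk (d s : ℝ) : ℝ := (d - 1 / 2) * (d + 3 / 2) / 2 + s * (1 / 4 - d ^ 2)

/-- The constant term in the expansion of `log ρₙ`. -/
def c0 (d φ : ℝ) : ℝ :=
  Real.log (Real.Gamma (1 / 2)) - Real.log (Real.Gamma d) - Real.log (2 * Real.cos (φ / 2))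

lemma hR_pos {φ : ℝ} (h1 : |φ| < 2 * Real.pi / 3) : 0 < hR φ := by
  have h : ∀ y : ℝ, |y| < Real.pi → 0 < Real.sinc y := by
    intro y hy
    rcases lt_trichotomy y 0 with h | h | h
    · rw [abs_of_neg h] at hy
      rw [← Real.sinc_neg, Real.sinc_of_ne_zero (by linarith)]
      exact div_pos (Real.sin_pos_of_pos_of_lt_pi (by linarith) hy) (by linarith)
    · simp [h]
    · rw [abs_of_pos h] at hy
      rw [Real.sinc_of_ne_zero (by linarith)]
      exact div_pos (Real.sin_pos_of_pos_of_lt_pi (by linarith) hy) (by linarith)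
  have h2 := abs_lt.1 h1
  have hp := Real.pi_pos
  have a1 := h (3 * φ / 4) (by rw [abs_lt]; constructor <;> linarith)
  have a2 := h (φ / 2) (by rw [abs_lt]; constructor <;> linarith)
  unfold hR
  positivity

lemma gR_eq (n : ℕ) : gR n = gD (dl n) n := rfl

lemma tendsto_log_gR : Tendsto (fun n : ℕ => (n : ℝ) * (Real.log (gR n)
    - (dl n - 1 / 2) * Real.log n - (Real.log (Real.Gamma (1 / 2)) - Real.log (Real.Gamma (dl n))))
    - (dl n - 1 / 2) * (dl n + 3 / 2) / 2) atTop (𝓝 0) := by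
  have h1 := (tendsto_log_gD (δ := 2 / 3) (by norm_num) (by norm_num)).sub_const
    ((2 / 3 - 1 / 2 : ℝ) * (2 / 3 + 3 / 2) / 2)
  have h2 := (tendsto_log_gD (δ := 1 / 3) (by norm_num) (by norm_num)).sub_const
    ((1 / 3 - 1 / 2 : ℝ) * (1 / 3 + 3 / 2) / 2)
  rw [sub_self] at h1 h2
  have h3 := h1.norm.add h2.norm
  rw [norm_zero, add_zero] at h3
  refine squeeze_zero_norm (fun n => ?_) h3
  rw [gR_eq]
  rcases Nat.mod_two_eq_zero_or_one n with h | h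
  · rw [show dl n = 2 / 3 from if_pos h]
    exact le_add_of_nonneg_right (norm_nonneg _)
  · rw [show dl n = 1 / 3 from if_neg (by omega)]
    exact le_add_of_nonneg_left (norm_nonneg _)

theorem log_rho_asymptotic {Q : ℕ → Polynomial ℝ} (hQ : ∀ n φ, KK n (dl n) (3 * φ / 2)
      = lamK n * Real.sin φ * ((2 * Real.cos φ - 2) ^ n * (Q n).eval (2 * Real.cos φ)))
    {φ : ℝ} (h1 : |φ| < 2 * Real.pi / 3) :
    (∀ᶠ n in atTop, 0 < (Q n).eval (2 * Real.cos φ)) ∧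
    Tendsto (fun n : ℕ => (n : ℝ) * (Real.log ((Q n).eval (2 * Real.cos φ))
      - (2 * n + 1) * Real.log (hR φ) - c0 (dl n) φ - (dl n - 1 / 2) * Real.log n
      - kk (dl n) (Real.sin (3 * φ / 4) ^ 2) / n)) atTop (𝓝 0) := by
  choose β hβ hβ2 using fun n => rho_asymptotic (hQ n) h1
  set s : ℝ := Real.sin (3 * φ / 4) ^ 2 with hs
  have hs0 : 0 ≤ s := sq_nonneg _
  have hs1 : s ≤ 1 := Real.sin_sq_le_one _
  have h2 := abs_lt.1 h1
  have hp := Real.pi_pos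
  have hc : 0 < Real.cos (3 * φ / 4) := Real.cos_pos_of_mem_Ioo ⟨by linarith, by linarith⟩
  have hc2 : 0 < Real.cos (φ / 2) := Real.cos_pos_of_mem_Ioo ⟨by linarith, by linarith⟩
  have hh := hR_pos h1
  set K : ℝ := 2100 * Real.sin (3 * φ / 4) ^ 4 / Real.cos (3 * φ / 4) with hK
  have hK0 : 0 ≤ K := by positivity
  have ha : ∀ n, |(1 / 2 - 2 * dl n ^ 2) * s| ≤ 2 := by
    intro n
    have d0 := dl_pos n
    have d1 := dl_le_one n
    rw [abs_mul, abs_of_nonneg hs0]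
    have : |1 / 2 - 2 * dl n ^ 2| ≤ 2 := by rw [abs_le]; constructor <;> nlinarith
    nlinarith [abs_nonneg (1 / 2 - 2 * dl n ^ 2)]
  have hev : ∀ᶠ n : ℕ in atTop, 2 * (2 + K) ≤ 2 * (n : ℝ) + 3 := by
    filter_upwards [tendsto_natCast_atTop_atTop.eventually_ge_atTop (2 + K)] with n hn
    linarith
  have hlogβ : ∀ᶠ n : ℕ in atTop, 0 < β n ∧ |n * Real.log (β n) - (1 / 2 - 2 * dl n ^ 2) * s / 2|
      ≤ (2 * (2 + K) ^ 2 + K + 2 * 2) / (2 * n + 3) := by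
    filter_upwards [hev] with n hn
    exact log_bound_of_near_one (ha n) hK0 (hβ n) hn
  have hgpos : ∀ n, 0 < gR n := fun n => by rw [gR_eq]; exact gD_pos (dl_pos n) n
  refine ⟨?_, ?_⟩
  · filter_upwards [hlogβ] with n hn
    rw [hβ2 n]
    have := hgpos n
    have := hn.1
    positivity
  · have ht : Tendsto (fun n : ℕ => n * Real.log (β n) - (1 / 2 - 2 * dl n ^ 2) * s / 2) atTop
        (𝓝 0) := by
      refine squeeze_zero_norm' (hlogβ.mono fun n h => h.2) ?_
      refine Tendsto.const_div_atTop ?_ _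
      exact tendsto_atTop_add_const_right _ _
        (tendsto_natCast_atTop_atTop.const_mul_atTop (by norm_num))
    have h3 := ht.add tendsto_log_gR
    rw [add_zero] at h3
    refine h3.congr' ?_
    filter_upwards [hlogβ, eventually_gt_atTop 0] with n hn hn0
    have hn0' : (n : ℝ) ≠ 0 := by exact_mod_cast hn0.ne'
    have hb := hn.1
    have hg := hgpos n
    rw [hβ2 n, Real.log_mul hb.ne' (by positivity), Real.log_div (by positivity) (by positivity),
      Real.log_mul (by positivity) hg.ne', Real.log_pow, c0, kk]
    push_cast
    field_simp
    ring

end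

section
open Filter Topology

lemma fidelity_arg_eq {r x : ℝ} (hr : r ∈ Set.Ioo (0 : ℝ) 2)
    (hxr : x = Real.sin (Real.pi * (r + 1) / 3) / Real.sin (Real.pi * r / 3)) :
    (4 * x - 1 - x ^ 2) / (x ^ 2 - x + 1) = 2 * Real.cos (2 * Real.pi * (r - 1) / 3) := by
  have hp := Real.pi_pos
  obtain ⟨h0, h2⟩ := hr
  have hs : 0 < Real.sin (Real.pi * r / 3) :=
    Real.sin_pos_of_pos_of_lt_pi (by positivity) (by nlinarith)
  have e1 : Real.pi * (r + 1) / 3 = Real.pi * r / 3 + Real.pi / 3 := by ring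
  have e2 : 2 * Real.pi * (r - 1) / 3 = 2 * (Real.pi * r / 3) - 2 * (Real.pi / 3) := by ring
  rw [e1, Real.sin_add, Real.cos_pi_div_three, Real.sin_pi_div_three] at hxr
  rw [e2, Real.cos_sub, Real.cos_two_mul, Real.sin_two_mul, Real.cos_two_mul, Real.sin_two_mul,
    Real.cos_pi_div_three, Real.sin_pi_div_three]
  have h3 : Real.sqrt 3 ^ 2 = 3 := Real.sq_sqrt (by norm_num)
  have hsc := Real.sin_sq_add_cos_sq (Real.pi * r / 3)
  generalize Real.sin (Real.pi * r / 3) = A at *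
  generalize Real.cos (Real.pi * r / 3) = c at *
  generalize Real.sqrt 3 = q at *
  have hxA : x * A = A / 2 + c * q / 2 := by rw [hxr]; field_simp
  have hden : (x ^ 2 - x + 1) * A ^ 2 = 3 / 4 := by
    have : (x ^ 2 - x + 1) * A ^ 2 = (x * A) ^ 2 - (x * A) * A + A ^ 2 := by ring
    rw [this, hxA]; grind
  have hd0 : x ^ 2 - x + 1 ≠ 0 := by intro h; rw [h] at hden; norm_num at hden
  rw [div_eq_iff hd0]
  have hA2 : A ^ 2 ≠ 0 := by positivity
  apply mul_right_cancel₀ hA2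
  rw [mul_assoc, hden]
  have : (4 * x - 1 - x ^ 2) * A ^ 2 = 4 * (x * A) * A - A ^ 2 - (x * A) ^ 2 := by ring
  rw [this, hxA]
  grind

lemma gamma_third_mul : Real.Gamma (1 / 3) * Real.Gamma (2 / 3) = 2 * Real.pi / Real.sqrt 3 := by
  have := Real.Gamma_mul_Gamma_one_sub (1 / 3)
  rw [show (1 : ℝ) - 1 / 3 = 2 / 3 by norm_num, show Real.pi * (1 / 3) = Real.pi / 3 by ring,
    Real.sin_pi_div_three] at this
  rw [this]
  field_simp

lemma amplitude_eq {r D φ : ℝ} (hφ : φ = 2 * Real.pi * (r - 1) / 3)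
    (hD : D = if r = 1 then 8 / (3 * Real.Gamma (1 / 3)) * Real.sqrt (Real.pi / 3)
      else 2 / Real.Gamma (1 / 3) * Real.sqrt (Real.pi / 3) *
        (Real.sin (2 * Real.pi * (r - 1) / 3) / Real.sin (Real.pi * (r - 1) / 2))) :
    D = Real.Gamma (2 / 3) * (2 * Real.cos (φ / 2)) / (Real.Gamma (1 / 2) * hR φ) := by
  have hp := Real.pi_pos
  have hg := gamma_third_mul
  have g1 : 0 < Real.Gamma (1 / 3) := Real.Gamma_pos_of_pos (by norm_num)
  have hpp : Real.sqrt Real.pi ^ 2 = Real.pi := Real.sq_sqrt hp.le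
  have h33 : Real.sqrt 3 ^ 2 = 3 := Real.sq_sqrt (by norm_num)
  have hsp : 0 < Real.sqrt Real.pi := Real.sqrt_pos.2 hp
  have hs3 : 0 < Real.sqrt 3 := Real.sqrt_pos.2 (by norm_num)
  have g2 : Real.Gamma (2 / 3) = 2 * Real.pi / (Real.sqrt 3 * Real.Gamma (1 / 3)) := by
    rw [← div_div, ← hg]; field_simp
  rw [hD, g2, Real.Gamma_one_half_eq, Real.sqrt_div hp.le]
  split_ifs with h
  · have : φ = 0 := by rw [hφ, h]; ring
    subst this
    simp only [hR, mul_zero, zero_div, Real.sinc_zero, Real.cos_zero]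
    field_simp
    rw [hpp]; ring
  · have h1 : r - 1 ≠ 0 := sub_ne_zero.2 h
    have hφ0 : φ ≠ 0 := by rw [hφ]; positivity
    rw [← hφ, show Real.pi * (r - 1) / 2 = 3 * φ / 4 by rw [hφ]; ring, hR_eq hφ0]
    rw [show Real.sin φ = 2 * Real.sin (φ / 2) * Real.cos (φ / 2) by
      rw [← Real.sin_two_mul]; congr 1; ring]
    field_simp
    rw [hpp]; ring

lemma log_amplitude {φ : ℝ} (h1 : |φ| < 2 * Real.pi / 3) :
    Real.log (Real.Gamma (2 / 3) * (2 * Real.cos (φ / 2)) / (Real.Gamma (1 / 2) * hR φ))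
      = -(c0 (2 / 3) φ + Real.log (hR φ)) := by
  have hp := Real.pi_pos
  have h2 := abs_lt.1 h1
  have hc : 0 < Real.cos (φ / 2) := Real.cos_pos_of_mem_Ioo ⟨by linarith, by linarith⟩
  have hh := hR_pos h1
  have g2 : 0 < Real.Gamma (2 / 3) := Real.Gamma_pos_of_pos (by norm_num)
  have g1 : 0 < Real.Gamma (1 / 2) := Real.Gamma_pos_of_pos (by norm_num)
  rw [Real.log_div (by positivity) (by positivity), Real.log_mul g2.ne' (by positivity),
    Real.log_mul g1.ne' hh.ne', c0]
  ring

/-- `n` times the remainder in the expansion of `log ρₙ`. -/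
def logRem (q : ℕ → ℝ) (φ : ℝ) (n : ℕ) : ℝ :=
  (n : ℝ) * (Real.log (q n)
      - (2 * n + 1) * Real.log (hR φ) - c0 (dl n) φ - (dl n - 1 / 2) * Real.log n
      - kk (dl n) (Real.sin (3 * φ / 4) ^ 2) / n)

lemma log_ratio_eq {q : ℕ → ℝ} {φ : ℝ} {D E Ebar : ℝ} {a b : ℕ} (ha : Even a) (hb : Odd b)
    (ha0 : 0 < a) (hqa : 0 < q a) (hqb : 0 < q b) (hqn : 0 < q (a + b))
    (hD : Real.log D = -(c0 (2 / 3) φ + Real.log (hR φ)))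
    (hE : E = 13 - 14 * Real.sin (3 * φ / 4) ^ 2)
    (hEbar : Ebar = 11 - 10 * Real.sin (3 * φ / 4) ^ 2) :
    -Real.log (q (a + b) / (q a * q b)) - asymExprOdd D E Ebar (a / (a + b)) (a + b)
      = logRem q φ a / a + logRem q φ b / b - logRem q φ (a + b) / (a + b) := by
  have hb0 : 0 < b := hb.pos
  have da : dl a = 2 / 3 := by rw [dl, if_pos (Nat.even_iff.1 ha)]
  have db : dl b = 1 / 3 := by rw [dl, if_neg (by have := Nat.odd_iff.1 hb; omega)]
  have dn : dl (a + b) = 1 / 3 := by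
    rw [dl, if_neg (by have := Nat.odd_iff.1 (ha.add_odd hb); omega)]
  have ha' : (0 : ℝ) < a := by exact_mod_cast ha0
  have hb' : (0 : ℝ) < b := by exact_mod_cast hb0
  have hn' : (0 : ℝ) < a + b := by positivity
  have h1t : (1 : ℝ) - a / (a + b) = b / (a + b) := by field_simp; ring
  rw [Real.log_div hqn.ne' (by positivity), Real.log_mul hqa.ne' hqb.ne', asymExprOdd, h1t,
    div_div_div_cancel_right₀ hn'.ne', Real.log_div ha'.ne' hb'.ne', hD, hE, hEbar]
  simp only [logRem, da, db, dn, kk]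
  push_cast
  field_simp
  ring

end

section
open Filter Topology

lemma cub_ofReal (k : ℕ) (u : ℂ) : ((cubP k).map (algebraMap ℝ ℂ)).eval u = cub k u := by
  simp [cubP, cub]

lemma omega_root : (-(1 / 2) + (Real.sqrt 3 : ℂ) / 2 * Complex.I) ^ 2
    + (-(1 / 2) + (Real.sqrt 3 : ℂ) / 2 * Complex.I) + 1 = 0 := by
  have h3 : (Real.sqrt 3 : ℂ) ^ 2 = 3 := by
    rw [← Complex.ofReal_pow, Real.sq_sqrt (by norm_num)]; norm_num
  linear_combination (Complex.I ^ 2 / 4) * h3 + 3 / 4 * Complex.I_sq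

/-- The logarithmic bipartite fidelity in terms of a sequence of real polynomials with known
asymptotics. -/
theorem exists_lbf_formula {x φ : ℝ} (hx : 0 < x)
    (hφ : (4 * x - 1 - x ^ 2) / (x ^ 2 - x + 1) = 2 * Real.cos φ) (h1 : |φ| < 2 * Real.pi / 3)
    {ψ : (M : ℕ) → Conf M → ℂ} (hψ : ∀ M : ℕ, 1 ≤ M → IsGroundState M x (ψ M)) :
    ∃ q : ℕ → ℝ, (∀ᶠ n in atTop, 0 < q n) ∧ Tendsto (logRem q φ) atTop (𝓝 0) ∧
      ∀ N1 N2 : ℕ, 1 ≤ N1 → 1 ≤ N2 → (N1 + N2) % 2 = 1 → 0 < q N1 → 0 < q N2 → 0 < q (N1 + N2) →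
        LBF N1 N2 (ψ (N1 + N2)) (ψ N1) (ψ N2)
          = ((-Real.log (q (N1 + N2) / (q N1 * q N2)) : ℝ) : ℂ) := by
  choose Q hQa hQ using exists_rho
  obtain ⟨hpos, hlim⟩ := log_rho_asymptotic hQ h1
  refine ⟨fun n => (Q n).eval (2 * Real.cos φ), hpos, hlim, ?_⟩
  intro N1 N2 hN1 hN2 h12 p1 p2 pN
  set ρ : ℕ → ℂ → ℂ := fun j u => ((Q j).map (algebraMap ℝ ℂ)).eval u with hρ
  have hρr : ∀ (j : ℕ) (t : ℝ), ρ j (t : ℂ) = (((Q j).eval t : ℝ) : ℂ) := by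
    intro j t
    have := Polynomial.eval_map_apply (p := Q j) (f := algebraMap ℝ ℂ) t
    simpa [hρ] using this
  have hw : wb (x : ℂ) = ((2 * Real.cos φ : ℝ) : ℂ) := by rw [wb_real, hφ]
  have hne : ∀ j, 0 < (Q j).eval (2 * Real.cos φ) → ρ j (wb x) ≠ 0 := by
    intro j hj
    rw [hw, hρr]
    exact_mod_cast hj.ne'
  have key := fidelity_eq omega_root (ρ := ρ) (fun j => Polynomial.continuous _) ?_ ?_ hN1 hN2 h12
    hx (hψ _ (by omega)) (hψ N1 hN1) (hψ N2 hN2) (hne _ p1) (hne _ p2) (hne _ pN)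
  · rw [LBF, key, hw, hρr, hρr, hρr, ← Complex.ofReal_mul, ← Complex.ofReal_div,
      ← Complex.ofReal_log (by positivity), ← Complex.ofReal_neg]
  · intro j
    obtain ⟨a, ha⟩ := hQa j
    refine ⟨fun k => a k, fun u => ?_⟩
    have := congrArg (fun p => (Polynomial.map (algebraMap ℝ ℂ) p).eval u) ha
    simpa [Polynomial.map_sum, Polynomial.eval_finsetSum, cub_ofReal, Polynomial.map_mul,
      Polynomial.map_add, -Polynomial.eval_map_algebraMap] using this
  · intro j
    have := hρr j 2
    rw [rho_two (hQ j)] at this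
    push_cast at this
    rw [this]
    have hh : 0 < hR 0 := hR_pos (by simpa using Real.pi_pos)
    have hg : 0 < gR j := by rw [gR_eq]; exact gD_pos (dl_pos j) j
    have h0 : hR 0 ^ (2 * j + 1) * gR j ≠ 0 := by positivity
    simpa using h0

lemma abs_log_ratio_sub_le {q : ℕ → ℝ} {φ : ℝ} {D E Ebar δ ε : ℝ} {a b M : ℕ} (ha : Even a)
    (hb : Odd b) (ha0 : 0 < a) (hδ : 0 < δ) (hε : 0 < ε)
    (hM : ∀ n ≥ M, 0 < q n ∧ |logRem q φ n| ≤ ε * δ / 3)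
    (hδa : δ * (a + b) ≤ a) (hδb : δ * (a + b) ≤ b) (haM : M ≤ a) (hbM : M ≤ b)
    (hD : Real.log D = -(c0 (2 / 3) φ + Real.log (hR φ)))
    (hE : E = 13 - 14 * Real.sin (3 * φ / 4) ^ 2)
    (hEbar : Ebar = 11 - 10 * Real.sin (3 * φ / 4) ^ 2) :
    |-Real.log (q (a + b) / (q a * q b)) - asymExprOdd D E Ebar (a / (a + b)) (a + b)|
      ≤ ε / (a + b) := by
  obtain ⟨qa, ra⟩ := hM a haM
  obtain ⟨qb, rb⟩ := hM b hbM
  obtain ⟨qn, rn⟩ := hM (a + b) (by omega)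
  rw [log_ratio_eq ha hb ha0 qa qb qn hD hE hEbar]
  have ha' : (0 : ℝ) < a := by exact_mod_cast ha0
  have hb' : (0 : ℝ) < b := by exact_mod_cast hb.pos
  have hn' : (0 : ℝ) < (a : ℝ) + b := by positivity
  have hδn : δ * ((a : ℝ) + b) ≤ a + b := by linarith
  have hle : ∀ z m : ℝ, 0 < m → δ * (a + b) ≤ m → |z| ≤ ε * δ / 3 → |z / m| ≤ ε / (a + b) / 3 := by
    intro z m hm h hz
    rw [abs_div, abs_of_pos hm, div_le_iff₀ hm]
    refine hz.trans ?_
    calc ε * δ / 3 = ε / (a + b) / 3 * (δ * (a + b)) := by field_simp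
      _ ≤ _ := by gcongr
  have e1 := hle _ _ ha' hδa ra
  have e2 := hle _ _ hb' hδb rb
  have e3 := hle _ _ hn' hδn rn
  rw [abs_le] at *
  constructor <;> linarith [e1.1, e1.2, e2.1, e2.2, e3.1, e3.2]

end

/-- **Theorem 1.2 (mixed-parity case).** Asymptotics of the logarithmic bipartite
fidelity for `N1` even and `N2` odd (with `ξ = N1/N`), and for `N1` odd and `N2`
even (the same estimate with `ξ` replaced by `1−ξ`). -/
theorem lbf_asymptotics_mixed_parity
    (x : ℝ) (hx : 0 < x)
    (ψ : (M : ℕ) → Conf M → ℂ)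
    (hψ : ∀ M : ℕ, 1 ≤ M → IsGroundState M x (ψ M))
    (r : ℝ) (hr : r ∈ Set.Ioo (0:ℝ) 2)
    (hxr : x = Real.sin (Real.pi * (r+1)/3) / Real.sin (Real.pi * r/3))
    (D E Ebar : ℝ)
    (hD : D = if r = 1 then 8/(3 * Real.Gamma (1/3)) * Real.sqrt (Real.pi/3)
      else 2/Real.Gamma (1/3) * Real.sqrt (Real.pi/3) *
        (Real.sin (2*Real.pi*(r-1)/3) / Real.sin (Real.pi*(r-1)/2)))
    (hE : E = 13 - 14 * Real.sin (Real.pi*(r-1)/2)^2)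
    (hEbar : Ebar = 11 - 10 * Real.sin (Real.pi*(r-1)/2)^2) :
    ∀ δ ∈ Set.Ioo (0:ℝ) (1/2), ∀ ε > (0:ℝ), ∃ N₀ : ℕ,
      ∀ N1 N2 : ℕ, 2 ≤ N1 → 2 ≤ N2 →
        N₀ ≤ N1 + N2 →
        δ ≤ (N1 : ℝ)/((N1:ℝ)+N2) → (N1 : ℝ)/((N1:ℝ)+N2) ≤ 1 - δ →
        ((Even N1 ∧ Odd N2) →
          ‖LBF N1 N2 (ψ (N1+N2)) (ψ N1) (ψ N2)
            - ((asymExprOdd D E Ebar ((N1:ℝ)/((N1:ℝ)+N2)) ((N1:ℝ)+N2) : ℝ) : ℂ)‖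
            ≤ ε / ((N1:ℝ)+N2))
        ∧ ((Odd N1 ∧ Even N2) →
          ‖LBF N1 N2 (ψ (N1+N2)) (ψ N1) (ψ N2)
            - ((asymExprOdd D E Ebar (1 - (N1:ℝ)/((N1:ℝ)+N2)) ((N1:ℝ)+N2) : ℝ) : ℂ)‖
            ≤ ε / ((N1:ℝ)+N2)) := by
  intro δ hδ ε hε
  have hp := Real.pi_pos
  set φ : ℝ := 2 * Real.pi * (r - 1) / 3 with hφ
  have h1 : |φ| < 2 * Real.pi / 3 := by
    rw [abs_lt, hφ]
    constructor <;> nlinarith [hr.1, hr.2]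
  have hs : Real.pi * (r - 1) / 2 = 3 * φ / 4 := by rw [hφ]; ring
  have hlD : Real.log D = -(c0 (2 / 3) φ + Real.log (hR φ)) := by
    rw [amplitude_eq hφ hD, log_amplitude h1]
  rw [hs] at hE hEbar
  obtain ⟨q, hq, hlim, hF⟩ := exists_lbf_formula hx (fidelity_arg_eq hr hxr) h1 hψ
  have hδ0 := hδ.1
  have hsmall : ∀ᶠ n in Filter.atTop, |logRem q φ n| ≤ ε * δ / 3 := by
    have := hlim.abs
    rw [abs_zero] at this
    exact this.eventually_le_const (by positivity)
  obtain ⟨M, hM⟩ := Filter.eventually_atTop.1 (hq.and hsmall)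
  refine ⟨⌈(M : ℝ) / δ⌉₊, ?_⟩
  intro N1 N2 hN1 hN2 hN hξ hξ'
  have hn : (0 : ℝ) < (N1 : ℝ) + N2 := by
    have : (2 : ℝ) ≤ N1 := by exact_mod_cast hN1
    positivity
  have b1 : δ * ((N1 : ℝ) + N2) ≤ N1 := (le_div_iff₀ hn).1 hξ
  have b2 : δ * ((N1 : ℝ) + N2) ≤ N2 := by
    have := (div_le_iff₀ hn).1 hξ'
    linarith
  have bM : (M : ℝ) ≤ δ * ((N1 : ℝ) + N2) := by
    have h : (M : ℝ) / δ ≤ ((N1 + N2 : ℕ) : ℝ) := Nat.ceil_le.1 hN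
    rw [div_le_iff₀ hδ0] at h
    push_cast at h
    linarith
  have hM1 : M ≤ N1 := by exact_mod_cast bM.trans b1
  have hM2 : M ≤ N2 := by exact_mod_cast bM.trans b2
  have q1 := (hM N1 hM1).1
  have q2 := (hM N2 hM2).1
  have qn := (hM (N1 + N2) (by omega)).1
  refine ⟨fun ⟨he, ho⟩ => ?_, fun ⟨ho, he⟩ => ?_⟩
  · rw [hF N1 N2 (by omega) (by omega) (Nat.odd_iff.1 (he.add_odd ho)) q1 q2 qn,
      ← Complex.ofReal_sub, Complex.norm_real, Real.norm_eq_abs]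
    exact abs_log_ratio_sub_le he ho (by omega) hδ0 hε hM b1 b2 hM1 hM2 hlD hE hEbar
  · rw [hF N1 N2 (by omega) (by omega) (Nat.odd_iff.1 (ho.add_even he)) q1 q2 qn,
      ← Complex.ofReal_sub, Complex.norm_real, Real.norm_eq_abs]
    have hc : 1 - (N1 : ℝ) / ((N1 : ℝ) + N2) = N2 / ((N2 : ℝ) + N1) := by
      rw [add_comm (N2 : ℝ)]; field_simp; ring
    rw [hc, add_comm (N1 : ℝ), mul_comm (q N1), add_comm N1]
    rw [add_comm (N1 : ℝ)] at b1 b2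
    exact abs_log_ratio_sub_le he ho (by omega) hδ0 hε hM b2 b1 hM2 hM1 hlD hE hEbar

end
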